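/- Let S be a finite alphabet with a complementation and let U ⊆ S^7 be a partition code. If there exist i ∈ {1,…,7} and l ∈ S such that U^{i,l} is nonempty and |U^{i,l}| ≤ 12, then U contains a twin pair. -/

import Mathlib

variable {S : Type}

/-- Two words are dichotomous: at some position they carry complementary letters. -/
def Dicho {d : ℕ} (c : S → S) (u v : Fin d → S) : Prop := ∃ j, v j = c (u j)

/-- Two words form a twin pair. -/
def TwinPair {d : ℕ} (c : S → S) (u v : Fin d → S) : Prop :=
  ∃ j, v j = c (u j) ∧ ∀ i, i ≠ j → v i = u i

/-- A polybox code: a set of pairwise dichotomous words. -/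
def PolyboxCode {d : ℕ} (c : S → S) (V : Set (Fin d → S)) : Prop :=
  ∀ u ∈ V, ∀ v ∈ V, u ≠ v → Dicho c u v

/-- The code contains no twin pair. -/
def NoTwinPair {d : ℕ} (c : S → S) (V : Set (Fin d → S)) : Prop :=
  ∀ u ∈ V, ∀ v ∈ V, ¬ TwinPair c u v

/-- `ES`: sets containing exactly one of `s`, `s'` for every letter `s`. -/
def ESet (c : S → S) : Set (Set S) := {B | ∀ s, Xor' (s ∈ B) (c s ∈ B)}

/-- `Es`: members of `ES` containing the letter `s`. -/
def ELetter (c : S → S) (s : S) : Set (Set S) := {B | B ∈ ESet c ∧ s ∈ B}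

/-- The equicomplementary realization `v̌ ⊆ (ES)^d` of a word `v`. -/
def Realize {d : ℕ} (c : S → S) (v : Fin d → S) : Set (Fin d → Set S) :=
  {x | ∀ i, x i ∈ ELetter c (v i)}

/-- The union `⋃_{v ∈ V} v̌`. -/
def RealizeSet {d : ℕ} (c : S → S) (V : Set (Fin d → S)) : Set (Fin d → Set S) :=
  ⋃ v ∈ V, Realize c v

/-- Two codes are equivalent if their realizations coincide. -/
def EquivCodes {d : ℕ} (c : S → S) (V W : Set (Fin d → S)) : Prop :=
  RealizeSet c V = RealizeSet c W

/-- A partition code: a polybox code whose realization is the whole box `(ES)^d`. -/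
def PartitionCode {d : ℕ} (c : S → S) (U : Set (Fin d → S)) : Prop :=
  PolyboxCode c U ∧ RealizeSet c U = {x | ∀ i, x i ∈ ESet c}

/-- `V^{i,l}`: the words of `V` with letter `l` at position `i`. -/
def Subcode {d : ℕ} (V : Set (Fin d → S)) (i : Fin d) (l : S) : Set (Fin d → S) :=
  {v | v ∈ V ∧ v i = l}

namespace Polybox
variable {ι : Type} {c : S → S}

/-- The hypotheses on a complementation. -/
structure IsCompl' (c : S → S) : Prop where
  inv : ∀ s, c (c s) = s
  ne : ∀ s, c s ≠ s

/-- Members of `ES` as a type. -/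
def Pt (c : S → S) : Type := {B : Set S // B ∈ ESet c}

instance : Membership S (Pt c) := ⟨fun x s => s ∈ x.1⟩

theorem mem_c (x : Pt c) (s : S) : c s ∈ x ↔ s ∉ x := by
  have h := x.2 s
  change c s ∈ x.1 ↔ s ∉ x.1
  rcases h with h | h <;> tauto

theorem mk_pt (B : Set S) (h : ∀ s, c s ∈ B ↔ s ∉ B) : B ∈ ESet c := by
  intro s
  have := h s
  by_cases hs : s ∈ B
  · exact Or.inl ⟨hs, by tauto⟩
  · exact Or.inr ⟨by tauto, hs⟩

section ops
variable (hc : IsCompl' c)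
include hc

theorem exists_pt : Nonempty (Pt c) := by
  refine ⟨⟨{s | WellOrderingRel s (c s)}, mk_pt _ fun s => ?_⟩⟩
  simp only [Set.mem_ofPred_eq, hc.inv]
  constructor
  · intro h h'
    exact asymm h h'
  · intro h
    rcases trichotomous_of (r := (WellOrderingRel : S → S → Prop)) s (c s) with h1 | h1 | h1
    · exact absurd h1 h
    · exact absurd h1.symm (hc.ne s)
    · exact h1

theorem c_inj {s t : S} : c s = c t ↔ s = t :=
  ⟨fun h => by rw [← hc.inv s, h, hc.inv], fun h => by rw [h]⟩

theorem c_comm {s t : S} : s = c t ↔ t = c s :=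
  ⟨fun h => by rw [h, hc.inv], fun h => by rw [h, hc.inv]⟩

/-- Force the letter `a` into a point. -/
theorem exists_set (x : Pt c) (a : S) :
    ∃ y : Pt c, ∀ t, t ∈ y ↔ t = a ∨ (t ≠ c a ∧ t ∈ x) := by
  refine ⟨⟨{t | t = a ∨ (t ≠ c a ∧ t ∈ x)}, mk_pt _ fun s => ?_⟩, fun t => Iff.rfl⟩
  simp only [Set.mem_ofPred_eq, mem_c]
  have h1 := hc.ne a
  have h2 := @c_comm _ _ hc a s
  have h3 := @c_inj _ _ hc s a
  by_cases hs : s = a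
  · subst hs; simp [hc.ne]
  · by_cases hs' : s = c a
    · subst hs'; simp [hc.inv, hc.ne]
    · have : c s ≠ a := fun h => hs' (by rw [← h, hc.inv])
      have h4 : c s ≠ c a := fun h => hs (h3.1 h)
      tauto

end ops

theorem exists_compl (x : Pt c) : ∃ y : Pt c, ∀ t, t ∈ y ↔ t ∉ x := by
  refine ⟨⟨{t | t ∉ x}, mk_pt _ fun s => ?_⟩, fun t => Iff.rfl⟩
  simp [mem_c]

/-- The letter-set operation as a function. -/
noncomputable def pset (hc : IsCompl' c) (x : Pt c) (a : S) : Pt c := (exists_set hc x a).choose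
theorem mem_pset (hc : IsCompl' c) (x : Pt c) (a t : S) :
    t ∈ pset hc x a ↔ t = a ∨ (t ≠ c a ∧ t ∈ x) := (exists_set hc x a).choose_spec t

theorem mem_pset_self (hc : IsCompl' c) (x : Pt c) (a : S) : a ∈ pset hc x a := by
  simp [mem_pset]
theorem mem_pset_of (hc : IsCompl' c) {x : Pt c} {a t : S} (h : t ∈ x) (h' : t ≠ c a) :
    t ∈ pset hc x a := by
  rw [mem_pset]; exact Or.inr ⟨h', h⟩
theorem not_mem_pset (hc : IsCompl' c) (x : Pt c) (a : S) : c a ∉ pset hc x a := by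
  rw [mem_c]; simp [mem_pset_self]
theorem mem_pset_other (hc : IsCompl' c) {x : Pt c} {a t : S} (h : t ≠ a) (h' : t ≠ c a) :
    t ∈ pset hc x a ↔ t ∈ x := by
  rw [mem_pset]; tauto

/-- `w` covers `x`. -/
def Cov (w : ι → S) (x : ι → Pt c) : Prop := ∀ k, w k ∈ x k
/-- `w` covers `x` off coordinate `i`. -/
def OffCov (i : ι) (w : ι → S) (x : ι → Pt c) : Prop := ∀ k, k ≠ i → w k ∈ x k

/-- Not dichotomous off `i`. -/
def Meet (c : S → S) (u v : ι → S) : Prop := ∀ k, u k ≠ c (v k)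
def OffMeet (c : S → S) (i : ι) (u v : ι → S) : Prop := ∀ k, k ≠ i → u k ≠ c (v k)

/-- Pairwise dichotomous. -/
def Code (c : S → S) (V : Finset (ι → S)) : Prop :=
  ∀ u ∈ V, ∀ v ∈ V, u ≠ v → ∃ k, v k = c (u k)
def Twin (c : S → S) (u v : ι → S) : Prop := ∃ j, v j = c (u j) ∧ ∀ k, k ≠ j → v k = u k
def TF (c : S → S) (V : Finset (ι → S)) : Prop := ∀ u ∈ V, ∀ v ∈ V, ¬ Twin c u v

theorem Code.subset {V W : Finset (ι → S)} (h : Code c W) (hs : V ⊆ W) : Code c V :=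
  fun u hu v hv => h u (hs hu) v (hs hv)
theorem TF.subset {V W : Finset (ι → S)} (h : TF c W) (hs : V ⊆ W) : TF c V :=
  fun u hu v hv => h u (hs hu) v (hs hv)

theorem Code.unique {V : Finset (ι → S)} (h : Code c V) {u v : ι → S} (hu : u ∈ V) (hv : v ∈ V)
    {x : ι → Pt c} (h1 : Cov u x) (h2 : Cov v x) : u = v := by
  by_contra hne
  obtain ⟨k, hk⟩ := h u hu v hv hne
  have := h2 k
  rw [hk, mem_c] at this
  exact this (h1 k)

theorem OffMeet.symm (hc : IsCompl' c) {i : ι} {u v : ι → S} (h : OffMeet c i u v) : OffMeet c i v u :=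
  fun k hk hk' => h k hk (by rw [hk', hc.inv])
theorem Meet.off {u v : ι → S} (h : Meet c u v) (i : ι) : OffMeet c i u v := fun k _ => h k

theorem meet_of_cov {u v : ι → S} {x : ι → Pt c} (h1 : Cov u x) (h2 : Cov v x) :
    Meet c u v := fun k hk => by
  have := h1 k
  rw [hk, mem_c] at this
  exact this (h2 k)

theorem exists_cov (hc : IsCompl' c) (w : ι → S) : ∃ x : ι → Pt c, Cov w x := by
  obtain ⟨x0⟩ := exists_pt hc
  exact ⟨fun k => pset hc x0 (w k), fun k => mem_pset_self hc _ _⟩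

theorem exists_cov₂ (hc : IsCompl' c) {u v : ι → S} (h : Meet c u v) :
    ∃ x : ι → Pt c, Cov u x ∧ Cov v x := by
  obtain ⟨x, hx⟩ := exists_cov hc u
  exact ⟨fun k => pset hc (x k) (v k), fun k => mem_pset_of hc (hx k) (h k),
    fun k => mem_pset_self hc _ _⟩

section T5
open scoped Classical in
/-- A single word `p` of letter `t` at `i` having, on the box of `w`, the same coverage off `i`
as a family `T'`. -/
theorem single_layer (hc : IsCompl' c) {T' : Finset (ι → S)} {p w : ι → S} {i : ι} {t' : S}
    (hT' : ∀ p' ∈ T', p' i = t') (hm : ∀ p' ∈ T', OffMeet c i p' w) (hp : OffMeet c i p w)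
    (hcov : ∀ x : ι → Pt c, OffCov i w x → (OffCov i p x ↔ ∃ p' ∈ T', OffCov i p' x)) :
    (∀ p' ∈ T', Meet c p' (Function.update p i t')) ∧
    (∀ x : ι → Pt c, Cov (Function.update p i t') x → ∃ p' ∈ T', Cov p' x) := by
  have key : ∀ p' ∈ T', ∀ k, k ≠ i → p k ≠ w k → p' k = p k := by
    intro p' hp' k hk hpw
    by_contra hne
    obtain ⟨x0⟩ := exists_pt hc
    let x : ι → Pt c := fun j => if j = k then pset hc (pset hc (pset hc x0 (w j)) (p' j)) (c (p j))
      else (pset hc (pset hc x0 (w j)) (p' j))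
    have hx : OffCov i w x := by
      intro j hj
      by_cases hjk : j = k
      · subst hjk
        simp only [x, if_true]
        refine mem_pset_of hc (mem_pset_of hc (mem_pset_self hc _ _) ?_) ?_
        · exact (hm p' hp').symm hc j hj
        · rw [hc.inv]; exact Ne.symm hpw
      · simp only [x, if_neg hjk]
        exact mem_pset_of hc (mem_pset_self hc _ _) ((hm p' hp').symm hc j hj)
    have h2 : OffCov i p' x := by
      intro j hj
      by_cases hjk : j = k
      · subst hjk
        simp only [x, if_true]
        refine mem_pset_of hc (mem_pset_self hc _ _) ?_
        rw [hc.inv]; exact hne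
      · simp only [x, if_neg hjk]
        exact mem_pset_self hc _ _
    have h3 := (hcov x hx).2 ⟨p', hp', h2⟩ k hk
    simp only [x, if_true] at h3
    have := not_mem_pset hc (pset hc (pset hc x0 (w k)) (p' k)) (c (p k))
    rw [hc.inv] at this
    exact this h3
  constructor
  · intro p' hp' k hk
    by_cases hki : k = i
    · subst hki
      rw [Function.update_self, hT' p' hp'] at hk
      exact hc.ne t' hk.symm
    · rw [Function.update_of_ne hki] at hk
      by_cases hpw : p k = w k
      · rw [hpw] at hk; exact hm p' hp' k hki hk
      · rw [key p' hp' k hki hpw] at hk; exact hc.ne _ hk.symm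
  · intro x hx
    let z : ι → Pt c := fun k => pset hc (x k) (w k)
    have hz : OffCov i w z := fun k _ => mem_pset_self hc _ _
    have hpx : ∀ k, k ≠ i → p k ∈ x k := fun k hk => by
      have := hx k
      rwa [Function.update_of_ne hk] at this
    obtain ⟨p', hp', h'⟩ := (hcov z hz).1 (fun k hk => mem_pset_of hc (hpx k hk) (hp k hk))
    refine ⟨p', hp', fun k => ?_⟩
    by_cases hki : k = i
    · subst hki
      have := hx k
      rwa [Function.update_self, ← hT' p' hp'] at this
    · by_cases hpw : p k = w k
      · have h1 := h' k hki
        rw [mem_pset] at h1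
        rcases h1 with h1 | h1
        · rw [h1, ← hpw]; exact hpx k hki
        · exact h1.2
      · rw [key p' hp' k hki hpw]; exact hpx k hki

/-- In a code covering the box of `w`, complementary layers have the same coverage there. -/
theorem layer_transfer (hc : IsCompl' c) {D : Finset (ι → S)} {w : ι → S} (hD : Code c D)
    (hcov : ∀ x : ι → Pt c, Cov w x → ∃ p ∈ D, Cov p x) {i : ι} {t : S} (ht1 : t ≠ w i)
    (ht2 : t ≠ c (w i)) {x : ι → Pt c} (hx : OffCov i w x) {p : ι → S} (hp : p ∈ D) (hpt : p i = t)
    (hpx : OffCov i p x) : ∃ p' ∈ D, p' i = c t ∧ OffCov i p' x := by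
  classical
  let xi := pset hc (pset hc (x i) (w i)) t
  let y := Function.update x i xi
  have hwt : w i ≠ c t := fun h => ht2 (by rw [h, hc.inv])
  have hpy : Cov p y := by
    intro k
    by_cases hk : k = i
    · subst hk; simp only [y, xi, Function.update_self, hpt]; exact mem_pset_self hc _ _
    · simp only [y, Function.update_of_ne hk]; exact hpx k hk
  let y' := Function.update x i (pset hc (pset hc (x i) (w i)) (c t))
  have hwy' : Cov w y' := by
    intro k
    by_cases hk : k = i
    · subst hk
      simp only [y', Function.update_self]
      refine mem_pset_of hc (mem_pset_self hc _ _) ?_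
      rw [hc.inv]; exact ht1.symm
    · simp only [y', Function.update_of_ne hk]; exact hx k hk
  obtain ⟨p', hp', hp'y⟩ := hcov y' hwy'
  have hoff : OffCov i p' x := fun k hk => by
    have := hp'y k
    simpa only [y', Function.update_of_ne hk] using this
  refine ⟨p', hp', ?_, hoff⟩
  by_contra hne
  have hi' := hp'y i
  simp only [y', Function.update_self] at hi'
  have hne2 : p' i ≠ t := by
    intro h
    rw [h] at hi'
    have := not_mem_pset hc (pset hc (x i) (w i)) (c t)
    rw [hc.inv] at this
    exact this hi'
  have : Cov p' y := by
    intro k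
    by_cases hk : k = i
    · subst hk
      simp only [y, xi, Function.update_self]
      rw [mem_pset_other hc hne (by rwa [hc.inv])] at hi'
      exact (mem_pset_other hc hne2 hne).2 hi'
    · simp only [y, Function.update_of_ne hk]; exact hoff k hk
  have := hD.unique hp hp' hpy this
  exact hne2 (by rw [← this, hpt])

/-- A twin-free code covering the box of `w`, all of whose words meet it, is `{w}` or has at least
five words. -/
theorem trace (hc : IsCompl' c) (n : ℕ) : ∀ (D : Finset (ι → S)) (w : ι → S), D.card = n → Code c D →
    TF c D → (∀ p ∈ D, Meet c p w) → (∀ x : ι → Pt c, Cov w x → ∃ p ∈ D, Cov p x) →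
    D = {w} ∨ 5 ≤ D.card := by
  classical
  induction n using Nat.strong_induction_on with
  | _ n ih =>
  intro D w hn hD htf hm hcov
  by_contra hcon
  push Not at hcon
  obtain ⟨hDw, h5⟩ := hcon
  have hne : ∃ p ∈ D, p ≠ w := by
    by_contra h
    push Not at h
    obtain ⟨x, hx⟩ := exists_cov hc w
    obtain ⟨p, hp, _⟩ := hcov x hx
    apply hDw
    ext q
    rw [Finset.mem_singleton]
    exact ⟨h q, fun hq => by rw [hq, ← h p hp]; exact hp⟩
  obtain ⟨p0, hp0, hpw0⟩ := hne
  obtain ⟨i, hi⟩ := Function.ne_iff.1 hpw0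
  have trans : ∀ t, t ≠ w i → t ≠ c (w i) → ∀ x : ι → Pt c, OffCov i w x →
      ∀ p ∈ D, p i = t → OffCov i p x → ∃ p' ∈ D, p' i = c t ∧ OffCov i p' x :=
    fun t ht1 ht2 x hx p hp hpt hpx => layer_transfer hc hD hcov ht1 ht2 hx hp hpt hpx
  set t := p0 i with ht
  have ht1 : t ≠ w i := hi
  have ht2 : t ≠ c (w i) := hm p0 hp0 i
  have hct1 : c t ≠ w i := fun h => ht2 (by rw [← h, hc.inv])
  have hct2 : c t ≠ c (w i) := fun h => ht1 ((c_inj hc).1 h)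
  let T := D.filter (fun p => p i = t)
  let T' := D.filter (fun p => p i = c t)
  have memT : ∀ p, p ∈ T ↔ p ∈ D ∧ p i = t := fun p => Finset.mem_filter
  have memT' : ∀ p, p ∈ T' ↔ p ∈ D ∧ p i = c t := fun p => Finset.mem_filter
  have hdisj : Disjoint T T' := by
    rw [Finset.disjoint_left]
    intro p h1 h2
    exact hc.ne t (by rw [← ((memT' p).1 h2).2, ((memT p).1 h1).2])
  have hTT : T ∪ T' ⊆ D := Finset.union_subset (Finset.filter_subset _ _) (Finset.filter_subset _ _)
  have hcard : T.card + T'.card ≤ D.card := by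
    rw [← Finset.card_union_of_disjoint hdisj]; exact Finset.card_le_card hTT
  have iffT : ∀ x : ι → Pt c, OffCov i w x → ((∃ p ∈ T, OffCov i p x) ↔ ∃ p ∈ T', OffCov i p x) := by
    intro x hx
    constructor
    · rintro ⟨p, hp, hpx⟩
      obtain ⟨p', h1, h2, h3⟩ := trans t ht1 ht2 x hx p ((memT p).1 hp).1 ((memT p).1 hp).2 hpx
      exact ⟨p', (memT' p').2 ⟨h1, h2⟩, h3⟩
    · rintro ⟨p, hp, hpx⟩
      obtain ⟨p', h1, h2, h3⟩ := trans (c t) hct1 hct2 x hx p ((memT' p).1 hp).1 ((memT' p).1 hp).2 hpx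
      exact ⟨p', (memT p').2 ⟨h1, by rw [h2, hc.inv]⟩, h3⟩
  have hT0 : p0 ∈ T := (memT p0).2 ⟨hp0, rfl⟩
  have hT0' : T'.Nonempty := by
    obtain ⟨x, h1, h2⟩ := exists_cov₂ hc (hm p0 hp0)
    obtain ⟨p', hp', _⟩ := (iffT x (fun k _ => h2 k)).1 ⟨p0, hT0, fun k _ => h1 k⟩
    exact ⟨p', hp'⟩
  -- no singleton layer
  have nosingle : ∀ (A B : Finset (ι → S)) (a : S), A ⊆ D → B ⊆ D → A.card = 1 → B.card < n →
      (∀ p ∈ A, p i = c a) → (∀ p ∈ B, p i = a) →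
      (∀ x : ι → Pt c, OffCov i w x → ((∃ p ∈ A, OffCov i p x) ↔ ∃ p ∈ B, OffCov i p x)) → False := by
    intro A B a hA hB hA1 hBn hAa hBa hAB
    obtain ⟨p, rfl⟩ := Finset.card_eq_one.1 hA1
    have hpD := hA (Finset.mem_singleton_self p)
    obtain ⟨h1, h2⟩ := single_layer hc (T' := B) (p := p) (w := w) (i := i) (t' := a) hBa
      (fun p' h => (hm p' (hB h)).off i) ((hm p hpD).off i)
      (fun x hx => by simpa using hAB x hx)
    rcases ih B.card hBn B _ rfl (hD.subset hB) (htf.subset hB) h1 h2 with h | h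
    · have hq : Function.update p i a ∈ D := hB (by rw [h]; exact Finset.mem_singleton_self _)
      refine htf _ hpD _ hq ⟨i, ?_, fun k hk => by rw [Function.update_of_ne hk]⟩
      rw [Function.update_self, hAa p (Finset.mem_singleton_self p), hc.inv]
    · have := Finset.card_le_card hB
      omega
  have hTpos : 0 < T.card := Finset.card_pos.2 ⟨p0, hT0⟩
  have hTpos' : 0 < T'.card := Finset.card_pos.2 hT0'
  have c1 : T.card ≠ 1 := fun h => nosingle T T' (c t) (Finset.filter_subset _ _)
    (Finset.filter_subset _ _) h (by omega) (fun p hp => by rw [((memT p).1 hp).2, hc.inv])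
    (fun p hp => ((memT' p).1 hp).2) iffT
  have c2 : T'.card ≠ 1 := fun h => nosingle T' T t (Finset.filter_subset _ _)
    (Finset.filter_subset _ _) h (by omega) (fun p hp => ((memT' p).1 hp).2)
    (fun p hp => ((memT p).1 hp).2) (fun x hx => (iffT x hx).symm)
  have hall : T ∪ T' = D := by
    apply Finset.eq_of_subset_of_card_le hTT
    rw [Finset.card_union_of_disjoint hdisj]; omega
  have hmT : ∀ p ∈ T, Meet c p (Function.update w i t) := by
    intro p hp k hk
    by_cases hki : k = i
    · subst hki
      rw [Function.update_self, ((memT p).1 hp).2] at hk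
      exact hc.ne t hk.symm
    · rw [Function.update_of_ne hki] at hk
      exact hm p ((memT p).1 hp).1 k hk
  have hcT : ∀ x : ι → Pt c, Cov (Function.update w i t) x → ∃ p ∈ T, Cov p x := by
    intro x hx
    let y := Function.update x i (pset hc (x i) (w i))
    have hxt : t ∈ x i := by have := hx i; rwa [Function.update_self] at this
    have hy : Cov w y := by
      intro k
      by_cases hk : k = i
      · subst hk; simp only [y, Function.update_self]; exact mem_pset_self hc _ _
      · have := hx k
        rw [Function.update_of_ne hk] at this
        simpa only [y, Function.update_of_ne hk] using this
    obtain ⟨p, hp, hpy⟩ := hcov y hy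
    have hpT : p ∈ T := by
      rw [← hall, Finset.mem_union] at hp
      refine hp.resolve_right fun h => ?_
      have := hpy i
      rw [((memT' p).1 h).2] at this
      simp only [y, Function.update_self, mem_c] at this
      exact this (mem_pset_of hc hxt ht2)
    refine ⟨p, hpT, fun k => ?_⟩
    by_cases hk : k = i
    · subst hk; rw [((memT p).1 hpT).2]; exact hxt
    · have := hpy k
      simpa only [y, Function.update_of_ne hk] using this
  rcases ih T.card (by omega) T _ rfl (hD.subset (Finset.filter_subset _ _))
    (htf.subset (Finset.filter_subset _ _)) hmT hcT with h | h
  · exact c1 (by rw [h]; exact Finset.card_singleton _)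
  · omega
end T5
end Polybox

namespace Polybox
variable {ι : Type} {c : S → S}

theorem exists_offcov₃ (hc : IsCompl' c) {i : ι} {p u q : ι → S} (h1 : OffMeet c i p u)
    (h2 : OffMeet c i p q) (h3 : OffMeet c i u q) :
    ∃ x : ι → Pt c, OffCov i p x ∧ OffCov i u x ∧ OffCov i q x := by
  obtain ⟨x, hx⟩ := exists_cov hc p
  refine ⟨fun k => pset hc (pset hc (x k) (u k)) (q k), fun k hk => ?_, fun k hk => ?_, fun k hk => ?_⟩
  · exact mem_pset_of hc (mem_pset_of hc (hx k) (h1 k hk)) (h2 k hk)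
  · exact mem_pset_of hc (mem_pset_self hc _ _) (h3 k hk)
  · exact mem_pset_self hc _ _

theorem offmeet_of_cov {i : ι} {u v : ι → S} {x : ι → Pt c} (h1 : OffCov i u x) (h2 : OffCov i v x) :
    OffMeet c i u v := fun k hk hk' => by
  have := h1 k hk
  rw [hk', mem_c] at this
  exact this (h2 k hk)

/-- If every off-`i` point of `p` and `q` having the letter `e` at `γ` lies in `u`, then `u` takes
only letters of `p` or `q` away from `γ`. -/
theorem letters_of_contained (hc : IsCompl' c) {i γ : ι} {p q u : ι → S} {e : S}
    (hpq : OffMeet c i p q) (hpe : γ ≠ i → p γ ≠ c e) (hqe : γ ≠ i → q γ ≠ c e)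
    (h : ∀ x : ι → Pt c, OffCov i p x → OffCov i q x → (γ ≠ i → e ∈ x γ) → OffCov i u x) :
    ∀ k, k ≠ i → k ≠ γ → u k = p k ∨ u k = q k := by
  classical
  intro k hki hkγ
  by_contra hcon
  push Not at hcon
  obtain ⟨x0⟩ := exists_pt hc
  let y : ι → Pt c := fun j => pset hc (pset hc x0 (p j)) (q j)
  have hyp : ∀ j, j ≠ i → p j ∈ y j := fun j hj => mem_pset_of hc (mem_pset_self hc _ _) (hpq j hj)
  have hyq : ∀ j, j ≠ i → q j ∈ y j := fun j hj => mem_pset_self hc _ _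
  let x : ι → Pt c := fun j => if j = γ then pset hc (y j) e
    else if j = k then pset hc (y j) (c (u j)) else y j
  have hxp : OffCov i p x := by
    intro j hj
    by_cases h1 : j = γ
    · subst h1; simp only [x, if_true]; exact mem_pset_of hc (hyp j hj) (hpe hj)
    · by_cases h2 : j = k
      · subst h2
        simp only [x, if_neg h1, if_true]
        exact mem_pset_of hc (hyp j hj) (by rw [hc.inv]; exact hcon.1.symm)
      · simp only [x, if_neg h1, if_neg h2]; exact hyp j hj
  have hxq : OffCov i q x := by
    intro j hj
    by_cases h1 : j = γ
    · subst h1; simp only [x, if_true]; exact mem_pset_of hc (hyq j hj) (hqe hj)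
    · by_cases h2 : j = k
      · subst h2
        simp only [x, if_neg h1, if_true]
        exact mem_pset_of hc (hyq j hj) (by rw [hc.inv]; exact hcon.2.symm)
      · simp only [x, if_neg h1, if_neg h2]; exact hyq j hj
  have := h x hxp hxq (fun _ => by simp only [x, if_true]; exact mem_pset_self hc _ _) k hki
  simp only [x, if_neg hkγ, if_true] at this
  have h4 := not_mem_pset hc (y k) (c (u k))
  rw [hc.inv] at h4
  exact h4 this

theorem letters_of_subset (hc : IsCompl' c) {i : ι} {p q u : ι → S}
    (hpq : OffMeet c i p q)
    (h : ∀ x : ι → Pt c, OffCov i p x → OffCov i q x → OffCov i u x) :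
    ∀ k, k ≠ i → u k = p k ∨ u k = q k := by
  intro k hk
  exact letters_of_contained hc (γ := i) (e := p k) hpq (fun h => absurd rfl h)
    (fun h => absurd rfl h) (fun x h1 h2 _ => h x h1 h2) k hk hk

theorem split (hc : IsCompl' c) {i γ : ι} {p q u v : ι → S} (hγ : γ ≠ i) (huv : v γ = c (u γ))
    (hpq : OffMeet c i p q) (hpu : OffMeet c i p u) (hpv : OffMeet c i p v)
    (hqu : OffMeet c i q u) (hqv : OffMeet c i q v)
    (h : ∀ x : ι → Pt c, OffCov i q x → OffCov i p x → OffCov i u x ∨ OffCov i v x) :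
    ∀ k, k ≠ i → k ≠ γ → (u k = p k ∨ u k = q k) ∧ (v k = p k ∨ v k = q k) := by
  intro k hki hkγ
  constructor
  · refine letters_of_contained hc (γ := γ) (e := u γ) hpq (hpu γ) (hqu γ) ?_ k hki hkγ
    intro x h1 h2 h3
    refine (h x h2 h1).resolve_right fun h4 => ?_
    have := h4 γ hγ
    rw [huv, mem_c] at this
    exact this (h3 hγ)
  · refine letters_of_contained hc (γ := γ) (e := v γ) hpq (hpv γ) (hqv γ) ?_ k hki hkγ
    intro x h1 h2 h3
    refine (h x h2 h1).resolve_left fun h4 => ?_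
    have := h3 hγ
    rw [huv, mem_c] at this
    exact this (h4 γ hγ)

/-- The shape of two pairs of words with equal coverage on a box. -/
def Shape (c : S → S) (i : ι) (q p₁ p₂ r₁ r₂ : ι → S) (α β : ι) : Prop :=
  α ≠ i ∧ β ≠ i ∧ α ≠ β ∧ p₁ α ≠ q α ∧ p₁ α ≠ c (q α) ∧ p₁ β ≠ q β ∧ p₁ β ≠ c (q β) ∧
  p₂ α = c (p₁ α) ∧ p₂ β = q β ∧ r₁ α = q α ∧ r₁ β = p₁ β ∧ r₂ α = c (p₁ α) ∧ r₂ β = c (p₁ β) ∧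
  ∀ k, k ≠ i → k ≠ α → k ≠ β → p₂ k = p₁ k ∧ r₁ k = p₁ k ∧ r₂ k = p₁ k

def OffDich (c : S → S) (i : ι) (u v : ι → S) : Prop := ∃ k, k ≠ i ∧ v k = c (u k)

theorem shape_of_miss (hc : IsCompl' c) {i : ι} {q p₁ p₂ r₁ r₂ : ι → S}
    (hp : OffDich c i p₁ p₂) (hr : OffDich c i r₁ r₂)
    (m1 : OffMeet c i p₁ q) (m2 : OffMeet c i p₂ q) (m3 : OffMeet c i r₁ q) (m4 : OffMeet c i r₂ q)
    (hcov : ∀ x : ι → Pt c, OffCov i q x →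
      ((OffCov i p₁ x ∨ OffCov i p₂ x) ↔ (OffCov i r₁ x ∨ OffCov i r₂ x)))
    (hne : ∃ k, k ≠ i ∧ p₁ k ≠ r₁ k) (hmiss : ¬ OffMeet c i p₁ r₂) :
    ∃ α β, Shape c i q p₁ p₂ r₁ r₂ α β := by
  have s1 : ∀ k, k ≠ i → r₁ k = p₁ k ∨ r₁ k = q k := letters_of_subset hc m1 fun x h1 h2 =>
    ((hcov x h2).1 (Or.inl h1)).resolve_right fun h => hmiss (offmeet_of_cov h1 h)
  have s2 : ∀ k, k ≠ i → p₂ k = r₂ k ∨ p₂ k = q k := letters_of_subset hc m4 fun x h1 h2 =>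
    ((hcov x h2).2 (Or.inr h1)).resolve_left fun h => hmiss (offmeet_of_cov h h1)
  have mp1r1 : OffMeet c i p₁ r₁ := by
    intro k hk h
    rcases s1 k hk with h' | h'
    · rw [h'] at h; exact hc.ne _ h.symm
    · rw [h'] at h; exact m1 k hk h
  have mr1p2 : OffMeet c i r₁ p₂ := by
    by_contra hm
    obtain ⟨k, hk, hkne⟩ := hne
    have s3 : ∀ k, k ≠ i → p₁ k = r₁ k ∨ p₁ k = q k := letters_of_subset hc m3 fun x h1 h2 =>
      ((hcov x h2).2 (Or.inl h1)).resolve_right fun h => hm (offmeet_of_cov h1 h)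
    rcases s1 k hk with h | h
    · exact hkne h.symm
    · rcases s3 k hk with h' | h'
      · exact hkne h'
      · exact hkne (h'.trans h.symm)
  have mp2r2 : OffMeet c i p₂ r₂ := by
    intro k hk h
    rcases s2 k hk with h' | h'
    · rw [h'] at h; exact hc.ne _ h.symm
    · rw [h'] at h; exact m4 k hk ((c_comm hc).1 h)
  obtain ⟨α, hα, hαp⟩ := hp
  obtain ⟨β, hβ, hβr⟩ := hr
  have t1 := split hc hα hαp m3 (mp1r1.symm hc) mr1p2 (m1.symm hc) (m2.symm hc)
    (fun x h1 h2 => (hcov x h1).2 (Or.inl h2))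
  have t2 := split hc hβ hβr m2 (mr1p2.symm hc) mp2r2 (m3.symm hc) (m4.symm hc)
    (fun x h1 h2 => (hcov x h1).1 (Or.inr h2))
  have e1 : ∀ k, k ≠ i → k ≠ α → r₁ k = p₁ k := fun k hk hk' => by
    rcases s1 k hk with h | h
    · exact h
    · rcases (t1 k hk hk').1 with h' | h'
      · exact h'.symm
      · rw [h, h']
  have e2 : ∀ k, k ≠ i → k ≠ β → p₂ k = r₂ k := fun k hk hk' => by
    rcases s2 k hk with h | h
    · exact h
    · rcases (t2 k hk hk').2 with h' | h'
      · exact h'.symm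
      · rw [h, h']
  have r1α : r₁ α = q α := by
    rcases s1 α hα with h | h
    · exact absurd (by rw [hαp, hc.inv]; exact h) (mr1p2 α hα)
    · exact h
  have p2β : p₂ β = q β := by
    rcases s2 β hβ with h | h
    · exact absurd (by rw [hβr] at h; exact (c_comm hc).1 h) (mr1p2 β hβ)
    · exact h
  have a1 : p₁ α ≠ q α := fun h => m2 α hα (by rw [hαp, h])
  have b1' : r₁ β ≠ q β := fun h => m4 β hβ (by rw [hβr, h])
  have hαβ : α ≠ β := fun h => b1' (by rw [← h]; exact r1α)
  have b1 := e1 β hβ hαβ.symm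
  refine ⟨α, β, hα, hβ, hαβ, a1, m1 α hα, by rwa [← b1], m1 β hβ, hαp, p2β, r1α, b1,
    by rw [← e2 α hα hαβ]; exact hαp, by rw [hβr, b1], fun k hki hkα hkβ => ?_⟩
  have f1 := e1 k hki hkα
  have f2 := e2 k hki hkβ
  have f3 : p₂ k = p₁ k := by
    rcases (t1 k hki hkα).2 with h | h
    · rw [h, f1]
    · rcases (t2 k hki hkβ).1 with h' | h'
      · rw [← h', f1]
      · rw [h, ← h', f1]
  exact ⟨f3, f1, by rw [← f2, f3]⟩

/-- Two disjoint pairs of words with equal coverage on the box of `q`, neither being a twin pair. -/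
theorem pair_shape (hc : IsCompl' c) {i : ι} {q p₁ p₂ r₁ r₂ : ι → S}
    (hp : OffDich c i p₁ p₂) (hr : OffDich c i r₁ r₂)
    (m1 : OffMeet c i p₁ q) (m2 : OffMeet c i p₂ q) (m3 : OffMeet c i r₁ q) (m4 : OffMeet c i r₂ q)
    (hcov : ∀ x : ι → Pt c, OffCov i q x →
      ((OffCov i p₁ x ∨ OffCov i p₂ x) ↔ (OffCov i r₁ x ∨ OffCov i r₂ x)))
    (n11 : ∃ k, k ≠ i ∧ p₁ k ≠ r₁ k) (n12 : ∃ k, k ≠ i ∧ p₁ k ≠ r₂ k)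
    (n21 : ∃ k, k ≠ i ∧ p₂ k ≠ r₁ k) (n22 : ∃ k, k ≠ i ∧ p₂ k ≠ r₂ k)
    (ht : ∀ j, j ≠ i → p₂ j = c (p₁ j) → ∃ k, k ≠ i ∧ k ≠ j ∧ p₂ k ≠ p₁ k) :
    (∃ α β, Shape c i q p₁ p₂ r₁ r₂ α β) ∨ (∃ α β, Shape c i q p₂ p₁ r₁ r₂ α β) ∨
    (∃ α β, Shape c i q p₁ p₂ r₂ r₁ α β) ∨ (∃ α β, Shape c i q p₂ p₁ r₂ r₁ α β) := by
  have sw : ∀ {u v : ι → S}, OffDich c i u v → OffDich c i v u := by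
    rintro u v ⟨k, hk, h⟩
    exact ⟨k, hk, (c_comm hc).1 h⟩
  by_cases h12 : OffMeet c i p₁ r₂
  swap
  · exact Or.inl (shape_of_miss hc hp hr m1 m2 m3 m4 hcov n11 h12)
  by_cases h22 : OffMeet c i p₂ r₂
  swap
  · exact Or.inr (Or.inl (shape_of_miss hc (sw hp) hr m2 m1 m3 m4
      (fun x hx => by rw [or_comm]; exact hcov x hx) n21 h22))
  by_cases h11 : OffMeet c i p₁ r₁
  swap
  · exact Or.inr (Or.inr (Or.inl (shape_of_miss hc hp (sw hr) m1 m2 m4 m3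
      (fun x hx => by rw [hcov x hx, or_comm]) n12 h11)))
  by_cases h21 : OffMeet c i p₂ r₁
  swap
  · exact Or.inr (Or.inr (Or.inr (shape_of_miss hc (sw hp) (sw hr) m2 m1 m4 m3
      (fun x hx => by rw [or_comm, hcov x hx, or_comm]) n22 h21)))
  exfalso
  obtain ⟨γ', hγ', hp'⟩ := hp
  obtain ⟨γ, hγ, hr'⟩ := hr
  have a1 := split hc hγ hr' m1 h11 h12 (m3.symm hc) (m4.symm hc) (fun x h1 h2 => (hcov x h1).1 (Or.inl h2))
  have a2 := split hc hγ hr' m2 h21 h22 (m3.symm hc) (m4.symm hc) (fun x h1 h2 => (hcov x h1).1 (Or.inr h2))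
  have b1 := split hc hγ' hp' m3 (h11.symm hc) (h21.symm hc) (m1.symm hc) (m2.symm hc)
    (fun x h1 h2 => (hcov x h1).2 (Or.inl h2))
  have b2 := split hc hγ' hp' m4 (h12.symm hc) (h22.symm hc) (m1.symm hc) (m2.symm hc)
    (fun x h1 h2 => (hcov x h1).2 (Or.inr h2))
  obtain ⟨k, hki, hkγ', hne⟩ := ht γ' hγ' hp'
  apply hne
  by_cases hkγ : k = γ
  · subst hkγ
    have h1 := b1 k hki hkγ'
    have h2 := b2 k hki hkγ'
    have hne' := hc.ne (r₁ k)
    rw [hr'] at h2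
    have e1 : p₁ k = q k := by
      rcases h1.1 with h | h
      · rcases h2.1 with h' | h'
        · exact absurd (h'.symm.trans h) hne'
        · exact h'
      · exact h
    have e2 : p₂ k = q k := by
      rcases h1.2 with h | h
      · rcases h2.2 with h' | h'
        · exact absurd (h'.symm.trans h) hne'
        · exact h'
      · exact h
    rw [e1, e2]
  · have h1 := a1 k hki hkγ
    have h2 := a2 k hki hkγ
    have h3 := b1 k hki hkγ'
    grind

end Polybox

namespace Polybox
open scoped Classical
variable {ι : Type} {c : S → S}

/-- The words of `V` with letter `s` at `i`. -/
noncomputable def lay (V : Finset (ι → S)) (i : ι) (s : S) : Finset (ι → S) := V.filter fun v => v i = s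

theorem mem_lay {V : Finset (ι → S)} {i : ι} {s : S} {v : ι → S} : v ∈ lay V i s ↔ v ∈ V ∧ v i = s :=
  Finset.mem_filter
theorem lay_subset (V : Finset (ι → S)) (i : ι) (s : S) : lay V i s ⊆ V := Finset.filter_subset _ _

/-- Complementary layers with the same coverage on a box are not too small. -/
theorem layers_card (hc : IsCompl' c) {D T T' : Finset (ι → S)} (hD : Code c D) (htf : TF c D)
    (hT : T ⊆ D) (hT' : T' ⊆ D) {i : ι} {t : S} (ht : ∀ p ∈ T, p i = t) (ht' : ∀ p ∈ T', p i = c t)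
    {w : ι → S} (hm : ∀ p ∈ T, OffMeet c i p w) (hm' : ∀ p ∈ T', OffMeet c i p w)
    (hcov : ∀ x : ι → Pt c, OffCov i w x → ((∃ p ∈ T, OffCov i p x) ↔ ∃ p ∈ T', OffCov i p x))
    (hne : T.Nonempty) : (2 ≤ T.card ∧ 2 ≤ T'.card) ∨ (1 ≤ T.card ∧ 1 ≤ T'.card ∧ 6 ≤ T.card + T'.card) := by
  have single : ∀ (A B : Finset (ι → S)) (a : S), A ⊆ D → B ⊆ D → (∀ p ∈ A, p i = c a) →
      (∀ p ∈ B, p i = a) → (∀ p ∈ A, OffMeet c i p w) → (∀ p ∈ B, OffMeet c i p w) →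
      (∀ x : ι → Pt c, OffCov i w x → ((∃ p ∈ A, OffCov i p x) ↔ ∃ p ∈ B, OffCov i p x)) →
      A.card = 1 → 5 ≤ B.card := by
    intro A B a hA hB ha hb hmA hmB hAB h1
    obtain ⟨p, rfl⟩ := Finset.card_eq_one.1 h1
    have hp := Finset.mem_singleton_self p
    obtain ⟨h1, h2⟩ := single_layer hc (T' := B) (p := p) (w := w) (i := i) (t' := a) hb
      hmB (hmA p hp) (fun x hx => by simpa using hAB x hx)
    rcases trace hc B.card B _ rfl (hD.subset hB) (htf.subset hB) h1 h2 with h | h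
    · exfalso
      have hq : Function.update p i a ∈ D := hB (by rw [h]; exact Finset.mem_singleton_self _)
      refine htf _ (hA hp) _ hq ⟨i, ?_, fun k hk => by rw [Function.update_of_ne hk]⟩
      rw [Function.update_self, ha p hp, hc.inv]
    · exact h
  have hne' : T'.Nonempty := by
    obtain ⟨p, hp⟩ := hne
    obtain ⟨x, h1, _, h3⟩ := exists_offcov₃ hc (u := w) (fun k hk => hm p hp k hk) (hm p hp)
      (fun k _ h => hc.ne _ h.symm)
    obtain ⟨p', hp', _⟩ := (hcov x h3).1 ⟨p, hp, h1⟩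
    exact ⟨p', hp'⟩
  have s1 := single T T' (c t) hT hT' (fun p hp => by rw [ht p hp, hc.inv]) ht' hm hm' hcov
  have s2 := single T' T t hT' hT ht' ht hm' hm (fun x hx => (hcov x hx).symm)
  have c1 := Finset.card_pos.2 hne
  have c2 := Finset.card_pos.2 hne'
  omega

/-- `pair_shape` for two-element layers. -/
theorem layers_shape (hc : IsCompl' c) {D T T' : Finset (ι → S)} (hD : Code c D) (htf : TF c D)
    (hT : T ⊆ D) (hT' : T' ⊆ D) {i : ι} {t : S} (ht : ∀ p ∈ T, p i = t) (ht' : ∀ p ∈ T', p i = c t)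
    {w : ι → S} (hm : ∀ p ∈ T, OffMeet c i p w) (hm' : ∀ p ∈ T', OffMeet c i p w)
    (hcov : ∀ x : ι → Pt c, OffCov i w x → ((∃ p ∈ T, OffCov i p x) ↔ ∃ p ∈ T', OffCov i p x))
    (h2 : T.card = 2) (h2' : T'.card = 2) :
    ∃ p₁ p₂ r₁ r₂ α β, (∀ p, p ∈ T ↔ p = p₁ ∨ p = p₂) ∧ (∀ p, p ∈ T' ↔ p = r₁ ∨ p = r₂) ∧ p₁ ≠ p₂ ∧ r₁ ≠ r₂ ∧ Shape c i w p₁ p₂ r₁ r₂ α β := by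
  obtain ⟨p₁, p₂, hp, hTe⟩ := Finset.card_eq_two.1 h2
  obtain ⟨r₁, r₂, hr, hTe'⟩ := Finset.card_eq_two.1 h2'
  have hp1 : p₁ ∈ T := by simp [hTe]
  have hp2 : p₂ ∈ T := by simp [hTe]
  have hr1 : r₁ ∈ T' := by simp [hTe']
  have hr2 : r₂ ∈ T' := by simp [hTe']
  have dich : ∀ a b, a ∈ D → b ∈ D → a ≠ b → a i = b i → OffDich c i a b := by
    intro a b ha hb hab hi
    obtain ⟨k, hk⟩ := hD a ha b hb hab
    refine ⟨k, fun h => ?_, hk⟩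
    subst h
    exact hc.ne _ (by rw [← hk, hi])
  have diff : ∀ p ∈ T, ∀ r ∈ T', ∃ k, k ≠ i ∧ p k ≠ r k := by
    intro p hp r hr
    by_contra h
    push Not at h
    exact htf p (hT hp) r (hT' hr) ⟨i, by rw [ht p hp, ht' r hr], fun k hk => (h k hk).symm⟩
  have := pair_shape hc (dich p₁ p₂ (hT hp1) (hT hp2) hp (by rw [ht _ hp1, ht _ hp2]))
    (dich r₁ r₂ (hT' hr1) (hT' hr2) hr (by rw [ht' _ hr1, ht' _ hr2]))
    (hm _ hp1) (hm _ hp2) (hm' _ hr1) (hm' _ hr2)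
    (fun x hx => by simpa [hTe, hTe'] using hcov x hx)
    (diff _ hp1 _ hr1) (diff _ hp1 _ hr2) (diff _ hp2 _ hr1) (diff _ hp2 _ hr2)
    (fun j hj h => by
      by_contra hcon
      push Not at hcon
      refine htf p₁ (hT hp1) p₂ (hT hp2) ⟨j, h, fun k hk => ?_⟩
      by_cases hki : k = i
      · rw [hki, ht _ hp1, ht _ hp2]
      · exact hcon k hki hk)
  have mT : ∀ p, p ∈ T ↔ p = p₁ ∨ p = p₂ := fun p => by simp [hTe]
  have mT' : ∀ p, p ∈ T' ↔ p = r₁ ∨ p = r₂ := fun p => by simp [hTe']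
  rcases this with ⟨α, β, h⟩ | ⟨α, β, h⟩ | ⟨α, β, h⟩ | ⟨α, β, h⟩
  · exact ⟨p₁, p₂, r₁, r₂, α, β, mT, mT', hp, hr, h⟩
  · exact ⟨p₂, p₁, r₁, r₂, α, β, fun p => by rw [mT, or_comm], mT', hp.symm, hr, h⟩
  · exact ⟨p₁, p₂, r₂, r₁, α, β, mT, fun p => by rw [mT', or_comm], hp, hr.symm, h⟩
  · exact ⟨p₂, p₁, r₂, r₁, α, β, fun p => by rw [mT, or_comm], fun p => by rw [mT', or_comm],
      hp.symm, hr.symm, h⟩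

theorem sum_pair_of_mem {α M : Type} [AddCommMonoid M] {T : Finset α} {a b : α}
    (h : ∀ p, p ∈ T ↔ p = a ∨ p = b) (hab : a ≠ b) (f : α → M) : ∑ p ∈ T, f p = f a + f b := by
  have : T = {a, b} := by ext p; simp [h]
  rw [this, Finset.sum_pair hab]

/-- Indicator of a proposition. -/
noncomputable def ind (P : Prop) : ℤ := if P then 1 else 0
theorem ind_true {P : Prop} (h : P) : ind P = 1 := if_pos h
theorem ind_false {P : Prop} (h : ¬ P) : ind P = 0 := if_neg h

variable [Fintype ι]

theorem sum_ind (R : ι → Bool → Prop) (σ : ι → Bool → ℤ) :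
    (∑ δ : ι → Bool, (∏ k, σ k (δ k)) * ind (∀ k, R k (δ k))) =
      ∏ k, ∑ b, σ k b * ind (R k b) := by
  rw [Finset.prod_univ_sum]
  rw [Fintype.piFinset_univ]
  refine Finset.sum_congr rfl fun δ _ => ?_
  rw [Finset.prod_mul_distrib]
  congr 1
  by_cases h : ∀ k, R k (δ k)
  · rw [ind_true h]; exact (Finset.prod_eq_one fun k _ => ind_true (h k)).symm
  · rw [ind_false h]
    push Not at h
    obtain ⟨k, hk⟩ := h
    exact (Finset.prod_eq_zero (Finset.mem_univ k) (ind_false hk)).symm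

theorem shape_dvd {i : ι} {q p₁ p₂ r₁ r₂ : ι → S} {α β : ι} (hc : IsCompl' c)
    (h : Shape c i q p₁ p₂ r₁ r₂ α β) (f : ι → S → ℤ) (h2 : ∀ k, k ≠ i → f k (q k) = 2)
    (h1 : ∀ k, k ≠ i → ∀ a, a ≠ q k → a ≠ c (q k) → f k a = 1) (hp : p₂ i = p₁ i) (hr : r₂ i = r₁ i) :
    (3 : ℤ) ∣ ∏ k, f k (p₁ k) + ∏ k, f k (p₂ k) ∧ (3 : ℤ) ∣ ∏ k, f k (r₁ k) + ∏ k, f k (r₂ k) := by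
  obtain ⟨hα, hβ, hαβ, a1, a2, b1, b2, e1, e2, e3, e4, e5, e6, e7⟩ := h
  have dec : ∀ g : ι → S, ∏ k, f k (g k) = f α (g α) * (f β (g β) *
      ∏ k ∈ (Finset.univ.erase α).erase β, f k (g k)) := by
    intro g
    rw [Finset.mul_prod_erase (Finset.univ.erase α) (fun k => f k (g k))
      (Finset.mem_erase.2 ⟨hαβ.symm, Finset.mem_univ _⟩),
      Finset.mul_prod_erase Finset.univ (fun k => f k (g k)) (Finset.mem_univ _)]
  have a1' : c (p₁ α) ≠ q α := fun h => a2 (by rw [← h, hc.inv])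
  have a2' : c (p₁ α) ≠ c (q α) := fun h => a1 ((c_inj hc).1 h)
  have b1' : c (p₁ β) ≠ q β := fun h => b2 (by rw [← h, hc.inv])
  have b2' : c (p₁ β) ≠ c (q β) := fun h => b1 ((c_inj hc).1 h)
  have rp : ∏ k ∈ (Finset.univ.erase α).erase β, f k (p₂ k) =
      ∏ k ∈ (Finset.univ.erase α).erase β, f k (p₁ k) := by
    refine Finset.prod_congr rfl fun k hk => ?_
    simp only [Finset.mem_erase] at hk
    by_cases hki : k = i
    · rw [hki, hp]
    · rw [(e7 k hki hk.2.1 hk.1).1]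
  have rr : ∏ k ∈ (Finset.univ.erase α).erase β, f k (r₂ k) =
      ∏ k ∈ (Finset.univ.erase α).erase β, f k (r₁ k) := by
    refine Finset.prod_congr rfl fun k hk => ?_
    simp only [Finset.mem_erase] at hk
    by_cases hki : k = i
    · rw [hki, hr]
    · rw [(e7 k hki hk.2.1 hk.1).2.1, (e7 k hki hk.2.1 hk.1).2.2]
  rw [dec p₁, dec p₂, dec r₁, dec r₂, rp, rr, e1, e2, e3, e4, e5, e6, h2 α hα, h2 β hβ,
    h1 α hα _ a1 a2, h1 β hβ _ b1 b2, h1 α hα _ a1' a2', h1 β hβ _ b1' b2']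
  constructor
  · exact ⟨∏ k ∈ (Finset.univ.erase α).erase β, f k (p₁ k), by ring⟩
  · exact ⟨∏ k ∈ (Finset.univ.erase α).erase β, f k (r₁ k), by ring⟩

/-- A twin-free code cannot cover a box with small layers of letters foreign to it. -/
theorem no_thin_cover (hc : IsCompl' c) {D : Finset (ι → S)} (hD : Code c D) (htf : TF c D) {q : ι → S}
    {i : ι} (hm : ∀ p ∈ D, Meet c p q) (hcov : ∀ x : ι → Pt c, Cov q x → ∃ p ∈ D, Cov p x)
    (hi : ∀ p ∈ D, p i ≠ q i ∧ p i ≠ c (q i)) (hl : ∀ s, (lay D i s).card ≤ 2) : False := by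
  obtain ⟨x, hx⟩ := exists_cov hc q
  have hy : ∀ k, ∃ y : Pt c, ∀ t, t ∈ y ↔ t ∉ x k := fun k => exists_compl (x k)
  choose y hy using hy
  let X : ι → Bool → Pt c := fun k b => if k = i then x k else if b then pset hc (y k) (q k) else x k
  have hX : ∀ δ : ι → Bool, Cov q fun k => X k (δ k) := by
    intro δ k
    simp only [X]
    split_ifs
    · exact hx k
    · exact mem_pset_self hc _ _
    · exact hx k
  let f : ι → S → ℤ := fun k a => ∑ b, ind (a ∈ X k b)
  have hf : ∀ p : ι → S, ∑ δ : ι → Bool, ind (Cov p fun k => X k (δ k)) =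
      ∏ k, f k (p k) := by
    intro p
    have := sum_ind (fun k b => p k ∈ X k b) (fun _ _ => 1)
    simp only [Finset.prod_const_one, one_mul] at this
    exact this
  have tot : ∑ p ∈ D, ∏ k, f k (p k) = 2 ^ Fintype.card ι := by
    simp only [← hf]
    rw [Finset.sum_comm]
    have : ∀ δ : ι → Bool, ∑ p ∈ D, ind (Cov p fun k => X k (δ k)) = 1 := by
      intro δ
      obtain ⟨p, hp, hpc⟩ := hcov _ (hX δ)
      rw [Finset.sum_eq_single_of_mem p hp, ind_true hpc]
      intro p' hp' hne
      exact ind_false fun h => hne (hD.unique hp' hp h hpc)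
    rw [Finset.sum_congr rfl fun δ _ => this δ]
    simp
  have f2 : ∀ k, k ≠ i → f k (q k) = 2 := by
    intro k hk
    have : q k ∈ pset hc (y k) (q k) := mem_pset_self hc _ _
    simp [f, X, hk, this, ind_true, show q k ∈ x k from hx k]
  have f1 : ∀ k, k ≠ i → ∀ a, a ≠ q k → a ≠ c (q k) → f k a = 1 := by
    intro k hk a h1 h2
    have h3 : a ∈ pset hc (y k) (q k) ↔ a ∉ x k := by rw [mem_pset_other hc h1 h2, hy]
    by_cases h : a ∈ x k <;> simp [f, X, hk, h3, h, ind_true, ind_false]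
  have lay3 : ∀ s, (3 : ℤ) ∣ ∑ p ∈ lay D i s, ∏ k, f k (p k) := by
    intro s
    by_cases hne : (lay D i s).Nonempty
    · obtain ⟨p0, hp0⟩ := hne
      have hs1 : s ≠ q i := by rw [← (mem_lay.1 hp0).2]; exact (hi p0 (mem_lay.1 hp0).1).1
      have hs2 : s ≠ c (q i) := by rw [← (mem_lay.1 hp0).2]; exact (hi p0 (mem_lay.1 hp0).1).2
      have hiff : ∀ x : ι → Pt c, OffCov i q x →
          ((∃ p ∈ lay D i s, OffCov i p x) ↔ ∃ p ∈ lay D i (c s), OffCov i p x) := by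
        intro x hx
        constructor
        · rintro ⟨p, hp, hpx⟩
          obtain ⟨p', h1, h2, h3⟩ := layer_transfer hc hD hcov hs1 hs2 hx (mem_lay.1 hp).1
            (mem_lay.1 hp).2 hpx
          exact ⟨p', mem_lay.2 ⟨h1, h2⟩, h3⟩
        · rintro ⟨p, hp, hpx⟩
          obtain ⟨p', h1, h2, h3⟩ := layer_transfer hc hD hcov (t := c s)
            (fun h => hs2 (by rw [← h, hc.inv])) (fun h => hs1 ((c_inj hc).1 h)) hx (mem_lay.1 hp).1
            (mem_lay.1 hp).2 hpx
          exact ⟨p', mem_lay.2 ⟨h1, by rw [h2, hc.inv]⟩, h3⟩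
      have l1 := hl s
      have l2 := hl (c s)
      have hcard := layers_card hc hD htf (lay_subset D i s) (lay_subset D i (c s)) (t := s)
        (fun p hp => (mem_lay.1 hp).2) (fun p hp => (mem_lay.1 hp).2)
        (fun p hp => (hm p (mem_lay.1 hp).1).off i) (fun p hp => (hm p (mem_lay.1 hp).1).off i)
        hiff ⟨p0, hp0⟩
      obtain ⟨p₁, p₂, r₁, r₂, α, β, hT, hT', hp, -, hsh⟩ := layers_shape hc hD htf (lay_subset D i s)
        (lay_subset D i (c s)) (t := s)
        (fun p hp => (mem_lay.1 hp).2) (fun p hp => (mem_lay.1 hp).2)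
        (fun p hp => (hm p (mem_lay.1 hp).1).off i) (fun p hp => (hm p (mem_lay.1 hp).1).off i)
        hiff (by omega) (by omega)
      have e : ∀ p ∈ lay D i s, p i = s := fun p hp => (mem_lay.1 hp).2
      have e' : ∀ p ∈ lay D i (c s), p i = c s := fun p hp => (mem_lay.1 hp).2
      rw [sum_pair_of_mem hT hp]
      exact (shape_dvd hc hsh f f2 f1 (by rw [e p₂ (by simp [hT]), e p₁ (by simp [hT])])
        (by rw [e' r₂ (by simp [hT']), e' r₁ (by simp [hT'])])).1
    · rw [Finset.not_nonempty_iff_eq_empty.1 hne]; simp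
  have hdvd : (3 : ℤ) ∣ 2 ^ Fintype.card ι := by
    rw [← tot, ← Finset.sum_fiberwise_of_maps_to (t := D.image fun p => p i) (g := fun p => p i)
      (fun p hp => Finset.mem_image_of_mem _ hp)]
    exact Finset.dvd_sum fun s _ => lay3 s
  have := Int.prime_three.dvd_of_dvd_pow hdvd
  omega
end Polybox

namespace Polybox
open scoped Classical
variable {ι : Type} {c : S → S}

theorem c_ne_iff (hc : IsCompl' c) {s t : S} : c s ≠ t ↔ s ≠ c t := by
  rw [Ne, Ne, c_comm hc, eq_comm]

theorem exists_three (hc : IsCompl' c) {a b e : S} (h1 : a ≠ c b) (h2 : a ≠ c e) (h3 : b ≠ c e) :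
    ∃ x : Pt c, a ∈ x ∧ b ∈ x ∧ e ∈ x := by
  obtain ⟨x0⟩ := exists_pt hc
  exact ⟨pset hc (pset hc (pset hc x0 a) b) e, mem_pset_of hc (mem_pset_of hc (mem_pset_self hc _ _) h1) h2,
    mem_pset_of hc (mem_pset_self hc _ _) h3, mem_pset_self hc _ _⟩

theorem Shape.swap (hc : IsCompl' c) {i : ι} {q p₁ p₂ r₁ r₂ : ι → S} {α β : ι}
    (h : Shape c i q p₁ p₂ r₁ r₂ α β) : Shape c i q r₂ r₁ p₂ p₁ β α := by
  obtain ⟨hα, hβ, hαβ, a1, a2, b1, b2, e1, e2, e3, e4, e5, e6, e7⟩ := h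
  refine ⟨hβ, hα, hαβ.symm, ?_, ?_, ?_, ?_, ?_, e3, e2, ?_, ?_, ?_, fun k h1 h2 h3 => ?_⟩
  · rw [e6, c_ne_iff hc]; exact b2
  · rw [e6, Ne, c_inj hc]; exact b1
  · rw [e5, c_ne_iff hc]; exact a2
  · rw [e5, Ne, c_inj hc]; exact a1
  · rw [e4, e6, hc.inv]
  · rw [e5, e1]
  · rw [e6, hc.inv]
  · rw [e5, hc.inv]
  · obtain ⟨f1, f2, f3⟩ := e7 k h1 h3 h2
    exact ⟨by rw [f2, f3], by rw [f1, f3], f3.symm⟩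

/-- The difference of the coverages of the two pairs of a shape. -/
noncomputable def gap (i : ι) (p₁ p₂ r₁ r₂ : ι → S) (x : ι → Pt c) : ℤ :=
  ind (OffCov i p₁ x) + ind (OffCov i p₂ x) - ind (OffCov i r₁ x) - ind (OffCov i r₂ x)

def Rest (i α β : ι) (p : ι → S) (x : ι → Pt c) : Prop := ∀ k, k ≠ i → k ≠ α → k ≠ β → p k ∈ x k

theorem ind_and (P Q : Prop) : ind (P ∧ Q) = ind P * ind Q := by
  by_cases hP : P <;> by_cases hQ : Q <;> simp [ind, hP, hQ]
theorem ind_not (P : Prop) : ind (¬ P) = 1 - ind P := by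
  by_cases hP : P <;> simp [ind, hP]

theorem Shape.gap_eq {i : ι} {q p₁ p₂ r₁ r₂ : ι → S} {α β : ι}
    (h : Shape c i q p₁ p₂ r₁ r₂ α β) (x : ι → Pt c) :
    gap i p₁ p₂ r₁ r₂ x = ind (Rest i α β p₁ x) * (ind (p₁ β ∈ x β) * ind (q α ∉ x α)
      - ind (p₁ α ∉ x α) * ind (q β ∉ x β)) := by
  obtain ⟨hα, hβ, hαβ, a1, a2, b1, b2, e1, e2, e3, e4, e5, e6, e7⟩ := h
  have key : ∀ g : ι → S, (∀ k, k ≠ i → k ≠ α → k ≠ β → g k = p₁ k) →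
      ind (OffCov i g x) = ind (g α ∈ x α) * ind (g β ∈ x β) * ind (Rest i α β p₁ x) := by
    intro g hg
    rw [← ind_and, ← ind_and]
    congr 1
    apply propext
    constructor
    · intro h
      exact ⟨⟨h α hα, h β hβ⟩, fun k h1 h2 h3 => by rw [← hg k h1 h2 h3]; exact h k h1⟩
    · rintro ⟨⟨h1, h2⟩, h3⟩ k hk
      by_cases hkα : k = α
      · rw [hkα]; exact h1
      · by_cases hkβ : k = β
        · rw [hkβ]; exact h2
        · rw [hg k hk hkα hkβ]; exact h3 k hk hkα hkβ
  rw [gap, key p₁ (fun _ _ _ _ => rfl), key p₂ (fun k h1 h2 h3 => (e7 k h1 h2 h3).1),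
    key r₁ (fun k h1 h2 h3 => (e7 k h1 h2 h3).2.1), key r₂ (fun k h1 h2 h3 => (e7 k h1 h2 h3).2.2),
    e1, e2, e3, e4, e5, e6]
  simp only [mem_c, ind_not]
  ring

theorem Shape.rest_of_gap {i : ι} {q p₁ p₂ r₁ r₂ : ι → S} {α β : ι}
    (h : Shape c i q p₁ p₂ r₁ r₂ α β) {x : ι → Pt c} (hx : gap i p₁ p₂ r₁ r₂ x ≠ 0) :
    Rest i α β p₁ x := by
  by_contra hR
  rw [h.gap_eq, ind_false hR, zero_mul] at hx
  exact hx rfl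

theorem Shape.exists_gap_left (hc : IsCompl' c) {i : ι} {q p₁ p₂ r₁ r₂ : ι → S} {α β : ι}
    (h : Shape c i q p₁ p₂ r₁ r₂ α β) (e : S) :
    ∃ x : ι → Pt c, e ∈ x α ∧ gap i p₁ p₂ r₁ r₂ x ≠ 0 := by
  have h' := h
  obtain ⟨hα, hβ, hαβ, a1, a2, b1, b2, -⟩ := h
  obtain ⟨x0, hx0⟩ := exists_cov hc p₁
  by_cases he : e = q α
  · obtain ⟨xa, ha1, ha2, -⟩ := exists_three hc (a := e) (b := c (p₁ α)) (e := e)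
      (by rw [hc.inv, he]; exact a1.symm) (fun h => hc.ne _ h.symm) (by rw [he, Ne, c_inj hc]; exact a1)
    obtain ⟨xb, hb1, hb2, -⟩ := exists_three hc (a := c (q β)) (b := c (p₁ β)) (e := c (q β))
      (by rw [hc.inv]; exact fun h => b2 h.symm) (by rw [hc.inv]; exact hc.ne _)
      (by rw [hc.inv, c_ne_iff hc]; exact b2)
    refine ⟨Function.update (Function.update x0 α xa) β xb, ?_, ?_⟩
    · rw [Function.update_of_ne hαβ, Function.update_self]; exact ha1
    · rw [h'.gap_eq, Function.update_self, Function.update_of_ne hαβ, Function.update_self, ind_true,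
        ind_false ((mem_c _ _).1 hb2), ind_true ((mem_c _ _).1 ha2), ind_true ((mem_c _ _).1 hb1)]
      · norm_num
      · intro k h1 h2 h3
        rw [Function.update_of_ne h3, Function.update_of_ne h2]; exact hx0 k
  · obtain ⟨xa, ha1, ha2, -⟩ := exists_three hc (a := e) (b := c (q α)) (e := e)
      (by rw [hc.inv]; exact he) (fun h => hc.ne _ h.symm) (by rw [Ne, c_inj hc]; exact Ne.symm he)
    obtain ⟨xb, hb1, hb2, -⟩ := exists_three hc (a := q β) (b := p₁ β) (e := q β)
      (fun h => b2 ((c_comm hc).1 h)) (fun h => hc.ne _ h.symm) b2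
    refine ⟨Function.update (Function.update x0 α xa) β xb, ?_, ?_⟩
    · rw [Function.update_of_ne hαβ, Function.update_self]; exact ha1
    · rw [h'.gap_eq, Function.update_self, Function.update_of_ne hαβ, Function.update_self, ind_true,
        ind_true hb2, ind_true ((mem_c _ _).1 ha2), ind_false (P := q β ∉ xb) (not_not.2 hb1)]
      · norm_num
      · intro k h1 h2 h3
        rw [Function.update_of_ne h3, Function.update_of_ne h2]; exact hx0 k

theorem gap_swap (i : ι) (p₁ p₂ r₁ r₂ : ι → S) (x : ι → Pt c) :
    gap i r₂ r₁ p₂ p₁ x = - gap i p₁ p₂ r₁ r₂ x := by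
  unfold gap; ring

theorem Shape.exists_gap (hc : IsCompl' c) {i : ι} {q p₁ p₂ r₁ r₂ : ι → S} {α β : ι}
    (h : Shape c i q p₁ p₂ r₁ r₂ α β) {k : ι} {e : S}
    (he : k ≠ α → k ≠ β → e ≠ c (p₁ k)) :
    ∃ x : ι → Pt c, e ∈ x k ∧ gap i p₁ p₂ r₁ r₂ x ≠ 0 := by
  by_cases hkα : k = α
  · rw [hkα]; exact h.exists_gap_left hc e
  · by_cases hkβ : k = β
    · rw [hkβ]
      obtain ⟨x, h1, h2⟩ := (h.swap hc).exists_gap_left hc e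
      rw [gap_swap] at h2
      exact ⟨x, h1, fun h => h2 (by rw [h, neg_zero])⟩
    · obtain ⟨x, h1, h2⟩ := h.exists_gap_left hc (q α)
      refine ⟨Function.update x k (pset hc (x k) e), ?_, ?_⟩
      · rw [Function.update_self]; exact mem_pset_self hc _ _
      · have hR := h.rest_of_gap h2
        rw [h.gap_eq] at h2 ⊢
        rw [ind_true hR] at h2
        rw [Function.update_of_ne (Ne.symm hkα), Function.update_of_ne (Ne.symm hkβ), ind_true]
        · exact h2
        · intro j j1 j2 j3
          by_cases hj : j = k
          · subst hj; rw [Function.update_self]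
            exact mem_pset_of hc (hR j j1 j2 j3) fun h => he hkα hkβ ((c_comm hc).1 h)
          · rw [Function.update_of_ne hj]; exact hR j j1 j2 j3

/-- Two shapes with proportional gaps live on the same coordinates and rest word. -/
theorem shapes_rest (hc : IsCompl' c) {i : ι} {q p₁ p₂ r₁ r₂ q' p₁' p₂' r₁' r₂' : ι → S} {α β α' β' : ι}
    (h : Shape c i q p₁ p₂ r₁ r₂ α β) (h' : Shape c i q' p₁' p₂' r₁' r₂' α' β')
    (hg : ∀ x : ι → Pt c, gap i p₁' p₂' r₁' r₂' x ≠ 0 → gap i p₁ p₂ r₁ r₂ x ≠ 0) {k : ι} (hki : k ≠ i)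
    (hkα : k ≠ α) (hkβ : k ≠ β) : k ≠ α' ∧ k ≠ β' ∧ p₁' k = p₁ k := by
  have : ¬ (k ≠ α' → k ≠ β' → c (p₁ k) ≠ c (p₁' k)) := by
    intro hh
    obtain ⟨x, h1, h2⟩ := h'.exists_gap hc hh
    have := h.rest_of_gap (hg x h2) k hki hkα hkβ
    exact ((mem_c _ _).1 h1) this
  push Not at this
  exact ⟨this.1, this.2.1, ((c_inj hc).1 this.2.2).symm⟩

theorem ind_nonneg (P : Prop) : 0 ≤ ind P := by by_cases h : P <;> simp [ind, h]

theorem tensor_left (hc : IsCompl' c) {u w v z u' w' v' z' : S} (huw : u ≠ w) (huw' : u ≠ c w)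
    (hvz : v ≠ z) (h2 : u' ≠ c w')
    (h : ∀ x y : Pt c, ind (u ∈ x) * ind (v ∈ y) - ind (w ∈ x) * ind (z ∈ y) =
      ind (u' ∈ x) * ind (v' ∈ y) - ind (w' ∈ x) * ind (z' ∈ y)) : u' = u := by
  have A : u' = u ∨ u' = c w := by
    by_contra hcon
    push Not at hcon
    obtain ⟨x, x1, x2, x3⟩ := exists_three hc (a := u) (b := c u') (e := c w) (by rw [hc.inv]; exact hcon.1.symm)
      (by rwa [hc.inv]) (by rw [hc.inv, c_ne_iff hc]; exact hcon.2)
    obtain ⟨y, y1, -⟩ := exists_three hc (a := v) (b := v) (e := v) (fun h => hc.ne _ h.symm)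
      (fun h => hc.ne _ h.symm) (fun h => hc.ne _ h.symm)
    have := h x y
    rw [ind_true x1, ind_true y1, ind_false ((mem_c _ _).1 x3), ind_false ((mem_c _ _).1 x2)] at this
    have := mul_nonneg (ind_nonneg (w' ∈ x)) (ind_nonneg (z' ∈ y))
    linarith
  refine A.resolve_right fun hA => ?_
  have B : w' = c u := by
    by_contra hcon
    obtain ⟨x, x1, x2, x3⟩ := exists_three hc (a := c u) (b := w) (e := c w')
      (fun h => huw ((c_inj hc).1 h)) (by rw [hc.inv]; exact Ne.symm hcon)
      (by rw [hc.inv]; intro h; exact h2 (by rw [hA, h]))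
    obtain ⟨y, y1, -⟩ := exists_three hc (a := z) (b := z) (e := z) (fun h => hc.ne _ h.symm)
      (fun h => hc.ne _ h.symm) (fun h => hc.ne _ h.symm)
    have := h x y
    rw [ind_false ((mem_c _ _).1 x1), ind_true x2, ind_true y1, ind_false ((mem_c _ _).1 x3),
      ind_false (P := u' ∈ x) (by rw [hA, mem_c]; exact not_not.2 x2)] at this
    norm_num at this
  obtain ⟨x, x1, x2, -⟩ := exists_three hc (a := u) (b := w) (e := u) huw' (fun h => hc.ne _ h.symm)
    (fun h => huw' ((c_comm hc).1 h))
  obtain ⟨y, y1, y2, -⟩ := exists_three hc (a := v) (b := c z) (e := v) (by rwa [hc.inv])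
    (fun h => hc.ne _ h.symm) (by rw [Ne, c_inj hc]; exact Ne.symm hvz)
  have := h x y
  rw [hA, B, ind_true x1, ind_true x2, ind_true y1, ind_false ((mem_c _ _).1 y2),
    ind_false (P := c w ∈ x) (by rw [mem_c]; exact not_not.2 x2),
    ind_false (P := c u ∈ x) (by rw [mem_c]; exact not_not.2 x1)] at this
  norm_num at this

theorem tensor (hc : IsCompl' c) {u w v z u' w' v' z' : S} (huw : u ≠ w) (huw' : u ≠ c w)
    (hvz : v ≠ z) (hvz' : v ≠ c z) (h2 : u' ≠ c w') (h3 : v' ≠ c z')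
    (h : ∀ x y : Pt c, ind (u ∈ x) * ind (v ∈ y) - ind (w ∈ x) * ind (z ∈ y) =
      ind (u' ∈ x) * ind (v' ∈ y) - ind (w' ∈ x) * ind (z' ∈ y)) :
    u' = u ∧ w' = w ∧ v' = v ∧ z' = z := by
  refine ⟨tensor_left hc huw huw' hvz h2 h, ?_, ?_, ?_⟩
  · exact tensor_left (u' := w') (w' := u') (v' := z') (z' := v') hc huw.symm
      (fun h => huw' ((c_comm hc).1 h)) hvz.symm (fun h => h2 ((c_comm hc).1 h))
      (fun x y => by linarith [h x y])
  · exact tensor_left (u' := v') (w' := z') (v' := u') (z' := w') hc hvz hvz' huw h3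
      (fun x y => by linarith [h y x])
  · exact tensor_left (u' := z') (w' := v') (v' := w') (z' := u') hc hvz.symm
      (fun h => hvz' ((c_comm hc).1 h)) huw.symm (fun h => h3 ((c_comm hc).1 h))
      (fun x y => by linarith [h y x])

theorem shapes_letters (hc : IsCompl' c) {i : ι} {q p₁ p₂ r₁ r₂ q' p₁' p₂' r₁' r₂' : ι → S} {α β : ι}
    (h : Shape c i q p₁ p₂ r₁ r₂ α β) (h' : Shape c i q' p₁' p₂' r₁' r₂' α β)
    (hr : ∀ k, k ≠ i → k ≠ α → k ≠ β → p₁' k = p₁ k) :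
    ((∀ x : ι → Pt c, gap i p₁ p₂ r₁ r₂ x = gap i p₁' p₂' r₁' r₂' x) →
      p₁' α = p₁ α ∧ p₁' β = p₁ β) ∧
    ((∀ x : ι → Pt c, gap i p₁ p₂ r₁ r₂ x = - gap i p₁' p₂' r₁' r₂' x) →
      p₁' α = q α ∧ p₁' β = c (q β) ∧ q' α = p₁ α ∧ q' β = c (p₁ β)) := by
  obtain ⟨x0, hx0⟩ := exists_cov hc p₁
  have h0 := h
  have h0' := h'
  obtain ⟨hα, hβ, hαβ, a1, a2, b1, b2, -⟩ := h0
  obtain ⟨-, -, -, a1', a2', b1', b2', -⟩ := h0'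
  have ev : ∀ x y : Pt c, gap i p₁ p₂ r₁ r₂ (Function.update (Function.update x0 α x) β y) =
      ind (c (q α) ∈ x) * ind (p₁ β ∈ y) - ind (c (p₁ α) ∈ x) * ind (c (q β) ∈ y) := by
    intro x y
    rw [h.gap_eq, Function.update_self, Function.update_of_ne hαβ, Function.update_self, ind_true]
    · simp only [mem_c]; ring
    · intro k h1 h2 h3
      rw [Function.update_of_ne h3, Function.update_of_ne h2]; exact hx0 k
  have ev' : ∀ x y : Pt c, gap i p₁' p₂' r₁' r₂' (Function.update (Function.update x0 α x) β y) =
      ind (c (q' α) ∈ x) * ind (p₁' β ∈ y) - ind (c (p₁' α) ∈ x) * ind (c (q' β) ∈ y) := by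
    intro x y
    rw [h'.gap_eq, Function.update_self, Function.update_of_ne hαβ, Function.update_self, ind_true]
    · simp only [mem_c]; ring
    · intro k h1 h2 h3
      rw [Function.update_of_ne h3, Function.update_of_ne h2, hr k h1 h2 h3]; exact hx0 k
  have n1 : c (q α) ≠ c (p₁ α) := fun h => a1 ((c_inj hc).1 h).symm
  have n2 : c (q α) ≠ c (c (p₁ α)) := by rw [hc.inv]; exact fun h => a2 h.symm
  have n3 : p₁ β ≠ c (q β) := b2
  have n4 : p₁ β ≠ c (c (q β)) := by rw [hc.inv]; exact b1
  have n2' : c (q' α) ≠ c (c (p₁' α)) := by rw [hc.inv]; exact fun h => a2' h.symm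
  have n4' : p₁' β ≠ c (c (q' β)) := by rw [hc.inv]; exact b1'
  constructor
  · intro hg
    obtain ⟨t1, t2, t3, t4⟩ := tensor hc n1 n2 n3 n4 n2' n4' (fun x y => by rw [← ev, ← ev', hg])
    exact ⟨(c_inj hc).1 t2, t3⟩
  · intro hg
    obtain ⟨t1, t2, t3, t4⟩ := tensor hc (u' := c (p₁' α)) (w' := c (q' α)) (v' := c (q' β)) (z' := p₁' β)
      n1 n2 n3 n4 (by rw [hc.inv, c_ne_iff hc]; exact a2') (fun h => b1' ((c_inj hc).1 h).symm)
      (fun x y => by rw [← ev, hg, ev']; ring)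
    exact ⟨(c_inj hc).1 t1, t4, (c_inj hc).1 t2, by rw [← t3, hc.inv]⟩
end Polybox

namespace Polybox
open scoped Classical
variable {ι : Type} {c : S → S}

/-- Disjoint twin-free codes with the same realization. -/
structure GP (c : S → S) (V W : Finset (ι → S)) : Prop where
  codeV : Code c V
  codeW : Code c W
  tfV : TF c V
  tfW : TF c W
  disj : ∀ v ∈ V, v ∉ W
  eqv : ∀ x : ι → Pt c, (∃ v ∈ V, Cov v x) ↔ ∃ w ∈ W, Cov w x

theorem GP.symm {V W : Finset (ι → S)} (h : GP c V W) : GP c W V :=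
  ⟨h.codeW, h.codeV, h.tfW, h.tfV, fun v h1 h2 => h.disj v h2 h1, fun x => (h.eqv x).symm⟩

theorem Code.sum_cov {V : Finset (ι → S)} (h : Code c V) (x : ι → Pt c) :
    ∑ v ∈ V, ind (Cov v x) = ind (∃ v ∈ V, Cov v x) := by
  by_cases hx : ∃ v ∈ V, Cov v x
  · rw [ind_true hx]
    obtain ⟨p, hp, hpc⟩ := hx
    rw [Finset.sum_eq_single_of_mem p hp, ind_true hpc]
    intro p' hp' hne
    exact ind_false fun h' => hne (h.unique hp' hp h' hpc)
  · rw [ind_false hx]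
    push Not at hx
    exact Finset.sum_eq_zero fun v hv => ind_false (hx v hv)

/-- Combinations of two point indicators. -/
def Fn (c : S → S) (f : S → ℤ) : Prop :=
  ∃ (σ : Bool → ℤ) (X : Bool → Pt c), ∀ a, f a = ∑ b, σ b * ind (a ∈ X b)

theorem fn_one (hc : IsCompl' c) : Fn c fun _ => 1 := by
  obtain ⟨x⟩ := exists_pt hc
  obtain ⟨y, hy⟩ := exists_compl x
  refine ⟨fun _ => 1, fun b => if b then x else y, fun a => ?_⟩
  rw [Fintype.sum_bool]
  by_cases h : a ∈ x
  · simp [ind_true h, ind_false (fun h' => (hy a).1 h' h)]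
  · simp [ind_false h, ind_true ((hy a).2 h)]

theorem fn_pt (y : Pt c) : Fn c fun a => ind (a ∈ y) :=
  ⟨fun b => if b then 1 else 0, fun _ => y, fun a => by simp⟩

theorem fn_diff (x y : Pt c) : Fn c fun a => ind (a ∈ x) - ind (a ∈ y) :=
  ⟨fun b => if b then 1 else -1, fun b => if b then x else y, fun a => by simp; ring⟩

theorem fn_letter (hc : IsCompl' c) (s : S) : Fn c fun a => ind (a = s) - ind (a = c s) := by
  obtain ⟨x0⟩ := exists_pt hc
  have h := fn_diff (pset hc x0 s) (pset hc x0 (c s))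
  convert h using 2 with a
  by_cases h1 : a = s
  · subst h1
    rw [ind_true rfl, ind_false (P := a = c a) (hc.ne a).symm, ind_true (mem_pset_self hc _ _), ind_false]
    have := not_mem_pset hc x0 (c a)
    rwa [hc.inv] at this
  · by_cases h2 : a = c s
    · rw [h2, ind_true (P := c s = c s) rfl, ind_false (hc.ne s), ind_true (mem_pset_self hc _ _),
        ind_false (not_mem_pset hc _ _)]
    · rw [ind_false h1, ind_false h2]
      have e : a ∈ pset hc x0 s ↔ a ∈ pset hc x0 (c s) := by
        rw [mem_pset_other hc h1 h2, mem_pset_other hc h2 (by rwa [hc.inv])]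
      simp only [e, sub_self]

theorem GP.bal [Fintype ι] {V W : Finset (ι → S)} (h : GP c V W) {f : ι → S → ℤ} (hf : ∀ k, Fn c (f k)) :
    ∑ v ∈ V, ∏ k, f k (v k) = ∑ w ∈ W, ∏ k, f k (w k) := by
  choose σ X hσ using hf
  have key : ∀ v : ι → S, ∏ k, f k (v k) =
      ∑ δ : ι → Bool, (∏ k, σ k (δ k)) * ind (Cov v fun k => X k (δ k)) := by
    intro v
    have := sum_ind (fun k b => v k ∈ X k b) σ
    simp only [← hσ] at this
    exact this.symm
  simp only [key]
  rw [Finset.sum_comm, Finset.sum_comm (s := W)]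
  refine Finset.sum_congr rfl fun δ _ => ?_
  rw [← Finset.mul_sum, ← Finset.mul_sum, h.codeV.sum_cov, h.codeW.sum_cov]
  simp only [h.eqv]

theorem card_eq_ind {α : Type} (A : Finset α) (P : α → Prop) :
    ((A.filter P).card : ℤ) = ∑ v ∈ A, ind (P v) := by
  rw [Finset.card_filter]; push_cast; rfl

theorem prod_update_one [Fintype ι] (i : ι) (g : S → ℤ) (v : ι → S) :
    ∏ k, (Function.update (fun _ _ => (1 : ℤ)) i g : ι → S → ℤ) k (v k) = g (v i) := by
  rw [Finset.prod_eq_single i]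
  · rw [Function.update_self]
  · intro k _ hk; rw [Function.update_of_ne hk]
  · simp

theorem GP.bal_single [Fintype ι] (hc : IsCompl' c) {V W : Finset (ι → S)} (h : GP c V W) (i : ι) {g : S → ℤ}
    (hg : Fn c g) : ∑ v ∈ V, g (v i) = ∑ w ∈ W, g (w i) := by
  have := h.bal (f := Function.update (fun _ _ => 1) i g) (fun k => by
    by_cases hk : k = i
    · subst hk; rwa [Function.update_self]
    · rw [Function.update_of_ne hk]; exact fn_one hc)
  simpa only [prod_update_one] using this

theorem GP.card_eq [Fintype ι] [Nonempty ι] (hc : IsCompl' c) {V W : Finset (ι → S)} (h : GP c V W) :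
    V.card = W.card := by
  obtain ⟨i⟩ := ‹Nonempty ι›
  have := h.bal_single hc i (fn_one hc)
  simpa using this

theorem GP.fiber_card [Fintype ι] (hc : IsCompl' c) {V W : Finset (ι → S)} (h : GP c V W) (i : ι) (y : Pt c) :
    (V.filter fun v => v i ∈ y).card = (W.filter fun v => v i ∈ y).card := by
  have := h.bal_single hc i (fn_pt y)
  rw [← card_eq_ind, ← card_eq_ind] at this
  exact_mod_cast this

theorem GP.layer_card [Fintype ι] (hc : IsCompl' c) {V W : Finset (ι → S)} (h : GP c V W) (i : ι) (s : S) :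
    (lay V i s).card + (lay W i (c s)).card = (lay V i (c s)).card + (lay W i s).card := by
  have := h.bal_single hc i (fn_letter hc s)
  rw [Finset.sum_sub_distrib, Finset.sum_sub_distrib, ← card_eq_ind, ← card_eq_ind, ← card_eq_ind,
    ← card_eq_ind] at this
  simp only [lay]
  omega

/-- Coverage off `i`. -/
def Cv (i : ι) (A : Finset (ι → S)) (x : ι → Pt c) : Prop := ∃ p ∈ A, OffCov i p x

theorem cov_of_off {i : ι} {p : ι → S} {x : ι → Pt c} (h : OffCov i p x) (hi : p i ∈ x i) : Cov p x := by
  intro k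
  by_cases hk : k = i
  · rw [hk]; exact hi
  · exact h k hk

theorem cov_update {i : ι} {p : ι → S} {x : ι → Pt c} {y : Pt c} (h : OffCov i p x) (hi : p i ∈ y) :
    Cov p (Function.update x i y) := by
  intro k
  by_cases hk : k = i
  · subst hk; rw [Function.update_self]; exact hi
  · rw [Function.update_of_ne hk]; exact h k hk

theorem off_of_cov_update {i : ι} {p : ι → S} {x : ι → Pt c} {y : Pt c} (h : Cov p (Function.update x i y)) :
    OffCov i p x ∧ p i ∈ y := by
  constructor
  · intro k hk
    have := h k
    rwa [Function.update_of_ne hk] at this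
  · have := h i
    rwa [Function.update_self] at this

/-- Layer identity. -/
theorem GP.layer_cov (hc : IsCompl' c) {V W : Finset (ι → S)} (h : GP c V W) {i : ι} {s : S} {x : ι → Pt c}
    (hP : Cv i (lay V i s) x) (hQ : ¬ Cv i (lay W i s) x) :
    Cv i (lay V i (c s)) x ∧ ¬ Cv i (lay W i (c s)) x ∧
      ∃ w ∈ W, w i ≠ s ∧ w i ≠ c s ∧ OffCov i w x := by
  obtain ⟨p, hp, hpx⟩ := hP
  rw [mem_lay] at hp
  obtain ⟨w, hw, hwx⟩ := (h.eqv (Function.update x i (pset hc (x i) s))).1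
    ⟨p, hp.1, cov_update hpx (by rw [hp.2]; exact mem_pset_self hc _ _)⟩
  obtain ⟨hw1, hw2⟩ := off_of_cov_update hwx
  have ws : w i ≠ s := fun e => hQ ⟨w, mem_lay.2 ⟨hw, e⟩, hw1⟩
  have ws' : w i ≠ c s := fun e => not_mem_pset hc (x i) s (by rw [← e]; exact hw2)
  have hw3 : w i ∈ x i := (mem_pset_other hc ws ws').1 hw2
  have hwy : Cov w (Function.update x i (pset hc (x i) (c s))) :=
    cov_update hw1 ((mem_pset_other hc ws' (by rwa [hc.inv])).2 hw3)
  obtain ⟨v, hv, hvx⟩ := (h.eqv (Function.update x i (pset hc (x i) (c s)))).2 ⟨w, hw, hwy⟩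
  obtain ⟨hv1, hv2⟩ := off_of_cov_update hvx
  refine ⟨⟨v, mem_lay.2 ⟨hv, ?_⟩, hv1⟩, ?_, w, hw, ws, ws', hw1⟩
  · by_contra hne
    have hvs : v i ≠ s := by
      intro e
      have := not_mem_pset hc (x i) (c s)
      rw [hc.inv] at this
      exact this (e ▸ hv2)
    have hv3 : v i ∈ x i := (mem_pset_other hc hne (by rwa [hc.inv])).1 hv2
    have := h.codeV.unique hv hp.1 (cov_update hv1 ((mem_pset_other hc hvs hne).2 hv3))
      (cov_update hpx (by rw [hp.2]; exact mem_pset_self hc _ _))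
    exact hvs (by rw [this]; exact hp.2)
  · rintro ⟨q, hq, hqx⟩
    rw [mem_lay] at hq
    have := h.codeW.unique hq.1 hw (cov_update hqx (by rw [hq.2]; exact mem_pset_self hc _ _)) hwy
    exact ws' (by rw [← this]; exact hq.2)

theorem GP.layer_box (hc : IsCompl' c) {V W : Finset (ι → S)} (h : GP c V W) {i : ι} {s : S} {x : ι → Pt c}
    {w : ι → S} (hw : w ∈ W) (ws : w i ≠ s) (ws' : w i ≠ c s) (hwx : OffCov i w x)
    (hP : Cv i (lay V i s) x) : Cv i (lay V i (c s)) x := by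
  refine (h.layer_cov hc hP ?_).1
  rintro ⟨q, hq, hqx⟩
  rw [mem_lay] at hq
  have e1 : w i ∈ pset hc (pset hc (x i) (w i)) s := mem_pset_of hc (mem_pset_self hc _ _) ws'
  have := h.codeW.unique hq.1 hw (cov_update hqx (by rw [hq.2]; exact mem_pset_self hc _ _)) (cov_update hwx e1)
  exact ws (by rw [← this]; exact hq.2)

/-- The part of a set of words meeting `w` off `i`. -/
noncomputable def touch (c : S → S) (i : ι) (w : ι → S) (A : Finset (ι → S)) : Finset (ι → S) :=
  A.filter fun p => OffMeet c i p w

theorem mem_touch {i : ι} {w p : ι → S} {A : Finset (ι → S)} : p ∈ touch c i w A ↔ p ∈ A ∧ OffMeet c i p w :=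
  Finset.mem_filter

theorem offmeet_of_off {i : ι} {u v : ι → S} {x : ι → Pt c} (h1 : OffCov i u x) (h2 : OffCov i v x) :
    OffMeet c i u v := fun k hk e => by
  have := h1 k hk
  rw [e, mem_c] at this
  exact this (h2 k hk)

theorem GP.touch_iff (hc : IsCompl' c) {V W : Finset (ι → S)} (h : GP c V W) {i : ι} {s : S}
    {w : ι → S} (hw : w ∈ W) (ws : w i ≠ s) (ws' : w i ≠ c s) {x : ι → Pt c} (hwx : OffCov i w x) :
    (∃ p ∈ touch c i w (lay V i s), OffCov i p x) ↔ ∃ p ∈ touch c i w (lay V i (c s)), OffCov i p x := by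
  constructor
  · rintro ⟨p, hp, hpx⟩
    obtain ⟨p', h1, h2⟩ := h.layer_box hc hw ws ws' hwx ⟨p, (mem_touch.1 hp).1, hpx⟩
    exact ⟨p', mem_touch.2 ⟨h1, offmeet_of_off h2 hwx⟩, h2⟩
  · rintro ⟨p, hp, hpx⟩
    obtain ⟨p', h1, h2⟩ := h.layer_box hc (s := c s) hw ws' (by rwa [hc.inv]) hwx ⟨p, (mem_touch.1 hp).1, hpx⟩
    rw [hc.inv] at h1
    exact ⟨p', mem_touch.2 ⟨h1, offmeet_of_off h2 hwx⟩, h2⟩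

theorem GP.plus (hc : IsCompl' c) {V W : Finset (ι → S)} (h : GP c V W) {i : ι} {s : S} {x : ι → Pt c}
    (hP : Cv i (lay V i s) x) (hQ : ¬ Cv i (lay W i s) x) :
    ∃ w ∈ W, w i ≠ s ∧ w i ≠ c s ∧
      ((2 ≤ (touch c i w (lay V i s)).card ∧ 2 ≤ (touch c i w (lay V i (c s))).card) ∨
       (1 ≤ (touch c i w (lay V i s)).card ∧ 1 ≤ (touch c i w (lay V i (c s))).card ∧
        6 ≤ (touch c i w (lay V i s)).card + (touch c i w (lay V i (c s))).card)) := by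
  obtain ⟨-, -, w, hw, ws, ws', hwx⟩ := h.layer_cov hc hP hQ
  refine ⟨w, hw, ws, ws', layers_card hc h.codeV h.tfV (T := touch c i w (lay V i s))
    (T' := touch c i w (lay V i (c s))) (i := i) (t := s) (w := w) ?_ ?_ ?_ ?_ ?_ ?_ ?_ ?_⟩
  · exact fun p hp => (mem_lay.1 (mem_touch.1 hp).1).1
  · exact fun p hp => (mem_lay.1 (mem_touch.1 hp).1).1
  · exact fun p hp => (mem_lay.1 (mem_touch.1 hp).1).2
  · exact fun p hp => (mem_lay.1 (mem_touch.1 hp).1).2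
  · exact fun p hp => (mem_touch.1 hp).2
  · exact fun p hp => (mem_touch.1 hp).2
  · exact fun x hx => h.touch_iff hc hw ws ws' hx
  · obtain ⟨p, hp, hpx⟩ := hP
    exact ⟨p, mem_touch.2 ⟨hp, offmeet_of_off hpx hwx⟩⟩

theorem touch_card_le (i : ι) (w : ι → S) (A : Finset (ι → S)) : (touch c i w A).card ≤ A.card :=
  Finset.card_le_card (Finset.filter_subset _ _)

/-- A layer whose coverage contains that of a nonempty layer of the other code is large. -/
theorem GP.five (hc : IsCompl' c) {V W : Finset (ι → S)} (h : GP c V W) {i : ι} {s : S} {q : ι → S}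
    (hq : q ∈ lay W i s) (hsub : ∀ x : ι → Pt c, Cv i (lay W i s) x → Cv i (lay V i s) x) :
    5 ≤ (lay V i s).card := by
  let D := (lay V i s).filter fun p => Meet c p q
  have hDl : D ⊆ lay V i s := Finset.filter_subset _ _
  have hDV : D ⊆ V := hDl.trans (lay_subset _ _ _)
  rcases trace hc D.card D q rfl (h.codeV.subset hDV) (h.tfV.subset hDV)
    (fun p hp => (Finset.mem_filter.1 hp).2) (fun x hx => by
      obtain ⟨p, hp, hpx⟩ := hsub x ⟨q, hq, fun k _ => hx k⟩
      have : Cov p x := cov_of_off hpx (by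
        rw [(mem_lay.1 hp).2, ← (mem_lay.1 hq).2]; exact hx i)
      exact ⟨p, Finset.mem_filter.2 ⟨hp, meet_of_cov this hx⟩, this⟩) with h1 | h1
  · exfalso
    have : q ∈ D := by rw [h1]; exact Finset.mem_singleton_self _
    exact h.disj q (hDV this) (mem_lay.1 hq).1
  · exact h1.trans (Finset.card_le_card hDl)

theorem code_image_update (hc : IsCompl' c) {A : Finset (ι → S)} (hA : Code c A) {i : ι} {s t : S}
    (hi : ∀ p ∈ A, p i = t) : Code c (A.image fun p => Function.update p i s) := by
  intro u hu v hv huv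
  obtain ⟨p, hp, rfl⟩ := Finset.mem_image.1 hu
  obtain ⟨p', hp', rfl⟩ := Finset.mem_image.1 hv
  obtain ⟨k, hk⟩ := hA p hp p' hp' (fun e => huv (by rw [e]))
  have hki : k ≠ i := by
    rintro rfl
    exact hc.ne t (by rw [← hi p hp, ← hk, hi p' hp', hi p hp])
  exact ⟨k, by rw [Function.update_of_ne hki, Function.update_of_ne hki]; exact hk⟩

theorem tf_image_update (hc : IsCompl' c) {A : Finset (ι → S)} (hA : TF c A) {i : ι} {s t : S}
    (hi : ∀ p ∈ A, p i = t) : TF c (A.image fun p => Function.update p i s) := by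
  rintro u hu v hv ⟨k, h1, h2⟩
  obtain ⟨p, hp, rfl⟩ := Finset.mem_image.1 hu
  obtain ⟨p', hp', rfl⟩ := Finset.mem_image.1 hv
  have hki : k ≠ i := by
    rintro rfl
    rw [Function.update_self, Function.update_self] at h1
    exact hc.ne s h1.symm
  rw [Function.update_of_ne hki, Function.update_of_ne hki] at h1
  refine hA p hp p' hp' ⟨k, h1, fun j hj => ?_⟩
  by_cases hji : j = i
  · rw [hji, hi p hp, hi p' hp']
  · have := h2 j hj
    rwa [Function.update_of_ne hji, Function.update_of_ne hji] at this

/-- Two complementary layers with equal coverage give a smaller pair. -/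
theorem GP.fold (hc : IsCompl' c) {V W : Finset (ι → S)} (h : GP c V W) {i : ι} {s : S}
    (he : ∀ x : ι → Pt c, Cv i (lay V i s) x ↔ Cv i (lay V i (c s)) x) :
    GP c (lay V i s) ((lay V i (c s)).image fun p => Function.update p i s) := by
  have hl := lay_subset V i s
  have hl' := lay_subset V i (c s)
  have hi' : ∀ p ∈ lay V i (c s), p i = c s := fun p hp => (mem_lay.1 hp).2
  refine ⟨h.codeV.subset hl, code_image_update hc (h.codeV.subset hl') hi', h.tfV.subset hl,
    tf_image_update hc (h.tfV.subset hl') hi', ?_, ?_⟩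
  · intro v hv hv'
    obtain ⟨p, hp, rfl⟩ := Finset.mem_image.1 hv'
    refine h.tfV p (hl' hp) _ (hl hv) ⟨i, ?_, fun k hk => by rw [Function.update_of_ne hk]⟩
    rw [Function.update_self, hi' p hp, hc.inv]
  · intro x
    constructor
    · rintro ⟨v, hv, hvx⟩
      obtain ⟨p, hp, hpx⟩ := (he x).1 ⟨v, hv, fun k _ => hvx k⟩
      refine ⟨_, Finset.mem_image_of_mem _ hp, cov_of_off (i := i) ?_ ?_⟩
      · intro k hk; rw [Function.update_of_ne hk]; exact hpx k hk
      · rw [Function.update_self, ← (mem_lay.1 hv).2]; exact hvx i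
    · rintro ⟨v, hv, hvx⟩
      obtain ⟨p, hp, rfl⟩ := Finset.mem_image.1 hv
      obtain ⟨v, hv, hv'⟩ := (he x).2 ⟨p, hp, fun k hk => by
        have := hvx k
        rwa [Function.update_of_ne hk] at this⟩
      refine ⟨v, hv, cov_of_off hv' ?_⟩
      have := hvx i
      rw [Function.update_self] at this
      rwa [(mem_lay.1 hv).2]

/-- Layers with equal coverage form a pair. -/
theorem GP.layer_gp {V W : Finset (ι → S)} (h : GP c V W) {i : ι} {s : S}
    (he : ∀ x : ι → Pt c, Cv i (lay V i s) x ↔ Cv i (lay W i s) x) : GP c (lay V i s) (lay W i s) := by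
  refine ⟨h.codeV.subset (lay_subset _ _ _), h.codeW.subset (lay_subset _ _ _),
    h.tfV.subset (lay_subset _ _ _), h.tfW.subset (lay_subset _ _ _),
    fun v h1 h2 => h.disj v (mem_lay.1 h1).1 (mem_lay.1 h2).1, fun x => ?_⟩
  constructor
  · rintro ⟨v, hv, hvx⟩
    obtain ⟨p, hp, hpx⟩ := (he x).1 ⟨v, hv, fun k _ => hvx k⟩
    exact ⟨p, hp, cov_of_off hpx (by rw [(mem_lay.1 hp).2, ← (mem_lay.1 hv).2]; exact hvx i)⟩
  · rintro ⟨v, hv, hvx⟩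
    obtain ⟨p, hp, hpx⟩ := (he x).2 ⟨v, hv, fun k _ => hvx k⟩
    exact ⟨p, hp, cov_of_off hpx (by rw [(mem_lay.1 hp).2, ← (mem_lay.1 hv).2]; exact hvx i)⟩
end Polybox

namespace Polybox
open scoped Classical
variable {ι : Type} {c : S → S}

/-- Pairs of minimal size. -/
structure MinGP (c : S → S) (V W : Finset (ι → S)) : Prop extends GP c V W where
  card : V.card = W.card
  ne : V.Nonempty
  min : ∀ V' W' : Finset (ι → S), GP c V' W' → V'.Nonempty → V.card ≤ V'.card

theorem MinGP.symm {V W : Finset (ι → S)} (h : MinGP c V W) : MinGP c W V :=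
  ⟨h.toGP.symm, h.card.symm, Finset.card_pos.1 (by rw [← h.card]; exact Finset.card_pos.2 h.ne),
    fun V' W' hg hn => by rw [← h.card]; exact h.min V' W' hg hn⟩

theorem lay_disjoint (hc : IsCompl' c) (V : Finset (ι → S)) (i : ι) (s : S) :
    (lay V i s).card + (lay V i (c s)).card ≤ V.card := by
  rw [← Finset.card_union_of_disjoint]
  · exact Finset.card_le_card (Finset.union_subset (lay_subset _ _ _) (lay_subset _ _ _))
  · rw [Finset.disjoint_left]
    intro p h1 h2
    exact hc.ne s ((mem_lay.1 h2).2.symm.trans (mem_lay.1 h1).2)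

/-- All letters at `i` used by the pair are `s`. -/
def AllAt (V W : Finset (ι → S)) (i : ι) (s : S) : Prop := (∀ v ∈ V, v i = s) ∧ ∀ w ∈ W, w i = s

theorem AllAt.symm {V W : Finset (ι → S)} {i : ι} {s : S} (h : AllAt V W i s) : AllAt W V i s := ⟨h.2, h.1⟩

theorem all_of_lay_card {V : Finset (ι → S)} {i : ι} {s : S} (h : V.card ≤ (lay V i s).card) :
    ∀ v ∈ V, v i = s := by
  intro v hv
  rw [← Finset.eq_of_subset_of_card_le (lay_subset V i s) h] at hv
  exact (mem_lay.1 hv).2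

/-- Coverage of the layers agrees only for constant coordinates or unused letters. -/
theorem MinGP.all_of_eq (hc : IsCompl' c) {V W : Finset (ι → S)} (h : MinGP c V W) {i : ι} {s : S}
    (he : ∀ x : ι → Pt c, Cv i (lay V i s) x ↔ Cv i (lay W i s) x) (hne : (lay V i s).Nonempty) :
    AllAt V W i s := by
  have hg := h.toGP.layer_gp he
  have h1 := h.min _ _ hg hne
  have h2 : (lay W i s).Nonempty := by
    obtain ⟨v, hv⟩ := hne
    obtain ⟨x, hx⟩ := exists_cov hc v
    obtain ⟨w, hw, -⟩ := (he x).1 ⟨v, hv, fun k _ => hx k⟩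
    exact ⟨w, hw⟩
  exact ⟨all_of_lay_card h1, all_of_lay_card (by rw [← h.card]; exact h.min _ _ hg.symm h2)⟩

variable [Fintype ι]

theorem MinGP.layer_four (hc : IsCompl' c) {V W : Finset (ι → S)} (h : MinGP c V W) {i : ι} {s : S}
    (hused : (∃ v ∈ V, v i = s ∨ v i = c s) ∨ ∃ w ∈ W, w i = s ∨ w i = c s)
    (hother : (∃ v ∈ V, v i ≠ s ∧ v i ≠ c s) ∨ ∃ w ∈ W, w i ≠ s ∧ w i ≠ c s) :
    4 ≤ (lay V i s).card + (lay W i (c s)).card ∧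
    ((lay V i s).card + (lay W i (c s)).card = 4 →
      (∃ x : ι → Pt c, Cv i (lay V i s) x ∧ ¬ Cv i (lay W i s) x) ∧
      (∃ x : ι → Pt c, Cv i (lay W i s) x ∧ ¬ Cv i (lay V i s) x) ∧
      (lay V i s).card = 2 ∧ (lay V i (c s)).card = 2 ∧ (lay W i s).card = 2 ∧ (lay W i (c s)).card = 2) := by
  have hcard := h.toGP.layer_card hc i s
  -- only one sign
  have only : ∀ {V W : Finset (ι → S)}, MinGP c V W → (∃ x : ι → Pt c, Cv i (lay V i s) x ∧ ¬ Cv i (lay W i s) x) →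
      (¬ ∃ x : ι → Pt c, Cv i (lay W i s) x ∧ ¬ Cv i (lay V i s) x) →
      5 ≤ (lay V i s).card ∨ 5 ≤ (lay V i (c s)).card := by
    intro V W h ⟨x, hx1, hx2⟩ hm
    push Not at hm
    have hm' : ∀ x : ι → Pt c, Cv i (lay W i (c s)) x → Cv i (lay V i (c s)) x := by
      intro x hx
      by_contra hcon
      have := h.symm.toGP.layer_cov hc hx hcon
      rw [hc.inv] at this
      exact this.2.1 (hm x this.1)
    by_cases hQ : (lay W i s).Nonempty
    · obtain ⟨q, hq⟩ := hQ
      exact Or.inl (h.toGP.five hc hq hm)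
    by_cases hQ' : (lay W i (c s)).Nonempty
    · obtain ⟨q, hq⟩ := hQ'
      exact Or.inr (h.toGP.five hc hq hm')
    exfalso
    rw [Finset.not_nonempty_iff_eq_empty] at hQ hQ'
    have he : ∀ x : ι → Pt c, Cv i (lay V i s) x ↔ Cv i (lay V i (c s)) x := by
      intro x
      constructor
      · intro hx
        exact (h.toGP.layer_cov hc hx (by rw [hQ]; rintro ⟨q, hq, -⟩; simp at hq)).1
      · intro hx
        have := (h.toGP.layer_cov hc hx (by rw [hQ']; rintro ⟨q, hq, -⟩; simp at hq)).1
        rwa [hc.inv] at this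
    obtain ⟨p, hp, hpx⟩ := hx1
    have h1 := h.min _ _ (h.toGP.fold hc he) ⟨p, hp⟩
    obtain ⟨p', hp', -⟩ := (he x).1 ⟨p, hp, hpx⟩
    have h2 := Finset.card_pos.2 ⟨p', hp'⟩
    have h3 := lay_disjoint hc V i s
    omega
  by_cases hp : ∃ x : ι → Pt c, Cv i (lay V i s) x ∧ ¬ Cv i (lay W i s) x
  · by_cases hm : ∃ x : ι → Pt c, Cv i (lay W i s) x ∧ ¬ Cv i (lay V i s) x
    · have hp0 := hp
      have hm0 := hm
      obtain ⟨x, x1, x2⟩ := hp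
      obtain ⟨y, y1, y2⟩ := hm
      obtain ⟨w, -, -, -, hw⟩ := h.toGP.plus hc x1 x2
      obtain ⟨v, -, -, -, hv⟩ := h.symm.toGP.plus hc y1 y2
      have t1 := touch_card_le (c := c) i w (lay V i s)
      have t2 := touch_card_le (c := c) i w (lay V i (c s))
      have t3 := touch_card_le (c := c) i v (lay W i s)
      have t4 := touch_card_le (c := c) i v (lay W i (c s))
      refine ⟨by omega, fun h4 => ⟨hp0, hm0, by omega, by omega, by omega, by omega⟩⟩
    · have := only h hp hm
      omega
  · by_cases hm : ∃ x : ι → Pt c, Cv i (lay W i s) x ∧ ¬ Cv i (lay V i s) x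
    · have := only h.symm hm hp
      omega
    · exfalso
      push Not at hp hm
      have he : ∀ x : ι → Pt c, Cv i (lay V i s) x ↔ Cv i (lay W i s) x := fun x => ⟨hp x, hm x⟩
      have he' : ∀ x : ι → Pt c, Cv i (lay V i (c s)) x ↔ Cv i (lay W i (c s)) x := by
        intro x
        constructor
        · intro hx
          by_contra hcon
          have := h.toGP.layer_cov hc hx hcon
          rw [hc.inv] at this
          exact this.2.1 (hp x this.1)
        · intro hx
          by_contra hcon
          have := h.symm.toGP.layer_cov hc hx hcon
          rw [hc.inv] at this
          exact this.2.1 (hm x this.1)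
      have key : AllAt V W i s ∨ AllAt V W i (c s) := by
        rcases hused with ⟨v, hv, hs | hs⟩ | ⟨v, hv, hs | hs⟩
        · exact Or.inl (h.all_of_eq hc he ⟨v, mem_lay.2 ⟨hv, hs⟩⟩)
        · exact Or.inr (h.all_of_eq hc he' ⟨v, mem_lay.2 ⟨hv, hs⟩⟩)
        · exact Or.inl (h.symm.all_of_eq hc (fun x => (he x).symm) ⟨v, mem_lay.2 ⟨hv, hs⟩⟩).symm
        · exact Or.inr (h.symm.all_of_eq hc (fun x => (he' x).symm) ⟨v, mem_lay.2 ⟨hv, hs⟩⟩).symm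
      rcases key with k | k
      · rcases hother with ⟨v, hv, h1, h2⟩ | ⟨v, hv, h1, h2⟩
        · exact h1 (k.1 v hv)
        · exact h1 (k.2 v hv)
      · rcases hother with ⟨v, hv, h1, h2⟩ | ⟨v, hv, h1, h2⟩
        · exact h2 (k.1 v hv)
        · exact h2 (k.2 v hv)
end Polybox

namespace Polybox
open scoped Classical
variable {ι : Type} {c : S → S}

/-- The pair of `s` is used at `i`. -/
def Used (c : S → S) (V W : Finset (ι → S)) (i : ι) (s : S) : Prop :=
  (∃ v ∈ V, v i = s ∨ v i = c s) ∨ ∃ w ∈ W, w i = s ∨ w i = c s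

/-- Letters of different pairs. -/
def Far (c : S → S) (s t : S) : Prop := s ≠ t ∧ s ≠ c t

theorem Far.symm (hc : IsCompl' c) {s t : S} (h : Far c s t) : Far c t s :=
  ⟨h.1.symm, fun e => h.2 ((c_comm hc).1 e)⟩

theorem Used.other (hc : IsCompl' c) {V W : Finset (ι → S)} {i : ι} {s t : S} (h : Used c V W i t) (hst : Far c s t) :
    (∃ v ∈ V, v i ≠ s ∧ v i ≠ c s) ∨ ∃ w ∈ W, w i ≠ s ∧ w i ≠ c s := by
  have key : ∀ e, e = t ∨ e = c t → e ≠ s ∧ e ≠ c s := by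
    rintro e (rfl | rfl)
    · exact ⟨hst.1.symm, (hst.symm hc).2⟩
    · exact ⟨hst.2.symm, fun e => hst.1 ((c_inj hc).1 e).symm⟩
  rcases h with ⟨v, hv, h⟩ | ⟨v, hv, h⟩
  · exact Or.inl ⟨v, hv, key _ h⟩
  · exact Or.inr ⟨v, hv, key _ h⟩

theorem six_layers (hc : IsCompl' c) (V : Finset (ι → S)) (i : ι) {a b d : S} (hab : Far c a b) (had : Far c a d)
    (hbd : Far c b d) : (lay V i a).card + (lay V i (c a)).card + ((lay V i b).card + (lay V i (c b)).card) +
      ((lay V i d).card + (lay V i (c d)).card) ≤ V.card := by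
  simp only [lay, Finset.card_filter, ← Finset.sum_add_distrib]
  rw [Finset.card_eq_sum_ones]
  refine Finset.sum_le_sum fun v _ => ?_
  have h1 := hc.ne a
  have h2 := hc.ne b
  have h3 := hc.ne d
  have e1 := @c_inj _ _ hc a b
  have e2 := @c_inj _ _ hc a d
  have e3 := @c_inj _ _ hc b d
  have f1 := hab.symm hc
  have f2 := had.symm hc
  have f3 := hbd.symm hc
  unfold Far at *
  split_ifs <;> first | omega | (exfalso; simp_all)

variable [Fintype ι]

theorem MinGP.three_four (hc : IsCompl' c) {V W : Finset (ι → S)} (h : MinGP c V W) (hn : V.card ≤ 12) {i : ι}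
    {a b d : S} (hab : Far c a b) (had : Far c a d) (hbd : Far c b d) (ha : Used c V W i a)
    (hb : Used c V W i b) (hd : Used c V W i d) :
    (∃ x : ι → Pt c, Cv i (lay V i a) x ∧ ¬ Cv i (lay W i a) x) ∧
      (∃ x : ι → Pt c, Cv i (lay W i a) x ∧ ¬ Cv i (lay V i a) x) ∧
      (lay V i a).card = 2 ∧ (lay V i (c a)).card = 2 ∧ (lay W i a).card = 2 ∧ (lay W i (c a)).card = 2 := by
  have h1 := h.layer_four hc ha (hb.other hc hab)
  have h2 := (h.layer_four hc hb (ha.other hc (hab.symm hc))).1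
  have h3 := (h.layer_four hc hd (ha.other hc (had.symm hc))).1
  have hV := six_layers hc V i hab had hbd
  have hW := six_layers hc W i hab had hbd
  have k1 := h.toGP.layer_card hc i a
  have k2 := h.toGP.layer_card hc i b
  have k3 := h.toGP.layer_card hc i d
  have := h.card
  exact h1.2 (by omega)

omit [Fintype ι] in
theorem GP.cv_identity (hc : IsCompl' c) {V W : Finset (ι → S)} (h : GP c V W) (i : ι) (s : S) (x : ι → Pt c) :
    ind (Cv i (lay V i s) x) - ind (Cv i (lay V i (c s)) x) =
      ind (Cv i (lay W i s) x) - ind (Cv i (lay W i (c s)) x) := by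
  have h1 := fun a b => h.layer_cov hc (i := i) (s := s) (x := x) a b
  have h2 := fun a b => h.symm.layer_cov hc (i := i) (s := s) (x := x) a b
  have h3 := fun a b => h.layer_cov hc (i := i) (s := c s) (x := x) a b
  have h4 := fun a b => h.symm.layer_cov hc (i := i) (s := c s) (x := x) a b
  rw [hc.inv] at h3 h4
  by_cases a1 : Cv i (lay V i s) x <;> by_cases a2 : Cv i (lay V i (c s)) x <;>
    by_cases a3 : Cv i (lay W i s) x <;> by_cases a4 : Cv i (lay W i (c s)) x <;>
    simp_all [ind]

omit [Fintype ι] in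
theorem ind_cv_pair {V : Finset (ι → S)} (h : Code c V) (hc : IsCompl' c) {i : ι} {s : S} {p₁ p₂ : ι → S}
    (hp : ∀ p, p ∈ lay V i s ↔ p = p₁ ∨ p = p₂) (hne : p₁ ≠ p₂) (x : ι → Pt c) :
    ind (Cv i (lay V i s) x) = ind (OffCov i p₁ x) + ind (OffCov i p₂ x) := by
  have m1 := mem_lay.1 ((hp p₁).2 (Or.inl rfl))
  have m2 := mem_lay.1 ((hp p₂).2 (Or.inr rfl))
  have hx : ¬ (OffCov i p₁ x ∧ OffCov i p₂ x) := by
    rintro ⟨h1, h2⟩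
    exact hne (h.unique m1.1 m2.1
      (cov_update (y := pset hc (x i) s) h1 (by rw [m1.2]; exact mem_pset_self hc _ _))
      (cov_update h2 (by rw [m2.2]; exact mem_pset_self hc _ _)))
  have e : Cv i (lay V i s) x ↔ OffCov i p₁ x ∨ OffCov i p₂ x := by
    simp only [Cv, hp]
    constructor
    · rintro ⟨p, rfl | rfl, h⟩
      · exact Or.inl h
      · exact Or.inr h
    · rintro (h | h)
      · exact ⟨p₁, Or.inl rfl, h⟩
      · exact ⟨p₂, Or.inr rfl, h⟩
  by_cases h1 : OffCov i p₁ x <;> by_cases h2 : OffCov i p₂ x <;> simp_all [ind]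

omit [Fintype ι] in
theorem GP.shape_of_plus (hc : IsCompl' c) {V W : Finset (ι → S)} (h : GP c V W) {i : ι} {s : S}
    (hx : ∃ x : ι → Pt c, Cv i (lay V i s) x ∧ ¬ Cv i (lay W i s) x)
    (h2 : (lay V i s).card = 2) (h2' : (lay V i (c s)).card = 2) :
    ∃ w ∈ W, ∃ p₁ p₂ r₁ r₂ α β, (∀ p, p ∈ lay V i s ↔ p = p₁ ∨ p = p₂) ∧
      (∀ p, p ∈ lay V i (c s) ↔ p = r₁ ∨ p = r₂) ∧ Shape c i w p₁ p₂ r₁ r₂ α β ∧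
      ∀ x : ι → Pt c, gap i p₁ p₂ r₁ r₂ x = ind (Cv i (lay V i s) x) - ind (Cv i (lay V i (c s)) x) := by
  obtain ⟨x, hx1, hx2⟩ := hx
  obtain ⟨w, hw, ws, ws', hT⟩ := h.plus hc hx1 hx2
  have t1 := touch_card_le (c := c) i w (lay V i s)
  have t2 := touch_card_le (c := c) i w (lay V i (c s))
  have e1 : touch c i w (lay V i s) = lay V i s :=
    Finset.eq_of_subset_of_card_le (Finset.filter_subset _ _) (by omega)
  have e2 : touch c i w (lay V i (c s)) = lay V i (c s) :=
    Finset.eq_of_subset_of_card_le (Finset.filter_subset _ _) (by omega)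
  obtain ⟨p₁, p₂, r₁, r₂, α, β, hp, hr, np, nr, hsh⟩ := layers_shape hc h.codeV h.tfV (T := lay V i s)
    (T' := lay V i (c s)) (i := i) (t := s) (w := w) (lay_subset _ _ _) (lay_subset _ _ _)
    (fun p hp => (mem_lay.1 hp).2) (fun p hp => (mem_lay.1 hp).2)
    (fun p hp => by rw [← e1] at hp; exact (mem_touch.1 hp).2)
    (fun p hp => by rw [← e2] at hp; exact (mem_touch.1 hp).2)
    (fun x hx => by
      have := h.touch_iff hc hw ws ws' hx
      rwa [e1, e2] at this) h2 h2'
  refine ⟨w, hw, p₁, p₂, r₁, r₂, α, β, hp, hr, hsh, fun x => ?_⟩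
  rw [ind_cv_pair h.codeV hc hp np, ind_cv_pair h.codeV hc hr nr, gap]
  ring

/-- No coordinate uses three pairs of letters. -/
theorem MinGP.no_three (hc : IsCompl' c) {V W : Finset (ι → S)} (h : MinGP c V W) (hn : V.card ≤ 12) {i : ι}
    {s b d : S} (hsb : Far c s b) (hsd : Far c s d) (hbd : Far c b d) (hs : Used c V W i s)
    (hb : Used c V W i b) (hd : Used c V W i d) : False := by
  obtain ⟨hp, hm, c1, c2, c3, c4⟩ := h.three_four hc hn hsb hsd hbd hs hb hd
  obtain ⟨w, hw, p₁, p₂, r₁, r₂, α, β, mp, mr, sh, g⟩ := h.toGP.shape_of_plus hc hp c1 c2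
  obtain ⟨v, hv, q₁, q₂, t₁, t₂, α', β', mq, mt, sh', g'⟩ := h.symm.toGP.shape_of_plus hc hm c3 c4
  have gg : ∀ x : ι → Pt c, gap i p₁ p₂ r₁ r₂ x = gap i q₁ q₂ t₁ t₂ x := fun x => by
    rw [g, g', h.toGP.cv_identity hc]
  have R1 := fun k => shapes_rest hc sh sh' (fun x hx => by rwa [gg]) (k := k)
  have P1 := mem_lay.1 ((mp p₁).2 (Or.inl rfl))
  have Q1 := mem_lay.1 ((mq q₁).2 (Or.inl rfl))
  have Q2 := mem_lay.1 ((mq q₂).2 (Or.inr rfl))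
  have hα' : α' = α ∨ α' = β := by
    by_contra hcon
    push Not at hcon
    exact (R1 α' sh'.1 hcon.1 hcon.2).1 rfl
  have hβ' : β' = α ∨ β' = β := by
    by_contra hcon
    push Not at hcon
    exact (R1 β' sh'.2.1 hcon.1 hcon.2).2.1 rfl
  have hαβ' : α' ≠ β' := sh'.2.2.1
  have rest : ∀ k, k ≠ i → k ≠ α → k ≠ β → q₁ k = p₁ k := fun k h1 h2 h3 => (R1 k h1 h2 h3).2.2
  rcases hα' with rfl | rfl
  · obtain rfl : β' = β := hβ'.resolve_left hαβ'.symm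
    have L := (shapes_letters hc sh sh' rest).1 gg
    refine h.disj p₁ P1.1 ?_
    have : q₁ = p₁ := by
      funext k
      by_cases hk : k = i
      · rw [hk, P1.2, Q1.2]
      by_cases hk1 : k = α'
      · rw [hk1, L.1]
      by_cases hk2 : k = β'
      · rw [hk2, L.2]
      exact rest k hk hk1 hk2
    rw [← this]; exact Q1.1
  · obtain rfl : β' = α := hβ'.resolve_right hαβ'.symm
    obtain ⟨hα, hβ, hαβ, a1, a2, b1, b2, e1, e2, e3, e4, e5, e6, e7⟩ := sh'.swap hc
    have q₂rest : ∀ k, k ≠ i → k ≠ β' → k ≠ α' → q₂ k = p₁ k := fun k h1 h2 h3 => by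
      rw [(e7 k h1 h2 h3).2.1, ← (e7 k h1 h2 h3).2.2, rest k h1 h2 h3]
    obtain ⟨L1, L2, L3, L4⟩ := (shapes_letters hc sh (sh'.swap hc) (fun k h1 h2 h3 => by
      rw [← (e7 k h1 h2 h3).2.2, rest k h1 h2 h3])).2 (fun x => by rw [gap_swap i q₁ q₂ t₁ t₂, neg_neg, gg])
    obtain ⟨-, -, -, A1, A2, B1, B2, E1, E2, E3, E4, E5, E6, E7⟩ := sh
    -- the box word
    let Y : ι → S := Function.update p₁ α' (c (p₁ α'))
    let D : Finset (ι → S) := V.filter fun u => (u i ≠ s ∧ u i ≠ c s) ∧ OffMeet c i u Y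
    have memD : ∀ u, u ∈ D ↔ u ∈ V ∧ (u i ≠ s ∧ u i ≠ c s) ∧ OffMeet c i u Y := fun u => Finset.mem_filter
    have hDV : D ⊆ V := Finset.filter_subset _ _
    have Yi : Y i = s := by simp only [Y]; rw [Function.update_of_ne (Ne.symm hβ), P1.2]
    have Yb : Y α' = c (p₁ α') := Function.update_self _ _ _
    have Yo : ∀ k, k ≠ α' → Y k = p₁ k := fun k hk => Function.update_of_ne hk _ _
    have R2 := mem_lay.1 ((mr r₂).2 (Or.inr rfl))
    have P2 := mem_lay.1 ((mp p₂).2 (Or.inr rfl))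
    have letters : ∀ u ∈ D, u α' = c (p₁ α') := by
      intro u hu
      obtain ⟨hu1, hu2, hu3⟩ := (memD u).1 hu
      obtain ⟨k, hk⟩ := h.codeV u hu1 p₁ P1.1 (fun e => hu2.1 (by rw [e, P1.2]))
      have hki : k ≠ i := by
        rintro rfl
        rw [P1.2] at hk
        exact hu2.2 ((c_comm hc).1 hk)
      by_cases hka : k = α'
      · rw [← hka]; exact (c_comm hc).1 hk
      · exact absurd ((c_comm hc).1 hk) (by rw [← Yo k hka]; exact hu3 k hki)
    refine no_thin_cover hc (h.codeV.subset hDV) (h.tfV.subset hDV) (q := Y) (i := i) ?_ ?_ ?_ ?_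
    · intro u hu k
      obtain ⟨hu1, hu2, hu3⟩ := (memD u).1 hu
      by_cases hk : k = i
      · rw [hk, Yi]; exact hu2.2
      · exact hu3 k hk
    · intro x hx
      have hxi : s ∈ x i := by rw [← Yi]; exact hx i
      let x' := Function.update x α' (pset hc (x α') (c (w α')))
      have x'o : ∀ k, k ≠ α' → x' k = x k := fun k hk => Function.update_of_ne hk _ _
      have x'b : x' α' = pset hc (x α') (c (w α')) := Function.update_self _ _ _
      have hYx' : Cov Y x' := by
        intro k
        by_cases hk : k = α'
        · subst hk
          rw [x'b, Yb]
          refine mem_pset_of hc (by rw [← Yb]; exact hx k) ?_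
          rw [hc.inv, c_ne_iff hc]; exact B2
        · rw [x'o k hk]; exact hx k
      have hq₂ : Cov q₂ x' := by
        intro k
        by_cases hki : k = i
        · rw [hki, Q2.2, x'o i (Ne.symm hβ)]; exact hxi
        by_cases hk : k = α'
        · rw [hk, e4, L2, x'b]; exact mem_pset_self hc _ _
        by_cases hkb : k = β'
        · rw [hkb, e3, L3, ← Yo β' hαβ]; exact hYx' β'
        · rw [q₂rest k hki hkb hk, ← Yo k hk]; exact hYx' k
      obtain ⟨u, hu, hux⟩ := (h.eqv x').2 ⟨q₂, Q2.1, hq₂⟩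
      have hus : u i ≠ s := by
        intro e
        rcases (mp u).1 (mem_lay.2 ⟨hu, e⟩) with rfl | rfl
        · have := hYx' α'
          rw [Yb, mem_c] at this
          exact this (hux α')
        · have := hux β'
          rw [E1, mem_c, ← Yo β' hαβ] at this
          exact this (hYx' β')
      have hus' : u i ≠ c s := by
        intro e
        have := hux i
        rw [e, mem_c, x'o i (Ne.symm hβ)] at this
        exact this hxi
      have huD : u ∈ D := (memD u).2 ⟨hu, ⟨hus, hus'⟩, (meet_of_cov hux hYx').off i⟩
      refine ⟨u, huD, fun k => ?_⟩
      by_cases hk : k = α'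
      · rw [hk, letters u huD, ← Yb]; exact hx α'
      · rw [← x'o k hk]; exact hux k
    · intro u hu
      rw [Yi]; exact ((memD u).1 hu).2.1
    · intro t
      by_cases hne : (lay D i t).Nonempty
      · obtain ⟨u, hu⟩ := hne
        obtain ⟨huD, hut⟩ := mem_lay.1 hu
        obtain ⟨hu1, hu2, hu3⟩ := (memD u).1 huD
        rw [hut] at hu2
        have ht : Used c V W i t := Or.inl ⟨u, hu1, Or.inl hut⟩
        have hts : Far c t s := ⟨hu2.1, hu2.2⟩
        have : (lay D i t).card ≤ (lay V i t).card :=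
          Finset.card_le_card fun p hp => mem_lay.2 ⟨hDV (mem_lay.1 hp).1, (mem_lay.1 hp).2⟩
        by_cases htb : Far c t b
        · have := (h.three_four hc hn hts htb hsb ht hs hb).2.2.1
          omega
        · have htd : Far c t d := by
            have e : t = b ∨ t = c b := by
              unfold Far at htb; tauto
            rcases e with rfl | rfl
            · exact hbd
            · exact ⟨by rw [c_ne_iff hc]; exact hbd.2, fun e => hbd.1 ((c_inj hc).1 e)⟩
          have := (h.three_four hc hn hts htd hsd ht hs hd).2.2.1
          omega
      · rw [Finset.not_nonempty_iff_eq_empty.1 hne]; simp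
end Polybox

namespace Polybox
namespace Search

/-!
A search engine over words of length six in the letters `0, 1, 2, 3` (complement: flip the low bit).
A word is a number below `4096`, two bits per letter; a set of words is a bit mask of length `4096`.
Everything is written with primitive recursors and kernel-accelerated operations on `ℕ`.
-/

/-- Masks of the words with letter `0` in a given column. -/
noncomputable def B0 : Nat := Nat.div (Nat.sub (Nat.pow 2 4096) 1) (Nat.sub (Nat.pow 2 4) 1)
noncomputable def B1 : Nat := Nat.mul 15 (Nat.div (Nat.sub (Nat.pow 2 4096) 1) (Nat.sub (Nat.pow 2 16) 1))
noncomputable def B2 : Nat := Nat.mul (Nat.sub (Nat.pow 2 16) 1) (Nat.div (Nat.sub (Nat.pow 2 4096) 1) (Nat.sub (Nat.pow 2 64) 1))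
noncomputable def B3 : Nat := Nat.mul (Nat.sub (Nat.pow 2 64) 1) (Nat.div (Nat.sub (Nat.pow 2 4096) 1) (Nat.sub (Nat.pow 2 256) 1))
noncomputable def B4 : Nat := Nat.mul (Nat.sub (Nat.pow 2 256) 1) (Nat.div (Nat.sub (Nat.pow 2 4096) 1) (Nat.sub (Nat.pow 2 1024) 1))
noncomputable def B5 : Nat := Nat.sub (Nat.pow 2 1024) 1
noncomputable def full : Nat := Nat.sub (Nat.pow 2 4096) 1

/-- Conditional. -/
noncomputable def bif' {α : Type} (b : Bool) (x y : α) : α := Bool.rec (motive := fun _ => α) y x b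

/-- Evaluate the argument before passing it on. -/
noncomputable def force {α : Type} (n : Nat) (k : Nat → α) : α :=
  Nat.rec (motive := fun _ => α) (k 0) (fun m _ => k (Nat.succ m)) n

/-- Words with the same letter as `w` in a given column. -/
noncomputable def col0 (w : Nat) : Nat := Nat.shiftLeft B0 (Nat.land w 3)
noncomputable def col1 (w : Nat) : Nat := Nat.shiftLeft B1 (Nat.land w 12)
noncomputable def col2 (w : Nat) : Nat := Nat.shiftLeft B2 (Nat.land w 48)
noncomputable def col3 (w : Nat) : Nat := Nat.shiftLeft B3 (Nat.land w 192)
noncomputable def col4 (w : Nat) : Nat := Nat.shiftLeft B4 (Nat.land w 768)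
noncomputable def col5 (w : Nat) : Nat := Nat.shiftLeft B5 (Nat.land w 3072)

/-- Words sharing a letter with `w`. -/
noncomputable def share (w : Nat) : Nat :=
  Nat.lor (Nat.lor (Nat.lor (col0 w) (col1 w)) (Nat.lor (col2 w) (col3 w))) (Nat.lor (col4 w) (col5 w))

/-- The single word `w xor k`. -/
noncomputable def bit (w k : Nat) : Nat := Nat.shiftLeft 1 (Nat.xor w k)

/-- Words dichotomous to `w` and not twins of `w`. -/
noncomputable def same (w : Nat) : Nat :=
  Nat.xor (share (Nat.xor w 1365))
   (Nat.lor (Nat.lor (Nat.lor (bit w 1) (bit w 4)) (Nat.lor (bit w 16) (bit w 64))) (Nat.lor (bit w 256) (bit w 1024)))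

/-- Words differing from `w` in at most one column, and not complementary there. -/
noncomputable def near (w : Nat) : Nat :=
  Nat.lor (bit w 0) (Nat.lor
   (Nat.lor (Nat.lor (Nat.lor (bit w 2) (bit w 8)) (Nat.lor (bit w 32) (bit w 128))) (Nat.lor (bit w 512) (bit w 2048)))
   (Nat.lor (Nat.lor (Nat.lor (bit w 3) (bit w 12)) (Nat.lor (bit w 48) (bit w 192))) (Nat.lor (bit w 768) (bit w 3072))))

/-- Words allowed on one side when `w` is on the other. -/
noncomputable def cross (h : Bool) (w : Nat) : Nat := Nat.xor full (bif' h (bit w 0) (near w))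

/-- Words covering the cell `c`. -/
noncomputable def cellMask (c : Nat) : Nat :=
  (fun c0 c1 => Nat.land (Nat.land (Nat.land (Nat.lor (col0 c0) (col0 c1)) (Nat.lor (col1 c0) (col1 c1)))
    (Nat.land (Nat.lor (col2 c0) (col2 c1)) (Nat.lor (col3 c0) (col3 c1))))
    (Nat.land (Nat.lor (col4 c0) (col4 c1)) (Nat.lor (col5 c0) (col5 c1))))
   (Nat.land c 1365) (Nat.lor 2730 (Nat.land (Nat.shiftRight c 1) 1365))

/-- Words using the second pair of letters in a given column. -/
noncomputable def p2 : Nat := Nat.lor (col2 32) (col2 48)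
noncomputable def p3 : Nat := Nat.lor (col3 128) (col3 192)
noncomputable def p4 : Nat := Nat.lor (col4 512) (col4 768)
noncomputable def p5 : Nat := Nat.lor (col5 2048) (col5 3072)
/-- Words whose pair bit does not drop between two consecutive columns. -/
noncomputable def g2 : Nat := Nat.lor (Nat.xor full p2) p3
noncomputable def g3 : Nat := Nat.lor (Nat.xor full p3) p4
noncomputable def g4 : Nat := Nat.lor (Nat.xor full p4) p5

/-- Words in normal form with respect to the available column swaps. -/
noncomputable def sortMask (e : Nat) : Nat :=
  Nat.land (bif' (Nat.beq (Nat.land e 48) 0) g2 full)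
   (Nat.land (bif' (Nat.beq (Nat.land e 192) 0) g3 full) (bif' (Nat.beq (Nat.land e 768) 0) g4 full))

/-- Membership in a mask. -/
noncomputable def inMask (m w : Nat) : Bool := Nat.beq (Nat.land (Nat.shiftRight m w) 1) 1
noncomputable def anyIn (m : Nat) (l : List Nat) : Bool :=
  List.rec (motive := fun _ => Bool) false (fun a _ r => bif' (inMask m a) true r) l

/-- Table of bit parities. -/
noncomputable def par : Nat := 4307624068277347486620978117644630389521163292326672683452035016566979907475895852677523809774830926120933592877073319585230491154385540995971187010650281115226865574582393694250313707189238962555984071516729832284987877447591461925080246935500987793642181789019049494784138145013823364755336800750664368622147732128142742462048521374106223184141910544191747735380670515611760277420951046115344572699793411047444622227947080138476022278394684742428293091197460646687102917172951796559483446945960831854814226072689753469729406682167083593796715188263174603794822750743830579155858691262974986866692934958105332433103978469547269513603464577125428878088465820359996190296996250373000040671427348366378604854853993982407653953650162341103160053446833939920503348048962897149188028824734337422666318682113719951400326862908643132959179752236079678730762311229802192694528230008633282109018284330819694646615046074450655249338141850020458050292921357687533705896912014762047137607986134752620425117132499180921122125699080049317340151015497894559165912962491262034830052921018476324843923619095877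15983481766030011319110617513322455913181277196524517688061548439494181853220249582114142996432906093435682956233714326210876384175117134230

/-- Insert a signed key, cancelling an opposite one. -/
noncomputable def ins (k : Nat) (l : List Nat) : List Nat :=
  List.rec (motive := fun _ => List Nat) [k] (fun a t r => bif' (Nat.beq a (Nat.xor k 1)) t (a :: r)) l

/-- Pair pattern of `w` on `pm` together with its sign. -/
noncomputable def key (pm side w : Nat) : Nat :=
  Nat.lor (Nat.shiftLeft (Nat.land w pm) 1)
    (Nat.land (Nat.xor side (Nat.shiftRight par (Nat.land w (Nat.shiftRight pm 1)))) 1)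

noncomputable def pushKeys (rm pm side : Nat) (l acc : List Nat) : List Nat :=
  List.rec (motive := fun _ => List Nat → List Nat) (fun acc => acc)
   (fun a _ r acc => bif' (inMask rm (Nat.land a 15)) (r (ins (key pm side a) acc)) (r acc)) l acc
noncomputable def cnt (rm : Nat) (l : List Nat) : Nat :=
  List.rec (motive := fun _ => Nat) 0
   (fun a _ r => Nat.add (Nat.land (Nat.shiftRight rm (Nat.land a 15)) 1) r) l
noncomputable def len (l : List Nat) : Nat :=
  List.rec (motive := fun _ => Nat) 0 (fun _ _ r => Nat.succ r) l
noncomputable def notMem (k : Nat) (l : List Nat) : Bool :=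
  List.rec (motive := fun _ => Bool) true (fun a _ r => bif' (Nat.beq a k) false r) l

/-- Spread six column bits over the pair bits. -/
noncomputable def spread (a : Nat) : Nat :=
  Nat.add (Nat.add (Nat.add (Nat.mul 2 (Nat.land a 1)) (Nat.mul 4 (Nat.land a 2))) (Nat.add (Nat.mul 8 (Nat.land a 4)) (Nat.mul 16 (Nat.land a 8))))
    (Nat.add (Nat.mul 32 (Nat.land a 16)) (Nat.mul 64 (Nat.land a 32)))

/-- A region: columns `0` and `1` as a mask `rm`, a bound on the words inside, and the restricted columns. -/
structure Reg where
  rm : Nat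
  b : Nat
  fx : Nat

noncomputable def getReg (i : Nat) (l : List Reg) : Reg :=
  List.rec (motive := fun _ => Nat → Reg) (fun _ => ⟨0, 0, 0⟩)
    (fun a _ r i => bif' (Nat.beq i 0) a (r (Nat.sub i 1))) l i

/-- Words excluded by the balance of the pair patterns inside a region. -/
noncomputable def mkFilter (regs : List Reg) (V W : List Nat) (side x : Nat) : Nat → Bool :=
  Reg.rec (motive := fun _ => Nat → Bool) (fun rm b fx =>
   (fun pm => (fun ks =>
     bif' (Nat.beq (Nat.land pm fx) 0)
      (bif' (Nat.ble (Nat.mul 2 b) (Nat.add (len ks) (Nat.add (cnt rm V) (cnt rm W))))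
       (fun w => bif' (inMask rm (Nat.land w 15)) (notMem (Nat.xor 1 (key pm side w)) ks) false)
       (fun _ => false)) (fun _ => false))
      (pushKeys rm pm 0 V (pushKeys rm pm 1 W [])))
    (spread (Nat.shiftRight x 2))) (getReg (Nat.land x 3) regs)

/-- Evaluate column by column, leaving out the columns in `jm`. -/
noncomputable def offCol (jm i m d : Nat) : Nat :=
  bif' (Nat.beq (Nat.land (Nat.shiftRight jm i) 1) 0) m d

/-- Words sharing a letter with `w` in a column outside `jm`. -/
noncomputable def shareOff (jm w : Nat) : Nat :=
  Nat.lor (Nat.lor (Nat.lor (offCol jm 0 (col0 w) 0) (offCol jm 1 (col1 w) 0))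
    (Nat.lor (offCol jm 2 (col2 w) 0) (offCol jm 3 (col3 w) 0)))
    (Nat.lor (offCol jm 4 (col4 w) 0) (offCol jm 5 (col5 w) 0))

/-- Words agreeing with `q` on `jm`. -/
noncomputable def agree (jm q : Nat) : Nat :=
  Nat.land (Nat.land (Nat.land (offCol jm 0 full (col0 q)) (offCol jm 1 full (col1 q)))
    (Nat.land (offCol jm 2 full (col2 q)) (offCol jm 3 full (col3 q))))
    (Nat.land (offCol jm 4 full (col4 q)) (offCol jm 5 full (col5 q)))

noncomputable def landAll (f : Nat → Nat) (l : List Nat) (m : Nat) : Nat :=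
  List.rec (motive := fun _ => Nat) m (fun a _ r => Nat.land (f a) r) l

noncomputable def allIn (m : Nat) (l : List Nat) : Bool :=
  List.rec (motive := fun _ => Bool) true (fun a _ r => bif' (inMask m a) r false) l

/-- Certificate that a code of twelve words is thin around `q`. -/
noncomputable def flat (q jm : Nat) (V : List Nat) : Bool :=
  bif' (Nat.beq (len V) 12)
    (bif' (Nat.ble (Nat.add (Nat.add (Nat.add (Nat.land jm 1) (Nat.land (Nat.shiftRight jm 1) 1))
        (Nat.add (Nat.land (Nat.shiftRight jm 2) 1) (Nat.land (Nat.shiftRight jm 3) 1)))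
        (Nat.add (Nat.land (Nat.shiftRight jm 4) 1) (Nat.land (Nat.shiftRight jm 5) 1))) 2)
      (bif' (allIn (agree jm q) V)
        (force (landAll (fun v => shareOff jm (Nat.xor v 1365)) V (agree jm q)) fun X =>
          Nat.beq (Nat.xor X (Nat.land X (shareOff jm (Nat.xor q 1365)))) (Nat.shiftLeft 1 q))
        false) false) false

noncomputable def eqList (l : List Nat) : List Nat → Bool :=
  List.rec (motive := fun _ => List Nat → Bool)
    (fun m => List.rec (motive := fun _ => Bool) true (fun _ _ _ => false) m)
    (fun a _ r m => List.rec (motive := fun _ => Bool) false (fun b t _ => bif' (Nat.beq a b) (r t) false) m) l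

/-- A pair of lists of words. -/
structure State where
  fst : List Nat
  snd : List Nat

/-- Whether a state has been settled before. -/
noncomputable def settled (known : List State) (V W : List Nat) : Bool :=
  List.rec (motive := fun _ => Bool) false
    (fun s _ r => State.rec (motive := fun _ => Bool)
      (fun p q => bif' (eqList p V) (bif' (eqList q W) true r) r) s) known

/-- Drop an exhausted first chunk of a certificate. -/
noncomputable def pop (h : List Nat) : List Nat :=
  List.rec (motive := fun _ => List Nat) [] (fun a t _ => force a fun a => bif' (Nat.beq a 1) t (a :: t)) h

/-- State of the search: words on both sides, masks of allowed words, swap information, certificate. -/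
abbrev Run := List Nat → List Nat → Nat → Nat → Nat → List Nat → List Nat

/-- Run through the words of a mask which cover a cell. -/
noncomputable def expl (kill : Nat → Bool) (go : Nat → List Nat → List Nat) (c : Nat) (j : Nat) : Nat → Nat → List Nat → List Nat :=
  Nat.rec (motive := fun _ => Nat → Nat → List Nat → List Nat)
   (fun _ w h => force w (fun w => bif' (kill w) h (List.rec (motive := fun _ => List Nat) [] (fun a t _ => go w (a :: t)) h)))
   (fun j r X w h =>
     (fun b s =>
      (fun sub h => sub (Nat.land b 1) h)
      (fun l h => force (Nat.land (Nat.shiftRight X (Nat.mul l s)) (Nat.sub (Nat.shiftLeft 1 s) 1)) (fun Y =>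
         bif' (Nat.beq Y 0) h (r Y (Nat.add w (Nat.mul l s)) h)))
      ((fun l h => force (Nat.land (Nat.shiftRight X (Nat.mul l s)) (Nat.sub (Nat.shiftLeft 1 s) 1)) (fun Y =>
         bif' (Nat.beq Y 0) h (r Y (Nat.add w (Nat.mul l s)) h))) (Nat.lor 2 (Nat.land (Nat.shiftRight b 1) 1)) h))
     (Nat.shiftRight c (Nat.mul 2 j)) (Nat.shiftLeft 1 (Nat.mul 2 j))) j

/-- Up to two exclusions. -/
noncomputable def kill2 (regs : List Reg) (V W : List Nat) (side nf a : Nat) : Nat → Bool :=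
  bif' (Nat.beq nf 0) (fun _ => false)
    (bif' (Nat.beq nf 1) (mkFilter regs V W side (Nat.land a 255))
      ((fun f g w => bif' (f w) true (g w)) (mkFilter regs V W side (Nat.land a 255)) (mkFilter regs V W side (Nat.land (Nat.shiftRight a 8) 255))))

/-- Branch on the words covering the cell `c`. -/
noncomputable def branch (hf : Bool) (regs : List Reg) (rec : Run) (V W : List Nat) (LV LW E : Nat)
    (c nf a : Nat) (t : List Nat) : List Nat :=
  force (cellMask c) fun cm => force (Nat.lor E (Nat.xor c (Nat.shiftRight c 2))) fun es =>
    bif' (anyIn cm W)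
      (bif' (anyIn cm V) []
        (expl (kill2 regs V W 0 nf a)
          (fun w => force (Nat.land LV (same w)) fun LV => force (Nat.land LW (cross hf w)) fun LW =>
             force (Nat.lor E (Nat.xor w (Nat.shiftRight w 2))) fun E => rec (w :: V) W LV LW E)
          c 6 (Nat.land LV (sortMask es)) 0 (Nat.shiftRight a (Nat.mul 8 nf) :: t)))
      (bif' (anyIn cm V)
        (expl (kill2 regs V W 1 nf a)
          (fun w => force (Nat.land LV (cross hf w)) fun LV => force (Nat.land LW (same w)) fun LW =>
             force (Nat.lor E (Nat.xor w (Nat.shiftRight w 2))) fun E => rec V (w :: W) LV LW E)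
          c 6 (Nat.land LW (sortMask es)) 0 (Nat.shiftRight a (Nat.mul 8 nf) :: t)) [])

/-- One step of a certificate. -/
noncomputable def node (hf : Bool) (regs : List Reg) (known : List State) (rec : Run) (V W : List Nat)
    (LV LW E : Nat) (h : List Nat) : List Nat :=
  List.rec (motive := fun _ => List Nat) [] (fun a t _ =>
    (fun nf => bif' (Nat.beq nf 3)
       (bif' (bif' (settled known V W) true
          (flat (Nat.land a 4095) (Nat.land (Nat.shiftRight a 14) 63) V))
         (Nat.shiftRight a 20 :: t) [])
       (branch hf regs rec V W LV LW E (Nat.land a 4095) nf (Nat.shiftRight a 14) t))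
     (Nat.land (Nat.shiftRight a 12) 3)) (pop h)

noncomputable def run (hf : Bool) (regs : List Reg) (known : List State) (fuel : Nat) : Run :=
  Nat.rec (motive := fun _ => Run) (fun _ _ _ _ _ _ => []) (fun _ r => node hf regs known r) fuel

noncomputable def lorAll (l : List Nat) (m : Nat) : Nat :=
  List.rec (motive := fun _ => Nat) m (fun a _ r => Nat.lor (Nat.xor a (Nat.shiftRight a 2)) r) l

/-- Check a certificate for the state `V`, `W`. -/
noncomputable def check (hf : Bool) (regs : List Reg) (known : List State) (s : State) (h : List Nat) : Bool :=
  State.rec (motive := fun _ => Bool) (fun V W =>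
    force (landAll same V (landAll (cross hf) W full)) fun LV =>
    force (landAll same W (landAll (cross hf) V full)) fun LW =>
    force (lorAll V (lorAll W 0)) fun E =>
    List.rec (motive := fun _ => Bool) false (fun _ _ _ => true) (run hf regs known 30 V W LV LW E h)) s

/-- Words of the search. -/
abbrev Word := Fin 6 → Fin 4

/-- The complementation of the search. -/
def c4 : Fin 4 → Fin 4 := ![1, 0, 3, 2]

def dec (x : ℕ) : Word := fun j => ⟨x / 4 ^ j.val % 4, Nat.mod_lt _ (by norm_num)⟩

def enc (u : Word) : ℕ := u 0 + 4 * u 1 + 16 * u 2 + 64 * u 3 + 256 * u 4 + 1024 * u 5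

theorem enc_lt (u : Word) : enc u < 4096 := by unfold enc; omega

theorem dec_enc (u : Word) : dec (enc u) = u := by
  funext j
  apply Fin.ext
  fin_cases j <;> simp [dec, enc] <;> omega

theorem enc_dec {x : ℕ} (hx : x < 4096) : enc (dec x) = x := by
  simp [dec, enc]; omega

theorem enc_inj {u v : Word} : enc u = enc v ↔ u = v :=
  ⟨fun h => by rw [← dec_enc u, h, dec_enc], fun h => by rw [h]⟩

theorem forall_lt {P : ℕ → Prop} (h : ∀ b : Fin 64, ∀ a : Fin 64, P (64 * b + a)) {x : ℕ} (hx : x < 4096) : P x := by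
  have := h ⟨x / 64, by omega⟩ ⟨x % 64, by omega⟩
  simpa [Nat.div_add_mod] using this

theorem pow_four (j : ℕ) : (4:ℕ) ^ j = 2 ^ (2 * j) := by rw [pow_mul]; norm_num

theorem dec_xor (x y : ℕ) (j : Fin 6) : (dec (x ^^^ y) j).val = (dec x j).val ^^^ (dec y j).val := by
  simp only [dec]
  rw [pow_four, Nat.xor_div_two_pow, show (4:ℕ) = 2 ^ 2 by norm_num, Nat.xor_mod_two_pow]

theorem dec_and (x y : ℕ) (j : Fin 6) : (dec (x &&& y) j).val = (dec x j).val &&& (dec y j).val := by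
  simp only [dec]
  rw [pow_four, Nat.and_div_two_pow, show (4:ℕ) = 2 ^ 2 by norm_num, Nat.and_mod_two_pow]

theorem dec_or (x y : ℕ) (j : Fin 6) : (dec (x ||| y) j).val = (dec x j).val ||| (dec y j).val := by
  simp only [dec]
  rw [pow_four, Nat.or_div_two_pow, show (4:ℕ) = 2 ^ 2 by norm_num, Nat.or_mod_two_pow]

theorem dec_ext {x y : ℕ} (hx : x < 4096) (hy : y < 4096) (h : ∀ j, (dec x j).val = (dec y j).val) : x = y := by
  rw [← enc_dec hx, ← enc_dec hy]
  congr 1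
  funext j
  exact Fin.ext (h j)

theorem testBit_col {B m sh w x : ℕ} (j : Fin 6) (hsh : sh = 4 ^ j.val) (hx : x < 4096)
    (hB : ∀ x < 4096, B.testBit x = true ↔ x / sh % 4 = 0) (hm : Nat.land w m = sh * (w / sh % 4)) :
    (Nat.shiftLeft B (Nat.land w m)).testBit x = true ↔ dec x j = dec w j := by
  rw [hm]
  change (B <<< _).testBit x = true ↔ _
  rw [Nat.testBit_shiftLeft, Fin.ext_iff]
  simp only [dec, ← hsh, Bool.and_eq_true, decide_eq_true_eq]
  rw [hB _ (by omega)]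
  have h0 : 0 < sh := by rw [hsh]; positivity
  generalize hd : w / sh % 4 = d
  have hd4 : d < 4 := by rw [← hd]; exact Nat.mod_lt _ (by norm_num)
  rw [Nat.sub_mul_div]
  have h1 : sh * d ≤ x ↔ d ≤ x / sh := by rw [Nat.le_div_iff_mul_le h0, mul_comm]
  rw [ge_iff_le, h1]
  generalize x / sh = e
  omega

theorem iff_of_xor {t : Bool} {n : ℕ} (h : Bool.xor t (Nat.beq n 0) = false) : t = true ↔ n = 0 := by
  rw [← Nat.beq_eq]
  cases t <;> cases h' : Nat.beq n 0 <;> simp_all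

theorem testBit_B0 : ∀ b : Fin 64, ∀ a : Fin 64, Bool.xor (Nat.testBit B0 (64 * b + a))
    (Nat.beq ((64 * b + a) / 1 % 4) 0) = false := by decide +kernel

theorem land_col0 : ∀ b : Fin 64, ∀ a : Fin 64, Nat.beq (Nat.land (64 * b + a) 3)
    (1 * ((64 * b + a) / 1 % 4)) = true := by decide +kernel

theorem testBit_col0 {w x : ℕ} (hw : w < 4096) (hx : x < 4096) :
    (col0 w).testBit x = true ↔ dec x 0 = dec w 0 :=
  testBit_col 0 rfl hx (fun _ h => forall_lt (P := fun x => B0.testBit x = true ↔ x / 4 ^ 0 % 4 = 0)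
    (fun b a => iff_of_xor (testBit_B0 b a)) h)
    (forall_lt (P := fun w => Nat.land w _ = 4 ^ 0 * (w / 4 ^ 0 % 4)) (fun b a => Nat.eq_of_beq_eq_true (land_col0 b a)) hw)

theorem testBit_B1 : ∀ b : Fin 64, ∀ a : Fin 64, Bool.xor (Nat.testBit B1 (64 * b + a))
    (Nat.beq ((64 * b + a) / 4 % 4) 0) = false := by decide +kernel

theorem land_col1 : ∀ b : Fin 64, ∀ a : Fin 64, Nat.beq (Nat.land (64 * b + a) 12)
    (4 * ((64 * b + a) / 4 % 4)) = true := by decide +kernel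

theorem testBit_col1 {w x : ℕ} (hw : w < 4096) (hx : x < 4096) :
    (col1 w).testBit x = true ↔ dec x 1 = dec w 1 :=
  testBit_col 1 rfl hx (fun _ h => forall_lt (P := fun x => B1.testBit x = true ↔ x / 4 ^ 1 % 4 = 0)
    (fun b a => iff_of_xor (testBit_B1 b a)) h)
    (forall_lt (P := fun w => Nat.land w _ = 4 ^ 1 * (w / 4 ^ 1 % 4)) (fun b a => Nat.eq_of_beq_eq_true (land_col1 b a)) hw)

theorem testBit_B2 : ∀ b : Fin 64, ∀ a : Fin 64, Bool.xor (Nat.testBit B2 (64 * b + a))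
    (Nat.beq ((64 * b + a) / 16 % 4) 0) = false := by decide +kernel

theorem land_col2 : ∀ b : Fin 64, ∀ a : Fin 64, Nat.beq (Nat.land (64 * b + a) 48)
    (16 * ((64 * b + a) / 16 % 4)) = true := by decide +kernel

theorem testBit_col2 {w x : ℕ} (hw : w < 4096) (hx : x < 4096) :
    (col2 w).testBit x = true ↔ dec x 2 = dec w 2 :=
  testBit_col 2 rfl hx (fun _ h => forall_lt (P := fun x => B2.testBit x = true ↔ x / 4 ^ 2 % 4 = 0)
    (fun b a => iff_of_xor (testBit_B2 b a)) h)
    (forall_lt (P := fun w => Nat.land w _ = 4 ^ 2 * (w / 4 ^ 2 % 4)) (fun b a => Nat.eq_of_beq_eq_true (land_col2 b a)) hw)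

theorem testBit_B3 : ∀ b : Fin 64, ∀ a : Fin 64, Bool.xor (Nat.testBit B3 (64 * b + a))
    (Nat.beq ((64 * b + a) / 64 % 4) 0) = false := by decide +kernel

theorem land_col3 : ∀ b : Fin 64, ∀ a : Fin 64, Nat.beq (Nat.land (64 * b + a) 192)
    (64 * ((64 * b + a) / 64 % 4)) = true := by decide +kernel

theorem testBit_col3 {w x : ℕ} (hw : w < 4096) (hx : x < 4096) :
    (col3 w).testBit x = true ↔ dec x 3 = dec w 3 :=
  testBit_col 3 rfl hx (fun _ h => forall_lt (P := fun x => B3.testBit x = true ↔ x / 4 ^ 3 % 4 = 0)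
    (fun b a => iff_of_xor (testBit_B3 b a)) h)
    (forall_lt (P := fun w => Nat.land w _ = 4 ^ 3 * (w / 4 ^ 3 % 4)) (fun b a => Nat.eq_of_beq_eq_true (land_col3 b a)) hw)

theorem testBit_B4 : ∀ b : Fin 64, ∀ a : Fin 64, Bool.xor (Nat.testBit B4 (64 * b + a))
    (Nat.beq ((64 * b + a) / 256 % 4) 0) = false := by decide +kernel

theorem land_col4 : ∀ b : Fin 64, ∀ a : Fin 64, Nat.beq (Nat.land (64 * b + a) 768)
    (256 * ((64 * b + a) / 256 % 4)) = true := by decide +kernel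

theorem testBit_col4 {w x : ℕ} (hw : w < 4096) (hx : x < 4096) :
    (col4 w).testBit x = true ↔ dec x 4 = dec w 4 :=
  testBit_col 4 rfl hx (fun _ h => forall_lt (P := fun x => B4.testBit x = true ↔ x / 4 ^ 4 % 4 = 0)
    (fun b a => iff_of_xor (testBit_B4 b a)) h)
    (forall_lt (P := fun w => Nat.land w _ = 4 ^ 4 * (w / 4 ^ 4 % 4)) (fun b a => Nat.eq_of_beq_eq_true (land_col4 b a)) hw)

theorem testBit_B5 : ∀ b : Fin 64, ∀ a : Fin 64, Bool.xor (Nat.testBit B5 (64 * b + a))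
    (Nat.beq ((64 * b + a) / 1024 % 4) 0) = false := by decide +kernel

theorem land_col5 : ∀ b : Fin 64, ∀ a : Fin 64, Nat.beq (Nat.land (64 * b + a) 3072)
    (1024 * ((64 * b + a) / 1024 % 4)) = true := by decide +kernel

theorem testBit_col5 {w x : ℕ} (hw : w < 4096) (hx : x < 4096) :
    (col5 w).testBit x = true ↔ dec x 5 = dec w 5 :=
  testBit_col 5 rfl hx (fun _ h => forall_lt (P := fun x => B5.testBit x = true ↔ x / 4 ^ 5 % 4 = 0)
    (fun b a => iff_of_xor (testBit_B5 b a)) h)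
    (forall_lt (P := fun w => Nat.land w _ = 4 ^ 5 * (w / 4 ^ 5 % 4)) (fun b a => Nat.eq_of_beq_eq_true (land_col5 b a)) hw)
theorem inMask_iff {m w : ℕ} : inMask m w = true ↔ m.testBit w = true := by
  rw [Nat.testBit_eq_decide_div_mod_eq, inMask]
  change Nat.beq ((m >>> w) &&& 1) 1 = true ↔ _
  rw [Nat.beq_eq, Nat.and_one_is_mod, Nat.shiftRight_eq_div_pow]
  simp

theorem testBit_lor {a b x : ℕ} : (Nat.lor a b).testBit x = true ↔ a.testBit x = true ∨ b.testBit x = true := by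
  change (a ||| b).testBit x = true ↔ _
  simp

theorem testBit_land {a b x : ℕ} : (Nat.land a b).testBit x = true ↔ a.testBit x = true ∧ b.testBit x = true := by
  change (a &&& b).testBit x = true ↔ _
  simp

theorem testBit_nxor {a b x : ℕ} : (Nat.xor a b).testBit x = true ↔ (a.testBit x = true ↔ ¬ b.testBit x = true) := by
  change (a ^^^ b).testBit x = true ↔ _
  rw [Nat.testBit_xor]
  cases a.testBit x <;> cases b.testBit x <;> simp

theorem testBit_bit {w k x : ℕ} : (bit w k).testBit x = true ↔ x = w ^^^ k := by
  change (1 <<< (w ^^^ k)).testBit x = true ↔ _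
  rw [Nat.one_shiftLeft, Nat.testBit_two_pow]
  simp [eq_comm]

theorem testBit_full {x : ℕ} (hx : x < 4096) : full.testBit x = true := by
  unfold full
  generalize 4096 = n at *
  exact (Nat.testBit_two_pow_sub_one n x).trans (decide_eq_true hx)

theorem bif'_true {α : Type} {x y : α} : bif' true x y = x := rfl
theorem bif'_false {α : Type} {x y : α} : bif' false x y = y := rfl

theorem bif'_eq {α : Type} (b : Bool) (x y : α) : bif' b x y = if b = true then x else y := by
  cases b <;> rfl

theorem force_eq {α : Type} (n : ℕ) (k : ℕ → α) : force n k = k n := by cases n <;> rfl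

theorem xor_lt {w k : ℕ} (hw : w < 4096) (hk : k < 4096) : w ^^^ k < 4096 :=
  Nat.xor_lt_two_pow (n := 12) hw hk

theorem exists_six {P : Fin 6 → Prop} : (∃ j, P j) ↔ ((P 0 ∨ P 1) ∨ (P 2 ∨ P 3)) ∨ (P 4 ∨ P 5) := by
  simp [Fin.exists_fin_succ, or_assoc]

theorem forall_six {P : Fin 6 → Prop} : (∀ j, P j) ↔ ((P 0 ∧ P 1) ∧ (P 2 ∧ P 3)) ∧ (P 4 ∧ P 5) := by
  simp [Fin.forall_fin_succ, and_assoc]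

theorem testBit_share {w x : ℕ} (hw : w < 4096) (hx : x < 4096) :
    (share w).testBit x = true ↔ ∃ j, dec x j = dec w j := by
  rw [exists_six]
  simp only [share, testBit_lor, testBit_col0 hw hx, testBit_col1 hw hx, testBit_col2 hw hx, testBit_col3 hw hx,
    testBit_col4 hw hx, testBit_col5 hw hx]

theorem c4_val (l : Fin 4) : (c4 l).val = l.val ^^^ 1 := by revert l; decide

theorem dec_compl (w : ℕ) (j : Fin 6) : dec (w ^^^ 1365) j = c4 (dec w j) := by
  apply Fin.ext
  rw [dec_xor, c4_val]
  congr 1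
  revert j
  decide

theorem c4_isCompl : IsCompl' c4 := ⟨by decide, by decide⟩

theorem dec_single (i : Fin 6) (l : Fin 4) :
    ∀ j, dec (l * 4 ^ i.val) j = if j = i then l else 0 := by
  revert i l
  decide

theorem dec_xor_single {w k : ℕ} (i : Fin 6) (l : Fin 4) (hk : k = l * 4 ^ i.val) (j : Fin 6) :
    (dec (w ^^^ k) j).val = if j = i then (dec w j).val ^^^ l.val else (dec w j).val := by
  rw [dec_xor, hk, dec_single]
  split <;> simp

theorem testBit_same {w x : ℕ} (hw : w < 4096) (hx : x < 4096) (hm : ∃ j, dec x j = c4 (dec w j))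
    (ht : ¬ Twin c4 (dec w) (dec x)) : (same w).testBit x = true := by
  have key : ∀ (i : Fin 6) (k : ℕ), k = (1 : Fin 4) * 4 ^ i.val → x ≠ w ^^^ k := by
    intro i k hk h
    refine ht ⟨i, Fin.ext ?_, fun j hj => Fin.ext ?_⟩
    · rw [h, dec_xor_single i 1 hk, if_pos rfl, c4_val]; rfl
    · rw [h, dec_xor_single i 1 hk, if_neg hj]
  rw [same, testBit_nxor]
  have h1 : (share (Nat.xor w 1365)).testBit x = true := by
    have hw' : Nat.xor w 1365 < 4096 := xor_lt hw (by norm_num)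
    rw [testBit_share hw' hx]
    obtain ⟨j, hj⟩ := hm
    exact ⟨j, hj.trans (dec_compl w j).symm⟩
  simp only [h1, testBit_lor, testBit_bit, true_iff]
  rintro (((h | h) | (h | h)) | (h | h))
  exacts [key 0 _ rfl h, key 1 _ rfl h, key 2 _ rfl h, key 3 _ rfl h, key 4 _ rfl h, key 5 _ rfl h]

/-- Words which differ in one column, where they are not complementary. -/
def Near (u v : Word) : Prop := ∃ i, (u i ≠ v i ∧ u i ≠ c4 (v i)) ∧ ∀ j, j ≠ i → u j = v j

/-- Admissible relation between a word and a word of the other side. -/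
def Cross (h : Bool) (u v : Word) : Prop := u ≠ v ∧ (h = false → ¬ Near u v)

theorem Near.symm {u v : Word} (h : Near u v) : Near v u := by
  obtain ⟨i, ⟨h1, h2⟩, h3⟩ := h
  exact ⟨i, ⟨h1.symm, fun h => h2 ((c_comm c4_isCompl).1 h)⟩, fun j hj => (h3 j hj).symm⟩

theorem Cross.symm {h : Bool} {u v : Word} (hu : Cross h u v) : Cross h v u :=
  ⟨hu.1.symm, fun hh hn => hu.2 hh hn.symm⟩

theorem c4_xor (l : Fin 4) : ∀ m : Fin 4, (m.val = l.val ^^^ 2 ∨ m.val = l.val ^^^ 3) → m ≠ l ∧ m ≠ c4 l := by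
  revert l; decide

theorem testBit_cross {h : Bool} {w x : ℕ} (hx : x < 4096) (hc : Cross h (dec x) (dec w)) :
    (cross h w).testBit x = true := by
  rw [cross, testBit_nxor]
  simp only [testBit_full hx, true_iff]
  have h0 : x ≠ w ^^^ 0 := fun h => hc.1 (by rw [h, Nat.xor_zero])
  cases h
  · have key2 : ∀ (i : Fin 6) (k : ℕ), k = (2 : Fin 4) * 4 ^ i.val → x ≠ w ^^^ k := by
      intro i k hk h
      refine hc.2 rfl ⟨i, c4_xor _ _ (Or.inl ?_), fun j hj => Fin.ext ?_⟩
      · rw [h, dec_xor_single i 2 hk, if_pos rfl]; rfl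
      · rw [h, dec_xor_single i 2 hk, if_neg hj]
    have key3 : ∀ (i : Fin 6) (k : ℕ), k = (3 : Fin 4) * 4 ^ i.val → x ≠ w ^^^ k := by
      intro i k hk h
      refine hc.2 rfl ⟨i, c4_xor _ _ (Or.inr ?_), fun j hj => Fin.ext ?_⟩
      · rw [h, dec_xor_single i 3 hk, if_pos rfl]; rfl
      · rw [h, dec_xor_single i 3 hk, if_neg hj]
    simp only [bif'_false, near, testBit_lor, testBit_bit]
    rintro (h | (((h | h) | (h | h)) | (h | h)) | (((h | h) | (h | h)) | (h | h)))
    exacts [h0 h, key2 0 _ rfl h, key2 1 _ rfl h, key2 2 _ rfl h, key2 3 _ rfl h, key2 4 _ rfl h, key2 5 _ rfl h,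
      key3 0 _ rfl h, key3 1 _ rfl h, key3 2 _ rfl h, key3 3 _ rfl h, key3 4 _ rfl h, key3 5 _ rfl h]
  · simp only [bif'_true, testBit_bit]
    exact h0

/-- The letter `l` contains the cell `b`. -/
def InCell (l b : Fin 4) : Prop := l.val = b.val % 2 ∨ l.val = 2 + b.val / 2

instance (l b : Fin 4) : Decidable (InCell l b) := by unfold InCell; infer_instance

theorem dec_shift_one (c : ℕ) (j : Fin 6) :
    (dec (Nat.lor 2730 (Nat.land (Nat.shiftRight c 1) 1365)) j).val = 2 + (dec c j).val / 2 := by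
  change (dec (2730 ||| ((c >>> 1) &&& 1365)) j).val = _
  have h1 : (dec 2730 j).val = 2 := by revert j; decide
  have h2 : (dec 1365 j).val = 1 := by revert j; decide
  have h3 : (dec (c >>> 1) j).val % 2 = (dec c j).val / 2 := by
    simp only [dec, Nat.shiftRight_eq_div_pow, Nat.div_div_eq_div_mul, pow_one]
    rw [mul_comm 2, ← Nat.div_div_eq_div_mul]
    omega
  rw [dec_or, dec_and, h1, h2, Nat.and_one_is_mod, h3]
  have : (dec c j).val / 2 < 2 := by omega
  interval_cases (dec c j).val / 2 <;> rfl

theorem dec_low (c : ℕ) (j : Fin 6) : (dec (Nat.land c 1365) j).val = (dec c j).val % 2 := by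
  change (dec (c &&& 1365) j).val = _
  have h2 : (dec 1365 j).val = 1 := by revert j; decide
  rw [dec_and, h2, Nat.and_one_is_mod]

theorem testBit_cellMask {c x : ℕ} (hc : c < 4096) (hx : x < 4096) :
    (cellMask c).testBit x = true ↔ ∀ j, InCell (dec x j) (dec c j) := by
  have h0 : Nat.land c 1365 < 4096 := lt_of_le_of_lt Nat.and_le_left hc
  have h1 : Nat.lor 2730 (Nat.land (Nat.shiftRight c 1) 1365) < 4096 :=
    Nat.or_lt_two_pow (n := 12) (by norm_num) (lt_of_le_of_lt Nat.and_le_right (by norm_num))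
  rw [forall_six]
  simp only [cellMask, testBit_land, testBit_lor, testBit_col0 h0 hx, testBit_col1 h0 hx, testBit_col2 h0 hx,
    testBit_col3 h0 hx, testBit_col4 h0 hx, testBit_col5 h0 hx, testBit_col0 h1 hx, testBit_col1 h1 hx,
    testBit_col2 h1 hx, testBit_col3 h1 hx, testBit_col4 h1 hx, testBit_col5 h1 hx, Fin.ext_iff, dec_shift_one,
    dec_low, InCell]

/-- A cell as a point. -/
def cell (b : Fin 4) : Pt c4 := ⟨{l | InCell l b}, mk_pt _ (by revert b; decide)⟩

theorem mem_cell {l b : Fin 4} : l ∈ cell b ↔ InCell l b := Iff.rfl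

/-- Columns `a` and `b` are in normal order. -/
def Ordered (u : Word) (a b : Fin 6) : Prop := 2 ≤ (u a).val → 2 ≤ (u b).val

theorem testBit_sortMask {e x : ℕ} (hx : x < 4096) (h2 : Nat.land e 48 = 0 → Ordered (dec x) 2 3)
    (h3 : Nat.land e 192 = 0 → Ordered (dec x) 3 4) (h4 : Nat.land e 768 = 0 → Ordered (dec x) 4 5) :
    (sortMask e).testBit x = true := by
  have e2 : p2.testBit x = true ↔ 2 ≤ (dec x 2).val := by
    have h1 := testBit_col2 (w := 32) (by norm_num) hx
    have h2 := testBit_col2 (w := 48) (by norm_num) hx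
    unfold p2
    generalize col2 32 = m1 at *
    generalize col2 48 = m2 at *
    rw [testBit_lor, h1, h2]
    generalize dec x 2 = l
    revert l
    decide
  have e3 : p3.testBit x = true ↔ 2 ≤ (dec x 3).val := by
    have h1 := testBit_col3 (w := 128) (by norm_num) hx
    have h2 := testBit_col3 (w := 192) (by norm_num) hx
    unfold p3
    generalize col3 128 = m1 at *
    generalize col3 192 = m2 at *
    rw [testBit_lor, h1, h2]
    generalize dec x 3 = l
    revert l
    decide
  have e4 : p4.testBit x = true ↔ 2 ≤ (dec x 4).val := by
    have h1 := testBit_col4 (w := 512) (by norm_num) hx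
    have h2 := testBit_col4 (w := 768) (by norm_num) hx
    unfold p4
    generalize col4 512 = m1 at *
    generalize col4 768 = m2 at *
    rw [testBit_lor, h1, h2]
    generalize dec x 4 = l
    revert l
    decide
  have e5 : p5.testBit x = true ↔ 2 ≤ (dec x 5).val := by
    have h1 := testBit_col5 (w := 2048) (by norm_num) hx
    have h2 := testBit_col5 (w := 3072) (by norm_num) hx
    unfold p5
    generalize col5 2048 = m1 at *
    generalize col5 3072 = m2 at *
    rw [testBit_lor, h1, h2]
    generalize dec x 5 = l
    revert l
    decide
  simp only [sortMask, testBit_land, bif'_eq, Nat.beq_eq]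
  refine ⟨?_, ?_, ?_⟩
  · split
    · next h =>
      have := h2 h
      have h0 := testBit_full hx
      unfold g2
      generalize full = m0 at *
      generalize p2 = m1 at *
      generalize p3 = m2 at *
      rw [testBit_lor, testBit_nxor, e2, e3, iff_true_left h0]
      exact imp_iff_not_or.1 this
    · exact testBit_full hx
  · split
    · next h =>
      have := h3 h
      have h0 := testBit_full hx
      unfold g3
      generalize full = m0 at *
      generalize p3 = m1 at *
      generalize p4 = m2 at *
      rw [testBit_lor, testBit_nxor, e3, e4, iff_true_left h0]
      exact imp_iff_not_or.1 this
    · exact testBit_full hx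
  · split
    · next h =>
      have := h4 h
      have h0 := testBit_full hx
      unfold g4
      generalize full = m0 at *
      generalize p4 = m1 at *
      generalize p5 = m2 at *
      rw [testBit_lor, testBit_nxor, e4, e5, iff_true_left h0]
      exact imp_iff_not_or.1 this
    · exact testBit_full hx

end Search
end Polybox

namespace Polybox
namespace Search
open scoped Classical

/-- The sign of a letter within its pair. -/
def sgn (l : Fin 4) : ℤ := if l.val % 2 = 1 then -1 else 1

theorem ind_cell (l b : Fin 4) : ind (l ∈ cell b) = if l.val = b.val % 2 ∨ l.val = 2 + b.val / 2 then 1 else 0 := by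
  by_cases h : l.val = b.val % 2 ∨ l.val = 2 + b.val / 2
  · rw [ind_true (show l ∈ cell b from h), if_pos h]
  · rw [ind_false (show l ∉ cell b from h), if_neg h]

theorem sgn_fst : ∀ l : Fin 4, (if l.val = 0 ∨ l.val = 2 then 1 else 0 : ℤ) - (if l.val = 1 ∨ l.val = 2 then 1 else 0) =
    if Nat.land l.val 2 = 0 then sgn l else 0 := by decide

theorem sgn_snd : ∀ l : Fin 4, (if l.val = 0 ∨ l.val = 2 then 1 else 0 : ℤ) - (if l.val = 0 ∨ l.val = 3 then 1 else 0) =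
    if Nat.land l.val 2 = 2 then sgn l else 0 := by decide

theorem fn_pair (p : ℕ) : Fn c4 fun l => if Nat.land l.val 2 = p then sgn l else 0 := by
  by_cases h0 : p = 0
  · have h := fn_diff (cell 0) (cell 1)
    simp only [ind_cell] at h
    subst h0
    simp only [← sgn_fst]
    exact h
  by_cases h2 : p = 2
  · have h := fn_diff (cell 0) (cell 2)
    simp only [ind_cell] at h
    subst h2
    simp only [← sgn_snd]
    exact h
  · have h := fn_diff (cell 0) (cell 0)
    simp only [sub_self] at h
    have h' : ∀ l : Fin 4, Nat.land l.val 2 = 0 ∨ Nat.land l.val 2 = 2 := by decide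
    convert h using 2 with l
    rw [if_neg]
    rcases h' l with h | h <;> rw [h] <;> tauto

theorem fn_zero : Fn c4 fun _ => 0 := by
  simpa using fn_diff (cell 0) (cell 0)

theorem fn_opt (y : Option (Pt c4)) : Fn c4 fun l => if ∀ z, y = some z → l ∈ z then 1 else 0 := by
  rcases y with _ | y
  · simpa using fn_one c4_isCompl
  · simpa [ind] using fn_pt y

/-- A region with its description by points, and the bounds on the words inside. -/
structure RegOk (r : Reg) (ρ : Fin 6 → Option (Pt c4)) (A B : Finset Word) : Prop where
  mem : ∀ w : Word, inMask r.rm (Nat.land (enc w) 15) = true ↔ ∀ k y, ρ k = some y → w k ∈ y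
  fx : ∀ k : Fin 6, ρ k ≠ none → r.fx.testBit (2 * k + 1) = true
  fst_le : (A.filter fun w => inMask r.rm (Nat.land (enc w) 15) = true).card ≤ r.b
  snd_le : (B.filter fun w => inMask r.rm (Nat.land (enc w) 15) = true).card ≤ r.b

theorem RegOk.symm {r : Reg} {ρ : Fin 6 → Option (Pt c4)} {A B : Finset Word} (h : RegOk r ρ A B) : RegOk r ρ B A :=
  ⟨h.mem, h.fx, h.snd_le, h.fst_le⟩

theorem dec_spread : ∀ a : Fin 64, ∀ k : Fin 6,
    (dec (spread a) k).val = if a.val.testBit k then 2 else 0 := by decide +kernel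

theorem dec_spread_half : ∀ a : Fin 64, ∀ k : Fin 6,
    (dec (Nat.shiftRight (spread a) 1) k).val = if a.val.testBit k then 1 else 0 := by decide +kernel

theorem testBit_spread : ∀ a : Fin 64, ∀ k : Fin 6, (spread a).testBit (2 * k + 1) = a.val.testBit k := by
  decide +kernel

/-- The sign of a word on the columns in `a`. -/
noncomputable def wsgn (a : ℕ) (w : Word) : ℤ := ∏ k : Fin 6, if a.testBit k then sgn (w k) else 1

theorem pair_bal {A B : Finset Word} (h : GP c4 A B) (ρ : Fin 6 → Option (Pt c4)) (a : Fin 64)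
    (ha : ∀ k : Fin 6, ρ k ≠ none → a.val.testBit k = false) {P : ℕ} (hP : P < 4096) :
    ∑ v ∈ A, (if (∀ k y, ρ k = some y → v k ∈ y) ∧ Nat.land (enc v) (spread a) = P then wsgn a v else 0) =
      ∑ v ∈ B, (if (∀ k y, ρ k = some y → v k ∈ y) ∧ Nat.land (enc v) (spread a) = P then wsgn a v else 0) := by
  let f : Fin 6 → Fin 4 → ℤ := fun k l =>
    if a.val.testBit k then (if Nat.land l.val 2 = (dec P k).val then sgn l else 0)
    else if (dec P k).val = 0 then (if ∀ y, ρ k = some y → l ∈ y then 1 else 0) else 0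
  have hf : ∀ k, Fn c4 (f k) := by
    intro k
    simp only [f]
    split
    · exact fn_pair _
    · split
      · exact fn_opt _
      · exact fn_zero
  have key : ∀ v : Word, (if (∀ k y, ρ k = some y → v k ∈ y) ∧ Nat.land (enc v) (spread a) = P then wsgn a v else 0) =
      ∏ k, f k (v k) := by
    intro v
    have hdig : ∀ k, (dec (Nat.land (enc v) (spread a)) k).val =
        if a.val.testBit k then Nat.land (v k).val 2 else 0 := by
      intro k
      change (dec (enc v &&& spread a) k).val = _
      rw [dec_and, dec_enc, dec_spread]
      split
      · rfl
      · simp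
    split
    · next hh =>
      obtain ⟨h1, h2⟩ := hh
      refine Finset.prod_congr rfl fun k _ => ?_
      have := hdig k
      rw [h2] at this
      simp only [f]
      split
      · next hk => rw [if_pos hk] at this; rw [if_pos this.symm]
      · next hk => rw [if_neg hk] at this; rw [if_pos this, if_pos (h1 k)]
    · next hh =>
      symm
      rw [Finset.prod_eq_zero_iff]
      by_contra hcon
      push Not at hcon
      apply hh
      constructor
      · intro k y hy
        have h1 := ha k (by rw [hy]; simp)
        have := hcon k (Finset.mem_univ k)
        simp only [f, h1] at this
        by_contra hny
        apply this
        rw [if_neg (by simp)]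
        split
        · rw [if_neg]
          intro h'
          exact hny (h' y hy)
        · rfl
      · refine dec_ext (lt_of_le_of_lt Nat.and_le_left (enc_lt v)) hP fun k => ?_
        rw [hdig]
        have := hcon k (Finset.mem_univ k)
        simp only [f] at this
        split
        · next hk =>
          rw [if_pos hk] at this
          by_contra h'
          exact this (if_neg h')
        · next hk =>
          rw [if_neg hk] at this
          by_contra h'
          exact this (if_neg (Ne.symm h'))
  simp only [key]
  exact h.bal hf

theorem pattern_bal {A B : Finset Word} (h : GP c4 A B) (ρ : Fin 6 → Option (Pt c4)) (a : Fin 64)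
    (ha : ∀ k : Fin 6, ρ k ≠ none → a.val.testBit k = false) (g : ℕ → ℤ) :
    ∑ v ∈ A, (if ∀ k y, ρ k = some y → v k ∈ y then wsgn a v * g (Nat.land (enc v) (spread a)) else 0) =
      ∑ v ∈ B, (if ∀ k y, ρ k = some y → v k ∈ y then wsgn a v * g (Nat.land (enc v) (spread a)) else 0) := by
  have key : ∀ v : Word, (if ∀ k y, ρ k = some y → v k ∈ y then wsgn a v * g (Nat.land (enc v) (spread a)) else 0) =
      ∑ P ∈ Finset.range 4096, g P *
        (if (∀ k y, ρ k = some y → v k ∈ y) ∧ Nat.land (enc v) (spread a) = P then wsgn a v else 0) := by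
    intro v
    have hv : Nat.land (enc v) (spread a) ∈ Finset.range 4096 :=
      Finset.mem_range.2 (lt_of_le_of_lt Nat.and_le_left (enc_lt v))
    by_cases hr : ∀ k y, ρ k = some y → v k ∈ y
    · rw [if_pos hr, Finset.sum_eq_single_of_mem _ hv, if_pos ⟨hr, rfl⟩, mul_comm]
      intro P _ hP
      rw [if_neg (fun h' => hP h'.2.symm), mul_zero]
    · rw [if_neg hr]
      symm
      refine Finset.sum_eq_zero fun P _ => ?_
      rw [if_neg (fun h' => hr h'.1), mul_zero]
  simp only [key]
  rw [Finset.sum_comm, Finset.sum_comm (s := B)]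
  refine Finset.sum_congr rfl fun P hP => ?_
  rw [← Finset.mul_sum, ← Finset.mul_sum, pair_bal h ρ a ha (Finset.mem_range.1 hP)]

theorem par_eq : ∀ b : Fin 64, ∀ a : Fin 64, Nat.beq (Nat.land (Nat.shiftRight par (64 * b + a)) 1)
    (((64 * b + a) % 2 + (64 * b + a) / 4 % 2 + (64 * b + a) / 16 % 2 + (64 * b + a) / 64 % 2 + (64 * b + a) / 256 % 2 +
      (64 * b + a) / 1024 % 2 + (64 * b + a) / 2 % 2 + (64 * b + a) / 8 % 2 + (64 * b + a) / 32 % 2 +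
      (64 * b + a) / 128 % 2 + (64 * b + a) / 512 % 2 + (64 * b + a) / 2048 % 2) % 2) = true := by decide +kernel

theorem digit_sum {x : ℕ} (h : ∀ k, (dec x k).val < 2) : (x % 2 + x / 4 % 2 + x / 16 % 2 + x / 64 % 2 +
    x / 256 % 2 + x / 1024 % 2 + x / 2 % 2 + x / 8 % 2 + x / 32 % 2 + x / 128 % 2 + x / 512 % 2 + x / 2048 % 2) =
      ∑ k : Fin 6, (dec x k).val := by
  rw [Fin.sum_univ_six]
  have key : ∀ k : Fin 6, (dec x k).val = x / 4 ^ k.val % 2 + x / (4 ^ k.val * 2) % 2 := by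
    intro k
    have hk : x / 4 ^ k.val % 4 < 2 := h k
    change x / 4 ^ k.val % 4 = _
    rw [← Nat.div_div_eq_div_mul]
    omega
  rw [key 0, key 1, key 2, key 3, key 4, key 5]
  norm_num
  ring

theorem par_odd {x : ℕ} (hx : x < 4096) (h : ∀ k, (dec x k).val < 2) :
    Nat.land (Nat.shiftRight par x) 1 = (∑ k : Fin 6, (dec x k).val) % 2 := by
  rw [← digit_sum h]
  exact forall_lt (P := fun x => Nat.land (Nat.shiftRight par x) 1 = (x % 2 + x / 4 % 2 + x / 16 % 2 + x / 64 % 2 +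
    x / 256 % 2 + x / 1024 % 2 + x / 2 % 2 + x / 8 % 2 + x / 32 % 2 + x / 128 % 2 + x / 512 % 2 + x / 2048 % 2) % 2)
    (fun b a => Nat.eq_of_beq_eq_true (par_eq b a)) hx

theorem neg_one_pow_sum (f : Fin 6 → ℕ) : ∏ k, (-1 : ℤ) ^ f k = if (∑ k, f k) % 2 = 1 then -1 else 1 := by
  rw [Finset.prod_pow_eq_pow_sum]
  split
  · next h => exact Odd.neg_one_pow (Nat.odd_iff.2 h)
  · next h => exact Even.neg_one_pow (Nat.even_iff.2 (by omega))

theorem wsgn_eq (a : Fin 64) (w : Word) : wsgn a w =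
    if Nat.land (Nat.shiftRight par (Nat.land (enc w) (Nat.shiftRight (spread a) 1))) 1 = 1 then -1 else 1 := by
  have hd : ∀ k, (dec (Nat.land (enc w) (Nat.shiftRight (spread a) 1)) k).val =
      if a.val.testBit k then (w k).val % 2 else 0 := by
    intro k
    change (dec (enc w &&& _) k).val = _
    rw [dec_and, dec_spread_half, dec_enc]
    split
    · rw [Nat.and_one_is_mod]
    · simp
  rw [par_odd (lt_of_le_of_lt (Nat.and_le_left (n := enc w)) (enc_lt w) :
    Nat.land (enc w) (Nat.shiftRight (spread a) 1) < 4096), ← neg_one_pow_sum, wsgn]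
  · refine Finset.prod_congr rfl fun k _ => ?_
    rw [hd]
    split
    · unfold sgn
      split
      · next h => rw [h, pow_one]
      · next h => rw [show (w k).val % 2 = 0 by omega, pow_zero]
    · rw [pow_zero]
  · intro k
    rw [hd]
    split <;> omega

theorem key_eq {pm side w : ℕ} (hs : side < 2) :
    key pm side w = (2 * Nat.land w pm) ^^^ (side ^^^ Nat.land (Nat.shiftRight par (Nat.land w (Nat.shiftRight pm 1))) 1) := by
  unfold key
  generalize Nat.shiftRight par (Nat.land w (Nat.shiftRight pm 1)) = z
  generalize Nat.land w pm = p
  change (p <<< 1) ||| ((side ^^^ z) &&& 1) = (2 * p) ^^^ (side ^^^ (z &&& 1))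
  have h1 : (side ^^^ z) &&& 1 = side ^^^ (z &&& 1) := by
    rw [Nat.and_xor_distrib_right, Nat.and_one_is_mod side, Nat.mod_eq_of_lt hs]
  rw [h1]
  have h2 : side ^^^ (z &&& 1) < 2 := by
    rw [Nat.and_one_is_mod]
    exact Nat.xor_lt_two_pow (n := 1) hs (Nat.mod_lt _ (by norm_num))
  generalize side ^^^ (z &&& 1) = e at h2
  interval_cases e
  · simp [Nat.shiftLeft_eq, mul_comm]
  · rw [Nat.shiftLeft_eq, pow_one, mul_comm, show 2 * p ||| 1 = 2 * p + 1 from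
      (Nat.two_pow_add_eq_or_of_lt (i := 1) (by norm_num) p).symm, Nat.xor_one_of_even (even_two_mul p)]

theorem sign_key {ψ : ℕ → ℤ} (hψ : ∀ x, ψ (x ^^^ 1) = - ψ x) (a : Fin 64) (w : Word) :
    ψ (key (spread a) 0 (enc w)) = wsgn a w * ψ (2 * Nat.land (enc w) (spread a)) ∧
      ψ (key (spread a) 1 (enc w)) = - (wsgn a w * ψ (2 * Nat.land (enc w) (spread a))) := by
  rw [key_eq (by norm_num), key_eq (by norm_num), wsgn_eq]
  have h : Nat.land (Nat.shiftRight par (Nat.land (enc w) (Nat.shiftRight (spread a) 1))) 1 < 2 :=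
    lt_of_le_of_lt Nat.and_le_right (by norm_num)
  generalize Nat.land (Nat.shiftRight par (Nat.land (enc w) (Nat.shiftRight (spread a) 1))) 1 = e at *
  interval_cases e
  · rw [Nat.xor_self, Nat.xor_zero, Nat.xor_zero, hψ, if_neg (by norm_num)]
    constructor <;> ring
  · rw [Nat.xor_self, Nat.xor_zero, Nat.zero_xor, hψ, if_pos rfl]
    constructor <;> ring

theorem key_bal {A B : Finset Word} (h : GP c4 A B) {r : Reg} {ρ : Fin 6 → Option (Pt c4)} (hr : RegOk r ρ A B)
    (a : Fin 64) (ha : Nat.land (spread a) r.fx = 0) {ψ : ℕ → ℤ} (hψ : ∀ x, ψ (x ^^^ 1) = - ψ x) :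
    ∑ v ∈ A.filter (fun w => inMask r.rm (Nat.land (enc w) 15) = true), ψ (key (spread a) 0 (enc v)) +
      ∑ v ∈ B.filter (fun w => inMask r.rm (Nat.land (enc w) 15) = true), ψ (key (spread a) 1 (enc v)) = 0 := by
  have ha' : ∀ k : Fin 6, ρ k ≠ none → a.val.testBit k = false := by
    intro k hk
    rw [← testBit_spread]
    by_contra hcon
    have h1 := testBit_land.2 ⟨Bool.eq_true_of_not_eq_false hcon, hr.fx k hk⟩
    rw [ha] at h1
    simp at h1
  have := pattern_bal h ρ a ha' (fun x => ψ (2 * x))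
  simp only [Finset.sum_filter, hr.mem, (sign_key hψ a _).1, (sign_key hψ a _).2]
  rw [this, ← Finset.sum_add_distrib]
  refine Finset.sum_eq_zero fun v _ => ?_
  split <;> simp

end Search
end Polybox

namespace Polybox
namespace Search
open scoped Classical

/-- No key of the list is opposite to another one. -/
def Red (l : List ℕ) : Prop := ∀ k ∈ l, k ^^^ 1 ∉ l

theorem xor_one_ne (k : ℕ) : k ^^^ 1 ≠ k := by
  intro h
  have := congrArg (fun n => n.testBit 0) h
  simp at this
  omega

theorem xor_one_one (k : ℕ) : k ^^^ 1 ^^^ 1 = k := by rw [Nat.xor_assoc, Nat.xor_self, Nat.xor_zero]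

theorem ins_cons (k a : ℕ) (t : List ℕ) : ins k (a :: t) = if a = k ^^^ 1 then t else a :: ins k t := by
  change bif' (Nat.beq a (k ^^^ 1)) t (a :: ins k t) = _
  simp only [bif'_eq, Nat.beq_eq]

theorem ins_sum {ψ : ℕ → ℤ} (hψ : ∀ x, ψ (x ^^^ 1) = - ψ x) (k : ℕ) (l : List ℕ) :
    ((ins k l).map ψ).sum = ψ k + (l.map ψ).sum := by
  induction l with
  | nil => rfl
  | cons a t ih =>
    rw [ins_cons]
    split
    · next h => rw [h, List.map_cons, List.sum_cons, hψ]; ring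
    · rw [List.map_cons, List.sum_cons, ih, List.map_cons, List.sum_cons]; ring

theorem mem_ins {k x : ℕ} {l : List ℕ} (h : x ∈ ins k l) : x ∈ l ∨ (x = k ∧ k ^^^ 1 ∉ l) := by
  induction l with
  | nil => right; simpa [ins] using h
  | cons a t ih =>
    rw [ins_cons] at h
    split at h
    · exact Or.inl (List.mem_cons_of_mem _ h)
    · next hn =>
      rcases List.mem_cons.1 h with rfl | h
      · exact Or.inl List.mem_cons_self
      · rcases ih h with h | ⟨rfl, h⟩
        · exact Or.inl (List.mem_cons_of_mem _ h)
        · refine Or.inr ⟨rfl, fun h' => ?_⟩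
          rcases List.mem_cons.1 h' with h' | h'
          · exact hn h'.symm
          · exact h h'

theorem Red.ins {l : List ℕ} (h : Red l) (k : ℕ) : Red (ins k l) := by
  intro x hx hx'
  rcases mem_ins hx with h1 | ⟨rfl, h1⟩
  · rcases mem_ins hx' with h2 | ⟨h2, h3⟩
    · exact h x h1 h2
    · rw [← h2, xor_one_one] at h3
      exact h3 h1
  · rcases mem_ins hx' with h2 | ⟨h2, h3⟩
    · exact h1 h2
    · exact xor_one_ne _ h2

theorem pushKeys_cons (rm pm side a : ℕ) (t acc : List ℕ) : pushKeys rm pm side (a :: t) acc =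
    if inMask rm (Nat.land a 15) = true then pushKeys rm pm side t (ins (key pm side a) acc)
    else pushKeys rm pm side t acc := by
  change bif' _ _ _ = _
  rw [bif'_eq]
  rfl

theorem cnt_eq (rm : ℕ) (l : List ℕ) : cnt rm l = (l.filter fun a => inMask rm (Nat.land a 15)).length := by
  induction l with
  | nil => rfl
  | cons a t ih =>
    change Nat.land (Nat.shiftRight rm (Nat.land a 15)) 1 + cnt rm t = _
    have h2 : Nat.land (Nat.shiftRight rm (Nat.land a 15)) 1 < 2 := lt_of_le_of_lt Nat.and_le_right (by norm_num)
    rw [ih, List.filter_cons]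
    unfold inMask
    split
    · next h => rw [Nat.eq_of_beq_eq_true h, List.length_cons, Nat.add_comm]
    · next h =>
      have h3 : Nat.land (Nat.shiftRight rm (Nat.land a 15)) 1 ≠ 1 := fun h' => h (by rw [h']; rfl)
      omega

theorem pushKeys_spec {ψ : ℕ → ℤ} (hψ : ∀ x, ψ (x ^^^ 1) = - ψ x) (rm pm side : ℕ) (l : List ℕ) : ∀ acc : List ℕ,
    ((pushKeys rm pm side l acc).map ψ).sum =
      ((l.filter fun a => inMask rm (Nat.land a 15)).map fun a => ψ (key pm side a)).sum + (acc.map ψ).sum := by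
  induction l with
  | nil => intro acc; simp [pushKeys]
  | cons a t ih =>
    intro acc
    rw [pushKeys_cons, List.filter_cons]
    split
    · rw [ih, ins_sum hψ, List.map_cons, List.sum_cons]; ring
    · exact ih acc

theorem Red.pushKeys (rm pm side : ℕ) (l : List ℕ) : ∀ {acc : List ℕ}, Red acc → Red (pushKeys rm pm side l acc) := by
  induction l with
  | nil => intro acc h; exact h
  | cons a t ih =>
    intro acc h
    rw [pushKeys_cons]
    split
    · exact ih (h.ins _)
    · exact ih h

theorem notMem_iff {k : ℕ} {l : List ℕ} : notMem k l = true ↔ k ∉ l := by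
  induction l with
  | nil => simp [notMem]
  | cons a t ih =>
    change bif' (Nat.beq a k) false (notMem k t) = true ↔ _
    simp only [bif'_eq, Nat.beq_eq, List.mem_cons]
    split
    · next h => simp [h]
    · next h => rw [ih]; tauto

theorem len_eq (l : List ℕ) : len l = l.length := by
  induction l with
  | nil => rfl
  | cons a t ih => change Nat.succ (len t) = _; rw [ih]; rfl

theorem sum_lower {M : Finset ℕ} {g : ℕ → ℤ} (hg : ∀ x, -1 ≤ g x) {l : List ℕ} (hl : l.Nodup) (hs : ∀ a ∈ l, a ∈ M) :
    (l.map g).sum + l.length ≤ ∑ x ∈ M, g x + M.card := by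
  have h1 : (l.map g).sum = ∑ x ∈ l.toFinset, g x := (List.sum_toFinset g hl).symm
  have h2 : l.length = l.toFinset.card := (List.toFinset_card_of_nodup hl).symm
  have hsub : l.toFinset ⊆ M := fun a ha => hs a (List.mem_toFinset.1 ha)
  have key : ∀ N : Finset ℕ, ∑ x ∈ N, g x + N.card = ∑ x ∈ N, (g x + 1) := fun N => by
    rw [Finset.sum_add_distrib]; simp
  rw [h1, h2, key, key]
  exact Finset.sum_le_sum_of_subset_of_nonneg hsub fun x _ _ => by linarith [hg x]

/-- The sign attached to the keys by a reduced list. -/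
noncomputable def dir (D : List ℕ) (x : ℕ) : ℤ := if x ∈ D then 1 else if x ^^^ 1 ∈ D then -1 else 0

theorem dir_ge (D : List ℕ) (x : ℕ) : -1 ≤ dir D x := by
  unfold dir
  split
  · norm_num
  · split <;> norm_num

theorem dir_xor {D : List ℕ} (h : Red D) (x : ℕ) : dir D (x ^^^ 1) = - dir D x := by
  unfold dir
  rw [xor_one_one]
  by_cases h1 : x ∈ D
  · rw [if_pos h1, if_pos h1, if_neg (h x h1)]
  · rw [if_neg h1, if_neg h1]
    split <;> simp

theorem dir_sum (D : List ℕ) {l : List ℕ} (h : ∀ x ∈ l, x ∈ D) : (l.map (dir D)).sum = l.length := by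
  induction l with
  | nil => rfl
  | cons a t ih =>
    rw [List.map_cons, List.sum_cons, ih fun x hx => h x (List.mem_cons_of_mem _ hx), dir, if_pos (h a List.mem_cons_self),
      List.length_cons]
    push_cast
    ring

theorem sum_enc (A : Finset Word) (r : ℕ) (g : ℕ → ℤ) :
    ∑ v ∈ A.filter (fun w => inMask r (Nat.land (enc w) 15) = true), g (enc v) =
      ∑ x ∈ (A.filter (fun w => inMask r (Nat.land (enc w) 15) = true)).image enc, g x := by
  rw [Finset.sum_image fun _ _ _ _ h => enc_inj.1 h]

theorem card_enc (A : Finset Word) (r : ℕ) :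
    ((A.filter (fun w => inMask r (Nat.land (enc w) 15) = true)).image enc).card =
      (A.filter (fun w => inMask r (Nat.land (enc w) 15) = true)).card :=
  Finset.card_image_of_injective _ fun _ _ h => enc_inj.1 h

/-- The list consists of codes of words of `A`. -/
structure Sub (U : List ℕ) (A : Finset Word) : Prop where
  nodup : U.Nodup
  lt : ∀ a ∈ U, a < 4096
  mem : ∀ a ∈ U, dec a ∈ A

theorem Sub.cons {U : List ℕ} {A : Finset Word} (h : Sub U A) {u : Word} (hu : u ∈ A) (hn : enc u ∉ U) :
    Sub (enc u :: U) A := by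
  refine ⟨List.nodup_cons.2 ⟨hn, h.nodup⟩, fun a ha => ?_, fun a ha => ?_⟩
  · rcases List.mem_cons.1 ha with rfl | ha
    · exact enc_lt u
    · exact h.lt a ha
  · rcases List.mem_cons.1 ha with rfl | ha
    · rwa [dec_enc]
    · exact h.mem a ha

theorem Sub.lower {U : List ℕ} {A : Finset Word} (h : Sub U A) (r : ℕ) {g : ℕ → ℤ} (hg : ∀ x, -1 ≤ g x) :
    ((U.filter fun a => inMask r (Nat.land a 15)).map g).sum + (U.filter fun a => inMask r (Nat.land a 15)).length ≤
      ∑ v ∈ A.filter (fun w => inMask r (Nat.land (enc w) 15) = true), g (enc v) +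
        (A.filter fun w => inMask r (Nat.land (enc w) 15) = true).card := by
  rw [sum_enc, ← card_enc]
  refine sum_lower hg (h.nodup.filter _) fun a ha => ?_
  obtain ⟨h1, h2⟩ := List.mem_filter.1 ha
  have he := enc_dec (h.lt a h1)
  exact Finset.mem_image.2 ⟨dec a, Finset.mem_filter.2 ⟨h.mem a h1, by rw [he]; exact h2⟩, he⟩

theorem key_excl {A B : Finset Word} (h : GP c4 A B) {r : Reg} {ρ : Fin 6 → Option (Pt c4)} (hr : RegOk r ρ A B)
    (a : Fin 64) (ha : Nat.land (spread a) r.fx = 0) {U T U' T' : List ℕ} (hU : Sub U' A) (hT : Sub T' B)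
    {k : ℕ} (hlen : (U'.filter fun a => inMask r.rm (Nat.land a 15)).length +
      (T'.filter fun a => inMask r.rm (Nat.land a 15)).length = cnt r.rm U + cnt r.rm T + 1)
    (hsum : ∀ ψ : ℕ → ℤ, ((U'.filter fun a => inMask r.rm (Nat.land a 15)).map fun x => ψ (key (spread a) 0 x)).sum +
      ((T'.filter fun a => inMask r.rm (Nat.land a 15)).map fun x => ψ (key (spread a) 1 x)).sum =
      ψ k + (((U.filter fun a => inMask r.rm (Nat.land a 15)).map fun x => ψ (key (spread a) 0 x)).sum +
      ((T.filter fun a => inMask r.rm (Nat.land a 15)).map fun x => ψ (key (spread a) 1 x)).sum))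
    (hb : 2 * r.b ≤ len (pushKeys r.rm (spread a) 0 U (pushKeys r.rm (spread a) 1 T [])) + (cnt r.rm U + cnt r.rm T)) :
    k ^^^ 1 ∈ pushKeys r.rm (spread a) 0 U (pushKeys r.rm (spread a) 1 T []) := by
  by_contra hcon
  set ks := pushKeys r.rm (spread a) 0 U (pushKeys r.rm (spread a) 1 T []) with hks
  have hred : Red ks := Red.pushKeys _ _ _ _ (Red.pushKeys _ _ _ _ fun x hx => absurd hx List.not_mem_nil)
  have hD : Red (k :: ks) := by
    intro x hx hx'
    rcases List.mem_cons.1 hx with rfl | hx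
    · rcases List.mem_cons.1 hx' with h' | h'
      · exact xor_one_ne _ h'
      · exact hcon h'
    · rcases List.mem_cons.1 hx' with h' | h'
      · rw [← h', xor_one_one] at hcon
        exact hcon hx
      · exact hred x hx h'
  have hψ := dir_xor hD
  have h1 := hU.lower r.rm (g := fun x => dir (k :: ks) (key (spread a) 0 x)) fun x => dir_ge _ _
  have h2 := hT.lower r.rm (g := fun x => dir (k :: ks) (key (spread a) 1 x)) fun x => dir_ge _ _
  have h3 := key_bal h hr a ha hψ
  have h4 := hsum (dir (k :: ks))
  have h5 := pushKeys_spec hψ r.rm (spread a) 0 U (pushKeys r.rm (spread a) 1 T [])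
  rw [pushKeys_spec hψ r.rm (spread a) 1 T [], ← hks, dir_sum _ fun x hx => List.mem_cons_of_mem _ hx] at h5
  have h6 : dir (k :: ks) k = 1 := if_pos List.mem_cons_self
  have h7 := hr.fst_le
  have h8 := hr.snd_le
  rw [len_eq] at hb
  simp only [List.map_nil, List.sum_nil] at h5
  zify at hb h7 h8 hlen
  linarith

theorem getReg_mem (regs : List Reg) : ∀ i, getReg i regs ∈ regs ∨ getReg i regs = ⟨0, 0, 0⟩ := by
  induction regs with
  | nil => intro i; exact Or.inr rfl
  | cons a t ih =>
    intro i
    change bif' _ a (getReg (Nat.sub i 1) t) ∈ _ ∨ bif' _ a (getReg (Nat.sub i 1) t) = _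
    rw [bif'_eq]
    split
    · exact Or.inl List.mem_cons_self
    · rcases ih (Nat.sub i 1) with h | h
      · exact Or.inl (List.mem_cons_of_mem _ h)
      · exact Or.inr h

theorem mkFilter_true {regs : List Reg} {V W : List ℕ} {side x w : ℕ} (h : mkFilter regs V W side x w = true) :
    ∃ r, r = getReg (Nat.land x 3) regs ∧
      Nat.land (spread (Nat.shiftRight x 2)) r.fx = 0 ∧
      2 * r.b ≤ len (pushKeys r.rm (spread (Nat.shiftRight x 2)) 0 V (pushKeys r.rm (spread (Nat.shiftRight x 2)) 1 W [])) +
        (cnt r.rm V + cnt r.rm W) ∧ inMask r.rm (Nat.land w 15) = true ∧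
      Nat.xor 1 (key (spread (Nat.shiftRight x 2)) side w) ∉
        pushKeys r.rm (spread (Nat.shiftRight x 2)) 0 V (pushKeys r.rm (spread (Nat.shiftRight x 2)) 1 W []) := by
  unfold mkFilter at h
  refine ⟨_, rfl, ?_⟩
  generalize getReg (Nat.land x 3) regs = r at h ⊢
  beta_reduce at h
  simp only [bif'_eq] at h
  split at h
  · next h1 =>
    split at h
    · next h2 =>
      beta_reduce at h
      split at h
      · next h3 => exact ⟨Nat.eq_of_beq_eq_true h1, Nat.le_of_ble_eq_true h2, h3, notMem_iff.1 h⟩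
      · cases h
    · cases h
  · cases h

theorem filter_excl {A B : Finset Word} (h : GP c4 A B) {regs : List Reg} (hr : ∀ r ∈ regs, ∃ ρ, RegOk r ρ A B)
    {U T : List ℕ} (hU : Sub U A) (hT : Sub T B) {x : ℕ} (hx : x < 256) {u : Word} :
    (u ∈ A → enc u ∉ U → mkFilter regs U T 0 x (enc u) = false) ∧
      (u ∈ B → enc u ∉ T → mkFilter regs U T 1 x (enc u) = false) := by
  have ha : Nat.shiftRight x 2 < 64 := by
    change x >>> 2 < 64
    rw [Nat.shiftRight_eq_div_pow]
    omega
  constructor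
  · intro hu hn
    by_contra hcon
    obtain ⟨r, hg, h1, h2, h3, h4⟩ := mkFilter_true (Bool.eq_true_of_not_eq_false hcon)
    have hmem : r ∈ regs := by
      rcases getReg_mem regs (Nat.land x 3) with h' | h'
      · rwa [hg]
      · rw [hg, h', inMask_iff] at h3
        simp at h3
    obtain ⟨ρ, hρ⟩ := hr r hmem
    refine h4 ?_
    rw [show Nat.xor 1 (key (spread (Nat.shiftRight x 2)) 0 (enc u)) =
      (key (spread (Nat.shiftRight x 2)) 0 (enc u)) ^^^ 1 from Nat.xor_comm _ _]
    refine key_excl h hρ ⟨_, ha⟩ h1 (hU.cons hu hn) hT ?_ ?_ h2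
    · rw [List.filter_cons_of_pos (p := fun a => inMask r.rm (Nat.land a 15)) h3, List.length_cons, cnt_eq, cnt_eq]; ring
    · intro ψ
      rw [List.filter_cons_of_pos (p := fun a => inMask r.rm (Nat.land a 15)) h3, List.map_cons, List.sum_cons]; ring
  · intro hu hn
    by_contra hcon
    obtain ⟨r, hg, h1, h2, h3, h4⟩ := mkFilter_true (Bool.eq_true_of_not_eq_false hcon)
    have hmem : r ∈ regs := by
      rcases getReg_mem regs (Nat.land x 3) with h' | h'
      · rwa [hg]
      · rw [hg, h', inMask_iff] at h3
        simp at h3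
    obtain ⟨ρ, hρ⟩ := hr r hmem
    refine h4 ?_
    rw [show Nat.xor 1 (key (spread (Nat.shiftRight x 2)) 1 (enc u)) =
      (key (spread (Nat.shiftRight x 2)) 1 (enc u)) ^^^ 1 from Nat.xor_comm _ _]
    refine key_excl h hρ ⟨_, ha⟩ h1 hU (hT.cons hu hn) ?_ ?_ h2
    · rw [List.filter_cons_of_pos (p := fun a => inMask r.rm (Nat.land a 15)) h3, List.length_cons, cnt_eq, cnt_eq]; ring
    · intro ψ
      rw [List.filter_cons_of_pos (p := fun a => inMask r.rm (Nat.land a 15)) h3, List.map_cons, List.sum_cons]; ring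

theorem kill2_excl {A B : Finset Word} (h : GP c4 A B) {regs : List Reg} (hr : ∀ r ∈ regs, ∃ ρ, RegOk r ρ A B)
    {U T : List ℕ} (hU : Sub U A) (hT : Sub T B) {nf a : ℕ} {u : Word} :
    (u ∈ A → enc u ∉ U → kill2 regs U T 0 nf a (enc u) = false) ∧
      (u ∈ B → enc u ∉ T → kill2 regs U T 1 nf a (enc u) = false) := by
  have h1 : ∀ x, Nat.land x 255 < 256 := fun x => lt_of_le_of_lt Nat.and_le_right (by norm_num)
  have key : ∀ side, (∀ x, x < 256 → mkFilter regs U T side x (enc u) = false) →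
      kill2 regs U T side nf a (enc u) = false := by
    intro side hf
    unfold kill2
    simp only [bif'_eq]
    split
    · rfl
    · split
      · exact hf _ (h1 _)
      · beta_reduce
        rw [hf _ (h1 _), hf _ (h1 _)]
        simp
  exact ⟨fun hu hn => key 0 fun x hx => (filter_excl h hr hU hT hx).1 hu hn,
    fun hu hn => key 1 fun x hx => (filter_excl h hr hU hT hx).2 hu hn⟩

end Search
end Polybox

namespace Polybox
open scoped Classical

section Perm
variable {S ι κ : Type} {c : S → S}

/-- Permute the coordinates. -/
noncomputable def perm (e : κ ≃ ι) (V : Finset (ι → S)) : Finset (κ → S) := V.image fun v => v ∘ e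

theorem mem_perm {e : κ ≃ ι} {V : Finset (ι → S)} {w : κ → S} : w ∈ perm e V ↔ w ∘ e.symm ∈ V := by
  unfold perm
  rw [Finset.mem_image]
  constructor
  · rintro ⟨v, hv, rfl⟩
    rwa [Function.comp_assoc, Equiv.self_comp_symm, Function.comp_id]
  · intro h
    exact ⟨_, h, by rw [Function.comp_assoc, Equiv.symm_comp_self, Function.comp_id]⟩

theorem comp_mem_perm {e : κ ≃ ι} {V : Finset (ι → S)} {w : ι → S} : w ∘ e ∈ perm e V ↔ w ∈ V := by
  rw [mem_perm, Function.comp_assoc, Equiv.self_comp_symm, Function.comp_id]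

theorem perm_card (e : κ ≃ ι) (V : Finset (ι → S)) : (perm e V).card = V.card :=
  Finset.card_image_of_injective _ e.surjective.injective_comp_right

theorem Code.perm {V : Finset (ι → S)} (h : Code c V) (e : κ ≃ ι) : Code c (perm e V) := by
  intro u hu v hv hne
  obtain ⟨k, hk⟩ := h _ (mem_perm.1 hu) _ (mem_perm.1 hv) fun h' => hne (e.symm.surjective.injective_comp_right h')
  exact ⟨e.symm k, hk⟩

theorem TF.perm {V : Finset (ι → S)} (h : TF c V) (e : κ ≃ ι) : TF c (perm e V) := by
  rintro u hu v hv ⟨j, h1, h2⟩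
  refine h _ (mem_perm.1 hu) _ (mem_perm.1 hv) ⟨e j, by simpa using h1, fun k hk => ?_⟩
  exact h2 _ fun h' => hk (by rw [← h', Equiv.apply_symm_apply])

theorem cov_perm (e : κ ≃ ι) {w : κ → S} {x : κ → Pt c} : Cov (w ∘ e.symm) (x ∘ e.symm) ↔ Cov w x :=
  ⟨fun h k => by simpa using h (e k), fun h k => h _⟩

theorem GP.perm {V W : Finset (ι → S)} (h : GP c V W) (e : κ ≃ ι) : GP c (perm e V) (perm e W) := by
  have key : ∀ (V : Finset (ι → S)) (x : κ → Pt c), (∃ v ∈ Polybox.perm e V, Cov v x) ↔ ∃ v ∈ V, Cov v (x ∘ e.symm) := by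
    intro V x
    constructor
    · rintro ⟨v, hv, h⟩
      exact ⟨_, mem_perm.1 hv, (cov_perm e).2 h⟩
    · rintro ⟨v, hv, h⟩
      refine ⟨v ∘ e, comp_mem_perm.2 hv, (cov_perm e).1 ?_⟩
      rwa [Function.comp_assoc, Equiv.self_comp_symm, Function.comp_id]
  refine ⟨h.codeV.perm e, h.codeW.perm e, h.tfV.perm e, h.tfW.perm e, fun v hv hw => h.disj _ (mem_perm.1 hv) (mem_perm.1 hw),
    fun x => ?_⟩
  rw [key, key, h.eqv]

end Perm

namespace Search

/-- No word of length six shows the code of twelve words to be thin. -/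
def NoFlat (A : Finset Word) : Prop :=
  ∀ (K : Finset (Fin 6)) (q : Word), K.card ≤ 2 → A.card = 12 → (∀ v ∈ A, ∀ k ∈ K, v k = q k) →
    (∀ v ∈ A, ∃ k, k ∉ K ∧ q k = c4 (v k)) →
    ¬ ∀ r : Word, (∀ k ∈ K, r k = q k) → (∀ v ∈ A, ∃ k, k ∉ K ∧ r k = c4 (v k)) →
      (∀ k, k ∉ K → r k ≠ c4 (q k)) → r = q

/-- The pairs of codes ruled out by the search. -/
structure Mdl (hf : Bool) (regs : List Reg) (A B : Finset Word) : Prop where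
  gp : GP c4 A B
  cross : ∀ u ∈ A, ∀ v ∈ B, Cross hf u v
  reg : ∀ r ∈ regs, ∃ ρ, RegOk r ρ A B
  flatA : NoFlat A
  flatB : NoFlat B

theorem Mdl.symm {hf : Bool} {regs : List Reg} {A B : Finset Word} (h : Mdl hf regs A B) : Mdl hf regs B A :=
  ⟨h.gp.symm, fun u hu v hv => (h.cross v hv u hu).symm, fun r hr => (h.reg r hr).imp fun _ => RegOk.symm, h.flatB, h.flatA⟩

theorem NoFlat.perm {A : Finset Word} (h : NoFlat A) (e : Fin 6 ≃ Fin 6) : NoFlat (perm e A) := by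
  intro K q hK hA h1 h2 h3
  have hmem : ∀ k, e k ∈ K.map e.toEmbedding ↔ k ∈ K := fun k => by simp
  refine h (K.map e.toEmbedding) (q ∘ e.symm) (by rwa [Finset.card_map]) (by rwa [perm_card] at hA) ?_ ?_ ?_
  · intro v hv k hk
    have := h1 _ (comp_mem_perm.2 hv) (e.symm k) ((hmem _).1 (by simpa using hk))
    simpa using this
  · intro v hv
    obtain ⟨k, hk, hk'⟩ := h2 _ (comp_mem_perm.2 hv)
    exact ⟨e k, fun h' => hk ((hmem k).1 h'), by simpa using hk'⟩
  · intro r hr1 hr2 hr3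
    have := h3 (r ∘ e) (fun k hk => by simpa using hr1 (e k) ((hmem k).2 hk)) (fun v hv => ?_) fun k hk => by
      simpa using hr3 (e k) fun h' => hk ((hmem k).1 h')
    · rw [← this, Function.comp_assoc, Equiv.self_comp_symm, Function.comp_id]
    · obtain ⟨k, hk, hk'⟩ := hr2 _ (mem_perm.1 hv)
      refine ⟨e.symm k, fun h' => hk ?_, by simpa using hk'⟩
      have := (hmem _).2 h'
      simpa using this

theorem enc_low (u : Word) : Nat.land (enc u) 15 = u 0 + 4 * u 1 := by
  change enc u &&& (2 ^ 4 - 1) = _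
  rw [Nat.and_two_pow_sub_one_eq_mod]
  unfold enc
  omega

theorem RegOk.perm {r : Reg} {ρ : Fin 6 → Option (Pt c4)} {A B : Finset Word} (h : RegOk r ρ A B) {e : Fin 6 ≃ Fin 6}
    (h0 : e 0 = 0) (h1 : e 1 = 1) : RegOk r ρ (perm e A) (perm e B) := by
  have key : ∀ A : Finset Word, ((Polybox.perm e A).filter fun w => inMask r.rm (Nat.land (enc w) 15) = true).card =
      (A.filter fun w => inMask r.rm (Nat.land (enc w) 15) = true).card := by
    intro A
    rw [← perm_card e (A.filter _)]
    congr 1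
    ext w
    have h0' : e.symm 0 = 0 := by rw [Equiv.symm_apply_eq, h0]
    have h1' : e.symm 1 = 1 := by rw [Equiv.symm_apply_eq, h1]
    rw [mem_perm, Finset.mem_filter, Finset.mem_filter, mem_perm, enc_low, enc_low]
    simp only [Function.comp_apply, h0', h1']
  exact ⟨h.mem, h.fx, by rw [key]; exact h.fst_le, by rw [key]; exact h.snd_le⟩

theorem Near.of_perm (e : Fin 6 ≃ Fin 6) {u v : Word} (h : Near u v) : Near (u ∘ e.symm) (v ∘ e.symm) := by
  obtain ⟨i, h1, h2⟩ := h
  exact ⟨e i, by simpa using h1, fun j hj => h2 _ fun h' => hj (by rw [← h', Equiv.apply_symm_apply])⟩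

theorem Mdl.perm {hf : Bool} {regs : List Reg} {A B : Finset Word} (h : Mdl hf regs A B) {e : Fin 6 ≃ Fin 6}
    (h0 : e 0 = 0) (h1 : e 1 = 1) : Mdl hf regs (perm e A) (perm e B) := by
  refine ⟨h.gp.perm e, fun u hu v hv => ?_, fun r hr => (h.reg r hr).imp fun _ hρ => hρ.perm h0 h1, h.flatA.perm e, h.flatB.perm e⟩
  have := h.cross _ (mem_perm.1 hu) _ (mem_perm.1 hv)
  exact ⟨fun h' => this.1 (by rw [h']), fun hh hn => this.2 hh (hn.of_perm e)⟩

/-- The columns `j` and `j + 1` have not been told apart. -/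
def Clear (e : ℕ) (j : Fin 6) : Prop :=
  (j = 2 ∧ Nat.land e 48 = 0) ∨ (j = 3 ∧ Nat.land e 192 = 0) ∨ (j = 4 ∧ Nat.land e 768 = 0)

theorem Clear.cases {e : ℕ} {j : Fin 6} (h : Clear e j) : j = 2 ∨ j = 3 ∨ j = 4 := by
  rcases h with h | h | h
  · exact Or.inl h.1
  · exact Or.inr (Or.inl h.1)
  · exact Or.inr (Or.inr h.1)

theorem land_lor_eq_zero {a b m : ℕ} : Nat.land (Nat.lor a b) m = 0 ↔ Nat.land a m = 0 ∧ Nat.land b m = 0 := by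
  change (a ||| b) &&& m = 0 ↔ a &&& m = 0 ∧ b &&& m = 0
  rw [Nat.and_or_distrib_right, Nat.or_eq_zero_iff]

theorem clear_lor {a b : ℕ} {j : Fin 6} (h : Clear (Nat.lor a b) j) : Clear a j ∧ Clear b j := by
  unfold Clear at *
  simp only [land_lor_eq_zero] at h
  tauto

theorem dec_shift (w : ℕ) {j k : Fin 6} (h : k.val = j.val + 1) : dec (Nat.shiftRight w 2) j = dec w k := by
  apply Fin.ext
  change (w >>> 2) / 4 ^ j.val % 4 = w / 4 ^ k.val % 4
  rw [Nat.shiftRight_eq_div_pow, Nat.div_div_eq_div_mul, h, pow_succ (4 : ℕ), mul_comm (4 ^ j.val)]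

theorem clear_agree {w : ℕ} {j : Fin 6} (h : Clear (Nat.xor w (Nat.shiftRight w 2)) j) : dec w j = dec w (j + 1) := by
  have key : ∀ (m : ℕ) (j k : Fin 6), k.val = j.val + 1 → (dec m j).val = 3 →
      Nat.land (Nat.xor w (Nat.shiftRight w 2)) m = 0 → dec w j = dec w k := by
    intro m j k hk hm h
    have h1 := dec_and (Nat.xor w (Nat.shiftRight w 2)) m j
    rw [show Nat.xor w (Nat.shiftRight w 2) &&& m = 0 from h, hm] at h1
    have h2 := dec_xor w (Nat.shiftRight w 2) j
    rw [dec_shift w hk] at h2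
    rw [show (dec (Nat.xor w (Nat.shiftRight w 2)) j).val = _ from h2] at h1
    have h3 : ∀ (j : Fin 6) (x y : Fin 4), (dec 0 j).val = (x.val ^^^ y.val) &&& 3 → x = y := by decide
    exact h3 _ _ _ h1
  rcases h with ⟨rfl, h⟩ | ⟨rfl, h⟩ | ⟨rfl, h⟩
  · exact key 48 2 3 rfl (by decide) h
  · exact key 192 3 4 rfl (by decide) h
  · exact key 768 4 5 rfl (by decide) h

theorem perm_fix {U : List ℕ} {A : Finset Word} (h : Sub U A) {e : Fin 6 ≃ Fin 6} (he : ∀ a ∈ U, dec a ∘ e = dec a) :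
    Sub U (perm e A) :=
  ⟨h.nodup, h.lt, fun a ha => by
    have := comp_mem_perm (e := e).2 (h.mem a ha)
    rwa [he a ha] at this⟩

theorem exists_sorted {hf : Bool} {regs : List Reg} {U T : List ℕ} {cw : Word} {F : Fin 6 → Prop}
    (hF : ∀ j, F j → (j = 2 ∨ j = 3 ∨ j = 4) ∧ (∀ a ∈ U, dec a j = dec a (j + 1)) ∧
      (∀ a ∈ T, dec a j = dec a (j + 1)) ∧ cw j = cw (j + 1)) :
    ∀ (n : ℕ) (A B : Finset Word) (u : Word), 3 * ((u 2).val / 2) + 2 * ((u 3).val / 2) + (u 4).val / 2 = n →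
      Mdl hf regs A B → Sub U A → Sub T B → u ∈ A → enc u ∉ U → (∀ j, InCell (u j) (cw j)) →
      ∃ (A B : Finset Word) (u : Word), Mdl hf regs A B ∧ Sub U A ∧ Sub T B ∧ u ∈ A ∧ enc u ∉ U ∧
        (∀ j, InCell (u j) (cw j)) ∧ ∀ j, F j → Ordered u j (j + 1) := by
  intro n
  induction n using Nat.strong_induction_on with
  | _ n ih =>
  intro A B u hn hM hU hT hu hnu hcell
  by_cases hall : ∀ j, F j → Ordered u j (j + 1)
  · exact ⟨A, B, u, hM, hU, hT, hu, hnu, hcell, hall⟩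
  push Not at hall
  obtain ⟨j, hj, hnot⟩ := hall
  obtain ⟨hj1, hjU, hjT, hjc⟩ := hF j hj
  unfold Ordered at hnot
  push Not at hnot
  set e : Fin 6 ≃ Fin 6 := Equiv.swap j (j + 1) with he
  have hfix : ∀ w : Word, w j = w (j + 1) → w ∘ e = w := by
    intro w hw
    funext k
    simp only [Function.comp_apply, he, Equiv.swap_apply_def]
    split
    · next h => rw [h, hw]
    · split
      · next h => rw [h, hw]
      · rfl
  have he0 : e 0 = 0 := by rcases hj1 with h | h | h <;> rw [he, h] <;> decide
  have he1 : e 1 = 1 := by rcases hj1 with h | h | h <;> rw [he, h] <;> decide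
  refine ih _ ?_ (perm e A) (perm e B) (u ∘ e) rfl (hM.perm he0 he1) (perm_fix hU fun a ha => hfix _ (hjU a ha))
    (perm_fix hT fun a ha => hfix _ (hjT a ha)) (comp_mem_perm.2 hu) ?_ ?_
  · have hlt := (u 2).isLt
    rcases hj1 with rfl | rfl | rfl
    · have e2 : e 2 = 3 := by rw [he]; decide
      have e3 : e 3 = 2 := by rw [he]; decide
      have e4 : e 4 = 4 := by rw [he]; decide
      simp only [Function.comp_apply, e2, e3, e4]
      have h1 : 2 ≤ (u 2).val := hnot.1
      have h2 : (u 3).val < 2 := hnot.2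
      omega
    · have e2 : e 2 = 2 := by rw [he]; decide
      have e3 : e 3 = 4 := by rw [he]; decide
      have e4 : e 4 = 3 := by rw [he]; decide
      simp only [Function.comp_apply, e2, e3, e4]
      have h1 : 2 ≤ (u 3).val := hnot.1
      have h2 : (u 4).val < 2 := hnot.2
      omega
    · have e2 : e 2 = 2 := by rw [he]; decide
      have e3 : e 3 = 3 := by rw [he]; decide
      have e4 : e 4 = 5 := by rw [he]; decide
      simp only [Function.comp_apply, e2, e3, e4]
      have h1 : 2 ≤ (u 4).val := hnot.1
      have h2 : (u 5).val < 2 := hnot.2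
      omega
  · intro h
    apply hnu
    have h1 := hfix _ (hjU _ h)
    rw [dec_enc, Function.comp_assoc] at h1
    have h2 : (e : Fin 6 → Fin 6) ∘ e = id := by
      funext k
      simp [he]
    rw [h2, Function.comp_id] at h1
    rwa [← h1] at h
  · intro k
    have h1 : cw k = cw (e k) := (congrFun (hfix cw hjc) k).symm
    rw [h1]
    exact hcell _

end Search
end Polybox

namespace Polybox
namespace Search
open scoped Classical

theorem testBit_block {X l s y : ℕ} (hy : y < s) :
    (Nat.land (Nat.shiftRight X (Nat.mul l s)) (Nat.sub (Nat.shiftLeft 1 s) 1)).testBit y = true ↔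
      X.testBit (l * s + y) = true := by
  rw [testBit_land]
  change ((X >>> (l * s)).testBit y = true ∧ ((1 <<< s) - 1).testBit y = true) ↔ _
  rw [Nat.testBit_shiftRight, Nat.one_shiftLeft, Nat.testBit_two_pow_sub_one]
  simp [hy]

/-- Every word of the mask covering the cell is excluded or explored further. -/
def Done (kill : ℕ → Bool) (go : ℕ → List ℕ → List ℕ) (c j X w : ℕ) : Prop :=
  ∀ y < 4 ^ j, X.testBit y = true →
    (∀ i < j, y / 4 ^ i % 4 = c / 4 ^ i % 2 ∨ y / 4 ^ i % 4 = 2 + c / 4 ^ i / 2 % 2) →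
    kill (w + y) = true ∨ ∃ h, h ≠ [] ∧ go (w + y) h ≠ []

theorem expl_spec (kill : ℕ → Bool) (go : ℕ → List ℕ → List ℕ) (c : ℕ) : ∀ (j X w : ℕ) (h : List ℕ),
    expl kill go c j X w h ≠ [] → h ≠ [] ∧ Done kill go c j X w := by
  intro j
  induction j with
  | zero =>
    intro X w h hne
    change force w (fun w => bif' (kill w) h
      (List.rec (motive := fun _ => List Nat) [] (fun a t _ => go w (a :: t)) h)) ≠ [] at hne
    rw [force_eq, bif'_eq] at hne
    split at hne
    · next hk =>
      refine ⟨hne, fun y hy _ _ => Or.inl ?_⟩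
      rw [pow_zero, Nat.lt_one_iff] at hy
      rw [hy]
      exact hk
    · cases h with
      | nil => exact absurd rfl hne
      | cons a t =>
        refine ⟨by simp, fun y hy _ _ => Or.inr ⟨a :: t, by simp, ?_⟩⟩
        rw [pow_zero, Nat.lt_one_iff] at hy
        rw [hy]
        exact hne
  | succ j ih =>
    intro X w h hne
    have hs : Nat.shiftLeft 1 (Nat.mul 2 j) = 4 ^ j := by
      change 1 <<< (2 * j) = _
      rw [Nat.one_shiftLeft, pow_four]
    have hb : Nat.shiftRight c (Nat.mul 2 j) = c / 4 ^ j := by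
      change c >>> (2 * j) = _
      rw [Nat.shiftRight_eq_div_pow, pow_four]
    set sub : ℕ → List ℕ → List ℕ := fun l h =>
      force (Nat.land (Nat.shiftRight X (Nat.mul l (4 ^ j))) (Nat.sub (Nat.shiftLeft 1 (4 ^ j)) 1)) (fun Y =>
        bif' (Nat.beq Y 0) h (expl kill go c j Y (Nat.add w (Nat.mul l (4 ^ j))) h)) with hsub
    have heq : expl kill go c (j + 1) X w h =
        sub (Nat.land (c / 4 ^ j) 1) (sub (Nat.lor 2 (Nat.land (Nat.shiftRight (c / 4 ^ j) 1) 1)) h) := by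
      rw [hsub, ← hb, ← hs]
      rfl
    have step : ∀ l h, sub l h ≠ [] → h ≠ [] ∧ ∀ y < 4 ^ j, X.testBit (l * 4 ^ j + y) = true →
        (∀ i < j, y / 4 ^ i % 4 = c / 4 ^ i % 2 ∨ y / 4 ^ i % 4 = 2 + c / 4 ^ i / 2 % 2) →
        kill (w + (l * 4 ^ j + y)) = true ∨ ∃ h, h ≠ [] ∧ go (w + (l * 4 ^ j + y)) h ≠ [] := by
      intro l h hne
      simp only [hsub, force_eq, bif'_eq] at hne
      split at hne
      · next h0 =>
        refine ⟨hne, fun y hy hX => ?_⟩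
        rw [← testBit_block hy, Nat.eq_of_beq_eq_true h0] at hX
        simp at hX
      · obtain ⟨h1, h2⟩ := ih _ _ _ hne
        refine ⟨h1, fun y hy hX hcell => ?_⟩
        have := h2 y hy ((testBit_block hy).2 hX) hcell
        rw [show Nat.add w (Nat.mul l (4 ^ j)) + y = w + (l * 4 ^ j + y) from Nat.add_assoc _ _ _] at this
        exact this
    rw [heq] at hne
    obtain ⟨h1, h2⟩ := step _ _ hne
    obtain ⟨h3, h4⟩ := step _ _ h1
    refine ⟨h3, fun y hy hX hcell => ?_⟩
    have hpos : 0 < 4 ^ j := by positivity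
    have hl : y / 4 ^ j < 4 := by
      rw [Nat.div_lt_iff_lt_mul hpos, mul_comm, ← pow_succ]
      exact hy
    have hdecomp : y / 4 ^ j * 4 ^ j + y % 4 ^ j = y := Nat.div_add_mod' _ _
    have hmod : y % 4 ^ j < 4 ^ j := Nat.mod_lt _ hpos
    have hlow : ∀ i < j, y % 4 ^ j / 4 ^ i % 4 = c / 4 ^ i % 2 ∨ y % 4 ^ j / 4 ^ i % 4 = 2 + c / 4 ^ i / 2 % 2 := by
      intro i hi
      have : y % 4 ^ j / 4 ^ i % 4 = y / 4 ^ i % 4 := by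
        obtain ⟨d, rfl⟩ := Nat.exists_eq_add_of_lt hi
        rw [show 4 ^ (i + d + 1) = 4 ^ i * 4 ^ (d + 1) by ring, Nat.mod_mul_right_div_self,
          Nat.mod_mod_of_dvd _ (dvd_pow_self 4 (Nat.succ_ne_zero d))]
      rw [this]
      exact hcell i (Nat.lt_succ_of_lt hi)
    have hland : Nat.land (c / 4 ^ j) 1 = c / 4 ^ j % 2 := Nat.and_one_is_mod _
    have hlor : Nat.lor 2 (Nat.land (Nat.shiftRight (c / 4 ^ j) 1) 1) = 2 + c / 4 ^ j / 2 % 2 := by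
      rw [show Nat.land (Nat.shiftRight (c / 4 ^ j) 1) 1 = c / 4 ^ j / 2 % 2 from Nat.and_one_is_mod _]
      rcases Nat.mod_two_eq_zero_or_one (c / 4 ^ j / 2) with h' | h' <;> rw [h'] <;> rfl
    rw [← hdecomp] at hX
    rcases hcell j (Nat.lt_succ_self j) with h' | h'
    · rw [Nat.mod_eq_of_lt hl] at h'
      rw [hland, ← h'] at h2
      have := h2 _ hmod hX hlow
      rwa [hdecomp] at this
    · rw [Nat.mod_eq_of_lt hl] at h'
      rw [hlor, ← h'] at h4
      have := h4 _ hmod hX hlow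
      rwa [hdecomp] at this

theorem expl_word {kill : ℕ → Bool} {go : ℕ → List ℕ → List ℕ} {c X : ℕ} {h : List ℕ}
    (hne : expl kill go c 6 X 0 h ≠ []) {u : Word} (hX : X.testBit (enc u) = true)
    (hc : ∀ j, InCell (u j) (dec c j)) (hk : kill (enc u) = false) : ∃ h, h ≠ [] ∧ go (enc u) h ≠ [] := by
  have := (expl_spec _ _ _ _ _ _ _ hne).2 (enc u) (enc_lt u) hX fun i hi => by
    have h1 := hc ⟨i, hi⟩
    have h2 : (u ⟨i, hi⟩).val = enc u / 4 ^ i % 4 := by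
      rw [← congrFun (dec_enc u) ⟨i, hi⟩]
      rfl
    unfold InCell at h1
    rw [h2, show (dec c ⟨i, hi⟩).val = c / 4 ^ i % 4 from rfl] at h1
    omega
  rw [Nat.zero_add, hk] at this
  simpa using this

/-- The masks contain all the words that may be added. -/
structure Inv (hf : Bool) (V W : List ℕ) (LV LW E : ℕ) : Prop where
  ltV : ∀ a ∈ V, a < 4096
  ltW : ∀ a ∈ W, a < 4096
  fst : ∀ u : Word, (∀ a ∈ V, (∃ j, u j = c4 (dec a j)) ∧ ¬ Twin c4 (dec a) u) → (∀ b ∈ W, Cross hf u (dec b)) →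
    LV.testBit (enc u) = true
  snd : ∀ u : Word, (∀ a ∈ W, (∃ j, u j = c4 (dec a j)) ∧ ¬ Twin c4 (dec a) u) → (∀ b ∈ V, Cross hf u (dec b)) →
    LW.testBit (enc u) = true
  clear : ∀ j, Clear E j → (∀ a ∈ V, dec a j = dec a (j + 1)) ∧ ∀ a ∈ W, dec a j = dec a (j + 1)

theorem Inv.symm {hf : Bool} {V W : List ℕ} {LV LW E : ℕ} (h : Inv hf V W LV LW E) : Inv hf W V LW LV E :=
  ⟨h.ltW, h.ltV, h.snd, h.fst, fun j hj => (h.clear j hj).symm⟩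

theorem Inv.cons {hf : Bool} {V W : List ℕ} {LV LW E : ℕ} (h : Inv hf V W LV LW E) {w : ℕ} (hw : w < 4096) :
    Inv hf (w :: V) W (Nat.land LV (same w)) (Nat.land LW (cross hf w)) (Nat.lor E (Nat.xor w (Nat.shiftRight w 2))) := by
  refine ⟨fun a ha => ?_, h.ltW, fun u h1 h2 => ?_, fun u h1 h2 => ?_, fun j hj => ?_⟩
  · rcases List.mem_cons.1 ha with rfl | ha
    · exact hw
    · exact h.ltV a ha
  · obtain ⟨h3, h4⟩ := h1 w List.mem_cons_self
    refine testBit_land.2 ⟨h.fst u (fun a ha => h1 a (List.mem_cons_of_mem _ ha)) h2, testBit_same hw (enc_lt u) ?_ ?_⟩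
    · rwa [dec_enc]
    · rwa [dec_enc]
  · refine testBit_land.2 ⟨h.snd u h1 fun b hb => h2 b (List.mem_cons_of_mem _ hb), testBit_cross (enc_lt u) ?_⟩
    rw [dec_enc]
    exact h2 w List.mem_cons_self
  · obtain ⟨h1, h2⟩ := clear_lor hj
    obtain ⟨h3, h4⟩ := h.clear j h1
    refine ⟨fun a ha => ?_, h4⟩
    rcases List.mem_cons.1 ha with rfl | ha
    · exact clear_agree h2
    · exact h3 a ha

/-- No admissible pair of codes contains the two lists. -/
def Good (hf : Bool) (regs : List Reg) (V W : List ℕ) : Prop :=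
  ∀ A B, Mdl hf regs A B → Sub V A → Sub W B → False

theorem Good.symm {hf : Bool} {regs : List Reg} {V W : List ℕ} (h : Good hf regs V W) : Good hf regs W V :=
  fun _ _ hM h1 h2 => h _ _ hM.symm h2 h1

theorem anyIn_iff {m : ℕ} {l : List ℕ} : anyIn m l = true ↔ ∃ a ∈ l, m.testBit a = true := by
  induction l with
  | nil => simp [anyIn]
  | cons a t ih =>
    change bif' (inMask m a) true (anyIn m t) = true ↔ _
    rw [bif'_eq, List.exists_mem_cons_iff, ← ih, ← inMask_iff]
    split
    · next h => simp [h]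
    · next h => simp [h]

theorem covered {A B : Finset Word} (h : GP c4 A B) {cw : Word} {b : Word} (hb : b ∈ B) (hc : ∀ j, InCell (b j) (cw j)) :
    ∃ u ∈ A, ∀ j, InCell (u j) (cw j) :=
  (h.eqv fun j => cell (cw j)).2 ⟨b, hb, hc⟩

theorem extend_good {hf : Bool} {regs : List Reg} {V W : List ℕ} {LV LW E c : ℕ} (hI : Inv hf V W LV LW E)
    (hc : c < 4096) (hW : anyIn (cellMask c) W = true) (hV : ¬ anyIn (cellMask c) V = true)
    {kill : ℕ → Bool} {go : ℕ → List ℕ → List ℕ} {h : List ℕ}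
    (hkill : ∀ A B, Mdl hf regs A B → Sub V A → Sub W B → ∀ u ∈ A, enc u ∉ V → kill (enc u) = false)
    (hgo : ∀ w < 4096, ∀ h, go w h ≠ [] → Good hf regs (w :: V) W)
    (hne : expl kill go c 6 (Nat.land LV (sortMask (Nat.lor E (Nat.xor c (Nat.shiftRight c 2))))) 0 h ≠ []) :
    Good hf regs V W := by
  intro A B hM hU hT
  obtain ⟨b, hb, hcb⟩ := anyIn_iff.1 hW
  obtain ⟨u, hu, hcu⟩ := covered hM.gp (hT.mem b hb) ((testBit_cellMask hc (hT.lt b hb)).1 hcb)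
  have hnu : enc u ∉ V := fun h' => hV (anyIn_iff.2 ⟨_, h', (testBit_cellMask hc (enc_lt u)).2 (by rwa [dec_enc])⟩)
  obtain ⟨A, B, u, hM, hU, hT, hu, hnu, hcu, hord⟩ := exists_sorted (cw := dec c)
    (F := Clear (Nat.lor E (Nat.xor c (Nat.shiftRight c 2)))) (fun j hj => by
      obtain ⟨h1, h2⟩ := clear_lor hj
      exact ⟨hj.cases, (hI.clear j h1).1, (hI.clear j h1).2, clear_agree h2⟩) _ A B u rfl hM hU hT hu hnu hcu
  have hX : (Nat.land LV (sortMask (Nat.lor E (Nat.xor c (Nat.shiftRight c 2))))).testBit (enc u) = true := by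
    refine testBit_land.2 ⟨hI.fst u (fun a ha => ⟨?_, hM.gp.tfV _ (hU.mem a ha) _ hu⟩) fun b hb => hM.cross _ hu _ (hT.mem b hb), ?_⟩
    · refine hM.gp.codeV _ (hU.mem a ha) _ hu fun h' => hnu ?_
      rwa [← h', enc_dec (hU.lt a ha)]
    · refine testBit_sortMask (enc_lt u) (fun h => ?_) (fun h => ?_) fun h => ?_
      · rw [dec_enc]; exact hord 2 (Or.inl ⟨rfl, h⟩)
      · rw [dec_enc]; exact hord 3 (Or.inr (Or.inl ⟨rfl, h⟩))
      · rw [dec_enc]; exact hord 4 (Or.inr (Or.inr ⟨rfl, h⟩))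
  obtain ⟨h', -, hg⟩ := expl_word hne hX hcu (hkill A B hM hU hT u hu hnu)
  exact hgo _ (enc_lt u) _ hg A B hM (hU.cons hu hnu) hT

theorem branch_good {hf : Bool} {regs : List Reg} {rec : Run} {V W : List ℕ} {LV LW E c nf a : ℕ} {t : List ℕ}
    (hrec : ∀ V W LV LW E h, Inv hf V W LV LW E → rec V W LV LW E h ≠ [] → Good hf regs V W)
    (hI : Inv hf V W LV LW E) (hc : c < 4096)
    (hne : branch hf regs rec V W LV LW E c nf a t ≠ []) : Good hf regs V W := by
  unfold branch at hne
  simp only [force_eq, bif'_eq] at hne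
  split at hne
  · next hW =>
    split at hne
    · exact absurd rfl hne
    · next hV =>
      refine extend_good hI hc hW hV (fun A B hM hU hT u hu hn => (kill2_excl hM.gp hM.reg hU hT).1 hu hn) ?_ hne
      exact fun w hw h hg => hrec _ _ _ _ _ _ (hI.cons hw) hg
  · next hW =>
    split at hne
    · next hV =>
      refine Good.symm (extend_good hI.symm hc hV hW
        (fun A B hM hU hT u hu hn => (kill2_excl hM.gp.symm (fun r hr => (hM.symm.reg r hr)) hT hU).2 hu hn) ?_ hne)
      exact fun w hw h hg => Good.symm (hrec _ _ _ _ _ _ (hI.symm.cons hw).symm hg)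
    · exact absurd rfl hne

theorem eqList_eq {l : List ℕ} : ∀ {m : List ℕ}, eqList l m = true → l = m := by
  induction l with
  | nil =>
    intro m h
    cases m with
    | nil => rfl
    | cons b t => cases h
  | cons a s ih =>
    intro m h
    cases m with
    | nil => cases h
    | cons b t =>
      change bif' (Nat.beq a b) (eqList s t) false = true at h
      rw [bif'_eq] at h
      split at h
      · next h' => rw [Nat.eq_of_beq_eq_true h', ih h]
      · cases h

theorem settled_mem {V W : List ℕ} {known : List State} (h : settled known V W = true) :
    ∃ s ∈ known, s.fst = V ∧ s.snd = W := by
  induction known with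
  | nil => cases h
  | cons s t ih =>
    change bif' (eqList s.fst V) (bif' (eqList s.snd W) true (settled t V W)) (settled t V W) = true at h
    simp only [bif'_eq] at h
    have hrest : settled t V W = true → ∃ s' ∈ s :: t, s'.fst = V ∧ s'.snd = W := fun h => by
      obtain ⟨s', h1, h2⟩ := ih h
      exact ⟨s', List.mem_cons_of_mem _ h1, h2⟩
    split at h
    · next h1 =>
      split at h
      · next h2 => exact ⟨s, List.mem_cons_self, eqList_eq h1, eqList_eq h2⟩
      · exact hrest h
    · exact hrest h

theorem allIn_iff {m : ℕ} {l : List ℕ} : allIn m l = true ↔ ∀ a ∈ l, m.testBit a = true := by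
  induction l with
  | nil => simp [allIn]
  | cons a t ih =>
    change bif' (inMask m a) (allIn m t) false = true ↔ _
    rw [bif'_eq, List.forall_mem_cons, ← ih, ← inMask_iff]
    split
    · next h => simp [h]
    · next h => simp [h]

theorem testBit_landAll {f : ℕ → ℕ} {l : List ℕ} {m x : ℕ} :
    (landAll f l m).testBit x = true ↔ (∀ a ∈ l, (f a).testBit x = true) ∧ m.testBit x = true := by
  induction l with
  | nil => simp [landAll]
  | cons a t ih =>
    change (Nat.land (f a) (landAll f t m)).testBit x = true ↔ _
    rw [testBit_land, ih, List.forall_mem_cons, and_assoc]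

/-- The columns marked in `jm`. -/
def marked (jm : ℕ) : Finset (Fin 6) := Finset.univ.filter fun k => ¬ Nat.beq (Nat.land (Nat.shiftRight jm k) 1) 0 = true

theorem testBit_offCol {jm m d x : ℕ} (k : Fin 6) :
    (offCol jm k m d).testBit x = true ↔ if k ∈ marked jm then d.testBit x = true else m.testBit x = true := by
  unfold offCol marked
  simp only [bif'_eq, Finset.mem_filter, Finset.mem_univ, true_and]
  generalize Nat.beq (Nat.land (Nat.shiftRight jm k) 1) 0 = b
  cases b <;> simp

theorem testBit_shareOff {jm w x : ℕ} (hw : w < 4096) (hx : x < 4096) :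
    (shareOff jm w).testBit x = true ↔ ∃ k, k ∉ marked jm ∧ dec x k = dec w k := by
  have key : ∀ (k : Fin 6) (m : ℕ), (m.testBit x = true ↔ dec x k = dec w k) →
      ((offCol jm k m 0).testBit x = true ↔ k ∉ marked jm ∧ dec x k = dec w k) := by
    intro k m hm
    rw [testBit_offCol, hm]
    split
    · next h => simp [h]
    · next h => simp [h]
  rw [exists_six, ← key 0 _ (testBit_col0 hw hx), ← key 1 _ (testBit_col1 hw hx), ← key 2 _ (testBit_col2 hw hx),
    ← key 3 _ (testBit_col3 hw hx), ← key 4 _ (testBit_col4 hw hx), ← key 5 _ (testBit_col5 hw hx)]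
  unfold shareOff
  simp only [testBit_lor]
  rfl

theorem testBit_agree {jm q x : ℕ} (hq : q < 4096) (hx : x < 4096) :
    (agree jm q).testBit x = true ↔ ∀ k, k ∈ marked jm → dec x k = dec q k := by
  have key : ∀ (k : Fin 6) (m : ℕ), (m.testBit x = true ↔ dec x k = dec q k) →
      ((offCol jm k full m).testBit x = true ↔ (k ∈ marked jm → dec x k = dec q k)) := by
    intro k m hm
    rw [testBit_offCol, hm]
    have := testBit_full hx
    split
    · next h => simp [h]
    · next h => simp [h, this]
  rw [forall_six, ← key 0 _ (testBit_col0 hq hx), ← key 1 _ (testBit_col1 hq hx), ← key 2 _ (testBit_col2 hq hx),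
    ← key 3 _ (testBit_col3 hq hx), ← key 4 _ (testBit_col4 hq hx), ← key 5 _ (testBit_col5 hq hx)]
  unfold agree
  simp only [testBit_land]
  rfl

theorem marked_card (jm : Fin 64) : (marked jm).card =
    Nat.add (Nat.add (Nat.add (Nat.land jm 1) (Nat.land (Nat.shiftRight jm 1) 1))
        (Nat.add (Nat.land (Nat.shiftRight jm 2) 1) (Nat.land (Nat.shiftRight jm 3) 1)))
        (Nat.add (Nat.land (Nat.shiftRight jm 4) 1) (Nat.land (Nat.shiftRight jm 5) 1)) := by
  unfold marked
  revert jm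
  decide +kernel

theorem flat_good {hf : Bool} {regs : List Reg} {q : ℕ} {jm : Fin 64} {V W : List ℕ} (hq : q < 4096)
    (hcard : ∀ A B, Mdl hf regs A B → A.card ≤ 12) (h : flat q jm V = true) : Good hf regs V W := by
  intro A B hM hU _
  unfold flat at h
  simp only [bif'_eq, force_eq] at h
  split at h; swap; cases h
  rename_i h1
  split at h; swap; cases h
  rename_i h2
  split at h; swap; cases h
  rename_i h3
  have hlen : V.length = 12 := by rw [← len_eq]; exact Nat.eq_of_beq_eq_true h1
  have himg : (V.toFinset.image dec) = A := by
    refine Finset.eq_of_subset_of_card_le ?_ ?_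
    · intro w hw
      obtain ⟨a, ha, rfl⟩ := Finset.mem_image.1 hw
      exact hU.mem a (List.mem_toFinset.1 ha)
    · rw [Finset.card_image_of_injOn, List.toFinset_card_of_nodup hU.nodup, hlen]
      · exact hcard A B hM
      · intro a ha b hb hab
        have h3 := enc_dec (hU.lt a (List.mem_toFinset.1 ha))
        rw [← h3, show dec a = dec b from hab, enc_dec (hU.lt b (List.mem_toFinset.1 hb))]
  have hA : ∀ v ∈ A, ∃ a ∈ V, dec a = v := by
    intro v hv
    rw [← himg] at hv
    obtain ⟨a, ha, rfl⟩ := Finset.mem_image.1 hv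
    exact ⟨a, List.mem_toFinset.1 ha, rfl⟩
  have hA12 : A.card = 12 := by
    refine le_antisymm (hcard A B hM) ?_
    rw [← himg, Finset.card_image_of_injOn, List.toFinset_card_of_nodup hU.nodup, hlen]
    intro a ha b hb hab
    have h3 := enc_dec (hU.lt a (List.mem_toFinset.1 ha))
    rw [← h3, show dec a = dec b from hab, enc_dec (hU.lt b (List.mem_toFinset.1 hb))]
  have hagree := allIn_iff.1 h3
  set X := landAll (fun v => shareOff jm (Nat.xor v 1365)) V (agree jm q) with hX
  have hmem : ∀ x < 4096, X.testBit x = true ↔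
      (∀ v ∈ A, ∃ k, k ∉ marked jm ∧ dec x k = c4 (v k)) ∧ ∀ k, k ∈ marked jm → dec x k = dec q k := by
    intro x hx
    rw [hX, testBit_landAll, testBit_agree hq hx]
    refine and_congr_left fun _ => ⟨fun h v hv => ?_, fun h a ha => ?_⟩
    · obtain ⟨a, ha, rfl⟩ := hA v hv
      obtain ⟨k, h1, h2⟩ := (testBit_shareOff (xor_lt (hU.lt a ha) (by norm_num)) hx).1 (h a ha)
      exact ⟨k, h1, h2.trans (dec_compl a k)⟩
    · obtain ⟨k, h1, h2⟩ := h _ (hU.mem a ha)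
      exact (testBit_shareOff (xor_lt (hU.lt a ha) (by norm_num)) hx).2 ⟨k, h1, h2.trans (dec_compl a k).symm⟩
  have hbit : ∀ x < 4096, (X.testBit x = true ∧ ¬ ∃ k, k ∉ marked jm ∧ dec x k = c4 (dec q k)) ↔ x = q := by
    intro x hx
    have h5 : (Nat.xor X (Nat.land X (shareOff jm (Nat.xor q 1365)))).testBit x = true ↔ x = q := by
      rw [Nat.eq_of_beq_eq_true h]
      change (1 <<< q).testBit x = true ↔ _
      rw [Nat.one_shiftLeft, Nat.testBit_two_pow]
      simp [eq_comm]
    have h6 := testBit_shareOff (jm := jm) (xor_lt hq (show 1365 < 4096 by norm_num)) hx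
    simp only [dec_compl q] at h6
    rw [← h5, testBit_nxor, testBit_land, ← h6, show q ^^^ 1365 = Nat.xor q 1365 from rfl]
    tauto
  refine hM.flatA (marked jm) (dec q) ?_ hA12 ?_ ?_ ?_
  · rw [marked_card]
    exact Nat.le_of_ble_eq_true h2
  · intro v hv k hk
    obtain ⟨a, ha, rfl⟩ := hA v hv
    exact (testBit_agree hq (hU.lt a ha)).1 (hagree a ha) k hk
  · exact ((hmem q hq).1 ((hbit q hq).2 rfl).1).1
  · intro r h1 h2 h3
    have h4 := (hbit (enc r) (enc_lt r)).1 ⟨(hmem _ (enc_lt r)).2 (by rw [dec_enc]; exact ⟨h2, h1⟩), by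
      rw [dec_enc]
      rintro ⟨k, hk, hk'⟩
      exact h3 k hk hk'⟩
    rw [← h4, dec_enc]

theorem run_good {hf : Bool} {regs : List Reg} {known : List State} (hcard : ∀ A B, Mdl hf regs A B → A.card ≤ 12)
    (hk : ∀ s ∈ known, Good hf regs s.fst s.snd) : ∀ (fuel : ℕ) (V W : List ℕ) (LV LW E : ℕ) (h : List ℕ),
      Inv hf V W LV LW E → run hf regs known fuel V W LV LW E h ≠ [] → Good hf regs V W := by
  intro fuel
  induction fuel with
  | zero => intro V W LV LW E h _ hne; exact absurd rfl hne
  | succ fuel ih =>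
    intro V W LV LW E h hI hne
    change node hf regs known (run hf regs known fuel) V W LV LW E h ≠ [] at hne
    unfold node at hne
    have h4096 : ∀ x, Nat.land x 4095 < 4096 := fun x => lt_of_le_of_lt Nat.and_le_right (by norm_num)
    have h64 : ∀ x, Nat.land x 63 < 64 := fun x => lt_of_le_of_lt Nat.and_le_right (by norm_num)
    generalize pop h = p at hne
    cases p with
    | nil => exact absurd rfl hne
    | cons a t =>
      simp only [bif'_eq] at hne
      split at hne
      · split at hne
        · next h2 =>
          obtain ⟨s, hs, rfl, rfl⟩ := settled_mem h2
          exact hk s hs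
        · split at hne
          · next h1 => exact flat_good (jm := ⟨_, h64 _⟩) (h4096 _) hcard h1
          · exact absurd rfl hne
      · exact branch_good ih hI (h4096 _) hne

theorem inv_init {hf : Bool} {V W : List ℕ} (hV : ∀ a ∈ V, a < 4096) (hW : ∀ a ∈ W, a < 4096) :
    Inv hf V W (landAll same V (landAll (cross hf) W full)) (landAll same W (landAll (cross hf) V full))
      (lorAll V (lorAll W 0)) := by
  have key : ∀ V W : List ℕ, (∀ a ∈ V, a < 4096) → ∀ u : Word,
      (∀ a ∈ V, (∃ j, u j = c4 (dec a j)) ∧ ¬ Twin c4 (dec a) u) → (∀ b ∈ W, Cross hf u (dec b)) →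
      (landAll same V (landAll (cross hf) W full)).testBit (enc u) = true := by
    intro V W hV u h1 h2
    refine testBit_landAll.2 ⟨fun a ha => ?_, testBit_landAll.2 ⟨fun b hb => ?_, testBit_full (enc_lt u)⟩⟩
    · exact testBit_same (hV a ha) (enc_lt u) (by rw [dec_enc]; exact (h1 a ha).1) (by rw [dec_enc]; exact (h1 a ha).2)
    · exact testBit_cross (enc_lt u) (by rw [dec_enc]; exact h2 b hb)
  have hcl : ∀ (l : List ℕ) (m : ℕ) (j : Fin 6), Clear (lorAll l m) j → (∀ a ∈ l, dec a j = dec a (j + 1)) ∧ Clear m j := by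
    intro l m j
    induction l with
    | nil => exact fun h => ⟨fun _ ha => absurd ha List.not_mem_nil, h⟩
    | cons a t ih =>
      intro h
      obtain ⟨h1, h2⟩ := clear_lor (a := Nat.xor a (Nat.shiftRight a 2)) (b := lorAll t m) h
      exact ⟨List.forall_mem_cons.2 ⟨clear_agree h1, (ih h2).1⟩, (ih h2).2⟩
  exact ⟨hV, hW, key V W hV, key W V hW, fun j hj => ⟨(hcl _ _ _ hj).1, (hcl _ _ _ (hcl _ _ _ hj).2).1⟩⟩

theorem check_good {hf : Bool} {regs : List Reg} {known : List State} {s : State} {h : List ℕ}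
    (hcard : ∀ A B, Mdl hf regs A B → A.card ≤ 12) (hk : ∀ s ∈ known, Good hf regs s.fst s.snd)
    (hc : check hf regs known s h = true) : Good hf regs s.fst s.snd := by
  intro A B hM hU hT
  refine run_good hcard hk 30 _ _ _ _ _ h (inv_init (hf := hf) hU.lt hT.lt) ?_ A B hM hU hT
  unfold check at hc
  simp only [force_eq] at hc
  intro h0
  rw [h0] at hc
  cases hc

/-! Blocks shared by the certificates. -/

def block1 : Nat := 735463984771089870974114687393038311785939177051021932058629690613808999614407092496510685196194114
def block2 : Nat := 2354419751740228821065245195662291455731823035640598172773147787095716535494747962375771633906951013686186818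
def block3 : Nat := 10464088836680975379560420312261105596385984803128869065477328358145911104654176075814408004339386605770242
def block4 : Nat := 29232498598939942591536143544363206180067877793166146963383520814321112716298
def block5 : Nat := 1192193460740146348033
def block6 : Nat := 122609985803528196971424727014315856220780917114133967364512876295512245307675513606
def block7 : Nat := 1192769956678969475081
def block8 : Nat := 173725514409755119120954750126286879162551854211462318397370023775435236394265702848089248651164041629210584225477950053828925186
def block9 : Nat := 173725514409755119120954750126423440489961688333800440742154699788949699147849340878892855018333218429254557106817664639674749250
def block10 : Nat := 2354419751740228821065245195664142206830013615885224721905605985326023634946918410726976518943535010873742466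
def block11 : Nat := 561337411818558888689338015476040125107344757196380397638305892355691815533468076374720109963283142274
def block12 : Nat := 9047020115995384094142544496318458911063908932490135118118396577281616320226296596909885596668599604994
def block13 : Nat := 9047020115995384094144439773998089725218339728399570758751144659561249807576371945134934681552649064710
def block14 : Nat := 173725514409755119120954750126286904193649931409627346464030642949874079394709324215113896468057883355230394207127119276210525762
def block15 : Nat := 9875152182403048705109242185154894314675953429161861591987570806676882236152399677785800521310944670247781522610562
def block16 : Nat := 9047020115995384094142544952249810282996428412800888589827033749532180941263939987140416777987114538502
def block17 : Nat := 514263553895681530670142352278053847681936743379058655065770418534683006304042689017420042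
def block18 : Nat := 122609985803528196971424733193337876992044794014989180834559504646268385953015533838
def block19 : Nat := 9047020115995384094142544952249810282996428412800888589827033749532180941263939987730703581146565448718
def block20 : Nat := 9047020115995384094142543562744739435202083329949068485572139510292364953339487082793424179958138933510
def block21 : Nat := 88572354255132802134171423616360952044305881568093844048982808732518670788584530493402571312075658043597511411465518330423808927330758840732700800310230249881998851935399617183798857952776172953307448320
def block22 : Nat := 11134741303994721404720884007951080272742814948042798984658745398244811550543747525809902563693371412066085900934408
def block23 : Nat := 15514537999918909052575188870438986159388911045835116466070933523163305388055702184017215110939709367086723982413728138470283556678093336488857535606446380456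
def block24 : Nat := 993252219449074671559650038006118279303507994510876145214819548450754560222080467439005781472915870708951917619306581348973628400413105520657821007545651451304
def block25 : Nat := 25815944424416804606426887181907932087606595752
def block26 : Nat := 1192553770701910802438
def block27 : Nat := 654903170026939690477930081425832041938515583343667924717736
def block28 : Nat := 48971115309211007066798106280230121048006748747287832579360419105657590166907884262649430878199837306275596314247726160413201664
def block29 : Nat := 25810371961372704349706375133446993463800763904
def block30 : Nat := 1467149784353563538258320882814984
def block31 : Nat := 2116740328333379852098955197961480
def block32 : Nat := 56441560445524042925445206021100552459352588069432809665416911314108093895104328781661807119015827509744572971298941914829933217660207530715387904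
def block33 : Nat := 993252219449074671559650038006118279303507994530138886886133934750316546328911213431946137450627818208844246855386108246708414998782346201920393956383191225768
def block34 : Nat := 48971115309211007066798106280230121048006748748237559068852392395016902647789672153277300248411438053561185316508534915312653568
def block35 : Nat := 228174959847176823976092027705751542285550959504280754857072531668345075980662273709447054226429057024
def block36 : Nat := 1477004672579172902098675724363847344405449915389081597774580624153873164544697376286245842152371155589691383319021633102029262165125002917132287593808803942568
def block37 : Nat := 12970244816141122554204913950897636271153655769937856510811828438155832599287707222938880
def block38 : Nat := 108268238372174578026426199013413159669969181955593472
def block39 : Nat := 33507396815952178316584420675132706745179790274677335906631443317784957615625480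
def block40 : Nat := 263097387564409992075334303824454854655057053973936922616835030342339711891848517091760773698489287805499287298001360136
def block41 : Nat := 2116740328295600920231601080259588
def block42 : Nat := 8875599161762709941005663424346912724224
def block43 : Nat := 8875599161604263249549374460256162682112
def block44 : Nat := 2116107740784707844149917235435524
def block45 : Nat := 25813159554523453511135417145968073870924337320
def block46 : Nat := 3565632012812685451792653443114896058125134723244827315411820988576878380556999609812520825337173256
def block47 : Nat := 263097387564409992075334303824454854655057053974820345938599639170016987246383920982333651009136906483461867890025714952
def block48 : Nat := 322363548352746171148451903790902150093906364454195354329642155230602168966502128189089235438398511434376020659714631851076675057091264474559368861803867205004895617629965404413455452735014912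
def block49 : Nat := 11676883362377227192683929505977151111775114709484989538709284985819078671941208942796034641990064580159776930114143062276
def block50 : Nat := 4411037469920311379939977337191097819247927975118062001432437142995490445158534313402271665594105987871519866491487851416244431868002082404552167592
def block51 : Nat := 1003219827496267939917306330966879040256375425774329413158782958645496860685201462695977928270955759164495295346739268546561927284494342
def block52 : Nat := 10979981426612821610834816138943905016049681296688092377934359082303173546927876309784832
def block53 : Nat := 11676883362377227192683929505977151111775114709598122937852765203813499747031399103532523742584875247106359907180262000900
def block54 : Nat := 325534678021545563950730473456867983982261309333047464937791565023876191901749823601808481413561487442798007215799252227610865139540724446578774174427294128452432269318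
def block55 : Nat := 3816477285691888401208910633652754267635434890356368494993288392398291025828153210778481068718238998217030205446
def block56 : Nat := 10980952761290518598630924322380351324778011820732303523198859798423997373793264674019584
def block57 : Nat := 782687447896312526780801189334645219996476377037980777779731558735751087623616998023641588061044916473676108753199993601
def block58 : Nat := 52208792506135467382287565666091623457427245800076301914550309082829288807178108657015490695427273388464186657519090879820175364502552641288763901006127255749320379236980691070401065920012285265533377410350684668985962166316812451761559455601007296704948385949666878940155625054367364779667803617663843437576
def block59 : Nat := 14760184731252800471011439143752591424361995830658552708827267532991062865151080683685855719923982918956291268084519275038949779070465966097327418823503299815566890611383639850900682503302445633035658032157280518387610412929361767391965334009886866434277064270951376933118500559112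
def block60 : Nat := 162617254084391859447367218303692187481701293785680071889845075687374887387617689833076340141322800648
def block61 : Nat := 148862346790344041112749859523795935231769225241802862618596750622824059801408802066335433712333571883194191899627929232373691980732452049349123474106732055704524529668209444933282496641069972241989609082849230338232040085290732619199266635473803832787189475531322319763939302374828362641929610958868096412284581638369152695009021389749833792245954790773549158513188653640319176899276566678402105352
def block62 : Nat := 801350875949681149764400329776860109072644299514509282445307807382989117868872592609954500864
def block63 : Nat := 463668759792891348262065709698054791241665703929185453079527555081479857670191035480134910126867684768294878429649385630807691607028894371596042451523644052407652079008716139699100927434293768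
def block64 : Nat := 10816232403719970547948668373090025226813721134441268141057834279259313539848544348379438623897022128358701088419742438498560164287783919181700235040915809201065313603665278691457115625637845619805853390106671610763480188137658327426914371084239079143412199101244143731409481438939567603458209550364138032662050627851386205244411746335379642944245026348142560109038084569123186897371151795521963820337163816507038979383859281444359418805950884346524359963793146393296577987718577599590102290910155707313570284096031063054890663627125287968709749825248105565472118715813345461984672095521036500722045626715134633530390317150104906696708
def block65 : Nat := 712700475698238169346278308247504710198960038177989787854671379647924888452669986502138374673696361504254754371930112
def block66 : Nat := 8876927741196833773284595761520698726656
def block67 : Nat := 35350602915177874382596461271245100066605516376069487245441253530076917714516033231558552389813803264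
def block68 : Nat := 154779220385181980974290744363292302864082291933443297157108647231248027266876906538021971260507492258328530324572676989484016670288618071517779183355495048884250247882480422560356463327025289496349951052174106359198398266731389889042965846090956544288924834660076492139097580570609592744090632856349553186682999396324266262033913984719282812377863896209890320380632273723410808082684201924430519303594014221492807000801859248264721276560585680475855826058700887764491597550278140505629938846547734991617735034441821958193037545572254234536349737099295813007819109828666039442899824874659622415078907218390706109933188099579747444918274860003041707808157645041656859003057322652228566946768649774853321613600203741949732297047369141477235735130177252802887276682120942000351174829967366189018219118386646020267276739920035066427106711408626131604731073955701211568350265982542534069731097358872958860356692983820832417927141935122920766298265215533781275361082393099913938992547523993429480469413406365425379206524967424866720986577823073852117230442362366111202205145255088670497479551919146724443379837496283691265428159697423274291768184897551121834287110086467609196460873168937153192597182157629376782292075511355609257903494633294818255304024920574292469545979559199667698891669766918447919028076849007710358648124999566036376264759059210168469440217249294007365997472850525065241697407734880141799803577314862268919152704445131965175036382572872341251093528913840789245315326591110218495552235987979987747899083238547889663081596759525042127137932586863952929196430713679489027115063153603401066424489269999289329107228464500751113706313702537317929506007800896619524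
def block69 : Nat := 45065106377698189684768585082243120606996060383053278146702434903075039473114282486356803947326043104479463700167326230686887061611105011023929940250883756501879934213654650902896034100853815382990904508360212427104435520470836833704802197805919425550504
def block70 : Nat := 8583815731839089837772647802993249649300449568435671015170224218924732458469505266745533557919544040791094646419876354433744778909547131312850476878680924828115262634541300766623816488650355608464180735439780620578655124997034341497729590510309309890208472352618782436724539804380390026663997620699011915546932531180030237224307334331624125026646467929463669526620593073306736647790039447242760
def block71 : Nat := 112140700645508314459952230090147379488475922243420360018728047139413048240810047893339384955346707420168999240528645130283063058375047689107335719518398984251214761556357473663096300270711361792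
def block72 : Nat := 35722701784952108354527040152559841586193270854509532835989210498594192326914898544385473246176705068216025630164251747838409915412309791176461877459222886791276065476206461344983186928671539001833666261925990417223470336174743460290300453376205351645509977096
def block73 : Nat := 6692337872692731923164757636456021193071307890078637532244692996754801450987368601667391040056177534146494592038995452124524780422816595266969550825628608445251080890436633192173912481527441585525030085891146386192022684587432
def block74 : Nat := 4014096649307150354037894601406034194222052749362309826837193837704648271265580720207432021208899006002012064585728
def block75 : Nat := 1477005301070169618157914766896269135304487140984354438043020204945815839002386285983760379740228882163289556289333493482812782009129057453661329599432472940712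
def block76 : Nat := 77599791819728163237801300403064543789083729792596287631575542508508393215739438740916516027736611341377333151314848088940859875390132767897389471078597663413512
def block77 : Nat := 57011323068172581333171339088344496882928383849779886545438185121946112138429653784025757952221399356703646130623849271457
def block78 : Nat := 3816474418817934897605053604326410227893494444036427400152777218755742071245741479605338474190823666764906250241
def block79 : Nat := 782686678325695523518102184308622684875457243823132769458724865534199926108300327217422913866983358618208038892775969542
def block80 : Nat := 841287048779759140980699563034657346385423560865852057544897387148640513566302931030970593340451049905180645425876635561673404255670451623438907041870365378934861735533456767797327151253268955783444716456973655512499080129553949641594977847116622646047800194526630056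
def block81 : Nat := 801350938115070872363304370830951394006928495665294241982724356623496969073596496363781640452
def block82 : Nat := 67565553433594734430561274521915260091169172895191357054025424099607231814510560713964322320722434304
def block83 : Nat := 45065109873657307575660718504932470580574660387555927281126427528051452191928828584316004477957815329906571404147949743057500649181672375808517135607671576906441333032552501130501260359791176235826638211901467113712908010228670667752909843034735839565992
def block84 : Nat := 8583815731839089837772647802993249649300449568435671015398164478630714735872405475496552327536103477370959504487445847782713968269276464277610077633837111349882749036358223158796685068494005779255257746789250963575750224109514228906210969777311516689086021903115286223947786476177440921178750448336873704449664513497741723150878047706799493315663717130771319992323309050610133206359820550670344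
def block85 : Nat := 112140700645508314459952230090147379488475922243420360021705904682875416120579472553458857505455205263712272720081878696735214610644170350996729354619241949312418096013993047852385451686450319616
def block86 : Nat := 14382000046535099806368141581623972742391638172532546702600342047252837170928106532979170891272
def block87 : Nat := 303231449233679308203102722526260974513302230306373825870538350002743534177553120986337123718016111489430005018531291830990151401122900541585600896510057775360
def block88 : Nat := 1791984090036352273444416247189512
def block89 : Nat := 1051952346562668894744207064958096626874857847433311160397649474701203483505946865141099438207991155599735493676540372292060886865430477019136
def block90 : Nat := 27143432171416551665613454996474656191865960319629874296228870678514495610508778682971893411743854810264338243838941276379144513348165103243476611929161337503750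
def block91 : Nat := 46069676301493201311512667340040010951081053356137349190640941597847023822885385683068917388288
def block92 : Nat := 193230227594132211215965458587392648387764459418733127952910409820202678621210134393565291845105750528
def block93 : Nat := 719838101624304439748965422139929162423285525856731872212420415142162205317140133428234834088
def block94 : Nat := 10983866763702520257536744940545796020374181092548333706014910252418001085812314522261504
def block95 : Nat := 171600146052841864792035761843491730712574286983585179124583758665964156031418373788936
def block96 : Nat := 1466832794388920081555880611041540
def block97 : Nat := 1904057827575363118587372474459296137214845373938582141520622145800
def block98 : Nat := 40918092293556593844800301550205874146987626011782828934805521111028315956203784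
def block99 : Nat := 2115789435489606524617169124873736
def block100 : Nat := 1791826871613879228106961126576644
def block101 : Nat := 15155826101848062381402828754707790906588301567213547297609358399195072766089656599953588340068631467948759782255341578296474125340077194972363115233808800
def block102 : Nat := 37226958515790431002035398039546880251579355304
def block103 : Nat := 4690500989981045533944243258747549984370441498349626653754342105466777187459417511193468129256544836320591093191739899800557550850988643655985886438040256575692177787693180076446984
def block104 : Nat := 24015971296084010860714338684216108879042380518539901999402178184470107094137605613448542387606089994683160834706672341218932108161671472327670861342937313577431955006757108913694580430088
def block105 : Nat := 31517968933960709347312263523358386956636281256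
def block106 : Nat := 2115870056316109848302437447391496
def block107 : Nat := 10979980952328423984400171482970685485747554802346167850849583860473373160521444844114944
def block108 : Nat := 8877255504934955314856079787741414953984
def block109 : Nat := 1791508643803330261498806395360008
def block110 : Nat := 12625442481892292376902246854285430752429223509883220608477878672978924255942646194109024611808992772494336
def block111 : Nat := 2144473396138145383130058918867326507919694831161013669404234649658714835435193348
def block112 : Nat := 73537642518589421551770050592093242284299883963236230424540046047796401776219060886201991648157381117551944684808
def block113 : Nat := 16826771848235705542876629438197794356433372638002220977219499392441599914582948883606520640967826136331956476939296279429860124636988006994944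
def block114 : Nat := 1003524154882130884460578431511155673807690723982842343378802080260486266892445897958341196764892316159459966078984
def block115 : Nat := 7514137062403154655289200184741051503616
def block116 : Nat := 202598652431346316122336833793014940386504522150702078137991250836789772354785499080802768957438638748831745
def block117 : Nat := 250827175922457164488768401166829582979410759907500233404983463548471418384108001077855258000078309724875616023427672506902115457011873
def block118 : Nat := 3018821834878643725689781688199502284672099030903514410959514845407388595559463457323746049237996808
def block119 : Nat := 310575682929653286675101696000588210427014773546706479187606351245896448830050097547213014141067829221845070960594846163036789099422092384776
def block120 : Nat := 4180131015720543334269339686221271806761017385453910175359626808119424013979088436269762021774873864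
def block121 : Nat := 100468379690719368532009230168383979848312172564601148992109005357225873458496870586853433144410008945756742514474149610274804719054636381926555572351306044711201800053891038944646411893955624976
def block122 : Nat := 1172821030065403340430729491041282770836778010816116099921310443401124199373812130625814718773252980424551468349633104967573301568025969470390171960400182917413632462319987862706524054195325317169769547745795189737671684228537176302971152748064796435581626534306001627242439503491604643919451748565056
def block123 : Nat := 303258264855932532904057374912697521850833517195731228190318168606383296878821378236939653838367334280625072796921704510333868779073630043857806962018363113728
def block124 : Nat := 31516575140044256541110298056895779171995505064
def block125 : Nat := 1791825633673544812906274145063432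
def block126 : Nat := 250782802387184549521850758097541223118552370918698522021323963912447759189130511667373103683956767082044981813739303993220732629352452
def block127 : Nat := 3666167621848569277382248175991717788037509916878490793889300785662875942570465018800407245948475363929511444481
def block128 : Nat := 31522147602085960023137442196015485871643431936
def block129 : Nat := 2325923957877507745056704690396229350876789921625717202476896637188
def block130 : Nat := 2325924158720599540109673052782649339436103509832923965822607053060
def block131 : Nat := 1791826794261477043870211030801412
def block132 : Nat := 3064940577104794226291327290912908037583978889983602420327691304114577638099297803165950556211281362319040331777
def block133 : Nat := 10984838098148633122018297929349000799552327391256828349606613638275971337128208055670784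
def block134 : Nat := 7516131229390841534951056900393310623744
def block135 : Nat := 2115789435451827601761413365388296
def block136 : Nat := 7516131229073928884930911052560751663104
def block137 : Nat := 1791985327976686688645103228702724
def block138 : Nat := 18507778084723930271671686806793882426601885107115531394749882112937037884091438457026670670386499398952450046857396469854317715669834082436892055811396000
def block139 : Nat := 101853560995447329288
def block140 : Nat := 1003824768404397766863433945692458858506534235761442795571880899063650654313525917249502827387437800165753537189896
def block141 : Nat := 54389465634941807394021509820325178212244702723092298990946979334859900615424275374726787599034013933897115476956160
def block142 : Nat := 31517968936619164705056644039287819694589628840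
def block143 : Nat := 2116503881767339690455005855895816
def block144 : Nat := 8874601267684428280931302348517608526848
def block145 : Nat := 2115869824334246702416253649835016
def block146 : Nat := 37222757898112981513781666388862510031509657600
def block147 : Nat := 8874597048309560182996193501678111560704
def block148 : Nat := 108268147024116352790208169793641100765097878718256128
def block149 : Nat := 1904673385132439382150113027259201931458707322172209051050176958724
def block150 : Nat := 14257873606977464607355744522183456175976448429929492788856572684657885538844597269419464641569883186314411564352974377220
def block151 : Nat := 7514137063036979804287551404865884787712
def block152 : Nat := 8874601591887307304898116313519213777920
def block153 : Nat := 2115869901630236459946183279399684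
def block154 : Nat := 10983866289186538507787545089939334960521870372870692677257337700325347123856388226814976
def block155 : Nat := 2116106502882150045975183808418824
def block156 : Nat := 2116106502844371114112224499226120
def block157 : Nat := 1467308240678592057917511549210628
def block158 : Nat := 269228140236537837255389358622658485825724770142192645532494606096062487541512916162722927150720484271665291410285886325950034805444953988663296
def block159 : Nat := 719583472187971046344250505431986052669419498080038051532247823913324376828707862172296515585
def block160 : Nat := 50219400448638025065940175526535383486352135401049955150304711364460106457273076633292362367299344839453360285173782917851006859260356539347260424
def block161 : Nat := 52186848015092267001181341768408076085179135560683585179604982612329215574392267528675490302255921750408632475472176295303569545521854534926551563772296902483695321383246025155905921454010975561306532736287778926266626939930205519415486218848640123389976956267100403124573539543779150303389156326272286721032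
def block162 : Nat := 61908701854600890296524272675524860883098246022937635430879826233199758712127809403527756779523247351403670242757297859461936219890755683894384770519732350293787275792392258373027510329381599973528936307538808823993963997129583425736916757492822533006664481052436599335432363674928123905
def block163 : Nat := 162548902515538674250069608184718939947702063879901632016937729543890476079686821592282546130838488584
def block164 : Nat := 8247010792016310984255585001223691984819992456493578542106920946925532351458148335565535267900609439697266627212862125697048599948715533297275005458618501241747576085079612766689512074557342539465135725956554820185665543722899174893852299027807614338777208111846474995711317352326182706448573249440947528442673174188754084142467932741323987807785606371175467904738101934615699096891183977177341048630242258717992588162660094335242612325668155861032794678172153828203330045936012123523446314393541661427234448895793045169706150023808122473528707613924084816586831655906167788303490497219687917389261296145497806505135986977552591342324917842878635279994620738523789331483064386316190007566384684086335564600611110918351108986571412653193442950088304642978338572148491267145732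
def block165 : Nat := 50219400448638025066278636182555990769015516038762733922696854562137818441546816816472858132364445762863798134095218799094526397829082901230801928
def block166 : Nat := 62057439814110509316654384212280656234130179364002298517533924829459661530754975721819184356036740820060380830996443202333270884715445606210885739811851828208780886043928982362766529672362721558790403447074081715225366514315816173752895294253266125546227811399447673425408868468278398977

def nearRegs : List Reg := [⟨39321, 6, 2⟩, ⟨65535, 12, 0⟩]

def nearA : State := ⟨[0], [2563, 2]⟩

def nearACert : List Nat := [
  11054955510543885122823503250813552878263322678347109794357957308236489046780484912885052372071730298962989382019865154771312052145527134481016303873354288975975134935805090888230269288351933210834985283324390569699454636751712057118131197687221121156987248723000410216209652664092211245324616176584296085837112026201637367920545868769070081095720843937782400331734626625431127839326763357477392493363148687516408802122704895862009726633781752832975435764107235098486099427485902766554408031411445048531031469834761466272606347363752237857653261092548559682427040939819545751845452920076963209503395156642573578797754235359431955212852114458684026531305414995950040519226342553690696882452729308697818525024330806288677352143804530634489447731218212287491235504270357712479616713470044939769770369516185864833530906938987171265762687437530941091973895362868828063835025166833152676042739938750507874707735160363018471988821483518442408263346799509360872977816723991763901680231405597131266,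
  263122921980246291866608135357275033933295125531618445349231144895386339910283758733698170346458290835810523994307222496578092848999370949426590956580092738876709409149947066649406496835203804241938872311929118624167527785160454504301223520984472384939152632163935903354841411900057494401197807791421206940889020009312813504338891842872596425235098217256545838169666687718194481924787821511089896472492891253162127999519335838248628451511269863132728177399042465462341224078616809512973316410966098816448279942550138505394576306731564618159100379990751812023958423509282760203797680466672107573828561013496684005598791453455133776659575428425725701204532922435494055742730524529153955122049198323150893584501769936590610364902851707736702272795256999571301192482965431007252263659161600321157329501425363301414572885699953452282101025920339220964350638370995486245077456948625252889755944999571999454533931504825277343826738151796522592303588902981521051709368496338479475033969503222766090,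
  3082271911692386962259065406178570230224126146092685482281574666987597986722358126502614033376448411788317406002524300754866349494921252219894955968304991738312792693924319072894658724352132435183028010431532557148169636158684275694097911159584267991313355849470625753673044614882995002540970679946552659982976810278907293524656674278615602063980434417015814012758091921440926431662914360076179082519573930210832098924714,
  block1,
  1669070920270411528282866600800869522051064049329296072060405693658593610418241704823430343887545264334600021429425384578945851153775392607277794923104863361974213971304918122794443527118356599685121,
  block1,
  32548101543560769471912149688577880732739739550089164842080597706269105962927782624599872949026437488085301837039819116811587909924504925567930786719129622691753355711003895932267326513774706623564034012571462186096472597406705051678887034947,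
  block2, 349932809656346589817548752515, block2,
  7935616940104615902550081016976775794615626153352971024292829465047671536211387172770946016564617895835740812851886734683391552785141912422517538654399602745460555782676940199967000828175731011756334534825177996887368153122190887778438527905613943561640128897789171164916596487136878238479750527957121669191474219314491109788964791656129507209092930798576440197618516845145787957506288010526758316531143037471716071393135841241031710999964437303694723919649813488128142631816886153905028129131367785874807810612666407298629994392902950465578516040669191342651475584,
  block3, 1908131869178569771010260423235848, block3,
  438765148479133643169071518317616764450257868960210110275246339168737596086427151723969053933089530181369253279853692602795934154117033926058909897819274722772639179309109368022178169830914201917083527248976422072947962316473174880773454564613410560034862888904015739104859938644643457107236545855349793784513120534013147623988130113716024045651079756299230006495649496997581486890702206681961977684615090776876248338136732192984683956998097820559818919964252202049831975678130309852208029363869638955914804045715955069060483759347981002972978405160856437267223318407420363683729481538071338012291772224014851129228457039519606904464073564377261162488414901475228932023691811902127875840104712,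
  block4, block5, 101547355731269259270, block5, 6814726663118083808784138247, block5,
  514906265777332029991231961244137899380005568839684, block5, block5,
  144933229167845381698631757345136124745719998595816612795212370954, block5,
  8579941696609800941524134622074754389566117228001075267561519762196469014659076, block6, 1303601300917715650059,
  block6, 421461103437878492576590646394687464057932131993096, block5, block7, 4724742, block5,
  99763786976056964916360434331734984654092935796537868400845827267259722947798450452071810786932467133657315014754161147608515058969847632703052012566933228607970329404530248851199441691636818478815718482552606557704,
  block5, block5, 4855298, block5, 24042273205148645008680588094785795, block5, block5, 4855298, block5,
  24619287762072787796936798996653410560, block5, block5, 4855298, block5,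
  64897537121501041899005479547963883618190283851803418223061245613088552139070760610497560232468293116552414146437941175678607463222981028429821881250371098831984056305375834470414171096868593575646616499782921325674134965496565638173628841537181630513859139253520686320298430071581771637795441152992076040298875151487259520954468222088304924639209112103545020441289910540538789277628506165419836968728838080184158310671972071510768511205054805269361391235930982802393919289502721872070908968210246966262895322451052381103508707448579007166144051887214294483284084174317347355139744078331743081496740741555625688024335234916519325922101288020543717334092824580517504786907871058716744424840605611166383086646956952833122505500424883007522079368243082656420843081965551188718101326685150146943330116185786829102053305809463630312812169651876966602828149106965269139918057324709402831602380525074180791182892663964526672903998838769944536651852478328078191474204469341743638422310417075639159040,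
  19287066630733289079906746074129269302085239175758602672793938384270277149446906834605861485011383297124788540017236368163311559322675241581192023368044640645245385721082549083919234021098316589505378157466974853488804823259605327372315222706313792784050685445991069130593034272709186357019754630245913715920300064620954259352536008170643951912656470489331181157038426043184688607372121239819888402886591356304489682892995083914060566971090621157692668819318729856505755860346874586073575789516513295390874539911015403176594191509709712278107594560239308636140254561107090439471425148435188336878792223804050705315299275965573286301922261512065416624993583912915724810391274061073989358888617113072499076371613191784024182326258051972400310249289514215166428821842428544555404264025448325462810051619255005931047652204424603178842401763395032959299278599946312246349403752675596985907641556505252785077481806579287398353367953711852750076848796151821651153024711779313589951680450814125152802,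
  331984432005990415368189422111535245914456350262269541230770667669206287129055605728524799177689340322189495665740713048653223505582687974831928968193385116550391957634,
  block8, 347456778452824442417933633027, block2, 2291973621733640930199040, block8,
  484701463172881401662860735902101503309403728784805194135996039494726000223302492022492630309634568164617104132657866533123807690398087063969345243669741435960445200071621603261061137920,
  block9, 318982419612319747322359758915, block10, 2291549346518790516637760, block9,
  531356100080542502383165295351444640076519564688559539063522495013423011121515683126956712739655950425689817367142402709591814051222975534251992827292982674078958523991528750980743177810932618069855438273132511836475883584,
  block11, 1953926893279034256498206989304908163, block11,
  44624927149360941383777780133941253666820449695898980749833637006303884912074131316531853340706367593287757404933536741385961086950215732278083904670122747554930834296335910787359668780499121395830000815660243766642075664677546369473552471876405868138665845145681063893383481083025350565823701277442163369921291522003495896302096276037849842707656986413592102141111328850702125143219504794106522547497545560946729030552941671484851159960727468524962881027377343026538910878553508322686254148591019138382858625533666725782405275160745373196713451249803108889419073438368283294872826143008315970209738033333884406298365132449550715699959575946189975852223243621171291212580371992717390782610552679988413918500435850901536147250446267489405649860520380129891909677572435113623188574483277948141913341435880070080668525895765918612588928,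
  block12, 1303024804978892523011, block6, 519435736362518016, block12,
  5309014342666045199738990441802465160580617497795486129655544361854722200362922407040243169231399129084271038842416196485882601277811296837496384217260868222512278275584,
  block13, 28582997655175441715225106617843719, block5, block5, 5772290, block5, 519330458099056644, block13,
  903430327109311258054828544374420012439782581544600506758816559073721629559157429837132530167217973583962540515886156635319418592568846194376708,
  block5, block5, 4855306, block5, 24042312819229902717345323689888011, block5, block5, 4855306, block5,
  24619328326891995100277647440911927560, block5, block5, 4855306, block7,
  20018778270408936210599747309298710614578421347354329273243726406893491106002061668545656594183512245894498186347042461534659622654777524544091896654256915534689648589430372919879009418034334365089225423410187518516891815672199326536124736422650028329792330891928449256013584865687756581636459585327692830776576281069607755219963334445514431016224332673372025129224]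

theorem nearA_ok : check true nearRegs [] nearA nearACert = true := by
  decide +kernel

def nearB : State := ⟨[0], [2691, 2]⟩

def nearBCert : List Nat := [
  1155829534472978206906300957180765679505266818426860657597334225032742931525732918970318153181572630386194173173047084298766732592227077646403908622666733697176716246547413131390701098131725629688718079681294499651792597915955978531857246669369129336032932729430629780698622881369731772167099216085491229432125075965327671441177183544638969178867335576410994709037029693118162780835328675561885882310348854250840924917242304277213474392543661180251053362402920545058083278959890676359199227818945749966930887432318429568501287966802224897564982755005236750852746282494319077180659027223296977936588284663622096956461227653720758709118459863420705336110638720308008698941996358324428559584830830256847286581934755193670763084791325473142146326672724755682538184487419909199455328737961992340890789614038729028918158952481073081041828859660515347560463096194727344210119273053286324503730992353096973384214833675514630303329771420705518459169070984750653646502589159494987089226044621561075499138,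
  40692949809912259328046281847961350272818769747248103474326660568611486018441162156381293374091633493207559135738058677153328215446537598626152929239440586712297441540609288229230035410270851281151541675669644620135498288605807243153239220162976029195746859904139372150068517669146531885274348698223300683223529267895298393480687419620947226379815132782283858092948753731073980753856624196731678292974753913032551659833154949525328595536963004613761747248057649394343678728106568479781475742308099648503505884106163309083376475419913735068480462817753116337324124175580116198896361075634552098704735531292317738240199382300541351769771364680624215416519241947502943280738934982467707869267349845697359869297439109403760893693738862001109256359596716560318981756184659278488129645264197702146178214653361898596904894124928670109569343005400061244989228890896239049123790774093267727296528169683116871122348690951831335401058085341763420498838597126041576177882191586599239150289866789020373634,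
  2471578666892711036372573480578841729504375476136149914268863763137369724486073997928047231290054284038755850567235040410391758278773740072932761810185129854760766516754974625935762900896673270599086235595645592385187604484124755612461451455249751018073539352058620762020728281859465871246174113505246578485239976646890254150740115581094139442393899268407260252527426331355291539907904900891322972668249997887932093162060850562996381245921202455102383826767428070120684843990614087769108004046089049752694459112920938950656045834009542840234257078108965412685608177759994326966262430452221891913372031970064966609248291472248397469156030419756152635364497285657415610049510111807567189975912761094193119409217943749884910212633694242752218167869101437644591444294993098570932433586552372797052719262753494713136013754682830081069439454986764761947102654708659429813945314822058709166927723865589458990128939632936176988733141777168075988134517677901762334024031602117630275533009238545928866,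
  4208991114164098173703850670879245018081963886258655702629240892311045574835028958476717643049952515309895396909829852596593674378609091680303508316684009429159506601730312002191028619175259478267903791110658811953579034630791713654179685522377730365517333750936958936689369197694065688906465107213200646832025347598669923112346299702441347114808700560201342630744205315249154190351287007589713247113951022393329877505774061397331109586452267035269449687271128117684489037609621284058530653257539397564180067125661905942013544717978575903207825170837522772751331938682409564981321413078440224974678688621091695907368422980629091999539338689917991192264140396524083886691593089627116606772774307560040341723001774607654914347815893940337400664843606287096763180920829584378568038842075959077308318462485124488819427805147940116270570054440375230410794295149814997404582356870261472243969648673198221600651589651264594557686158432245472545132169148816892235901291895531858902504703349821571586,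
  1077501865338755647298791755997910614358922737537286808977354618466372225817946597510154735866101728472795258718568664079504402551782508103201331466441057223561148853124096967473269167777281281272537923380745503662906836032631652224346008995750147584915271952334114423625796447558951749719890501069488443111132978038977167980520032552984422979501929980596501126276547016660068028687641134351937900308068025043217878531685534010298607178388050044528574320066838872617025745970959914090093299892365280481589429606974589670040870945632293303048569452692575003121053070003382502897856693471283493962449047749699975766768956177458006517350164130000966462661606381266206573772628437853728083503650332045264109643001686453952670337929467605667128292784391559066818945288300424256458918672786554379147258819978179176254236987803669274561432207236422609710313783649577391562543974429506770177906266906580668187251142651535739844123525122004929147141218861170926302081506929483143759369780681139960027146,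
  1214857166271774635834509471643652626698428091951756004493451113172433644504217913212565882787540657140690177480680281279496052626808149799389694059225702245354097245853694989512462767830154929707324730414977804528506136823731478025433317229066617271719220674169676702598913016949096568314836486653214622966912373046139287619032054258847571001963496202497328178630960848759414676674293471943686921437939994740203260737987239443192617821228305459462777950448959631204541986859211000310080259006646326703109547667480719238573179357475878959766218527574249393279878475186819866197348491778233555348734276529753662357435384328212918947276262998067209308494301300190342318773631712719298834578255332683810418926420261667711286648186340885181636159926590161122612313998439828164033395391401894911942261819559571336358573871208291771422870256898841645951584029413842728958911834035221271009618221375941672331281508458268189788735179991426244581046518406924414679402657205261549150790555417873357345418,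
  2935828629001576577377471010312131426700823047744369959616489880593429013305225011416641042778227995954973838637459809042226342543271431864369570396748146665645183199671771009259444620781310376996216825438605650648120276982358895007265682786306,
  block11,
  1050026278515820801501341805471681297703981573107490261513761492488143038250973727160393917966597509205634706722810553392674256744886939755829734178427406314972848176266417719530776230172105714145973970980700667983486548941112042656392536313671729658553416978472120139219103212442652549194759433202267888846613621533742122127900511449244579231070421176103485363197812022229399688548215897648629681820417520681992847980887282570674557547012758393016487852866826076276251455600380650622959617,
  block14,
  1705876667740222911612720110250276387981939995968014979422263973760301674814342813173922585668370555399489097213144692608226110202352757676558401118661745435657731,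
  block14,
  3630636473448527024468582604603714073673952561978322259308268564099331679573136822768518118700564977327317965727691033700120289807491814937481927797416342063030260045935768583659760788180846331488744178482343936736063101472578274192057825060946321930313447638528,
  block15, 358598918868674105716201670723, block10, 2292139642469886744201280, block15,
  1155834276687211416408739514494431033531928255909243401017692474295976959418337090462006291933765151032133802180445945105438992926257806695765853202863903371392552216483583371830385197004843906387387255983920157864430329998853780802959444666102835872916205040618665081984369112176964953144292681546001509992514237175653452949077657954403199762385747499355436826103819698252792796800046164039194347927629629866145799597578766131415630590841741404775897174808874874906528088069133291345746979415109066764798651288209133228670132839668305673807646777682418724163899898346669565488284090199416112670534326551549609130907063558335094294205296862995553061380685865956410823856436137873289329648365518268730832521158375568592436275192905399500029775731762781598638663754894798983652897091320804180600117842465489803480718794154668079082304167349750535211779806176314637324765838778095433874964999960046754978723855876211045931808519363330447515549822725288071620412413332926687490881915700049473570880,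
  4111200263123066024888978101166581978930997508077929334709183649120379753413149249148322462938991998873770050395019787989481381718967078894784580864430488811432090922299715933453326227164330121459330467004062189013065089176135052044277040627100393049404320792979077412264648224172278691741954490622966006546969980585643180980703428862373152811951857850802639385670159790766927953572271632292184305555327831965392299811785010356716989362284927401603642052748300307902688317410475836370520277521017751039476808428528403557050445889368538131074746104961630795966546710781123984595023267525944405329840700915624830340318254926254431953704813026157556480040469162809577159541618167755280047322467589725588859342025209144908773330739807957638631370149437101310644890608268870817424300630523907044141111157647934907360512092414569642094778993871520974790220425894044734971094954456190661689251717572877029172366398820032002925690532233796036535486609159279823159339286896561095170456468354634282,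
  152496555180867810799603209795114100340918111830352411064286579395919600827743757172572464463323397550538290600592098375856552847342906894168972203811831186824551491830250332018532852226783368290175047358879451254345503019390798489868106237931540613846932922667083707982114]

theorem nearB_ok : check true nearRegs [] nearB nearBCert = true := by
  decide +kernel

def nearRoot : State := ⟨[0], [2]⟩

def nearRootCert : List Nat := [
  77132725617248540394465153880610732947899038338796381361266904151452823438131636040990185132158832634794191724039869464897793253654644167914069202181021017461853001574121172694170913564915890001299052837934911999695527901498931720843254625121973069960051964869135799330864013953448168926487824038727080095662300375994165316771329009717815925990262412047380866512574037575185814231368201625922989593331130555637471834982425126863340382274121740838957264803137976504452824469116921839576039073407686176881565481776597449299057784893408109623120834382252253871705708984371648187892029813151792663513177078033014720556711226466662550002408276659253958341903566067358371638325026945650875520233633416668986911057471045676859455071871629442162014547508058549182118267415283240421553853299732562226712817164094175473490150363240382199064933910570566509340444781139280310738040997479513446441918387406456605500352293424556389252957317908512299893285453735634571381319433453458641516668942382461517826,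
  286947304775987252453193201587047665466063318874032325050146087901489277557548816749364234936869886723607564130803903982607983651394878237062633884472168563490269951123899539650510414100684923381280693286336367652842357353771268359300497244170805613495278691524565848456415596471472286694998723229030271680443057009702059466538825465155066622232652638016583641068675259859239923950271139624475932204162545330246503040557591855915800176028838987526579535427803414098780572454081845058358203130138720478152329874304318041658818895257749208674871314689965731680422728031960630807990847329551003188672992453810693686510057914326637882662673996987097861787882251689891978612189472476916691700190117094342743450098895170240210621442270961324933940990936896910026413986450844040993442905780178611218394885747091558842731989542362813337479803057868531696263862358446588657532817883829039175174253390151248445666005460496017225463104175167872842934285726749368318283553668133505167721355244475912706,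
  18233766753671446158544430403976045496456330303063198542465335155887730800689906153069479350309057290688740048115217077504686040892494163930608812185881539933736634647882213304387686068568171293607935389179122478788335291381502036128714305638654537802525356364279356560139005331653097230199231296337912587383609445150977628941728659051884581992095752718475261063544773959931964330270571344042536817615326229277177483454760030468738232505994909993499725972868630713626678666472123674629061924262856350235246885800383557330480645339415538294678825837453893607563013166700484145772443186209718131657093062129836830007016153529325574255401965400546922485891686399727046578040943619989642255809745544645940010528045454571463524922532329553640056128758598053063374994353544529348929149835162734642640566196545765478452969672373284108046121824607408218517940560567803339576456575438853502848913384537952215343633032706941894386998459558289152155174514069104647074873717534568574100147766873166370,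
  1195216694166493639246907026944215162859400434735496594212254785150520943556067979703229202790132608375185662548645694377916101542361926852704908764348246921945203448921345539270404713205664777599294855430710346778343539165838559279159200074523262860693540398073049057765869218309881720730791105241020806230137208562369982620238313047646463236159524423871445107806502093923563622634001715470901749458640317976815667355546259649284108970580994387327428700857469205785129808897119866459232319641575485334474364502906763145441944626185033493876170022726143229344576627351643046218937364572917808307364706807938421594061419316037839888441910147994208158250799676850615949750166085738819107726168151638266577927859129481259070753512803876606041177398897231021015201450567724534118754003862278458002505355648071581740241959390607359620330121413401210067777269839889667073904974780391331344251224951236797425901535145797105064803012139042650160349523414785658192433015822701897037479486678656467210762,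
  60001758713483928754771836228638082601918861682095628227289353995052400873586592443464021723900723751336523794600227822025510523583514715815713561698435788104372219502184716200105474037058986294182930430586875756057059620634965235292968848552237789741465093414786115760745060346759835302370575360416447823184264077426559914236902670086571404912905872058560583490305040295026018904446684454037816769816523167679418831241593367884509970923032833954989964339338238678674649954441473461790328798436814031976408455917070709113850327630501961187075932464858941619280238526424787101952853924824108303691252646011168041504463579842281444374085173803079896888395924207736867071073976005371526777189155959557500870358559861263211283131659704342314792023972729764270276222211202818735118865758782781229481547593137938570944901271403799427314950043761481062108487617977004531480904283881995753169460420644596464386157701396711399175521355723229504538429677618372717850637586734982368069244816465021767850,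
  288957674127107970135050241651444374946003933344801353299230996151708897638075077488502281111197892180422856293989050853489461623937985599141169967613310901271051713249490269982422691455113133479951950283182270850686332835404651819429689972167318364647283513571948243082009362478667987849143605203737967420919832624439661158084405634861838499743956518000926684318496245090682174601897492087416372347706997216624111357781775118791755595363874856039512834742680372165234917593034518285085083747161514378166501331026791513446006211123613668827938295443253086465167080569342454616326891065647267981039754033502150794555884423826703822859356174047355602022552058038603391905407931277109191948156719005747336900853907366184487916123535820883191751577634011346502525585151228251575619599329727110347606454732052030968628494171267238012926136700888387491982000274529676079298050993570020201981361062469087264872619617610224799557107398799115613848648829064644317508333189006152006996831256299514237450,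
  69350394637682538906802947156406158561767193507977898005596086271677759700019002193453410476089767899603943055263705579889873727196116584002989722016590369906927201795886586525562193828099792965767013908845327182006613704027381401241875997432838639351628855050167537085352763005423716334495811750549082292919844550863224675507427415056449601092386644806409654521630874480679294769273288499277378249670050075705853925982305618132909916126502169199489303589269643661848937483371992076061065112718291926018515215991544665421946030007516781775689134271057956897855566354184460993602927912052962024582269611117684873957187072270939872740800565356422640560171414299835383428897039342502009571984196606966656214495032808261088777596722711345908090112161759504484688097485310442046123576638371629795636874632608438072752338410475958218822296701183114763865081088698823821457779605741364979959585744317012543614227072533242656252552809678345777111293798246259571276747074861998419695477295490957826,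
  75325009047032036108556169122357800749080261443085178065574138373908442119925083757502859353770763594253009321446242637605602451799090532485748172943136885332046971657948723815641107419532644157123865179968032007986893378301968769143363916042751918312812205243604852450890537795782518297520462387660173839457795258847323044870419503162223120733546525380264098381230867346478612893047339080845897070486741956573611819967152403348552571705796293483617703833706516440117542614056091407066928799548479471242123433998401724582882582596648671181421110823203939711832296201368626862564857629178844122583917380957341405879557783037745154373416572991983124325839300958743325789592218889353502569014516933631313361193294534505387765383191519884823640429470562639561476064088646067768091059863526730699499488914444150830336621035845109610932873045751517260617245200171578692895927633203346232897427926299867438120160380717020008960472338518747553704552010590085345162832315839267004583782289591769226,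
  284116573672031559732833132755970570671176929789655926846111832763140590843855794926781367147163633055492637702336309093132913872468852653652613797213299023353222170823220361029943441498696897674229584350749955967424543785488406585113938669146415597999999680929401824544269772012076368754591802510095619057253415609050688496439228178808933559641999618903645727785132209924623908391372036167940177764640255671672804346481438545448934993535130165987261906692363405581371896890290999996115240293879879741320627499979816906348650351241062493769581749145708273990372613337353630224790483918517674365844445553517081107100733176650962157405726269384586004074694601678440249149683453481418684465274666299629922609489787929687154673904977669412634680602981725512864004873783493382517689009625670873995604517773479941314269719660925807203329205850762694645986960924316847828551554430963800537444967064122308755509465492221069734707085098647043205633015160885225700582627643053508015909336026949154116106,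
  3520471413927363568556679920450576786069174067700415942101822248867782838797878817364393371190843630375892380889245628418491736238574085953968572863152816657540826232460267179109473499409513833073828914324310746348946907468188088869400811181235427050717144189258380824041564489289154238184536483010880883172429370266423850413352861521898404023373225118955049127461549520695172262112751716092487134023525857087990602029093316531475928583370509495769164814119179449801371856142737331311811312470916775323133519358435610914282869073186516432094014343307637705751129842737506189102010311232773936555784868772249060527236366482064078884338936621197739647980699710132756198850155585138309925854372293458033686998934490093372620455206824089834304705422576911811333564045961802674523910904831202865320265040509336219541626743325096357910570812399991071404610808710538637589968815047850419540657139310652479716410662430408649752333867488313174286586092871171157649196302521498344006450181567971857026,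
  291744936679836700235037622974848402716574269203603759419435065127287341970696412424479888765234097514178551829688317244128420122033201364894772533864414876647849576997547290631101606529001804710556902091943253868858396321374581579085407763121922602162441509034465942689332118264090257510350424132851443328396221280842567959523304398194182725933265092445940123385505651399901326057310196381918682298971236169693080765701480338378621737141978777626910416850365704420973565280002299852439197171863089460748995946480156827624736089760539936911593377886816549290293107167366348474517874593768819431614018194759464740892479051258385261419229927182740233556025226533124668179288027967887273652565278563661473425057146480193898735658330698907851714473993814466786483654365716829499597899915054817875420663367585479421623788529217360458658407198071997141401267490239800189434629984048458720161146862024106285722676723777442647214105644079993247970593901429838224639271890759781716886174252072833578,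
  10120602594988898061906887118556981252975549488540334842253892973666729602675508997260389252468274045835744853136848457602129025744041063238324917852848165037769719762330284646463734816269481125940187380399856190968812123313889227125238948294661948342631876790152028340344654578611929861827456327533255128707704843767740639251094326668171461496232550452520872868450347311068705496637480678439513740645800545383384248703842219725184718808206755065930789223412268355286202471500716783619350109899542010310441109696780066294705722173302852805619691257313834994112376378161989711120760670490894215609482413119206552081554480262814445735772295298625670545587241099947347984758187763116892280938837895188092408489030727635140250576270255738570671802032034599762558157397788983739948001679373879197730976445077388103359174396407233061277478329934340516662154115593284323950440861309895581502201392026675186443282605231394625617334977410697757686626339466531531313271066085495181127910450335917676554,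
  263061944618425592658744586791164249666396827040855001523746933940791318925661291767726844524567211530615750892095756506917226294137010503300654959867211542954450982144129500768709925907407713018843983044997453493117743916873817178724639893865487024602984167561801112235401860898100215088265787928090984079008354023706174138822771602019179010433235847844760347648761793480909054853425557437547578406292608152320767927082880993922270835442348189305709042650959511898734169204235928401562107842083995625789220578043377301552008197895812293653347823156684929830633809769331740859867827098072821925759285924552086456761258999246582814054089449673266735698744641322836468061104815486517448864348244854743649088966221448558826435972863259986315447516961244374182879107827893944069274660627665374297012859183353671156557197310973639107393946844093012102111932770397384961643358024624014851873784701249514210792704804962933545094354364048122020128212114845559302668700801130434648130418667162309154,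
  39514932622037101803653618955872908178606268249840410579371864955629520000798488103512645740573126235396994059840941533710718308658111453594682502388473975976229131760938035278014485505275665324572668919207164131870230878144791848874159789959602144150354445707660932278949399496838139829811624750725631400938969550916187074994739161924177967971512005302383599882415435145104102017562203271861756820400486808366911659365201479157528164079333470732163404763423184745860553574481704698571294352351704363326493782573257544848201062509637986753041178551013622481411591738055642288453687566547761197027154804988263181936649358347861496757074767649843611545546643403386165291294280500922100649736820625288441742487840379809561621246938767860999904933306619395015230897959262352415625554775847803319522752803003875524488496223158323658043525608328625789423241887369152880172620343721233062702772150866943070281633489868721247590597389010280035762056774879371987863949548852630947065318123994223242,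
  14487372085622326759073086430870452891297148561762727507223970309545674358701695891730887219858890374532474483526111842616413263563599566156294840309944029874399084770274564870117576735735328770989608913383950289419047733504078780822921210828491701203990568211203375659156649341971529380343992025716664966663074284766367396440370631388465728580014063249194003013877587466968836928482410507849409192351317943535177859042359319301799166826610436781684045198306061665123143573529541902155057199846050,
  block5, block5, 4855306, block5, block5, 85415458018794410242, block5, 5732133610389301394586386699, block5,
  433107826505175457130520812748900638192924738846984, block5, block5,
  121909015378747101225027222510041083989137433961388699037769274890, block5,
  43752812798581821033594274445167841750640636557457003366071654133645358484841017508104, block16,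
  23397037810790409616100262008112643, block5, block5, 4724994, block5, 519435736362518016, block16,
  2191184195755217373945371054627119211084431938239375721832152013040569247109710616743160455708393220703077470316113280504856838220517504684296481374866485236345748320675231382404145812449528382976,
  block17, 28582997655175589298185445338368007, block5, block5, 5772290, block5, 519471195620968452, block17,
  633043194743772916047838177899080748550525300915180238533338954298477899837327433721001681359553848646276690899670865352915360760202405475455812578446050952273991721099870602109396094397586309497573205100893307146846639109933459314682695178253867500877867178992896546031861830882949761507428573024438560202607900997486212827730930188089257386059354612517397169474464189813716710491662028172214085474262613088151675847930450671673497411932367795885642578164269780374684577042393728427183691334040069726494950382624163449020731700524774569641344943519831218824127146941818799549496218474316492219938664575411727867154687455005450001212777150069061523962541501339331469872592459595220058943723392882542444516703570108648179919388554472071023465543195897900486141106554408735139579937012598921324385585323532621717823687096127689037811127910068168915932771551565962598240612998420317953899302601173036434706311415460811769418723492676496351402644308550756441534299381751467391642748336596719306756,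
  4633127579323244071600421575345424716067870375268674506899676418006211918909823944631461440215442639656423675190824174987125103817971330724962361259478849020460326403629878295017974716857333958888891467949389066316996924984359497033815492824266043921856666295864582812385238502395992506677292429972670805662843015856496454244852409960907074225550000038628468290697130270916284825077789061218572779768868184366668000708953733144663252105713652202068361227758235896996827194284010459487499397758006481431911714160181331071619298115266905859609585645953003231949928485382912730811044074605241633641350521004057039781199345825225503592007765868448983445802208108963171798839123416951868679671320992961225965391033842632162806982244423673568516379307440937056577798606392935431196486686806923954701117075862935751500144531008043346124959217298721570008489618613749172959169571865448644773356997403020611657080098900406645597930307532870601729799120053989423985689442852876001136781417292792490,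
  1205447540249246777835587868516487198705028768812275031884191461824674955400849034274136588450950119589901022930763485795589297232630517730031489410847074199325562561148404271606674018776869691007404208216492175389283130830997063112551348017692247942372935755383107009563968503979072523236987805280674768968544660916267013008721286879263186652907379695637469005485572506954221198160640703193473220069576694021556197371910156383360240495725156487418039048340685369484779847301073154759374944543429752327551313230057586698168519251661597686980363202621521710987392174454029637947048764470326881127329389542094502560627868366159713175057453244623906681793467995436902098669988106495251073748596805717640867477572431235213816196175147197353760878430656484113573295803288064373413410490473422020862099599139332760307021079009728049961457263542208256568961778520118473636638515731000863361648395460698828696118785871702583978192188296942954680941264957273266574134278477703330324816670683003097738,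
  11135620750850891603973197864913918271419460264855678371995814621512968556581515384377728006300419888326222157826,
  block5, block5, 4855298, block5, block5, 85415317281306054914, block5, 5732124165079839716472832259, block5,
  433107112881329104150580283605913607601797577834752, block5, block5,
  121908814511491568851242777042519956899580594869209692028636108290, block5,
  3157203959285341781398549963646027669588375746574703420855793550141188664875401330544741479270515200229632, block18,
  1303601300917715650059, block18, 421483563065172321748189556191394270883510724724232, block5, block7, 4724994,
  block5,
  28919884647849281403238184487120637433923502360708216081500201585738653126569011284809162772004275925554184871663893434722469576504717931509828327664664475652852192138730015222616525595248556556660947202737672,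
  block4, 6969459870878750942576625671, block4, 7136727501755975882137762596868, block4,
  4409089104064747300450705100194977992059113591625879930889121004497181490640361768781084148952006192689403217755616916820554683111368912522202618020602493729842157879762741982243048279712868032908790618583611884232520269187762486358010931643707682405471944677848381753178692966792544859003867614322551716854517884017815373426319736211392483493511286084920987076182032206680783723751699641373151198012585768264583968454854006350388795011644785486260093766013789400078229838622894073995903671105061226974549559298831358011904810755645195443928082323259741970461189164769427216138773474448803797774712970792094696871045617954095913264688398383976261381693145849482512737880578913113042821741309801341281211490026673966761863164409274845824324982326986909969973401635453673752502951526159076807821466551898638451459215745164411083487457789823526489699723729945034145515837600618728428262629558462922241550074728315118188465698630279798503390680961840028789278474813129263918968697994051389444,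
  21020547053693897988389589158149072590565561535643232229085847628489163812775275375997896765803392639403309527267169809361923387852378732194527551074078758916941336939864025919843637659291575299113685622430853377131071073905278828673991302764283912706508954982000274862332732262851666699783944256798141554537416380415015609295704556711027022346,
  block19, 1266705560833035518987, block18, 519401101737985032, block19,
  308378836852687003914861076463214365724274573883627514202945613117990307223394433629443794115762642017706775084184702247322789152981386248,
  block20, 23393234859896327053256532079198467, block5, block5, 4724226, block5, 519347775411323136, block20,
  21786369563415528246315625660667956717268269581276828485260255396117305866322498626226458901060776346173686166247624146404229631112591362673449086815987994108778701150031970560,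
  block5, block5, 5772810, block5, 28585572570447895051931580906457607, block5, block5, 5772810, block5,
  29271626312139200728075044259436759556, block5, block5,
  1128968386017846240804747995100116496121567066710660029693316092523652729990913001504921532240599272104183858750501867449602211899753115768827451322321813911872073667693221407208398193886686707439101052027675190038830695643389767175793754653133750867339558119367366319196456518705019848319029915850436691750515069803140185721935542472335770222882458622689938933100832626636918607017927763640496305797454805488244566964498117078665258538834631642222765309416246228109647048840220867864239071857518394369021362120733124853093919129293518023883553783765746338209600166141328645662044720817980070473749405897186998047421304249577889160043637070896031294585511844994124281041415613993467600091448045559722421649355660063525990252043737855345881284646338371001134289918381370499742708323257987317797799476094476085572975415305293855477857197814469515057485958019436743200138340159316338092092599568795207029815964155792042723651103900569287664968024381054806922326036172098196217516993633360287242,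
  1234354241713603261044748683087414802024744752250274385951841564672118009143631123222435478414772645688832405400609224166622459237249414161487245342500393546174105442360218152749497647852501453056094315567652402988476575597180923715876151536169911874643788242894868024042833365349355303337453504282697895969704954766825540732578349531303176342987817630060331946096442890481683206201353380545458543117598987366731878505070633987639890327345049368322608151533434777375953459424980012633867403996249862047580551310824763678268912071512696921538914619122213976684527750842262603497890636890402916144999623562371896947797700842171639628198721633706432270970315658782944354447469266296401210002566081335051598472332931704675041518337381943574439736355001219736873244372907453367507934056796439634826803587752041923945763488831614497208550157815682517271259327697204790771429743671104722605964951294759638268702906682072757989157634292946412813877609590023756315925272140910861005050948944848848427522,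
  881628849001907173821044710959259304582168705906625963641683012843938829395712406134537658019853377569531929766111172956370339356691860718711768582870749578908588106906908635398174645006245810107816423821115682637536307296266938483814264642414768055714292577786755447858128763218197170777275295618431667641101407516447617934268797081232308442060493383318514574719100390800002659446829688883168162672221311803773064961700210526579152134934581670606384581765305566095862916956574999464307230058854935661340368780350767358610756957126932007435044524236309314215393180048127255576453405001686490200917622800397280629635509886495522002586130956730786322874014065670390282]

theorem nearRoot_ok : check true nearRegs [nearB, nearA] nearRoot nearRootCert = true := by
  decide +kernel

def farRegs : List Reg := [⟨1285, 3, 10⟩, ⟨21845, 6, 2⟩, ⟨65535, 12, 0⟩]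

def farA : State := ⟨[6, 0], [2056]⟩

def farACert : List Nat := [
  block21, block7, 33965717606920, block22, 8098818, block23, block7, 5080518025391269191082332680, block22,
  1266057002901859501058, block24, 7050242, block25, block26, 4741640, block26,
  10514194914125397217728456852760681926920, block27, 7050242, block28, 8098818, block25,
  77085444588993935982049734052090688485961327522410010710488022948705046879106621177795877454381616513533523721000815755809646655491487271446510601165632031526648753362837645240625197238893721064762615949163420601974073308671628113503488822024788698890936065416973221544399572840774038198978562,
  block27, 8098818, block29, 8098818, block30, 160999080431296414678043376611923656654413849876468738, block31,
  113108594779237387854345032013476494666328252308231170, block31, 4953090, block32, 19879293587462, block26, block22,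
  8099073, block23, block26, 4739592, block26, block22, 1284721058921258239237, block33, 7050497, block25,
  35127536460734743314774434163345287032665700550591197153178127592524042018556678735892486, block27, 7050501,
  block34, 8099073, block25,
  249996981020118030907904633793612917487865493136144426480784497459883948819566649721260849359694668646279825503998566359190945099560983406068611063817368948975811363133129937205661873683531350793257603394005924716029019913619969835613914642196916540748280125418692885219880206490070756128025298571270,
  block27, 8099073, block29, 8099073, block30, 137059660775853141582508922119455429600527492698576133, block31,
  137059660775853141582508922119455429600527492698576133, block31, 8099073, block35, 28675385561097, block26,
  2115870072163834494450583937243144, block26, block36, block37, block7,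
  52050642773225079687280810517375025087923438634844215896663459910152, block36, block38, 8098818, block39, 8098818,
  block40, 7050242, block41, 6001666, block42, 6001666, block41, 6001666, block43, 6001666, block44, 8098818, block35,
  63346130037649813403627719463373521172922358463200170234755266077596772364660122966616272388915241306361686080897555016838223830551499398967435361493373444337742009126016813632824372540120580997863425721835863244229365917892378049190582376989567383552495103877817078446462601097988353151438857,
  block45, 8099330, block46, 8099330, block37,
  5686467579945616355802334117114947872128009246753015858188290994987409710069546423120556948887088706145939291811188888592476331193063266289629404064568363946032327751297804663963260187596689296876456944581217002247322574123991636908916884679171007490463872310587453615593744214245929485348455083798007585272578053,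
  block45, 8099585, block46, 8099585, block38, 8099330, block39, 8099330, block47, 4953602, block41, 4953602, block42,
  6002433, block41, 8099585, block43, 6002178, block44, 8099330, block48,
  2325615747425886090117188513288772435985513865959384833759135895558, block7,
  1176902930515684249163122549211409040950134142212000585640322834153733884390930133861502926177324868321986114771464,
  block49,
  921164203443934820622332929908909573025176638706728684920976242333915114152709630849796705667960820028317090750039697256408918069122294291274567690576657539756484086429049941766861993904672738002719791939706708340018204335208028241290204842784515175500121594195495618863181969872979362526905661769452960881415353226893927531652782973752322,
  block50, block51,
  22009083928782150604427596425371728105379177289251510308680166748181008388948945235125509459145196204844585345500708881522183978692071589610523805712390,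
  block52, block51,
  230662500145206610398073451741396872672576868515513870569632478041234583293336014649526519548589469792191508996644332251063571577902563871823677113285859096506685988711314805748654319586101135744416671760287468700108428019929089673814618920048099957831376575681983986388756430854,
  block53, 2325615546558630557743404070543510893340188550684010610910031482886, block7,
  1176902930515684249163122549211409040950134142212000585640322834153733884390930133861503080919829778994520477161992,
  block53,
  1588997763308606792373857330267297205100944641114864533576303911427755606970223895310698809623509532877375637075073594589967959465989310740245374634647305483391686900365527749024616834106922740721074120907230433653140325916825528020123247040171061428088088777789160121918687632013497052538901036782912654897464687282185069285730044710982658,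
  block50,
  1003219857048291064506920435700218441433733457032251040804846127074223622748506130494949343240145712622168825358130514500678326269218822,
  block7, 6429478904878899251381362487161075162632, block52,
  194082576974321120147828959642068559138934377357114344541108262554426852774702719718965059746300237125760966479405397076241798010594892319131311379890590984825473191655103013310849499504820093132868949435562195187775375275499134784899000428684695040573071116496560473435157581100544539101423612316209568953604500636270245967891047335737088582078171598647462087746469022707953223092523144426901832240518366101931488638704039289474331506609337137166332051325710531470663917524186772835220588721341714065451842556752415592697807588444023399779113765355817206059170836696786206594767724237894138966822513249524738832661667161549920272824148758758646997722472692337334168022891938940674685701068521746001147360943006280511759055769245598398366455533416841777494618467244904054944131393300665576531298533216262,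
  block7, 1791193046540438740603960966143496, block54, 120226192998450474484005282124837417404417, block26, 5788680,
  block55, 9151737840404863321895819884757322980360, block56, 132190097165037815446596401405745310713688757287751686,
  block7,
  1689973594278219953481314525414203800883913127321916167443530010574888516758071672187728844624391921197338616668042720704145315195797432068192655716631775804529715967486772233068685945949300255362667528,
  block54, 120226192998450474484042177864922097535489, block26,
  48372019437205888185831557944451329281220961177597471990853274784565978371895163360836717518419458829188677376530671315096422325528049427897319944733385981712970076042091685056327630002362688592564953763575934177108547430425625113883329149892335781815972383952277608092680,
  block56, 132190097165037815446596401405745310713688757290897414, block7,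
  4392837039897006714329522303477111048745519834100946673725788239680947282914826760691180322580939848575670797164474125814250254202250831101224178767956621809755254334184849405704541692678403857531872968690870287148420507069992434759072591986120355069999545583359116996905305778289932529858504684966540772594304516960981910462304179276573894319165818482200162022344503251052852922433940099162178427636323878322358116225842135931474385506639133802423524951067477382394824552509917028687444659850965724707633442495469251482632,
  block57,
  1484142278235026798559907692491657817904204704069097488587777713294269014937125109895916709753194225059943416327237655829989446092404509620281283879765984191701870897157269046712840,
  block58, 6001161, block59, block60, 6000649, block59, block61, block62, block63, block62, block64,
  556095810413186241190747059928821267931932044365578676739887485844253435871971331276519082917894, block65,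
  2266418028456775776093897496419829002290929461261573337409823166569856928643907285343645777291612166, block66,
  38385169271825204172559177894033323180597940230, block66,
  20792106446082247012852481992348346338405498203391269042415459774913944560687541664229467445441243179538633459442749541463216448013568578987990776348503133160138622060120757905166516886092741600323499167750,
  block66, 44094160042649043696792321771831303726129975302, block66,
  2858896931194690949426234348779342457415291371570725013515935717837720519096047007463791853558979529492229027645789059734903634904428263232141822495418121957977471638239361707785596009240058989855226016529681623532565484507142,
  block67,
  125176978916470234574990601055471634471580412259518854908247228765401306752895590735949286130139742878557737799327631883536284619093348802140564191564014630776390295063430795106816,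
  block67, block68,
  3676038466338732460075544473177180611080361661777970889019182935686187176904805891519182517950976009, block69,
  6627648826179195081987942990053073859166592934796102448641769464773226035882196183080265544281758527780630278335994346973829163061842496491383773702327502856,
  block69, block70, 122574614631419632904, block71,
  172103317347333789194975794634717998964100016500813716104542477705028750634294712843314776333080366568690576235812881063176,
  block72, 605796512506469388431139524126358829090390890489817641019160216405042503298221936140903747590, block26,
  5175893988479672334240970143209810659957766174502148472677284936558082422148563935530589262018458578102025924178252706005429269258355074648726515156691735114147713717326778148264247270593704,
  block26, 9384692916241047442839875769795706901672]

theorem farA_ok : check false farRegs [] farA farACert = true := by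
  decide +kernel

def farB : State := ⟨[6, 0], [2058]⟩

def farBCert : List Nat := [
  block21, block5, 4739592, block5, 83379795319677541640, block5,
  3253679192780599926994347037104243788999691147311153989227240772104, block73, block5, 4739592, block5,
  29332905858866735736501579729798317212580540633427343566792786990504, block24, 7050498, block25,
  53493339195148140928015637335207558844520737383121115713253861363366913564472730756662789, block27, 7050498,
  block28, 8099074, block25,
  323238038962317078361885661087959488582454683809722616969849503335908913864563761582182228707204851345581199844838758651630237129297902368174524009760391834515812133888373989749055705628845386860142240741583542509689206767519916701428942400769369881329376097381194824709156910496842725616519318355969,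
  block27, 8099078, block29, 8099078, block30, 137059683611816224877867019052030940792449674822522114, block31,
  137059683611816224877867019052030940792449674822522114, block31, 8099078, block32, block5, 4739592, block5,
  283426298212695796627754512285709095197747022477171511572859698258929065254460048201493662435818979482688776,
  block73,
  169007963840862845239311246787632883880501061585111439818107479546302384795903313349947632676302866088828278655369485,
  block33, 7050241, block25, 6155000787834359313570455068807123408902, block5, 4741640, block5, block27, 7050241,
  block34, 8098817, block25,
  45308725505685163268909963567590207706277123007619485665107424609977685856855891890322595108341522736057604524376136674024000300140834392391394783612617571055432507508296713076818214551589581608231067723152889193622136083859361987819093756364714650540904720502951461194853960036919961764730886,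
  block27, 8098817, block29, 8098817, block30, 160999057595333331382685279679348145462491667752522753, block31,
  113108571943274304558986935080900983474406070184285185, block31, 4953089, block74,
  1828466813299053733719270257823583004271347144360535754447619266155687527429, block75, block37, block5,
  2115869911245009206793436173718024, block5, 29566616228360, block75, block38, 8098821, block39, 8098821, block40,
  6001669, block41, 6001669, block42, 7050245, block41, 6001669, block43, 8098821, block44, 6001669, block74,
  169078730745156193016324318294741825835456099301488422579029390561512955303649557189576733775360807790220314329904426904762662686170452440972143079331792546269627865649502379731423398340648895619918139562533925352377342554154024829847265534238509298113932335028999913500469573450599154177904178381069,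
  block45, 8099586, block46, 8099590, block37,
  77066082434583295154607366941194183355070783960312125312915351577982735459696968955566904794899440194023322554067063008314417375107760155615744908774867037125180860448723907318869004766969163098599879392147337231816632230756832827683565301558297341682080921448616068802760001919456211276152833,
  block45, 8099329, block46, 8099329, block38, 8099333, block39, 8099333, block47, 6002434, block41, 8099590, block42,
  4953601, block41, 4953601, block43, 8099333, block44, 6002181, block48,
  2341204697376889358347543192117372747635839674051738488727620366920453740688309429909771468914529701662078561922504259453758547635544734449325648547641903086860631337504256559379936499844758232314384385,
  block49,
  53971951332925695847564556769991731440839586719840679419678807573824382695231094842764804152581765214635124087472488169333954224186647385326419957197456930376065508328863269123815251854605845314840149937036929078857285287464846204219689928765886940949709386457515668963247749441471903957397762190649512560239193838308967552001,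
  block76,
  5517132853881868909769608658896515305265428014800930556833844637227585245847984635048366873794117861034601842870097208233587366937663117142197142652078372659352279191373967038668289045570177961985,
  block52,
  25862372721231826244099673385223679920996136516710267676613637395776151061330974459481550422197549263933557941445283743036166124623883117659540574119796724173812089315893621992503503607772011170601138968449918388491370779718535330640514482788866330184675008527566416515481034892906390963411188260111738214560132731475958529187926086874477803829662284183072768075312944239930499201571506941953661916252903952670395394779430116802903891470588185577471189688000513923251187926644552059578033494488164374644268554676228309230591870110349774576748286595497109147401111412653438518794538160390828302474363646272041587147356253578558533764016301411604278164693713010665117815150093337427076656862445926147708568240082088129020206489951395448093416766038075903032977000469066015052464899339332157305788075556337219596915117713858652680335911021532051907299018448689340017336651005792257,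
  block53,
  2341204697376889358347543192117372747635839674051738488727621891211738074668891159205293828859014930469765410052948020255019920138304769273511054274176088645248079526313087255753735848807607818046377985,
  block53,
  90324003660357702638019220272451116204345060468100080811098261727626578250880980431544987566615835716171423791378196422382682266480222240352059329635719567399755778634118542987169999996437367348309169716520847328097439877306637784472809169833742683136173104932621469299570454802881874551712063113145502072247694075243458696193,
  block76,
  94050765479434567302384487297155547566511375639593282022976008131666147383831694911162310904580035571008857446949487509138192357222585650868739627636838076417,
  block77, 7050241, block52,
  58946126024509289043960588369437299341287202258991579329280527432330420834934887847667639499443109949512724680335049924608138254809731194218079168325497264814656790530663144421557677520819720924427004796186496166380959749750848772896782154271543538573362734292033204883457,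
  block77, 24217174904833, block56,
  5517132854017840268348791418041964618991427657745089577731693695990591037822998686251001190779237328479090740599422243966613679795717118702389751040077837208540086179975628826757331899244926963713,
  block56, 132190097165037815446596401405745310713688757288800257, block78, 5788680, block5,
  5989644110446278044817799428478595728053397380211219947559526446871693445396593270427377008723622291634178326000134621419588298319665027241681067435548489003590771626302995263248820361736,
  block56,
  153731808306877174068125982891702257414164182777550629430427559511041909406014153200621255555014500063985923435892724209704913449937343091911169266305216411859235607286734567873425142425232379470425114167650192664329291068175664679789823431726106904981907166834340291496440729970257213821693271707766300765208788338637803413270491229720951111865943956019066958704395397936469134184956932925206669926379389730567315392198591433342058506895835349694488881186835899996373241194102201447996743204712746783348980843195779798864160683795486367561707239376536467925085873391064597272808071159243104180491298163277945326915334934529,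
  block79, 38570635693952069139990876870922868661459582062614421691577354703880, block56,
  820910063798489695465254112255449958742999892763336787724404041988694424503831268091777264416675592489302231147942581271259577378813310815342513926847556639554295644322897322998853371007137295283645251066297421727360184158633818587569580656488286639125135463618251491558412660118360065,
  block5,
  2002830487693143552851288372940447863544715039010248619899300074923508965382284878070603305912046319081194779325464102606112665461452296152952536773102631671949945816259172338522632,
  block58, 105564624400548597761, block80, block60, 105573631599803338753, block80, block61, block81, block63,
  block81, block64, 555932837588007633023561942603990434258611465564707214414964385396266890669264808263765958606849,
  block65, 2266418028456775776093897517621993779631541416261143346324845356499663691151334782802920192803049473,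
  block66, 44094176376202655901838568013812460451004125185, block66,
  20792106446082247012852482186856888629702043133660387652938638728622361697051771351525904774690593668648730502127587228642288899231105697961415485907653365068294510842408728470411559383522405818259602116609,
  block66, 38385185605378816377605424136014479905472090113, block66,
  2488748832604121981247682110529713300845483482406970538534744774057189006537960230291653166848835560984820819447095099253470779394873296670725712979736360035978732197174270558436991778625675914960600312760343368514809709170689,
  block82,
  108967856434778395485634613930890217585688181040664457999216957065233575288545771421259137035296524556536494082038774361909044012191808876804099449984807570027751050927076040776192,
  block82, block68,
  4222846975684836990695227089621186071260619033197089363459377340485425476201415945098699015989202945, block83,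
  5768710312319546703707327431154878092292501264183870179780343871434862780724092684890621075812426899838399855209941092666513379111110426808976380893025929224,
  block83, block84, 85681135292978450696, block85,
  172052879700932775293450439441222401907461081056655835146959713226225496444011858450266344307135838382509463174955972317448,
  block72, 675231151666321370047653053501164290294161077779817865908225, block86,
  1059544747447172026824981148043568148257015296290666874238577597130324041920887747727886654001849758260313261892830216,
  block86]

theorem farB_ok : check false farRegs [] farB farBCert = true := by
  decide +kernel

def farC : State := ⟨[6, 0], [2568]⟩

def farCCert : List Nat := [
  block87,
  1003219857048291064506925245514281142939893711047964169120787509995689559916975178842534989023412503403920259974701223627529795584888838,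
  block7, block88, 4952070, block89,
  1212818482173735552780174125230317235054579108698529944585944640013982067677600035281943119144664090535621311084689712975614352780874036452693591392787946897414,
  block90, block91,
  506579162676482065163630521733475304034344590674789879590189111541664004067402209572326176883552077358816583471738871693694327410842407636687414195353586010089065365054120724961218608698802118130881684763789229768368295708468683906598302927810701325840813162232990034891133177967189420563402846383706605157548962781423494006866305337508125338804046369231089729394743233784720121310688688639166273451826556316954848824440150070465307646167533388261364779441039178465053327587635819676122701007381954023705002275010092694349950962432384443108806279226171630192987492799376494123620601031830587206701057418217929230303875313200734253591265775115144759719950431176679643734116580384204024510300377357789128671461029770408999719574595202762831134600171526,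
  block7, block88, 7049222, block89,
  62031697322349380049636725989012261760982985309485429286096536049645546008133609518967048248150955779229808503695676261110725579270777723866794192946644717134565719187749401556487378142432698041638398609346752450280711044964035597480071942434214395954154299842417885146925894819086946868561529160544119521286,
  block90, block92,
  12661855403697644351409124935195489448568503383603852068609146578707591226573217990120771051120802051887110, block7,
  1571595836472710248660123282984451861942682193690645000, block93, 6000646, block94, 6000646, block95, block26,
  1791589119596493428780754164798728, block26, 33964628137224, block93, 24215027421190, block96, 8097798, block97,
  8097798, block98, 6000646, block99, 137030539218112560232061862204601891134701049350950918, block99, 24215027421190,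
  block100, 7049222, block100, 8097798, block92,
  27831120938144701136482576008202379089558177717564120300047982494739250433460746011742012826100827260887854313815649055945714773855621540756758742149790968558469476510334335615422360779862136736178001443053180127867571484448092347699144844812304862470648582104277206884836977473481914100244449703054430267485648050173298635051496008215252348505458449413140216508894124961338013689549826,
  block93, 8098818, block94, 8099329, block95,
  77066003921833583523091455612105954165062538900539386898597332707334189899143392192444874394043974324821091378615051780999143856983907736437701646646141057818823780307132110368111118056979909397229780766855408493509637067057811561027573591191507282932338301669831392966715136013589594688274437,
  block93, 24215029519873, block96, 8098818, block97, 8098818, block98, 4953090, block99,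
  161010743903622598837157438276933106961604679895323650, block99, 24215029519873, block100, 7050242, block100,
  8098818, block101, 7049222, block102, 28678606786569, block7,
  1643435949723336058537650609073754301673773615944325128, block103, 8098050, block102,
  3661725486654860832899301929497076213940021282772401748305952266390551052673005559126256494853913677093468707741155418154308338378218653329640489047462531656947136974177877245634955813037800098855302751241554645297722571813048456252527652028985334850905770425934050425954436222717994234382066715802703534246039561,
  block104, 6832858336379650196185303041, block7, 1809364742094857863244373671553236632221188669985806856, block105,
  4952070, block106, 4952322, block107,
  1047335726614317435553633082588660077458941757459816758573540642742412065966761586964466314891287216944883748236292939129375113744443484843600416355258553977988850537432519425379471037262358123247293928473409932570943695399308850879793452657001482939307809237393829464706530566444264048915472606733646756663530227825583675475650155920590945293713816459805717697052839958927782888684278861329920699093065087349341943976017785335370658278815139808379062980310972839302524765107638936783764891061576882511834949032837126,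
  block57, 5787656, block7, 2958736397744277271976125122733172707572337172867996168, block105, 8097798, block106,
  4222981240704026263857633780052182228069727970873925916426395897268038472026767460193801171983110150, block108,
  4952070, block109, 4952322, block110, block111, 7049222, block102, block26, 2116107595826999329459203073398024,
  block26, block112, block111, 8098561, block102,
  3600810602941340528310986398046993666237219626009401178104178786766671762058467744619498776097606937175671042836923295030128205442914482867861125124388274527725319478399108840934535516860105742409288418804989600853344709175118661010557841534965840950462249751415118104995325100037,
  block112, block113, block55, block114, 6001409, block113,
  2349638474360500653110699042107367595519259093745022307471493271528949797739402109673296824128066954320759637199797516773816937415599116951979399669798497483613303057827486804673883822447923409849936117630938591736817521360902,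
  block114, 4223247717602306435989495073043357189283244079763311719542959114617061214770877300848357259293200390,
  block108, 7049222, block109, 8098561, block110,
  51771087294807891393344978506780537220901181051820427358619417878412529015377083352536896169529082839564142244294389775318721923698126456179282948,
  block115, 32671999831542382408968227344309114459792314374, block115,
  20798232442254005388564873758055368348374020976107721844046939896185876931010243076239026693475750672021655233195127846842221109973143450351939752336560638306382874069932647977925635141913773691549746171910,
  block115, 44089981373190061457434515099905075550856384518, block115,
  44088609354686636233549830773487910661427793926]

theorem farC_ok : check false farRegs [] farC farCCert = true := by
  decide +kernel

def farD : State := ⟨[6, 0], [2570]⟩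

def farDCert : List Nat := [
  block87, block116,
  4151120666750172660008709292342438552278037060884895992921253509125628831903843866734243428921988639819619945163535882580886035202566,
  block117,
  893611514005983737393665108777038682478613078551493488797915929952373845473165866173728184694383584826850950155029624811144988572259474750438760677903142913,
  block88, 876434931470398412312283787642231457492222712384890587803792479569385344938971473717691650049, block91,
  block116,
  216841238147552611794969293249102711846529824097157582524867775913354254201294188001515675941751294638297326588855325949350598353167806011961996528295756857248368568595225511924946661568486839557832267695682248126247342097011052585171724337760931180700590638734733767001000404092418,
  block117,
  505609428891917999662600421782810939905281669764339566207914176772460143656643628910752271181364033777817000876704377972520711595856977596983261150512238424218484838044826925241118063172335731711258396999651039412322538187451711809166647709836519501144391409621282908726612005805243697864765625457983957039879380543478437333163142179592118798351137871890587630566417588719198959123808792597145664889503006104650821514570276721364923653485094295006853297783793989668046367404208838395387624514340813942930066665070408346440839292621767680264600557123274764198365058358866908015121373749973321499467157459902507483321325533991955902931963992854894547340658041451653484498222614331038857689233468650868697255498061392832509135106771197109450849542437133454469401666433814529,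
  block88, 876434931470398412312283787642231457492222712384890587803792479569385344938971473717693747201, block92,
  6000641, block118, block5, 1791589048099311489326977348293128, block5, block93, 6000641, block94, 6000641, block95,
  45536267958566321680454708690319147023256000372001947834321322572662145720878422089613573, block93, 24215027421185,
  block96, 8097793, block97, 8097793, block98, 6000641, block99,
  137030425038297143755271377541724335175090138731220993, block99, 24215027421185, block100, 8097793, block100,
  7049217, block92, 8099330, block118,
  2291444089937374955257965160777181011233725970492226847948513786340408940909789323481687786474413106584537449035508297444251116887480541598441453003992474112449298263542715873496592864204229148824742644749108125609583556770607839100823599757711388109548826660708350474948381786113,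
  block93, 8099330, block94, 8098817, block95,
  77066080057098626797317658040906689862329294824814278653964257776904607795706373617638883085277496581671791396980006083072463794468358762452183223040834056515931174173214099356691278093479085501860310864001095636362540346776046712728743639963420525384739778917068761742323171705333917734682881,
  block93, 24215029519361, block96, 8098821, block97, 8098821, block98, 7050758, block99,
  113108566238464924790113464199824214709361834869888518, block99, 24215026373633, block100, 8098821, block100,
  7050245, block101, 7049217, block102, 28678607835137, block5, 2116107679129009118186072991881224, block5, block103,
  8098562, block102,
  40311510740555809263306699815148024610793668381427745243641514247320893581842080683621128601248211552672783647402852629514139060231715113578451002103533405247453945011191083250934806868356312115271481230714071130329283079107666574779635157573319558528448185719869430767573397283110513427582977,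
  block104, block5, 5787656, block78, block119, 6001410, block107, block5,
  9855090648579228406130113040512298568085668458173878200039588016345135383014902366309323176727083796087379409908529587169373415039654390098732970455298109293566675648029409179262033341612691235559257314237951878725870810688227135496,
  block119, 4223250325008356144131685496653838353287290225163950755420769660639852942394469378038485198359465985,
  block108, 7049217, block109, 8098566, block108, 6000641, block109, 425919724047936630889877505, block111, 7049217,
  block102, 53493441638260498019129370480455299230329774858452617789265753037616264074547468517852165, block120,
  block111, 8098049, block102,
  5686473197865225726655595503026477279536593153518969122434759602712619846128725259952173876578949571362236085584251418911147729787704716090551318116108019753333250794813969306596499912696851454706678212905993210073881115222585081450498881800856786141824834752539991887540478567384821944331787566147222659863167237,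
  block120, block107,
  10169695073131691740917472318540559670415788193821783946994421560117629355591217491122337363369352990721, block105,
  4952065, block106, 4952321, block107,
  7947761576257707843668055445807091494685026854199550792100951208487268821509655904640839926839030782343372341597353853662076319861802824459125700268537301354672510762240619952502445523806436747472470126534837947824589972762964778487846724948203236666206250479888365320837826383933997609188685344112244916959171028599130601855688282859039587074303524965347636688382962043236793344174142329214416266050097906964641364292145050697214253562238666817297328809309007469913959492847432079710418715825631568902643398997535165283655705118468065399841038482112588252024266350910342519769294150813710066356225,
  block79, block105, 8097793, block106,
  4222980719222816322229195695330085995268918741219112281426125466179099991320683100898748413351006209, block108,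
  4952065, block109, 4952321, block108, 6000641, block109,
  16022375459895333173251020136478374083156038346452926070214625365088876227990321282657161947604425108958418192761386812795103473536894620066306719490133615504480564108038145,
  block115, 44089997706743673662480761341886232275730534401, block115,
  20798232442254005388564873758055368348385077506649191203477335075622366000026601243876965483793259088916906085230778689382609042172888762041307393920387699714356690258095429319041123615810824300874983772161,
  block115, 32672016165095994614014473586290271184666464257, block115,
  32670600590449603510006465947923355028906807297]

theorem farD_ok : check false farRegs [] farD farDCert = true := by
  decide +kernel

def farRoot : State := ⟨[6, 0], []⟩

def farRootCert : List Nat := [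
  16384, block121, block121, block122, block122, 1112396541952, block123, 4952065, block124, block5, 5788680, block5,
  1791509742565544765148966165172744, block5, block125, 24215026372609, block126, block127, 5788680, block5,
  101835546601231766024, block26, 25168514143240, block125,
  1006805233955805525451966237648063729944987303066137886437911133463535776499156912058505334785, block128,
  44088580772956464728514263043842016597753171969, block129, 32670599231308785680047975288246055506689101825,
  block130, block5, block131, 425995281893652544752422913, block126, 24279485485057, block5, 101835546601231766024,
  block26, 5788680, block132, block125, 6000641, block133, 4952065, block124, block26,
  1791509881743664694846176865309704, block26, 5788680, block26, block125,
  876434931470398415930785713589863527637717271114343995910609993877154596895297405661550972929, block128,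
  32670599231308785680047975288246055506689101825, block129, 44088580772956464728514263043842016597753171969,
  block130, 8097793, block131, block5, 28608780833280, block134, 7050246, block135, 8098822, block134, 4953089,
  block135, 4953089, block136, 8099333, block137, 28608780015109, block134, 4953094, block135, 4953094, block134,
  7050241, block135, 8098817, block136, 7050754, block137, 8099330, block138, block5, 5789704, block127, block139,
  6000641, block140, 6000902, block141, block5, block139, block5, 20770467633160, block142, 4952065, block143,
  4952326, block144, 8097793, block145, 7049217, block146, 44090001790791173894897718204524884920606887937, block147,
  26963029478319655322198286571130943284011831297, block148, 8097793, block149, 7049217, block150, 24283779403777,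
  block26, block139, block26, 5789704, block26, block142, 4952065, block143, 4952321, block141, 6000641, block139,
  block132, block140, 6000897, block144, 7049217, block145, 8097793, block146,
  26963002255730301647121209501162348742554914817, block147, 44089974568201820219820641134556290379149971457,
  block148, 7049217, block149, 8855317720641602203979104705599277600769, block151,
  44092782579628072256445786010795027682652033025, block151, 32674801037980393207979498255199066591587962881,
  block152, block5, block153, 28613076029441, block151, 32674784704426781002933252013217909866713812993, block151,
  44092766246074460051399539768813870957777883137, block152, 8097793, block153, block5, block123, 8098310, block124,
  2627462964924858067746154010013660872156596422189653050917620861391110925643591452791251707031345797866019971502958720784748733647193967737610575345970989914699564966356948162915624368591937667536614757924829726927436819238028921515987502569706952894467745842424605046700952002697207305054578255150288529005775385601323587506999476421183051119321127259054441676935134306042214310530049534495940880409058746677244753966877968824169922379487325389865893466601260862691692399251654993789492173620379625048345090018645385830172396218510913708858666654305786824256359784345107212376587478165418204006899882153896548711419456876974372364744941034424329,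
  block125, 7049734, block133, 6001158, block124,
  5601342679689653942376838332616186505820293816117485532805268800970697242086539055021363891297364468880867188624097062006096476728914969073342719788199187869080522986844717343321609377078906868922516116494162638906320455568346781299122872564583300945088596054025747085838261639424903490117039188211909586374129354558585277380673187926542294613852426,
  block125, 1006869512984111490375464820803636706538570298829821357694090449546690756650369550155373056518, block128,
  44091368366106281056406955008626097642941420033, block129, 32673386824458602007940667253030136551877349889,
  block130, 1229089200824826479105, block131, 119993923884153541121, block133, 6001153, block124,
  6702911533907887559196615293882321807611630497796084138674673230727356917530806334274944584679371342065775609463697723539877148052408460559936280096137485163347780036958269707570996499723729210456329583468290100894938567659067779440404219185645053943656772247432051802593767212475518614109851555002586870477330079612899558335669633397224513726025994,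
  block125, 6001153, block133, 8098305, block124,
  2907681953945378503320525160399548367966318128000502689014392798991491969974912455764003437583924143748005132478340371820008854739338155553284419392925878705111212822527028705730561720705638648772709534258399285129192910885398867350607656414722101341174867038039868124560633192174718792959135702305726392071076734798726112579940739727404472491594790751481979663343452604888146403264217333157760442555319192269573990646821391737887775163457372834742267979055968656655001528780813593286659250769128958095462985003332618104053825247428229952261437219204601292061442746414125898788869254668618851365778683488170376164681626250464187680677064532984074,
  block125, 876498588844658868620981602517626320705250141193659155065665718895675583041179167181081645569, block128,
  32673386824458602007940667253030136551877349889, block129, 44091368366106281056406955008626097642941420033,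
  block130, 8098305, block131, 33775286930711296358155061052326401, block134, 6001153, block135, 6001153, block134,
  6001153, block135, 6001153, block136, 8098305, block137, 28608780014081, block134, 6001158, block135, 6001158,
  block134, 6001158, block135, 6001158, block136, 7049734, block137, 8098310, block138,
  4373856903492152867155018248563777412051113221605457957950721187731786685366380836026838712181431339286876881785499075439793402741900868108283866622435656185244496821696642766396464229056807695708650117988701928383421530789629442619294810270627374700085925905842585286108934280936832918429911041,
  block139, 21299095252161075217488981840859394, block142, 6000898, block143, 6000898, block154,
  1792820771620611465781145876912472684057824872952599835412013978925153074071017190092607807597523264193924590546694920689456874269314601114868634824667614921663019112981508588933858046591270997335476037077076249032935951542398478809750661341612442754119176014561146289449746794910117021614969000395645509827875775182503294821108177750620273936280724447064768583780753926474232149606582937302415199748464075155282491255879966708942667875023680435266050444764088346138800408856652733472359703120330122895965223864776790052372955865505011530081833401568406074997638892194738193718607236936335618,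
  block139, 40100890681696672502707346498798089, block142, 8098310, block143, 7049474, block144, 8098310, block145,
  7049474, block146, 32671998471072011906369768792954048196378333442, block147,
  32671998471072011906369768792954048196378333697, block148, 8098305, block149, 7049474, block150,
  21638846349783570195074282298249729, block139,
  2003606159874625353902319146378936676595839638627444754597525570772866274266363997587612139144219564994252827437015135456958735491150604472495375395332996672174109522962011558494870850625163227506559100141752594641252603997240647724200103380323105907274125491730610576061832162889340914846534853177811952024141885544711638890381185024266518969822634731565305643223513026369910318550886454132638024265790908384716724433560328546608918000890674274173424115176297467359337939186045671616888000575314215195108061237502105772271279485656960395829979180793960303729342723250655077750637192708523018,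
  block142, 8098305, block143, 7049477, block154, 29715024362266613138605745789026565, block139,
  2899914366905521964889159504204322208717206448674651022347452314574258801850290512797945983567541515668787529854138933669010250633665322296665303425396292869678137569978752789050423594794014511163148801085042579673664158888114082360375375184643292536401096722905392158589258892456347001484755205,
  block142, 6000901, block143, 6000901, block144, 7049477, block145, 8098305, block146,
  32672014804625624111416015034935204921252483585, block147, 32672014804625624111416015034935204921252483333,
  block148, 7049477, block149, 8855317720641602203979104705599277601281, block151,
  44091367004981681152437778372428111526892376322, block151, 32673385463334002103971490616832150435828306178,
  block152, 1210713392774839304450, block153, 28613076029698, block151,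
  32673412685923355779048567686800744977285222658, block151, 44091394227571034827514855442396706068349292802,
  block152, 8098050, block153,
  145589097471218776396820391017426512892621884920485919807899989634195919672150581765544883619614601166437431741034126438161820764361985535599067370888790008508566283423335360311607365191254501590856714864338302245819172465586477208207618,
  block155, 137053928960269609705347261280835616315461662601352198, block155,
  83958042902719355020862145300912900466220301605280709132293894813855016516790642154539676580630575685730858869206977165597011557574803640066741254,
  block155, 113108686134240096293498088981612035321418863817233414, block155,
  352145305439163376362043668956421798623765216016383875302471119545714959304190816381997947248501074020220071519115326775850927078111805003888334643893254,
  block155, 113108571954424679816707604318734479361807953197503489, block155,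
  71470989158827091799219282581133893057894454784320554416355719007534222259930616260496527140447284580661269324558822069097388022751245192294798337,
  block155, 137053814780454193228556776617958060355850751981622273, block155,
  2411179453484025220862581443335605546628924921322503055598499369985, block156,
  161004994956885364098125149356625145843307631968228610, block156, 28609852708098, block157, 8099077, block157,
  675303607024730197824061764257022685028196645480322716898562, block156,
  137059752130855850686275977057401564849264833184109826, block156, 28609852708098, block157, 6001925, block157,
  2411283904456902055230491670871607722198088864517098937132793959682, block156,
  113120263967523327704667231767206804219611929636476422, block156, 28609851659777, block157, 8099589, block157,
  474461254544895484075264825853568552237155075768209096021762, block156,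
  137065506793552841116516404066430385213654728417449478, block156, 28609854805505, block157, 6002437, block157,
  8099586, block158,
  25203480707920458831979814118753340936211142722999443399729286690338205625214707945927899968319332841200901866680306706815742301876309162365231495728670074598513051541672966,
  block159,
  28678454450072438611847287403274003620145834828670227405747237389195392052997950103457569943656777047245522495747440536226285888623472231502494657330520115383329394208717098336661452698104317912952898443220030539819332508872650802567974144359753493659017927510681065982157779499036286350072467749292262382589805750383321570910400935380871671457064573715901595751430,
  block160,
  442321789503076533593905576500075415070905261969351366440717993432233892508265352679436670416814871629751810743312309926362330482933931674175591300945557493406034660635761454878685665792,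
  block160, block161, block162, block163, block162, block164, block84, 85699149678603033864, block85,
  172052879700932775293450439441222401907461081056655835146959713226225496397243627649715862679632791449842243373459707682056,
  block158,
  25203480707920458831979814118753343913342557437805267089759603799604778337729720930071145771036347888255159576747410202938283628577587379050903966683385305430285269631472641,
  block159,
  28678457602865179398537121113172266845465202389508097435554106018465287753225300020498573370497149036052078233839475919795460394221732894775761976950876174200407121968606745976348005187735546162429594573224454507219540953091559021827522551320014807785508213585954266942896547318701899632507523260680192059208527697682750378747311518592216336983548270941118542877697,
  block165,
  442321789503076533593905576500075415070905261966374235026003187608543862191156086106724155403439616854838826887468411402249852588989877075694841765922086054079067619400997769406664153600,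
  block165, block161, block166, block163, block166, block164, block70, 122628657831243043080, block71,
  172052879700932775293450439441222402902107553876230002881256598712031968246906300703669211302509183045677227709779745067272]

theorem farRoot_ok : check false farRegs [farD, farC, farB, farA] farRoot farRootCert = true := by
  decide +kernel

end Search
end Polybox

namespace Polybox
open scoped Classical
namespace Search

theorem land_low_lt (w : ℕ) : Nat.land w 15 < 16 := by
  change w &&& (2 ^ 4 - 1) < _
  rw [Nat.and_two_pow_sub_one_eq_mod]
  omega

theorem inMask_all (w : ℕ) : inMask 65535 (Nat.land w 15) = true := by
  rw [inMask_iff]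
  have : ∀ x : Fin 16, Nat.testBit 65535 x = true := by decide
  exact this ⟨_, land_low_lt w⟩

theorem Mdl.card_le {hf : Bool} {regs : List Reg} (hr : ⟨65535, 12, 0⟩ ∈ regs) {A B : Finset Word} (h : Mdl hf regs A B) :
    A.card ≤ 12 := by
  obtain ⟨ρ, hρ⟩ := h.reg _ hr
  have := hρ.fst_le
  rwa [Finset.filter_true_of_mem fun w _ => inMask_all _] at this

theorem near_core : Good true nearRegs [0] [2] := by
  have hcard : ∀ A B, Mdl true nearRegs A B → A.card ≤ 12 := fun A B h => h.card_le (by simp [nearRegs])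
  have hA : Good true nearRegs nearA.fst nearA.snd := check_good hcard (by simp) nearA_ok
  have hB : Good true nearRegs nearB.fst nearB.snd := check_good hcard (by simp) nearB_ok
  refine check_good (s := nearRoot) hcard (fun s hs => ?_) nearRoot_ok
  simp only [List.mem_cons, List.not_mem_nil, or_false] at hs
  rcases hs with rfl | rfl <;> assumption

theorem far_core : Good false farRegs [6, 0] [] := by
  have hcard : ∀ A B, Mdl false farRegs A B → A.card ≤ 12 := fun A B h => h.card_le (by simp [farRegs])
  have hA : Good false farRegs farA.fst farA.snd := check_good hcard (by simp) farA_ok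
  have hB : Good false farRegs farB.fst farB.snd := check_good hcard (by simp) farB_ok
  have hC : Good false farRegs farC.fst farC.snd := check_good hcard (by simp) farC_ok
  have hD : Good false farRegs farD.fst farD.snd := check_good hcard (by simp) farD_ok
  refine check_good (s := farRoot) hcard (fun s hs => ?_) farRoot_ok
  simp only [List.mem_cons, List.not_mem_nil, or_false] at hs
  rcases hs with rfl | rfl | rfl | rfl <;> assumption

theorem region_card {A B : Finset Word} (h : GP c4 A B) (ρ : Fin 6 → Option (Pt c4)) :
    (A.filter fun w => ∀ k y, ρ k = some y → w k ∈ y).card = (B.filter fun w => ∀ k y, ρ k = some y → w k ∈ y).card := by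
  have hb := h.bal (f := fun k l => if ∀ z, ρ k = some z → l ∈ z then 1 else 0) fun k => fn_opt (ρ k)
  have key : ∀ A : Finset Word, ∑ v ∈ A, ∏ k, (if ∀ z, ρ k = some z → v k ∈ z then (1 : ℤ) else 0) =
      (A.filter fun w => ∀ k y, ρ k = some y → w k ∈ y).card := by
    intro A
    rw [Finset.card_filter]
    push_cast
    refine Finset.sum_congr rfl fun v _ => ?_
    rw [Finset.prod_ite_zero]
    simp
  rw [key, key] at hb
  exact_mod_cast hb

theorem RegOk.of_gp {r : Reg} {A B : Finset Word} (h : GP c4 A B) (ρ : Fin 6 → Option (Pt c4))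
    (mem : ∀ w : Word, inMask r.rm (Nat.land (enc w) 15) = true ↔ ∀ k y, ρ k = some y → w k ∈ y)
    (fx : ∀ k : Fin 6, ρ k ≠ none → r.fx.testBit (2 * k + 1) = true)
    (hle : (A.filter fun w => ∀ k y, ρ k = some y → w k ∈ y).card ≤ r.b) : RegOk r ρ A B := by
  refine ⟨mem, fx, ?_, ?_⟩
  · simp only [mem]; exact hle
  · simp only [mem]; rw [← region_card h]; exact hle

theorem regOk_all {A B : Finset Word} (h : GP c4 A B) (hA : A.card ≤ 12) : RegOk ⟨65535, 12, 0⟩ (fun _ => none) A B :=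
  .of_gp h _ (fun w => ⟨fun _ => by simp, fun _ => inMask_all _⟩) (by simp) (by simpa using hA)

theorem regOk_fst {A B : Finset Word} (h : GP c4 A B) {m : ℕ} {b : Fin 4}
    (hm : ∀ x y : Fin 4, Nat.testBit m (x + 4 * y) = true ↔ InCell x b)
    (hA : (A.filter fun w => w 0 ∈ cell b).card ≤ 6) :
    RegOk ⟨m, 6, 2⟩ (fun k => if k = 0 then some (cell b) else none) A B := by
  have e : ∀ w : Word, (∀ k y, (if k = 0 then some (cell b) else none) = some y → w k ∈ y) ↔ w 0 ∈ cell b := by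
    intro w
    constructor
    · intro h; exact h 0 _ (by simp)
    · intro h k y hy
      split_ifs at hy with hk
      cases hy; rw [hk]; exact h
  refine .of_gp h _ (fun w => ?_) ?_ ?_
  · rw [e, inMask_iff, enc_low, hm]; rfl
  · intro k hk
    have : k = 0 := by
      by_contra h'
      simp [h'] at hk
    subst this
    change Nat.testBit 2 1 = true
    decide
  · simp only [e]; exact hA

theorem regOk_both {A B : Finset Word} (h : GP c4 A B)
    (hA : (A.filter fun w => w 0 ∈ cell 0 ∧ w 1 ∈ cell 0).card ≤ 3) :
    RegOk ⟨1285, 3, 10⟩ (fun k => if k = 0 ∨ k = 1 then some (cell 0) else none) A B := by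
  have e : ∀ w : Word, (∀ k y, (if k = 0 ∨ k = 1 then some (cell 0) else none) = some y → w k ∈ y) ↔
      w 0 ∈ cell 0 ∧ w 1 ∈ cell 0 := by
    intro w
    constructor
    · intro h; exact ⟨h 0 _ (by simp), h 1 _ (by simp)⟩
    · intro h k y hy
      split_ifs at hy with hk
      cases hy
      rcases hk with rfl | rfl
      exacts [h.1, h.2]
  refine .of_gp h _ (fun w => ?_) ?_ ?_
  · rw [e, inMask_iff, enc_low]
    have : ∀ x y : Fin 4, Nat.testBit 1285 (x + 4 * y) = true ↔ InCell x 0 ∧ InCell y 0 := by decide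
    exact this _ _
  · intro k hk
    have : k = 0 ∨ k = 1 := by
      by_contra h'
      simp [h'] at hk
    rcases this with rfl | rfl <;> decide
  · simp only [e]; exact hA

end Search
end Polybox

namespace Polybox
open scoped Classical
namespace Search
variable {c : S → S}

/-- Maps of the letters to the four letters of the search, injective on the letters in use. -/
structure Frame (c : S → S) (V W : Finset (Fin 6 → S)) (d : Fin 6 → S → Fin 4) : Prop where
  comm : ∀ k s, d k (c s) = c4 (d k s)
  inj : ∀ k a b, Used c V W k a → Used c V W k b → d k a = d k b → a = b

theorem _root_.Polybox.Used.symm {ι : Type} {V W : Finset (ι → S)} {k : ι} {a : S} (h : Used c V W k a) : Used c W V k a := Or.symm h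

theorem _root_.Polybox.Used.compl {ι : Type} (hc : IsCompl' c) {V W : Finset (ι → S)} {k : ι} {a : S} (h : Used c V W k a) :
    Used c V W k (c a) := by
  unfold Used at *
  simp only [hc.inv]
  exact h.imp (fun ⟨v, hv, h⟩ => ⟨v, hv, h.symm⟩) fun ⟨v, hv, h⟩ => ⟨v, hv, h.symm⟩

theorem _root_.Polybox.used_fst {ι : Type} {V W : Finset (ι → S)} {v : ι → S} (hv : v ∈ V) (k : ι) : Used c V W k (v k) :=
  Or.inl ⟨v, hv, Or.inl rfl⟩

theorem _root_.Polybox.used_snd {ι : Type} {V W : Finset (ι → S)} {w : ι → S} (hw : w ∈ W) (k : ι) : Used c V W k (w k) :=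
  Or.inr ⟨w, hw, Or.inl rfl⟩

/-- The code seen through a frame. -/
noncomputable def hat (d : Fin 6 → S → Fin 4) (V : Finset (Fin 6 → S)) : Finset Word := V.image fun v k => d k (v k)

variable {V W : Finset (Fin 6 → S)} {d : Fin 6 → S → Fin 4}

theorem Frame.symm (h : Frame c V W d) : Frame c W V d :=
  ⟨h.comm, fun k a b ha hb => h.inj k a b ha.symm hb.symm⟩

theorem mem_hat {v : Fin 6 → S} (hv : v ∈ V) : (fun k => d k (v k)) ∈ hat d V := Finset.mem_image_of_mem _ hv

theorem Frame.word_inj (h : Frame c V W d) {u v : Fin 6 → S} (hu : u ∈ V ∨ u ∈ W) (hv : v ∈ V ∨ v ∈ W) {k : Fin 6}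
    (e : d k (u k) = d k (v k)) : u k = v k :=
  h.inj k _ _ (hu.elim (used_fst · k) (used_snd · k)) (hv.elim (used_fst · k) (used_snd · k)) e

theorem Frame.word_compl (hc : IsCompl' c) (h : Frame c V W d) {u v : Fin 6 → S} (hu : u ∈ V ∨ u ∈ W) (hv : v ∈ V ∨ v ∈ W)
    {k : Fin 6} (e : d k (u k) = c4 (d k (v k))) : u k = c (v k) :=
  h.inj k _ _ (hu.elim (used_fst · k) (used_snd · k)) ((hv.elim (used_fst · k) (used_snd · k)).compl hc) (by rw [e, h.comm])

theorem Frame.filter_card (h : Frame c V W d) (P : Word → Prop) [DecidablePred P] :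
    ((hat d V).filter P).card = (V.filter fun v => P fun k => d k (v k)).card := by
  rw [hat, Finset.filter_image, Finset.card_image_of_injOn]
  intro u hu v hv e
  simp only [Finset.coe_filter, Set.mem_ofPred_eq] at hu hv
  exact funext fun k => h.word_inj (Or.inl hu.1) (Or.inl hv.1) (congrFun e k)

theorem Frame.hat_card (h : Frame c V W d) : (hat d V).card = V.card := by
  have := h.filter_card fun _ => True
  simpa using this

theorem Frame.code (h : ∀ k s, d k (c s) = c4 (d k s)) (hV : Code c V) : Code c4 (hat d V) := by
  intro u hu v hv huv
  obtain ⟨p, hp, rfl⟩ := Finset.mem_image.1 hu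
  obtain ⟨q, hq, rfl⟩ := Finset.mem_image.1 hv
  obtain ⟨k, hk⟩ := hV p hp q hq fun e => huv (by rw [e])
  exact ⟨k, by simp only [hk, h]⟩

theorem Frame.tf (hc : IsCompl' c) (h : Frame c V W d) (hV : TF c V) : TF c4 (hat d V) := by
  rintro u hu v hv ⟨j, h1, h2⟩
  obtain ⟨p, hp, rfl⟩ := Finset.mem_image.1 hu
  obtain ⟨q, hq, rfl⟩ := Finset.mem_image.1 hv
  exact hV p hp q hq ⟨j, h.word_compl hc (Or.inl hq) (Or.inl hp) h1, fun k hk => h.word_inj (Or.inl hq) (Or.inl hp) (h2 k hk)⟩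

theorem Frame.gp (hc : IsCompl' c) (h : Frame c V W d) (hg : GP c V W) : GP c4 (hat d V) (hat d W) := by
  refine ⟨Frame.code h.comm hg.codeV, Frame.code h.comm hg.codeW, h.tf hc hg.tfV, h.symm.tf hc hg.tfW, ?_, fun x => ?_⟩
  · intro u hu hu'
    obtain ⟨p, hp, rfl⟩ := Finset.mem_image.1 hu
    obtain ⟨q, hq, e⟩ := Finset.mem_image.1 hu'
    have : q = p := funext fun k => h.word_inj (Or.inr hq) (Or.inl hp) (congrFun e k)
    exact hg.disj p hp (this ▸ hq)
  · let y : Fin 6 → Pt c := fun k => ⟨{s | d k s ∈ x k}, mk_pt _ fun s => by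
      simp only [Set.mem_ofPred_eq, h.comm, mem_c]⟩
    have key : ∀ V : Finset (Fin 6 → S), (∃ v ∈ hat d V, Cov v x) ↔ ∃ v ∈ V, Cov v y := by
      intro V
      simp only [hat, Finset.mem_image, exists_exists_and_eq_and]
      rfl
    rw [key, key, hg.eqv]

/-- Adjusting one column of a frame by an automorphism of the four letters. -/
theorem Frame.turn (h : Frame c V W d) (i : Fin 6) {σ : Fin 4 → Fin 4} (hσ : ∀ l, σ (c4 l) = c4 (σ l))
    (hi : Function.Injective σ) : Frame c V W (Function.update d i fun s => σ (d i s)) := by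
  constructor
  · intro k s
    by_cases hk : k = i
    · subst hk
      simp only [Function.update_self, h.comm, hσ]
    · simp only [Function.update_of_ne hk, h.comm]
  · intro k a b ha hb e
    by_cases hk : k = i
    · subst hk
      simp only [Function.update_self] at e
      exact h.inj k a b ha hb (hi e)
    · simp only [Function.update_of_ne hk] at e
      exact h.inj k a b ha hb e

theorem exists_letter_map (hc : IsCompl' c) (hm : MinGP c V W) (hn : V.card ≤ 12) (k : Fin 6) {a b : S}
    (ha : Used c V W k a) (hb : Used c V W k b) (hab : Far c a b) :
    ∃ f : S → Fin 4, (∀ s, f (c s) = c4 (f s)) ∧ (∀ s t, Used c V W k s → Used c V W k t → f s = f t → s = t) ∧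
      f a = 0 ∧ f b = 2 := by
  obtain ⟨z⟩ := exists_pt hc
  set y := pset hc z a with hy
  have hya : a ∈ y := mem_pset_self hc _ _
  have hca : c a ∉ y := not_mem_pset hc _ _
  have hbb : c b ≠ b := hc.ne b
  have hba := hab.symm hc
  have huse : ∀ s, Used c V W k s → s = a ∨ s = c a ∨ s = b ∨ s = c b := by
    intro s hs
    by_contra hcon
    push Not at hcon
    exact hm.no_three hc hn (s := a) (b := b) (d := s) hab ⟨hcon.1.symm, fun e => hcon.2.1 ((c_comm hc).1 e)⟩
      ⟨hcon.2.2.1.symm, fun e => hcon.2.2.2 ((c_comm hc).1 e)⟩ ha hb hs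
  let f : S → Fin 4 := fun s => if s = b then 2 else if s = c b then 3 else if s ∈ y then 0 else 1
  have fb : f b = 2 := if_pos rfl
  have fcb : f (c b) = 3 := by simp [f, hbb]
  have fa : f a = 0 := by simp only [f]; rw [if_neg hab.1, if_neg hab.2, if_pos hya]
  have fca : f (c a) = 1 := by
    simp only [f]
    rw [if_neg fun e => hab.2 ((c_comm hc).1 e.symm), if_neg fun e => hab.1 ((c_inj hc).1 e), if_neg hca]
  refine ⟨f, fun s => ?_, fun s t hs ht e => ?_, fa, fb⟩
  · by_cases h1 : s = b
    · subst h1; rw [fb, fcb]; rfl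
    by_cases h2 : s = c b
    · subst h2; rw [hc.inv, fb, fcb]; rfl
    have h3 : c s ≠ b := fun e => h2 ((c_comm hc).2 e.symm)
    have h4 : c s ≠ c b := fun e => h1 ((c_inj hc).1 e)
    simp only [f]
    rw [if_neg h3, if_neg h4, if_neg h1, if_neg h2]
    by_cases h5 : s ∈ y
    · rw [if_neg fun h => (mem_c y s).1 h h5, if_pos h5]; rfl
    · rw [if_pos ((mem_c y s).2 h5), if_neg h5]; rfl
  · rcases huse s hs with rfl | rfl | rfl | rfl <;> rcases huse t ht with rfl | rfl | rfl | rfl <;>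
      first | rfl | (simp only [fa, fb, fca, fcb] at e; exact absurd e (by decide))

theorem exists_letter_map_zero (hc : IsCompl' c) (hm : MinGP c V W) (hn : V.card ≤ 12) (k : Fin 6) {a : S}
    (ha : Used c V W k a) :
    ∃ f : S → Fin 4, (∀ s, f (c s) = c4 (f s)) ∧ (∀ s t, Used c V W k s → Used c V W k t → f s = f t → s = t) ∧
      f a = 0 := by
  by_cases hex : ∃ b, Used c V W k b ∧ Far c a b
  · obtain ⟨b, hb, hab⟩ := hex
    obtain ⟨f, h1, h2, h3, -⟩ := exists_letter_map hc hm hn k ha hb hab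
    exact ⟨f, h1, h2, h3⟩
  push Not at hex
  have huse : ∀ s, Used c V W k s → s = a ∨ s = c a := by
    intro s hs
    by_contra hcon
    push Not at hcon
    exact hex s hs ⟨hcon.1.symm, fun e => hcon.2 ((c_comm hc).1 e)⟩
  obtain ⟨z⟩ := exists_pt hc
  set y := pset hc z a with hy
  have hya : a ∈ y := mem_pset_self hc _ _
  have hca : c a ∉ y := not_mem_pset hc _ _
  refine ⟨fun s => if s ∈ y then 0 else 1, fun s => ?_, fun s t hs ht e => ?_, if_pos hya⟩
  · by_cases h5 : s ∈ y
    · simp only [mem_c, h5, not_true_eq_false, if_true, if_false]; rfl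
    · simp only [mem_c, h5, not_false_eq_true, if_true, if_false]; rfl
  · rcases huse s hs with rfl | rfl <;> rcases huse t ht with rfl | rfl <;> first | rfl | simp [hya, hca] at e

end Search
end Polybox

namespace Polybox
open scoped Classical
namespace Search
variable {c : S → S} {V W : Finset (Fin 6 → S)} {d : Fin 6 → S → Fin 4}

theorem Frame.filter_card_perm (h : Frame c V W d) (e : Fin 6 ≃ Fin 6) (P : Word → Prop) [DecidablePred P] :
    ((perm e (hat d V)).filter P).card = (V.filter fun v => P fun k => d (e k) (v (e k))).card := by
  have : (perm e (hat d V)).filter P = perm e ((hat d V).filter fun w => P (w ∘ e)) := by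
    ext w
    rw [Finset.mem_filter, mem_perm, mem_perm, Finset.mem_filter, Function.comp_assoc, Equiv.symm_comp_self, Function.comp_id]
  rw [this, perm_card, h.filter_card]
  rfl

theorem Frame.mdl (hc : IsCompl' c) (h : Frame c V W d) (hg : GP c V W) (hf : NoFlat (hat d V) ∧ NoFlat (hat d W)) {b : Bool}
    (hb : b = false → ∀ v ∈ V, ∀ w ∈ W, ¬ ∃ i, Far c (v i) (w i) ∧ ∀ k, k ≠ i → v k = w k) (e : Fin 6 ≃ Fin 6)
    {regs : List Reg} (hr : ∀ r ∈ regs, ∃ ρ, RegOk r ρ (perm e (hat d V)) (perm e (hat d W))) :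
    Mdl b regs (perm e (hat d V)) (perm e (hat d W)) := by
  have hgp := (h.gp hc hg).perm e
  refine ⟨hgp, fun u hu v hv => ⟨fun huv => hgp.disj u hu (huv ▸ hv), fun hb' hN => ?_⟩, hr, hf.1.perm e, hf.2.perm e⟩
  have hN' := hN.of_perm e
  rw [mem_perm] at hu hv
  obtain ⟨p, hp, hp'⟩ := Finset.mem_image.1 hu
  obtain ⟨q, hq, hq'⟩ := Finset.mem_image.1 hv
  rw [← hp', ← hq'] at hN'
  obtain ⟨i, ⟨h1, h2⟩, h3⟩ := hN'
  refine hb hb' p hp q hq ⟨i, ⟨fun e => h1 (by simp only [e]), fun e => h2 (by simp only [e, h.comm])⟩, fun k hk =>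
    h.word_inj (Or.inl hp) (Or.inr hq) (h3 k hk)⟩

theorem near_frame (hc : IsCompl' c) (hg : GP c V W) (h : Frame c V W d) (hf : NoFlat (hat d V) ∧ NoFlat (hat d W))
    (hn : V.card ≤ 12) {i : Fin 6} {v w : Fin 6 → S} (hv : v ∈ V) (hw : w ∈ W) (h0 : ∀ k, d k (v k) = 0)
    (h1 : ∀ k, k ≠ i → d k (w k) = 0) (h2 : d i (w i) = 2)
    (hle : (V.filter fun v => d i (v i) ∈ cell 2).card ≤ 6) : False := by
  set e : Fin 6 ≃ Fin 6 := Equiv.swap 0 i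
  have e0 : e 0 = i := Equiv.swap_apply_left _ _
  have hgp := (h.gp hc hg).perm e
  have hM : Mdl true nearRegs (perm e (hat d V)) (perm e (hat d W)) := by
    refine h.mdl hc hg hf (by simp) e fun r hr => ?_
    simp only [nearRegs, List.mem_cons, List.not_mem_nil, or_false] at hr
    rcases hr with rfl | rfl
    · refine ⟨_, regOk_fst hgp (b := 2) (by decide) ?_⟩
      rw [h.filter_card_perm]
      simp only [e0]
      exact hle
    · exact ⟨_, regOk_all hgp (by rwa [perm_card, h.hat_card])⟩
  refine near_core _ _ hM ⟨by simp, by simp, ?_⟩ ⟨by simp, by simp, ?_⟩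
  · intro a ha
    rw [List.mem_singleton] at ha
    subst ha
    rw [show dec 0 = (fun k => d k (v k)) ∘ e from funext fun k => by
      rw [Function.comp_apply, h0]; revert k; decide]
    exact comp_mem_perm.2 (mem_hat hv)
  · intro a ha
    rw [List.mem_singleton] at ha
    subst ha
    rw [show dec 2 = (fun k => d k (w k)) ∘ e from funext fun k => by
      rw [Function.comp_apply]
      by_cases hk : k = 0
      · rw [hk, e0, h2]; decide
      · rw [h1 _ fun h' => hk (e.injective (h'.trans e0.symm))]
        revert k; decide]
    exact comp_mem_perm.2 (mem_hat hw)

theorem far_frame (hc : IsCompl' c) (hg : GP c V W) (h : Frame c V W d) (hf : NoFlat (hat d V) ∧ NoFlat (hat d W))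
    (hn : V.card ≤ 12) (hfar : ∀ v ∈ V, ∀ w ∈ W, ¬ ∃ i, Far c (v i) (w i) ∧ ∀ k, k ≠ i → v k = w k)
    {i j : Fin 6} (hij : j ≠ i) {v w : Fin 6 → S} (hv : v ∈ V) (hw : w ∈ V) (h0 : ∀ k, d k (v k) = 0)
    (h1 : ∀ k, k ≠ i → k ≠ j → d k (w k) = 0) (h2 : d i (w i) = 2) (h3 : d j (w j) = 1)
    (hle : (V.filter fun v => d i (v i) ∈ cell 0).card ≤ 6)
    (hle' : (V.filter fun v => d i (v i) ∈ cell 0 ∧ d j (v j) ∈ cell 0).card ≤ 3) : False := by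
  set τ : Fin 6 ≃ Fin 6 := Equiv.swap 0 i with hτ
  have τj : τ j ≠ 0 := fun h' => hij (by rw [← τ.injective.eq_iff, h', hτ, Equiv.swap_apply_right])
  set e : Fin 6 ≃ Fin 6 := (Equiv.swap 1 (τ j)).trans τ with he
  have e0 : e 0 = i := by
    rw [he, Equiv.trans_apply, Equiv.swap_apply_of_ne_of_ne (by decide) τj.symm, hτ, Equiv.swap_apply_left]
  have e1 : e 1 = j := by
    rw [he, Equiv.trans_apply, Equiv.swap_apply_left, hτ, Equiv.swap_apply_self]
  have hgp := (h.gp hc hg).perm e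
  have hM : Mdl false farRegs (perm e (hat d V)) (perm e (hat d W)) := by
    refine h.mdl hc hg hf (fun _ => hfar) e fun r hr => ?_
    simp only [farRegs, List.mem_cons, List.not_mem_nil, or_false] at hr
    rcases hr with rfl | rfl | rfl
    · refine ⟨_, regOk_both hgp ?_⟩
      rw [h.filter_card_perm]
      simp only [e0, e1]
      exact hle'
    · refine ⟨_, regOk_fst hgp (b := 0) (by decide) ?_⟩
      rw [h.filter_card_perm]
      simp only [e0]
      exact hle
    · exact ⟨_, regOk_all hgp (by rwa [perm_card, h.hat_card])⟩
  have m6 : dec 6 = (fun k => d k (w k)) ∘ e := funext fun k => by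
    rw [Function.comp_apply]
    by_cases hk : k = 0
    · rw [hk, e0, h2]; decide
    by_cases hk' : k = 1
    · rw [hk', e1, h3]; decide
    rw [h1 _ (fun h' => hk (e.injective (h'.trans e0.symm))) fun h' => hk' (e.injective (h'.trans e1.symm))]
    revert k; decide
  have m0 : dec 0 = (fun k => d k (v k)) ∘ e := funext fun k => by
    rw [Function.comp_apply, h0]; revert k; decide
  refine far_core _ _ hM ⟨by decide, by simp, ?_⟩ ⟨by simp, by simp, by simp⟩
  intro a ha
  simp only [List.mem_cons, List.not_mem_nil, or_false] at ha
  rcases ha with rfl | rfl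
  · rw [m6]; exact comp_mem_perm.2 (mem_hat hw)
  · rw [m0]; exact comp_mem_perm.2 (mem_hat hv)

theorem exists_frame (hc : IsCompl' c) (hm : MinGP c V W) (hn : V.card ≤ 12) {v : Fin 6 → S} (hv : v ∈ V)
    {i : Fin 6} {b : S} (hb : Used c V W i b) (hab : Far c (v i) b) :
    ∃ d, Frame c V W d ∧ (∀ k, d k (v k) = 0) ∧ d i b = 2 := by
  have key : ∀ k, ∃ f : S → Fin 4, (∀ s, f (c s) = c4 (f s)) ∧
      (∀ s t, Used c V W k s → Used c V W k t → f s = f t → s = t) ∧ f (v k) = 0 ∧ (k = i → f b = 2) := by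
    intro k
    by_cases hk : k = i
    · subst hk
      obtain ⟨f, h1, h2, h3, h4⟩ := exists_letter_map hc hm hn k (used_fst hv k) hb hab
      exact ⟨f, h1, h2, h3, fun _ => h4⟩
    · obtain ⟨f, h1, h2, h3⟩ := exists_letter_map_zero hc hm hn k (used_fst (W := W) hv k)
      exact ⟨f, h1, h2, h3, fun h => absurd h hk⟩
  choose d h1 h2 h3 h4 using key
  exact ⟨d, ⟨h1, h2⟩, h3, h4 i rfl⟩

/-- Exchange of the two pairs of letters. -/
def turn : Fin 4 → Fin 4 := ![2, 3, 0, 1]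

theorem turn_comm : ∀ l, turn (c4 l) = c4 (turn l) := by decide
theorem turn_inj : Function.Injective turn := by decide
theorem c4_inj : Function.Injective c4 := by decide
theorem turn_cell_two : ∀ l, InCell (turn l) 2 ↔ ¬ InCell l 2 := by decide
theorem turn_cell_zero : ∀ l, InCell (turn l) 0 ↔ InCell l 0 := by decide
theorem c4_cell_zero : ∀ l, InCell (c4 l) 0 ↔ ¬ InCell l 0 := by decide

/-- The flatness assumption in terms of all frames. -/
def Flatless (c : S → S) (V W : Finset (Fin 6 → S)) : Prop :=
  ∀ d, Frame c V W d → NoFlat (hat d V) ∧ NoFlat (hat d W)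

theorem not_near (hc : IsCompl' c) (hm : MinGP c V W) (hn : V.card ≤ 12) (hf : Flatless c V W) :
    ∀ v ∈ V, ∀ w ∈ W, ¬ ∃ i, Far c (v i) (w i) ∧ ∀ k, k ≠ i → v k = w k := by
  rintro v hv w hw ⟨i, hi, hk⟩
  obtain ⟨d, hd, h0, h2⟩ := exists_frame hc hm hn hv (used_snd hw i) hi
  have h1 : ∀ k, k ≠ i → d k (w k) = 0 := fun k hki => by rw [← hk k hki, h0]
  by_cases hle : (V.filter fun v => d i (v i) ∈ cell 2).card ≤ 6
  · exact near_frame hc hm.toGP hd (hf d hd) hn hv hw h0 h1 h2 hle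
  have hd' := hd.turn i turn_comm turn_inj
  refine near_frame hc hm.toGP.symm hd'.symm (hf _ hd').symm (by rwa [← hm.card]) (i := i) hw hv ?_ ?_ ?_ ?_
  · intro k
    by_cases hki : k = i
    · subst hki; rw [Function.update_self, h2]; rfl
    · rw [Function.update_of_ne hki, h1 k hki]
  · intro k hki
    rw [Function.update_of_ne hki, h0]
  · rw [Function.update_self, h0]; rfl
  · have hg := hd.gp hc hm.toGP
    have := hg.fiber_card c4_isCompl i (cell 2)
    rw [hd.filter_card, hd.symm.filter_card] at this
    simp only [Function.update_self, mem_cell, turn_cell_two]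
    have h3 := Finset.card_filter_add_card_filter_not (s := W) (fun v => InCell (d i (v i)) 2)
    have := hm.card
    simp only [mem_cell] at *
    omega

theorem no_cross_twin (hc : IsCompl' c) (hm : MinGP c V W) (hn : V.card ≤ 12) (hf : Flatless c V W)
    {v w : Fin 6 → S} (hv : v ∈ V) (hw : w ∈ V) {i j : Fin 6} (hij : j ≠ i) (hi : Far c (v i) (w i))
    (hj : w j = c (v j)) (hk : ∀ k, k ≠ i → k ≠ j → w k = v k) {y : Pt c} (hvy : v i ∈ y) (hwy : w i ∈ y)
    (hle : (V.filter fun v => v i ∈ y).card ≤ 6) : False := by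
  obtain ⟨d, hd, h0, h2⟩ := exists_frame hc hm hn hv (used_fst hw i) hi
  have h1 : ∀ k, k ≠ i → k ≠ j → d k (w k) = 0 := fun k h h' => by rw [hk k h h', h0]
  have h3 : d j (w j) = 1 := by rw [hj, hd.comm, h0]; rfl
  have hle1 : (V.filter fun v => d i (v i) ∈ cell 0).card ≤ 6 := by
    refine (Finset.card_le_card fun u hu => ?_).trans hle
    rw [Finset.mem_filter] at hu ⊢
    refine ⟨hu.1, ?_⟩
    have h4 : ∀ l : Fin 4, InCell l 0 → l = 0 ∨ l = 2 := by decide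
    rcases h4 _ hu.2 with h5 | h5
    · rw [hd.word_inj (Or.inl hu.1) (Or.inl hv) (h5.trans (h0 i).symm)]; exact hvy
    · rw [hd.word_inj (Or.inl hu.1) (Or.inl hw) (h5.trans h2.symm)]; exact hwy
  by_cases hle' : (V.filter fun v => d i (v i) ∈ cell 0 ∧ d j (v j) ∈ cell 0).card ≤ 3
  · exact far_frame hc hm.toGP hd (hf d hd) hn (not_near hc hm hn hf) hij hv hw h0 h1 h2 h3 hle1 hle'
  have hd' := (hd.turn i turn_comm turn_inj).turn j (fun _ => rfl) c4_inj
  refine far_frame hc hm.toGP hd' (hf _ hd') hn (not_near hc hm hn hf) hij hw hv ?_ ?_ ?_ ?_ ?_ ?_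
  · intro k
    by_cases hkj : k = j
    · subst hkj; rw [Function.update_self, Function.update_of_ne hij, h3]; rfl
    rw [Function.update_of_ne hkj]
    by_cases hki : k = i
    · subst hki; rw [Function.update_self, h2]; rfl
    · rw [Function.update_of_ne hki, h1 k hki hkj]
  · intro k hki hkj
    rw [Function.update_of_ne hkj, Function.update_of_ne hki, h0]
  · rw [Function.update_of_ne hij.symm, Function.update_self, h0]; rfl
  · rw [Function.update_self, Function.update_of_ne hij, h0]; rfl
  · simp only [Function.update_of_ne hij.symm, Function.update_self, mem_cell, turn_cell_zero]
    convert hle1 using 2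
    ext u
    simp only [Finset.mem_filter, mem_cell]
  · simp only [Function.update_of_ne hij.symm, Function.update_of_ne hij, Function.update_self, mem_cell, turn_cell_zero, c4_cell_zero]
    have h3 := Finset.card_filter_add_card_filter_not (s := V.filter fun v => InCell (d i (v i)) 0)
      (fun v => InCell (d j (v j)) 0)
    rw [Finset.filter_filter, Finset.filter_filter] at h3
    simp only [mem_cell] at *
    omega

end Search
end Polybox

namespace Polybox
open scoped Classical
variable {c : S → S}

section Project
variable {ι : Type} {V W : Finset (ι → S)}

theorem far_of_mem {y : Pt c} {a b : S} (ha : a ∈ y) (hb : b ∈ y) (hab : a ≠ b) : Far c a b :=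
  ⟨hab, fun e => (mem_c y b).1 (e ▸ ha) hb⟩

/-- The words with letter in `y` at position `i`, with that letter replaced by `s`. -/
noncomputable def project (i : ι) (y : Pt c) (s : S) (V : Finset (ι → S)) : Finset (ι → S) :=
  (V.filter fun v => v i ∈ y).image fun v => Function.update v i s

/-- Two words that become twins once the position `i` is disregarded. -/
def CrossTwin (c : S → S) (i : ι) (v w : ι → S) : Prop :=
  Far c (v i) (w i) ∧ ∃ j, j ≠ i ∧ w j = c (v j) ∧ ∀ k, k ≠ i → k ≠ j → w k = v k

theorem mem_project {i : ι} {y : Pt c} (s : S) {v : ι → S} (hv : v ∈ V) (hy : v i ∈ y) :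
    Function.update v i s ∈ project i y s V :=
  Finset.mem_image_of_mem _ (Finset.mem_filter.2 ⟨hv, hy⟩)

theorem code_project (hV : Code c V) (i : ι) (y : Pt c) (s : S) : Code c (project i y s V) := by
  intro u hu v hv huv
  obtain ⟨p, hp, rfl⟩ := Finset.mem_image.1 hu
  obtain ⟨q, hq, rfl⟩ := Finset.mem_image.1 hv
  rw [Finset.mem_filter] at hp hq
  obtain ⟨k, hk⟩ := hV p hp.1 q hq.1 fun e => huv (by rw [e])
  have hki : k ≠ i := by
    rintro rfl
    exact (mem_c y _).1 (hk ▸ hq.2) hp.2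
  exact ⟨k, by rw [Function.update_of_ne hki, Function.update_of_ne hki, hk]⟩

theorem tf_project (hc : IsCompl' c) (hV : TF c V) {i : ι} {y : Pt c} {s : S}
    (hx : ∀ v ∈ V, ∀ w ∈ V, v i ∈ y → w i ∈ y → ¬ CrossTwin c i v w) : TF c (project i y s V) := by
  rintro u hu v hv ⟨j, h1, h2⟩
  obtain ⟨p, hp, rfl⟩ := Finset.mem_image.1 hu
  obtain ⟨q, hq, rfl⟩ := Finset.mem_image.1 hv
  rw [Finset.mem_filter] at hp hq
  have hji : j ≠ i := by
    rintro rfl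
    rw [Function.update_self, Function.update_self] at h1
    exact hc.ne s h1.symm
  rw [Function.update_of_ne hji, Function.update_of_ne hji] at h1
  have h2' : ∀ k, k ≠ i → k ≠ j → q k = p k := fun k hk hkj => by
    have := h2 k hkj
    rwa [Function.update_of_ne hk, Function.update_of_ne hk] at this
  by_cases hi : p i = q i
  · refine hV p hp.1 q hq.1 ⟨j, h1, fun k hk => ?_⟩
    by_cases hki : k = i
    · rw [hki, hi]
    · exact h2' k hki hk
  · exact hx p hp.1 q hq.1 hp.2 hq.2 ⟨far_of_mem hp.2 hq.2 hi, j, hji, h1, h2'⟩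

theorem project_card (hc : IsCompl' c) (hV : Code c V) (i : ι) (y : Pt c) (s : S) :
    (project i y s V).card = (V.filter fun v => v i ∈ y).card := by
  refine Finset.card_image_of_injOn fun p hp q hq e => ?_
  simp only [Finset.coe_filter, Set.mem_ofPred_eq] at hp hq
  by_contra hpq
  obtain ⟨k, hk⟩ := hV p hp.1 q hq.1 hpq
  have hki : k ≠ i := by
    rintro rfl
    exact (mem_c y _).1 (hk ▸ hq.2) hp.2
  have := congrFun e k
  simp only [Function.update_of_ne hki] at this
  exact hc.ne _ (hk.symm.trans this.symm)

theorem GP.project (hc : IsCompl' c) (h : GP c V W) {i : ι} {y : Pt c} (s : S)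
    (hnear : ∀ v ∈ V, ∀ w ∈ W, ¬ ∃ i, Far c (v i) (w i) ∧ ∀ k, k ≠ i → v k = w k)
    (hV : ∀ v ∈ V, ∀ w ∈ V, v i ∈ y → w i ∈ y → ¬ CrossTwin c i v w)
    (hW : ∀ v ∈ W, ∀ w ∈ W, v i ∈ y → w i ∈ y → ¬ CrossTwin c i v w) :
    GP c (project i y s V) (project i y s W) := by
  refine ⟨code_project h.codeV i y s, code_project h.codeW i y s, tf_project hc h.tfV hV, tf_project hc h.tfW hW, ?_, ?_⟩
  · intro u hu hu'
    obtain ⟨p, hp, rfl⟩ := Finset.mem_image.1 hu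
    obtain ⟨q, hq, e⟩ := Finset.mem_image.1 hu'
    rw [Finset.mem_filter] at hp hq
    have hk : ∀ k, k ≠ i → p k = q k := fun k hk => by
      have := congrFun e k
      simp only [Function.update_of_ne hk] at this
      exact this.symm
    by_cases hi : p i = q i
    · refine h.disj p hp.1 ?_
      rw [show p = q from funext fun k => (em (k = i)).elim (fun e => e ▸ hi) (hk k)]
      exact hq.1
    · exact hnear p hp.1 q hq.1 ⟨i, far_of_mem hp.2 hq.2 hi, hk⟩
  · have key : ∀ (V : Finset (ι → S)) (x : ι → Pt c), (∃ v ∈ Polybox.project i y s V, Cov v x) ↔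
        s ∈ x i ∧ ∃ v ∈ V, Cov v (Function.update x i y) := by
      intro V x
      constructor
      · rintro ⟨v, hv, hx⟩
        obtain ⟨p, hp, rfl⟩ := Finset.mem_image.1 hv
        rw [Finset.mem_filter] at hp
        refine ⟨by simpa using hx i, p, hp.1, cov_update (fun k hk => ?_) hp.2⟩
        simpa [Function.update_of_ne hk] using hx k
      · rintro ⟨hs, p, hp, hx⟩
        refine ⟨_, Finset.mem_image_of_mem _ (Finset.mem_filter.2 ⟨hp, by simpa using hx i⟩), fun k => ?_⟩
        by_cases hk : k = i
        · subst hk; simpa using hs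
        · simpa [Function.update_of_ne hk] using hx k
    intro x
    rw [key, key, h.eqv]

end Project

variable {V W : Finset (Fin 6 → S)}

/-- No minimal pair of at most twelve words. -/
theorem MinGP.absurd (hc : IsCompl' c) (hm : MinGP c V W) (hn : V.card ≤ 12) (hf : Search.Flatless c V W) : False := by
  by_cases hall : ∀ (i : Fin 6) (y : Pt c), (∃ v ∈ V, v i ∈ y) → ∀ v ∈ V, v i ∈ y
  · obtain ⟨v, hv⟩ := hm.ne
    have hfull : ∀ (i : Fin 6) (y : Pt c), v i ∈ y → ∀ w ∈ W, w i ∈ y := by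
      intro i y hy
      have h1 : V.filter (fun v => v i ∈ y) = V := Finset.filter_true_of_mem (hall i y ⟨v, hv, hy⟩)
      have h2 := hm.toGP.fiber_card hc i y
      rw [h1, hm.card] at h2
      intro w hw
      rw [← Finset.eq_of_subset_of_card_le (Finset.filter_subset _ W) h2.le] at hw
      exact (Finset.mem_filter.1 hw).2
    obtain ⟨w, hw⟩ := hm.symm.ne
    refine hm.disj v hv ?_
    rw [show v = w from funext fun i => ?_]
    · exact hw
    by_contra hi
    obtain ⟨z⟩ := exists_pt hc
    have h1 := hfull i (pset hc (pset hc z (c (w i))) (v i)) (mem_pset_self hc _ _) w hw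
    refine (mem_c _ _).1 ?_ h1
    refine mem_pset_of hc (mem_pset_self hc _ _) fun e => hi ((c_inj hc).1 e).symm
  push Not at hall
  obtain ⟨i, y, ⟨v, hv, hvy⟩, w, hw, hwy⟩ := hall
  have step : ∀ (y : Pt c) (v w : Fin 6 → S), v ∈ V → w ∈ V → v i ∈ y → w i ∉ y →
      (V.filter fun v => v i ∈ y).card ≤ 6 → False := by
    intro y v w hv hw hvy hwy hle
    have hcross : ∀ {V W : Finset (Fin 6 → S)}, MinGP c V W → V.card ≤ 12 → Search.Flatless c V W →
        (V.filter fun v => v i ∈ y).card ≤ 6 →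
        ∀ v ∈ V, ∀ w ∈ V, v i ∈ y → w i ∈ y → ¬ CrossTwin c i v w := by
      rintro V W hm hn hf hle v hv w hw hvy hwy ⟨h1, j, h2, h3, h4⟩
      exact Search.no_cross_twin hc hm hn hf hv hw h2 h1 h3 h4 hvy hwy hle
    have hg := hm.toGP.project hc (v i) (Search.not_near hc hm hn hf) (hcross hm hn hf hle)
      (hcross hm.symm (by rwa [← hm.card]) (fun d hd => (hf d hd.symm).symm) (by
        rwa [← hm.toGP.fiber_card hc i y]))
    have hmin := hm.min _ _ hg ⟨_, mem_project _ hv hvy⟩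
    rw [project_card hc hm.codeV] at hmin
    have := Finset.eq_of_subset_of_card_le (Finset.filter_subset _ V) hmin
    rw [← this] at hw
    exact hwy (Finset.mem_filter.1 hw).2
  by_cases hle : (V.filter fun v => v i ∈ y).card ≤ 6
  · exact step y v w hv hw hvy hwy hle
  · obtain ⟨y', hy'⟩ := exists_compl y
    refine step y' w v hw hv ((hy' _).2 hwy) (fun h => (hy' _).1 h hvy) ?_
    have := Finset.card_filter_add_card_filter_not (s := V) (fun v => v i ∈ y)
    simp only [hy']
    omega

/-- A pair of at most twelve words has exactly twelve words, and is flat in some frame. -/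
theorem GP.absurd (hc : IsCompl' c) (h : GP c V W) (hne : V.Nonempty) (hn : V.card ≤ 12)
    (hf : V.card = 12 → Search.Flatless c V W) : False := by
  let P : ℕ → Prop := fun n => ∃ V W : Finset (Fin 6 → S), GP c V W ∧ V.Nonempty ∧ V.card = n
  have hex : ∃ n, P n := ⟨_, V, W, h, hne, rfl⟩
  have hspec := Nat.find_spec hex
  have hmin : ∀ V' W' : Finset (Fin 6 → S), GP c V' W' → V'.Nonempty → Nat.find hex ≤ V'.card :=
    fun V' W' h1 h2 => Nat.find_min' hex ⟨V', W', h1, h2, rfl⟩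
  have hle := hmin V W h hne
  by_cases hlt : Nat.find hex = 12
  · have h12 : V.card = 12 := by omega
    exact MinGP.absurd hc ⟨h, h.card_eq hc, hne, fun V' W' h1 h2 => by rw [h12, ← hlt]; exact hmin V' W' h1 h2⟩ hn (hf h12)
  · obtain ⟨V', W', h1, h2, h3⟩ := hspec
    refine MinGP.absurd hc ⟨h1, h1.card_eq hc, h2, fun V'' W'' h4 h5 => by rw [h3]; exact hmin _ _ h4 h5⟩ (by omega) ?_
    intro d hd
    have e := h1.card_eq hc
    constructor
    · intro K q _ h12
      rw [hd.hat_card] at h12; omega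
    · intro K q _ h12
      rw [hd.symm.hat_card] at h12; omega

end Polybox

namespace Polybox
open scoped Classical
variable {c : S → S}

theorem card_le_two {ι : Type} (hc : IsCompl' c) {D : Finset (ι → S)} (hD : Code c D) (htf : TF c D) {a b : ι}
    (h : ∀ u ∈ D, ∀ v ∈ D, ∀ k, k ≠ a → k ≠ b → u k = v k) : D.card ≤ 2 := by
  have key : ∀ u ∈ D, ∀ v ∈ D, u ≠ v → (v a = c (u a) ∧ v b ≠ u b) ∨ (v b = c (u b) ∧ v a ≠ u a) := by
    intro u hu v hv huv
    obtain ⟨k, hk⟩ := hD u hu v hv huv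
    have hkab : k = a ∨ k = b := by
      by_contra hcon
      push Not at hcon
      exact hc.ne (u k) (hk.symm.trans (h v hv u hu k hcon.1 hcon.2))
    have hn : ¬ ∀ j, j ≠ k → v j = u j := fun h' => htf u hu v hv ⟨k, hk, h'⟩
    rcases hkab with rfl | rfl
    · refine Or.inl ⟨hk, fun e => hn fun j hj => ?_⟩
      by_cases hjb : j = b
      · rw [hjb, e]
      · exact h v hv u hu j hj hjb
    · refine Or.inr ⟨hk, fun e => hn fun j hj => ?_⟩
      by_cases hja : j = a
      · rw [hja, e]
      · exact h v hv u hu j hja hj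
  by_contra hcard
  obtain ⟨u, hu, v, hv, w, hw, huv, huw, hvw⟩ := Finset.two_lt_card.1 (not_le.1 hcard)
  have hinv : ∀ s, c (c s) = s := hc.inv
  have hne : ∀ s, s ≠ c s := fun s e => hc.ne s e.symm
  have h1 := key u hu v hv huv
  have h2 := key u hu w hw huw
  have h3 := key v hv w hw hvw
  grind

section Slice
variable {n : ℕ}

/-- The word `v` with the letter `l` inserted at position `i`. -/
def glue (i : Fin (n + 1)) {α : Type} (l : α) (v : Fin n → α) : Fin (n + 1) → α := Fin.insertNth (α := fun _ => α) i l v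

variable {i : Fin (n + 1)} {l : S} {U : Finset (Fin (n + 1) → S)}

@[simp] theorem glue_self {α : Type} {l : α} {v : Fin n → α} : glue i l v i = l := Fin.insertNth_apply_same _ _ _

@[simp] theorem glue_succAbove {α : Type} {l : α} {v : Fin n → α} (k : Fin n) : glue i l v (i.succAbove k) = v k :=
  Fin.insertNth_apply_succAbove _ _ _ _

theorem eq_glue {α : Type} (u : Fin (n + 1) → α) : u = glue i (u i) fun k => u (i.succAbove k) :=
  funext ((Fin.forall_iff_succAbove i).2 ⟨by simp, by simp⟩)

theorem glue_inj {α : Type} {l : α} {v w : Fin n → α} (h : glue i l v = glue i l w) : v = w :=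
  funext fun k => by simpa using congrFun h (i.succAbove k)

theorem cov_glue {y : Pt c} {v : Fin n → S} {x : Fin n → Pt c} : Cov (glue i l v) (glue i y x) ↔ l ∈ y ∧ Cov v x := by
  unfold Cov
  rw [Fin.forall_iff_succAbove i]
  simp only [glue_self, glue_succAbove]

/-- The words of `U` with letter `l` at position `i`, with that position removed. -/
noncomputable def slice (i : Fin (n + 1)) (l : S) (U : Finset (Fin (n + 1) → S)) : Finset (Fin n → S) :=
  (lay U i l).image fun u k => u (i.succAbove k)

theorem mem_slice {v : Fin n → S} : v ∈ slice i l U ↔ glue i l v ∈ U := by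
  constructor
  · intro h
    obtain ⟨u, hu, rfl⟩ := Finset.mem_image.1 h
    obtain ⟨hu, rfl⟩ := mem_lay.1 hu
    rwa [← eq_glue (i := i) u]
  · intro h
    exact Finset.mem_image.2 ⟨_, mem_lay.2 ⟨h, glue_self⟩, funext fun k => glue_succAbove k⟩

theorem slice_card : (slice i l U).card = (lay U i l).card := by
  refine Finset.card_image_of_injOn fun u hu v hv e => ?_
  rw [eq_glue (i := i) u, eq_glue (i := i) v, (mem_lay.1 hu).2, (mem_lay.1 hv).2]
  exact congrArg _ e

theorem code_slice (hc : IsCompl' c) (hU : Code c U) : Code c (slice i l U) := by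
  intro u hu v hv huv
  obtain ⟨k, hk⟩ := hU _ (mem_slice.1 hu) _ (mem_slice.1 hv) fun e => huv (glue_inj e)
  revert k
  refine (Fin.forall_iff_succAbove i).2 ⟨fun h => ?_, fun k h => ⟨k, by simpa using h⟩⟩
  rw [glue_self, glue_self] at h
  exact absurd h.symm (hc.ne l)

theorem tf_slice (hU : TF c U) : TF c (slice i l U) := by
  rintro u hu v hv ⟨j, h1, h2⟩
  refine hU _ (mem_slice.1 hu) _ (mem_slice.1 hv) ⟨i.succAbove j, by simpa using h1, ?_⟩
  refine (Fin.forall_iff_succAbove i).2 ⟨fun _ => by simp, fun k hk => ?_⟩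
  simpa using h2 k fun e => hk (by rw [e])

/-- Complementary layers of a partition without twins. -/
theorem slice_gp (hc : IsCompl' c) (hU : Code c U) (hT : TF c U) (hcov : ∀ x : Fin (n + 1) → Pt c, ∃ u ∈ U, Cov u x) :
    GP c (slice i l U) (slice i (c l) U) := by
  refine ⟨code_slice hc hU, code_slice hc hU, tf_slice hT, tf_slice hT, fun v hv hw => ?_, ?_⟩
  · refine hT _ (mem_slice.1 hv) _ (mem_slice.1 hw) ⟨i, by simp, ?_⟩
    exact (Fin.forall_iff_succAbove i).2 ⟨fun h => absurd rfl h, fun k _ => by simp⟩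
  · have key : ∀ (l : S) (x : Fin n → Pt c), (∃ v ∈ slice i l U, Cov v x) → ∃ w ∈ slice i (c l) U, Cov w x := by
      rintro l x ⟨v, hv, hx⟩
      obtain ⟨z⟩ := exists_pt hc
      set y := pset hc z (c l) with hy
      obtain ⟨u, hu, hux⟩ := hcov (glue i y x)
      rw [eq_glue (i := i) u, cov_glue] at hux
      by_cases hl : u i = c l
      · refine ⟨fun k => u (i.succAbove k), mem_slice.2 ?_, hux.2⟩
        rwa [← hl, ← eq_glue (i := i) u]
      exfalso
      have h1 : u i ∈ pset hc y l := mem_pset_of hc hux.1 hl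
      have h2 : u = glue i l v := hU.unique (x := glue i (pset hc y l) x) hu (mem_slice.1 hv)
        (by rw [eq_glue (i := i) u, cov_glue]; exact ⟨h1, hux.2⟩) (cov_glue.2 ⟨mem_pset_self hc _ _, hx⟩)
      have h3 : l ∈ y := by
        have := hux.1
        rwa [h2, glue_self] at this
      have h4 := not_mem_pset hc z (c l)
      rw [hc.inv] at h4
      exact h4 h3
    intro x
    refine ⟨key l x, fun h => ?_⟩
    have := key (c l) x h
    rwa [hc.inv] at this

end Slice

namespace Search
variable {i : Fin 7} {l : S} {U : Finset (Fin 7 → S)}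

theorem noFlat_slice (hc : IsCompl' c) (hU : Code c U) (hT : TF c U) (hcov : ∀ x : Fin 7 → Pt c, ∃ u ∈ U, Cov u x)
    {W : Finset (Fin 6 → S)} {d : Fin 6 → S → Fin 4} (hd : Frame c (slice i l U) W d) : NoFlat (hat d (slice i l U)) := by
  intro K q hK h12 h1 h2 h3
  rw [hd.hat_card] at h12
  obtain ⟨v₀, hv₀⟩ := Finset.card_pos.1 (by omega : 0 < (slice i l U).card)
  have hlift : ∀ k, ∃ a : S, (k ∈ K → a = v₀ k) ∧ (k ∉ K → ∀ b, Used c (slice i l U) W k b → d k b = q k → a = b) := by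
    intro k
    by_cases hk : k ∈ K
    · exact ⟨v₀ k, fun _ => rfl, fun h => absurd hk h⟩
    by_cases hex : ∃ b, Used c (slice i l U) W k b ∧ d k b = q k
    · obtain ⟨b, hb, hb'⟩ := hex
      exact ⟨b, fun h => absurd h hk, fun _ b' hb1 hb2 => hd.inj k b b' hb hb1 (hb'.trans hb2.symm)⟩
    · push Not at hex
      exact ⟨v₀ k, fun _ => rfl, fun _ b hb hb' => absurd hb' (hex b hb)⟩
  choose Q hQK hQ using hlift
  have hconst : ∀ v ∈ slice i l U, ∀ k ∈ K, v k = Q k := by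
    intro v hv k hk
    rw [hQK k hk]
    refine hd.word_inj (Or.inl hv) (Or.inl hv₀) ?_
    rw [h1 _ (mem_hat hv) k hk, h1 _ (mem_hat hv₀) k hk]
  have hopp : ∀ v ∈ slice i l U, ∃ k, Q k = c (v k) := by
    intro v hv
    obtain ⟨k, hk, hk'⟩ := h2 _ (mem_hat hv)
    exact ⟨k, hQ k hk _ ((used_fst hv k).compl hc) (by rw [hd.comm, hk'])⟩
  set D := U.filter fun u => (u i ≠ l ∧ u i ≠ c l) ∧ Meet c u (glue i l Q) with hDdef
  have hDU : D ⊆ U := Finset.filter_subset _ _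
  have hDQ : ∀ u ∈ D, ∀ k, k ∉ K → u (i.succAbove k) = Q k := by
    intro u hu
    obtain ⟨huU, ⟨hul, hucl⟩, hum⟩ := Finset.mem_filter.1 hu
    have hum' : ∀ k, u (i.succAbove k) ≠ c (Q k) := fun k => by simpa using hum (i.succAbove k)
    have hr := h3 (fun k => if k ∈ K then q k else if Used c (slice i l U) W k (u (i.succAbove k)) then
      d k (u (i.succAbove k)) else turn (q k)) (fun k hk => if_pos hk) ?_ ?_
    · intro k hk
      have := congrFun hr k
      simp only [if_neg hk] at this
      split_ifs at this with hus
      · exact (hQ k hk _ hus this).symm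
      · exact absurd this (by generalize q k = a; revert a; decide)
    · intro w hw
      obtain ⟨v, hv, rfl⟩ := Finset.mem_image.1 hw
      obtain ⟨k, hk⟩ := hU _ (mem_slice.1 hv) _ huU fun e => hul (by rw [← e, glue_self])
      revert k
      refine (Fin.forall_iff_succAbove i).2 ⟨fun h => absurd h (by rwa [glue_self]), fun k hk => ?_⟩
      rw [glue_succAbove] at hk
      have hkK : k ∉ K := fun h => hum' k (by rw [hk, hconst v hv k h])
      refine ⟨k, hkK, ?_⟩
      simp only [if_neg hkK]
      rw [hk, if_pos ((used_fst hv k).compl hc), hd.comm]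
    · intro k hk
      simp only [if_neg hk]
      split_ifs with hus
      · intro e
        refine hum' k ?_
        rw [hQ k hk _ (hus.compl hc) (by rw [hd.comm, e]; generalize q k = a; revert a; decide), hc.inv]
      · generalize q k = a; revert a; decide
  obtain ⟨a, b, hab⟩ : ∃ a b : Fin 6, K ⊆ {a, b} := by
    rcases Nat.lt_or_ge K.card 2 with hlt | hge
    · rcases Finset.card_le_one_iff_subset_singleton.1 (by omega : K.card ≤ 1) with ⟨a, ha⟩
      exact ⟨a, a, ha.trans (by simp)⟩
    · obtain ⟨a, b, -, rfl⟩ := Finset.card_eq_two.1 (le_antisymm hK hge)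
      exact ⟨a, b, subset_rfl⟩
  refine no_thin_cover hc (hU.subset hDU) (hT.subset hDU) (q := glue i l Q) (i := i) ?_ ?_ ?_ ?_
  · exact fun p hp => (Finset.mem_filter.1 hp).2.2
  · intro x hx
    obtain ⟨u, hu, hux⟩ := hcov x
    have hmeet : Meet c u (glue i l Q) := meet_of_cov hux hx
    refine ⟨u, Finset.mem_filter.2 ⟨hu, ⟨fun hl => ?_, by simpa using hmeet i⟩, hmeet⟩, hux⟩
    obtain ⟨k, hk⟩ := hopp (fun k => u (i.succAbove k)) (mem_slice.2 (by rwa [← hl, ← eq_glue (i := i) u]))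
    have := hmeet (i.succAbove k)
    rw [glue_succAbove, hk, hc.inv] at this
    exact this rfl
  · intro p hp
    rw [glue_self]
    exact (Finset.mem_filter.1 hp).2.1
  · intro s
    have hsub := (lay_subset D i s).trans hDU
    refine card_le_two hc (hU.subset hsub) (hT.subset hsub) (a := i.succAbove a) (b := i.succAbove b) ?_
    intro u hu v hv
    rw [mem_lay] at hu hv
    refine (Fin.forall_iff_succAbove i).2 ⟨fun _ _ => by rw [hu.2, hv.2], fun k hka hkb => ?_⟩
    have hk : k ∉ K := fun h => by
      rcases Finset.mem_insert.1 (hab h) with rfl | h'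
      · exact hka rfl
      · exact hkb (by rw [Finset.mem_singleton.1 h'])
    rw [hDQ u hu.1 k hk, hDQ v hv.1 k hk]

end Search

theorem exists_twin [Fintype S] (hc : IsCompl' c) {U : Finset (Fin 7 → S)} (hU : Code c U)
    (hcov : ∀ x : Fin 7 → Pt c, ∃ u ∈ U, Cov u x) {i : Fin 7} {l : S} (hne : (lay U i l).Nonempty)
    (hl : (lay U i l).card ≤ 12) : ∃ u ∈ U, ∃ v ∈ U, Twin c u v := by
  by_contra hcon
  push Not at hcon
  have hT : TF c U := hcon
  refine (slice_gp (i := i) (l := l) hc hU hT hcov).absurd hc ?_ (by rwa [slice_card]) fun _ d hd => ?_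
  · rwa [← Finset.card_pos, slice_card, Finset.card_pos]
  · exact ⟨Search.noFlat_slice hc hU hT hcov hd, Search.noFlat_slice hc hU hT hcov hd.symm⟩

end Polybox

theorem partition_code_dim7_twin_pair [Fintype S] (c : S → S)
    (hinv : Function.Involutive c) (hfix : ∀ s, c s ≠ s)
    (U : Set (Fin 7 → S)) (hU : PartitionCode c U)
    (h : ∃ (i : Fin 7) (l : S),
      (Subcode U i l).Nonempty ∧ (Subcode U i l).ncard ≤ 12) :
    ∃ u ∈ U, ∃ v ∈ U, TwinPair c u v := by
  classical
  obtain ⟨i, l, hne, hcard⟩ := h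
  have hfin : U.Finite := Set.toFinite U
  have hmem : ∀ u, u ∈ hfin.toFinset ↔ u ∈ U := fun u => hfin.mem_toFinset
  have hsub : ((Polybox.lay hfin.toFinset i l : Finset (Fin 7 → S)) : Set (Fin 7 → S)) = Subcode U i l := by
    ext u
    rw [Finset.mem_coe, Polybox.mem_lay, hmem]
    rfl
  have hc : Polybox.IsCompl' c := ⟨hinv, hfix⟩
  have hcov : ∀ x : Fin 7 → Polybox.Pt c, ∃ u ∈ hfin.toFinset, Polybox.Cov u x := by
    intro x
    have hx : (fun k => (x k).1) ∈ RealizeSet c U := by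
      rw [hU.2]
      exact fun k => (x k).2
    simp only [RealizeSet, Set.mem_iUnion] at hx
    obtain ⟨u, hu, hux⟩ := hx
    exact ⟨u, (hmem u).2 hu, fun k => (hux k).2⟩
  obtain ⟨u, hu, v, hv, ht⟩ := Polybox.exists_twin hc (U := hfin.toFinset) (i := i) (l := l)
    (fun u hu v hv huv => hU.1 u ((hmem u).1 hu) v ((hmem v).1 hv) huv) hcov
    (by rwa [← Finset.coe_nonempty, hsub]) (by rwa [← Set.ncard_coe_finset, hsub])
  exact ⟨u, (hmem u).1 hu, v, (hmem v).1 hv, ht⟩
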